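/- Let R be a commutative Noetherian ring and M a Φ-simplicial monoid. Let P be a finitely generated projective R[M]-module of constant rank ≥ max{dim R + 1, 2}. Then the group of elementary automorphisms EL(P ⊕ R[M]) acts transitively on the set of unimodular elements Um(P ⊕ R[M]). -/

import Mathlib

set_option synthInstance.maxHeartbeats 1000000
set_option maxHeartbeats 1000000

open MvPolynomial

/-- The coordinatewise cast `ℕ^r → ℤ^r` as an additive monoid hom. -/
def natCast (r : ℕ) : (Fin r → ℕ) →+ (Fin r → ℤ) where
  toFun x i := (x i : ℤ)
  map_zero' := by funext i; simp
  map_add' x y := by funext i; simp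

/-- A `Φ`-simplicial monoid of rank `r`: a finitely generated submonoid `M ⊆ ℤ₊^r`
such that the extension `M ⊆ ℤ₊^r` is integral. -/
def PhiSimplicial {r : ℕ} (M : AddSubmonoid (Fin r → ℕ)) : Prop :=
  M.FG ∧ ∀ x : Fin r → ℕ, ∃ n : ℕ, 0 < n ∧ n • x ∈ M

/-- Seminormality of a submonoid `M ⊆ ℤ₊^r`: if `x ∈ gp(M)` and `2x, 3x ∈ M`,
then `x ∈ M`. -/
def MonoidSeminormal {r : ℕ} (M : AddSubmonoid (Fin r → ℕ)) : Prop :=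
  ∀ x : Fin r → ℤ, x ∈ AddSubgroup.closure (M.map (natCast r) : Set (Fin r → ℤ)) →
    2 • x ∈ M.map (natCast r) → 3 • x ∈ M.map (natCast r) → x ∈ M.map (natCast r)

/-- The truncation `M_m` of `M`: elements supported on the coordinates `≤ m`. -/
def truncMonoid {r : ℕ} (M : AddSubmonoid (Fin r → ℕ)) (m : Fin r) :
    Set (Fin r → ℕ) := {x | x ∈ M ∧ ∀ i : Fin r, m < i → x i = 0}

/-- The monomial of `MvPolynomial (Fin r) R` with exponent vector `x`. -/
noncomputable def monomialOf {r : ℕ} (R : Type*) [CommRing R] (x : Fin r → ℕ) :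
    MvPolynomial (Fin r) R :=
  MvPolynomial.monomial (Finsupp.equivFunOnFinite.symm x) 1

/-- The subalgebra `R[M_m]` of `R[t₁,…,t_r]` spanned by the monomials of the
truncation `M_m`. -/
noncomputable def truncAlgebra {r : ℕ} (M : AddSubmonoid (Fin r → ℕ)) (m : Fin r)
    (R : Type*) [CommRing R] : Subalgebra R (MvPolynomial (Fin r) R) :=
  Algebra.adjoin R (monomialOf R '' truncMonoid M m)

/-- The substitution `t_i ↦ t_i + t_m^{c_i}` for `i < m`, fixing the other variables. -/
noncomputable def subst {r : ℕ} (m : Fin r) (cs : Fin r → ℕ) (R : Type*) [CommRing R] :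
    MvPolynomial (Fin r) R →ₐ[R] MvPolynomial (Fin r) R :=
  MvPolynomial.aeval (fun i => if i < m then X i + X m ^ cs i else X i)

/-- The class `C(Φ)`: `M` is seminormal and each truncation `M_m` satisfies the
automorphism condition: for every `c` there are `c_i > c` such that for every
commutative ring `R` the substitution `t_i ↦ t_i + t_m^{c_i}` (for `i < m`)
restricts to an `R`-automorphism of `R[M_m]`. -/
def InClassCPhi {r : ℕ} (M : AddSubmonoid (Fin r → ℕ)) : Prop :=
  MonoidSeminormal M ∧
  ∀ (m : Fin r) (c : ℕ), ∃ cs : Fin r → ℕ, (∀ i : Fin r, i < m → c < cs i) ∧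
    ∀ (R : Type) (_ : CommRing R),
      Subalgebra.map (subst m cs R) (truncAlgebra M m R) = truncAlgebra M m R

/-- A unimodular element of a module. -/
def IsUnimodular {R P : Type*} [CommRing R] [AddCommGroup P] [Module R P] (p : P) : Prop :=
  ∃ φ : P →ₗ[R] R, φ p = 1

/-- The group `EL(P ⊕ A)` of elementary automorphisms of `P ⊕ A`, generated by the
transvections `(p, a) ↦ (p, a + φ(p))` for `φ ∈ P*` and `(p, a) ↦ (p + a·q, a)` for
`q ∈ P`. -/
def elemGroup (A : Type*) [CommRing A] (P : Type*) [AddCommGroup P] [Module A P] :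
    Subgroup ((P × A) ≃ₗ[A] (P × A)) :=
  Subgroup.closure
    ({e | ∃ φ : P →ₗ[A] A, ∀ x : P × A, e x = (x.1, x.2 + φ x.1)} ∪
     {e | ∃ q : P, ∀ x : P × A, e x = (x.1 + x.2 • q, x.2)})

section ElementaryGroup

open Matrix

variable {ι : Type*} [Fintype ι] [DecidableEq ι] {A : Type*} [CommRing A]

/-- The rank one unipotent matrix `1 + v wᵀ`, where `w · v = 0`. -/
def rankOne (v w : ι → A) (h : w ⬝ᵥ v = 0) : GL ι A where
  val := 1 + vecMulVec v w
  inv := 1 - vecMulVec v w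
  val_inv := by
    simp [add_mul, mul_sub, vecMulVec_mul_vecMulVec, h]
  inv_val := by
    simp [sub_mul, mul_add, vecMulVec_mul_vecMulVec, h]

theorem single_dot_single_ne {i j : ι} (h : i ≠ j) (a b : A) :
    (Pi.single j b : ι → A) ⬝ᵥ Pi.single i a = 0 := by
  simp [h]

/-- The elementary matrix with entry `a` in position `(i, j)`. -/
def elemMat {i j : ι} (h : i ≠ j) (a : A) : GL ι A :=
  rankOne (Pi.single i a) (Pi.single j 1) (single_dot_single_ne h a 1)

/-- The group generated by the elementary matrices whose entry lies in `S`. -/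
def elemSubgroup (ι : Type*) [Fintype ι] [DecidableEq ι] (S : Set A) : Subgroup (GL ι A) :=
  Subgroup.closure {g | ∃ (i j : ι) (h : i ≠ j), ∃ a ∈ S, g = elemMat h a}

theorem elemMat_mem {S : Set A} {i j : ι} (h : i ≠ j) {a : A} (ha : a ∈ S) :
    elemMat h a ∈ elemSubgroup ι S :=
  Subgroup.subset_closure ⟨i, j, h, a, ha, rfl⟩

theorem rankOne_mul_right (v w w' : ι → A) (h : w ⬝ᵥ v = 0) (h' : w' ⬝ᵥ v = 0) :
    rankOne v w h * rankOne v w' h' =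
    rankOne v (w + w') (by rw [add_dotProduct, h, h', add_zero]) := by
  apply Units.ext
  simp [rankOne, add_mul, mul_add, vecMulVec_mul_vecMulVec, h, vecMulVec_add]
  abel

theorem rankOne_mul_left (v v' w : ι → A) (h : w ⬝ᵥ v = 0) (h' : w ⬝ᵥ v' = 0) :
    rankOne v w h * rankOne v' w h' =
    rankOne (v + v') w (by rw [dotProduct_add, h, h', add_zero]) := by
  apply Units.ext
  simp [rankOne, add_mul, mul_add, vecMulVec_mul_vecMulVec, h', add_vecMulVec]
  abel

theorem rankOne_zero_right (v : ι → A) (h : (0 : ι → A) ⬝ᵥ v = 0) : rankOne v 0 h = 1 := by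
  apply Units.ext; simp [rankOne]

theorem rankOne_zero_left (w : ι → A) (h : w ⬝ᵥ (0 : ι → A) = 0) : rankOne 0 w h = 1 := by
  apply Units.ext; simp [rankOne]

theorem rankOne_congr {v w v' w' : ι → A} (h : w ⬝ᵥ v = 0) (h' : w' ⬝ᵥ v' = 0)
    (e : vecMulVec v w = vecMulVec v' w') : rankOne v w h = rankOne v' w' h' := by
  apply Units.ext; simp [rankOne, e]

theorem conj_rankOne (g : GL ι A) (v w : ι → A) (h : w ⬝ᵥ v = 0) (h') :
    g * rankOne v w h * g⁻¹ = rankOne (g.1 *ᵥ v) (w ᵥ* (g⁻¹).1) h' := by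
  apply Units.ext
  simp only [rankOne, Units.val_mul, mul_add, mul_one, add_mul, Units.mul_inv]
  rw [mul_vecMulVec, vecMulVec_mul]

theorem rankOne_sum_right_mem {κ : Type*} (H : Subgroup (GL ι A)) (v : ι → A) (s : Finset κ)
    (w : κ → ι → A) (hw : ∀ k ∈ s, w k ⬝ᵥ v = 0)
    (hmem : ∀ k (hk : k ∈ s), rankOne v (w k) (hw k hk) ∈ H) (h : (∑ k ∈ s, w k) ⬝ᵥ v = 0) :
    rankOne v (∑ k ∈ s, w k) h ∈ H := by
  classical
  induction s using Finset.induction_on with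
  | empty => simp only [Finset.sum_empty]; rw [rankOne_zero_right]; exact H.one_mem
  | insert a s ha ih =>
    have h1 : (∑ k ∈ s, w k) ⬝ᵥ v = 0 := by
      rw [sum_dotProduct]
      exact Finset.sum_eq_zero fun k hk => hw k (Finset.mem_insert_of_mem hk)
    have := H.mul_mem (hmem a (Finset.mem_insert_self a s))
      (ih (fun k hk => hw k (Finset.mem_insert_of_mem hk))
        (fun k hk => hmem k (Finset.mem_insert_of_mem hk)) h1)
    rw [rankOne_mul_right] at this
    simpa only [Finset.sum_insert ha] using this

theorem rankOne_sum_left_mem {κ : Type*} (H : Subgroup (GL ι A)) (w : ι → A) (s : Finset κ)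
    (v : κ → ι → A) (hv : ∀ k ∈ s, w ⬝ᵥ v k = 0)
    (hmem : ∀ k (hk : k ∈ s), rankOne (v k) w (hv k hk) ∈ H) (h : w ⬝ᵥ (∑ k ∈ s, v k) = 0) :
    rankOne (∑ k ∈ s, v k) w h ∈ H := by
  classical
  induction s using Finset.induction_on with
  | empty => simp only [Finset.sum_empty]; rw [rankOne_zero_left]; exact H.one_mem
  | insert a s ha ih =>
    have h1 : w ⬝ᵥ (∑ k ∈ s, v k) = 0 := by
      rw [dotProduct_sum]
      exact Finset.sum_eq_zero fun k hk => hv k (Finset.mem_insert_of_mem hk)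
    have := H.mul_mem (hmem a (Finset.mem_insert_self a s))
      (ih (fun k hk => hv k (Finset.mem_insert_of_mem hk))
        (fun k hk => hmem k (Finset.mem_insert_of_mem hk)) h1)
    rw [rankOne_mul_left] at this
    simpa only [Finset.sum_insert ha] using this

/-- A rank one matrix in one row is elementary. -/
theorem rankOne_single_left_mem {S : Set A} (i : ι) (a : A) (w : ι → A)
    (h : w ⬝ᵥ Pi.single i a = 0) (hw : ∀ j ≠ i, a * w j ∈ S) (hi : w i = 0) :
    rankOne (Pi.single i a) w h ∈ elemSubgroup ι S := by
  have key := rankOne_sum_right_mem (elemSubgroup ι S) (Pi.single i a) Finset.univ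
    (fun j => Pi.single j (w j)) (fun j _ => by
      by_cases hj : j = i
      · subst hj; simp [hi]
      · simp [hj]) (fun j _ => by
      by_cases hj : j = i
      · subst hj
        have : rankOne (Pi.single j a) (Pi.single j (w j)) (by simp [hi]) = 1 := by
          apply Units.ext; simp [rankOne, hi]
        rw [this]; exact Subgroup.one_mem _
      · have := elemMat_mem (S := S) (Ne.symm hj) (hw j hj)
        convert this using 1
        refine rankOne_congr _ _ ?_
        ext p q
        simp [vecMulVec_apply, Pi.single_apply]
        ) (by rw [Finset.univ_sum_single]; exact h)
  have e : (∑ j, Pi.single j (w j) : ι → A) = w := Finset.univ_sum_single w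
  simpa only [e] using key

/-- A rank one matrix in one column is elementary. -/
theorem rankOne_single_right_mem {S : Set A} (i : ι) (a : A) (v : ι → A)
    (h : Pi.single i a ⬝ᵥ v = 0) (hv : ∀ j ≠ i, v j * a ∈ S) (hi : v i = 0) :
    rankOne v (Pi.single i a) h ∈ elemSubgroup ι S := by
  have key := rankOne_sum_left_mem (elemSubgroup ι S) (Pi.single i a) Finset.univ
    (fun j => Pi.single j (v j)) (fun j _ => by
      by_cases hj : j = i
      · subst hj; simp [hi]
      · simp [hj]) (fun j _ => by
      by_cases hj : j = i
      · subst hj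
        have : rankOne (Pi.single j (v j)) (Pi.single j a) (by simp [hi]) = 1 := by
          apply Units.ext; simp [rankOne, hi]
        rw [this]; exact Subgroup.one_mem _
      · have := elemMat_mem (S := S) hj (hv j hj)
        convert this using 1
        refine rankOne_congr _ _ ?_
        ext p q
        simp [vecMulVec_apply, Pi.single_apply]
        ) (by rw [Finset.univ_sum_single]; exact h)
  have e : (∑ j, Pi.single j (v j) : ι → A) = v := Finset.univ_sum_single v
  simpa only [e] using key

theorem commutator_rankOne (v w : ι → A) (p : ι) (a b : A) (hwv : w ⬝ᵥ v = 0)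
    (hwp : w p = 0) (h1) (h2) (h3) :
    rankOne v (Pi.single p a) h1 * rankOne (Pi.single p b) w h2 *
      (rankOne v (Pi.single p a) h1)⁻¹ * (rankOne (Pi.single p b) w h2)⁻¹ =
      rankOne v ((a * b) • w) h3 := by
  rw [mul_inv_eq_iff_eq_mul, mul_inv_eq_iff_eq_mul]
  apply Units.ext
  simp [rankOne, add_mul, mul_add, vecMulVec_mul_vecMulVec, hwv, vecMulVec_smul, hwp]
  abel

theorem rankOne_plucker_mem (S : Subring A) (hcard : 3 ≤ Fintype.card ι) {a b : A} (hb : b ∈ S)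
    {T : Set A} (haT : ∀ s ∈ S, a * s ∈ T) (hbT : ∀ s ∈ S, b * s ∈ T)
    (v : ι → A) (hv : ∀ i, v i ∈ S) {c : A} (hc : c ∈ S) (k l : ι) (h) :
    rankOne v ((a * b) • c • (Pi.single k (v l) - Pi.single l (v k))) h ∈ elemSubgroup ι T := by
  by_cases hkl : k = l
  · subst hkl
    simp only [sub_self, smul_zero, rankOne_zero_right]
    exact Subgroup.one_mem _
  obtain ⟨p, hp⟩ : ∃ p, p ∉ ({k, l} : Finset ι) := by
    by_contra! hcon
    have : Finset.univ ⊆ ({k, l} : Finset ι) := fun x _ => hcon x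
    have h1 := Finset.card_le_card this
    have h2 := Finset.card_le_two (a := k) (b := l)
    rw [Finset.card_univ] at h1
    omega
  simp only [Finset.mem_insert, Finset.mem_singleton, not_or] at hp
  obtain ⟨hpk, hpl⟩ := hp
  set w : ι → A := c • (Pi.single k (v l) - Pi.single l (v k)) with hw
  set v' : ι → A := Pi.single k (v k) + Pi.single l (v l) with hv'
  have hwv' : w ⬝ᵥ v' = 0 := by
    simp [hw, hv', dotProduct_add, hkl,
      Ne.symm hkl]
    ring
  have hwv : w ⬝ᵥ v = 0 := by
    simp [hw, smul_dotProduct, sub_dotProduct]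
    ring
  have h1 : ((a * b) • w) ⬝ᵥ v' = 0 := by rw [smul_dotProduct, hwv', smul_zero]
  have h2 : ((a * b) • w) ⬝ᵥ (v - v') = 0 := by
    rw [smul_dotProduct, dotProduct_sub, hwv', hwv, sub_zero, smul_zero]
  have hsplit : rankOne v ((a * b) • w) h = rankOne (v - v') _ h2 * rankOne v' _ h1 := by
    rw [rankOne_mul_left]
    exact rankOne_congr _ _ (by simp)
  rw [hsplit]
  refine Subgroup.mul_mem _ ?_ ?_
  · have e : (a * b) • w = Pi.single k (a * b * c * v l) + Pi.single l (-(a * b * c * v k)) := by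
      ext q
      simp [hw, Pi.single_apply]
      split_ifs <;> ring
    have hk0 : (v - v') k = 0 := by simp [hv', hkl]
    have hl0 : (v - v') l = 0 := by simp [hv', Ne.symm hkl]
    have hvS : ∀ q, (v - v') q ∈ S := by
      intro q
      simp only [hv', Pi.sub_apply, Pi.add_apply, Pi.single_apply]
      refine S.sub_mem (hv q) (S.add_mem ?_ ?_) <;> split_ifs <;>
        first | exact hv _ | exact S.zero_mem
    have hx : (Pi.single k (a * b * c * v l) : ι → A) ⬝ᵥ (v - v') = 0 := by
      rw [single_dotProduct, hk0, mul_zero]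
    have hy : (Pi.single l (-(a * b * c * v k)) : ι → A) ⬝ᵥ (v - v') = 0 := by
      rw [single_dotProduct, hl0, mul_zero]
    have : rankOne (v - v') _ h2 = rankOne (v - v') _ hx * rankOne (v - v') _ hy := by
      rw [rankOne_mul_right]; exact rankOne_congr _ _ (by rw [e])
    rw [this]
    refine Subgroup.mul_mem _ ?_ ?_
    · refine rankOne_single_right_mem k _ _ _ (fun j _ => ?_) hk0
      have := haT _ (S.mul_mem (S.mul_mem (S.mul_mem hb hc) (hv l)) (hvS j))
      convert this using 1; ring
    · refine rankOne_single_right_mem l _ _ _ (fun j _ => ?_) hl0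
      have := haT _ (S.neg_mem (S.mul_mem (S.mul_mem (S.mul_mem hb hc) (hv k)) (hvS j)))
      convert this using 1; ring
  · have hvp : v' p = 0 := by simp [hv', hpk, hpl]
    have hwp : w p = 0 := by simp [hw, hpk, hpl]
    rw [← commutator_rankOne v' w p a b hwv' hwp (by rw [single_dotProduct, hvp, mul_zero])
      (by rw [dotProduct_single, hwp, zero_mul])]
    have m1 : rankOne v' (Pi.single p a) (by rw [single_dotProduct, hvp, mul_zero]) ∈
        elemSubgroup ι T := by
      refine rankOne_single_right_mem p _ _ _ (fun j _ => ?_) hvp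
      rw [mul_comm]
      refine haT _ ?_
      simp only [hv', Pi.add_apply, Pi.single_apply]
      refine S.add_mem ?_ ?_ <;> split_ifs <;> first | exact hv _ | exact S.zero_mem
    have m2 : rankOne (Pi.single p b) w (by rw [dotProduct_single, hwp, zero_mul]) ∈
        elemSubgroup ι T := by
      refine rankOne_single_left_mem p _ _ _ (fun j _ => ?_) hwp
      refine hbT _ ?_
      simp only [hw, Pi.smul_apply, Pi.sub_apply, Pi.single_apply, smul_eq_mul]
      refine S.mul_mem hc (S.sub_mem ?_ ?_) <;> split_ifs <;> first | exact hv _ | exact S.zero_mem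
    exact Subgroup.mul_mem _ (Subgroup.mul_mem _ (Subgroup.mul_mem _ m1 m2) (Subgroup.inv_mem _ m1))
      (Subgroup.inv_mem _ m2)

/-- Suslin's normality lemma, with denominators. -/
theorem conj_elemMat_mem (S : Subring A) (hcard : 3 ≤ Fintype.card ι) {a b : A} (hb : b ∈ S)
    {T : Set A} (haT : ∀ s ∈ S, a * s ∈ T) (hbT : ∀ s ∈ S, b * s ∈ T) (D : A) (g : GL ι A)
    (hg : ∀ i j, D * g.1 i j ∈ S) (hg' : ∀ i j, D * (g⁻¹).1 i j ∈ S) {i j : ι} (hij : i ≠ j) :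
    g * elemMat hij (D ^ 4 * (a * b)) * g⁻¹ ∈ elemSubgroup ι T := by
  set v : ι → A := fun k => g.1 k i with hv
  set w : ι → A := fun k => (g⁻¹).1 j k with hw
  set z : ι → A := fun k => (g⁻¹).1 i k with hz
  have hinv : (g⁻¹).1 * g.1 = 1 := g.inv_mul
  have hzv : z ⬝ᵥ v = 1 := by
    have := congrFun (congrFun hinv i) i
    simpa [Matrix.mul_apply, dotProduct, hz, hv] using this
  have hwv : w ⬝ᵥ v = 0 := by
    have := congrFun (congrFun hinv j) i
    simpa [Matrix.mul_apply, dotProduct, hw, hv, Matrix.one_apply, hij.symm] using this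
  have hVS : ∀ k, (D • v) k ∈ S := fun k => hg k i
  have hgen : ∀ kl : ι × ι, ((a * b) • ((D * z kl.2) * (D * w kl.1)) •
      (Pi.single kl.1 ((D • v) kl.2) - Pi.single kl.2 ((D • v) kl.1)) : ι → A) ⬝ᵥ (D • v) = 0 := by
    intro kl
    simp [smul_dotProduct, sub_dotProduct]
    ring
  have hsum : ∑ kl : ι × ι, ((a * b) • ((D * z kl.2) * (D * w kl.1)) •
      (Pi.single kl.1 ((D • v) kl.2) - Pi.single kl.2 ((D • v) kl.1)) : ι → A)
      = (D ^ 3 * (a * b)) • w := by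
    ext q
    have e1 : ∑ l, z l * v l = 1 := hzv
    have e2 : ∑ l, w l * v l = 0 := hwv
    rw [Finset.sum_apply, Fintype.sum_prod_type]
    simp only [Pi.smul_apply, Pi.sub_apply, smul_eq_mul, Pi.single_apply, mul_sub,
      Finset.sum_sub_distrib]
    have t1 : ∑ k, ∑ l, a * b * (D * z l * (D * w k) * if q = k then D * v l else 0) =
        D ^ 3 * (a * b) * w q * ∑ l, z l * v l := by
      rw [Finset.sum_eq_single q]
      · rw [Finset.mul_sum]
        refine Finset.sum_congr rfl fun l _ => ?_
        simp; ring
      · intro k _ hk; simp [Ne.symm hk]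
      · simp
    have t2 : ∑ k, ∑ l, a * b * (D * z l * (D * w k) * if q = l then D * v k else 0) =
        D ^ 3 * (a * b) * z q * ∑ l, w l * v l := by
      rw [Finset.mul_sum]
      refine Finset.sum_congr rfl fun k _ => ?_
      rw [Finset.sum_eq_single q]
      · simp; ring
      · intro l _ hl; simp [Ne.symm hl]
      · simp
    rw [t1, t2, e1, e2]
    ring
  have h0 : ((D ^ 3 * (a * b)) • w) ⬝ᵥ (D • v) = 0 := by
    rw [smul_dotProduct, dotProduct_smul, hwv, smul_zero, smul_zero]
  have key := rankOne_sum_right_mem (elemSubgroup ι T) (D • v) Finset.univ _ (fun kl _ => hgen kl)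
    (fun kl _ => rankOne_plucker_mem S hcard hb haT hbT (D • v) hVS
      (S.mul_mem (hg' i kl.2) (hg' j kl.1)) kl.1 kl.2 (hgen kl)) (by rw [hsum]; exact h0)
  have e3 : g * elemMat hij (D ^ 4 * (a * b)) * g⁻¹ = rankOne (D • v) _ h0 := by
    have e4 : g.1 *ᵥ Pi.single i (D ^ 4 * (a * b)) = (D ^ 4 * (a * b)) • v := by
      ext q; simp [hv, mul_comm]
    have e5 : Pi.single j 1 ᵥ* (g⁻¹).1 = w := by
      ext q; simp [hw]
    have h6 : (Pi.single j 1 ᵥ* (g⁻¹).1) ⬝ᵥ (g.1 *ᵥ Pi.single i (D ^ 4 * (a * b))) = 0 := by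
      rw [e4, e5, dotProduct_smul, hwv, smul_zero]
    rw [elemMat, conj_rankOne _ _ _ _ h6]
    refine rankOne_congr _ _ ?_
    rw [e4, e5, smul_vecMulVec, smul_vecMulVec, vecMulVec_smul, smul_smul]
    congr 1; ring
  rw [e3]
  simpa only [hsum] using key

end ElementaryGroup

section RowEquivalence

open Matrix

variable {ι : Type*} [Fintype ι] [DecidableEq ι] {A B : Type*} [CommRing A] [CommRing B]

theorem map_rankOne (f : A →+* B) (v w : ι → A) (h : w ⬝ᵥ v = 0) (h') :
    GeneralLinearGroup.map f (rankOne v w h) = rankOne (f ∘ v) (f ∘ w) h' := by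
  apply Units.ext
  ext i j
  simp [rankOne, vecMulVec_apply, Matrix.one_apply, apply_ite f]

theorem map_elemMat (f : A →+* B) {i j : ι} (h : i ≠ j) (a : A) :
    GeneralLinearGroup.map f (elemMat h a) = elemMat h (f a) := by
  have e1 : f ∘ (Pi.single i a) = Pi.single i (f a) := by
    ext k; simp [Pi.single_apply, apply_ite f]
  have e2 : f ∘ (Pi.single j 1 : ι → A) = Pi.single j 1 := by
    ext k; simp [Pi.single_apply, apply_ite f]
  unfold elemMat
  rw [map_rankOne f _ _ _ (by rw [e1, e2]; exact single_dot_single_ne h _ _)]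
  simp only [e1, e2]

theorem elemMat_add {i j : ι} (h : i ≠ j) (a b : A) :
    elemMat h (a + b) = elemMat h a * elemMat h b := by
  unfold elemMat
  rw [rankOne_mul_left]
  exact rankOne_congr _ _ (by rw [Pi.single_add])

theorem elemMat_zero {i j : ι} (h : i ≠ j) : elemMat h (0 : A) = 1 := by
  apply Units.ext; simp [elemMat, rankOne]

theorem elemMat_neg {i j : ι} (h : i ≠ j) (a : A) : elemMat h (-a) = (elemMat h a)⁻¹ := by
  rw [eq_inv_iff_mul_eq_one, ← elemMat_add, neg_add_cancel, elemMat_zero]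

theorem map_mem_elemSubgroup (f : A →+* B) {S : Set A} {T : Set B} (h : ∀ s ∈ S, f s ∈ T)
    {g : GL ι A} (hg : g ∈ elemSubgroup ι S) :
    GeneralLinearGroup.map f g ∈ elemSubgroup ι T := by
  have : elemSubgroup ι S ≤ (elemSubgroup ι T).comap (GeneralLinearGroup.map f) := by
    rw [elemSubgroup, Subgroup.closure_le]
    rintro g ⟨i, j, hij, a, ha, rfl⟩
    change GeneralLinearGroup.map f (elemMat hij a) ∈ elemSubgroup ι T
    rw [map_elemMat]
    exact elemMat_mem hij (h a ha)
  exact this hg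

theorem exists_lift_elemSubgroup (f : A →+* B) {S : Set A} {T : Set B}
    (h : ∀ t ∈ T, ∃ s ∈ S, f s = t) {g : GL ι B} (hg : g ∈ elemSubgroup ι T) :
    ∃ g' ∈ elemSubgroup ι S, GeneralLinearGroup.map f g' = g := by
  have : elemSubgroup ι T ≤ (elemSubgroup ι S).map (GeneralLinearGroup.map f) := by
    rw [elemSubgroup, Subgroup.closure_le]
    rintro g ⟨i, j, hij, a, ha, rfl⟩
    obtain ⟨s, hs, rfl⟩ := h a ha
    exact ⟨elemMat hij s, Subgroup.subset_closure ⟨i, j, hij, s, hs, rfl⟩, map_elemMat f hij s⟩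
  exact this hg

theorem map_mulVec_comp (f : A →+* B) (g : GL ι A) (u : ι → A) :
    (GeneralLinearGroup.map f g).1 *ᵥ (f ∘ u) = f ∘ (g.1 *ᵥ u) := by
  ext i
  exact (RingHom.map_mulVec f g.1 u i).symm

theorem map_map_GL {C : Type*} [CommRing C] (f : A →+* B) (f' : B →+* C) (g : GL ι A) :
    GeneralLinearGroup.map f' (GeneralLinearGroup.map f g) =
      GeneralLinearGroup.map (f'.comp f) g := by
  apply Units.ext; ext i j; rfl

theorem map_id_GL (g : GL ι A) : GeneralLinearGroup.map (RingHom.id A) g = g := by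
  apply Units.ext; ext i j; rfl

/-- Two vectors lie in the same orbit of the elementary group. -/
def RowRel (u v : ι → A) : Prop :=
  ∃ g ∈ elemSubgroup ι (Set.univ : Set A), g.1 *ᵥ u = v

theorem RowRel.refl (u : ι → A) : RowRel u u := ⟨1, Subgroup.one_mem _, by simp⟩

theorem inv_mulVec_of_mulVec {g : GL ι A} {u v : ι → A} (h : g.1 *ᵥ u = v) :
    (g⁻¹).1 *ᵥ v = u := by
  rw [← h, mulVec_mulVec, Units.inv_mul, one_mulVec]

theorem mul_mulVec_GL (g h : GL ι A) (u : ι → A) : (g * h).1 *ᵥ u = g.1 *ᵥ (h.1 *ᵥ u) := by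
  rw [mulVec_mulVec]; rfl

theorem RowRel.symm {u v : ι → A} (h : RowRel u v) : RowRel v u := by
  obtain ⟨g, hg, e⟩ := h
  exact ⟨g⁻¹, Subgroup.inv_mem _ hg, inv_mulVec_of_mulVec e⟩

theorem RowRel.trans {u v w : ι → A} (h : RowRel u v) (h' : RowRel v w) : RowRel u w := by
  obtain ⟨g, hg, e⟩ := h
  obtain ⟨g', hg', e'⟩ := h'
  exact ⟨g' * g, Subgroup.mul_mem _ hg' hg, by rw [mul_mulVec_GL, e, e']⟩

theorem RowRel.map (f : A →+* B) {u v : ι → A} (h : RowRel u v) : RowRel (f ∘ u) (f ∘ v) := by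
  obtain ⟨g, hg, e⟩ := h
  exact ⟨GeneralLinearGroup.map f g, map_mem_elemSubgroup f (fun _ _ => Set.mem_univ _) hg, by
    rw [map_mulVec_comp, e]⟩

/-- A row of a ring `A` is unimodular if its entries generate the unit ideal. -/
def UniRow (u : ι → A) : Prop := ∃ c : ι → A, c ⬝ᵥ u = 1

theorem UniRow.map (f : A →+* B) {u : ι → A} (h : UniRow u) : UniRow (f ∘ u) := by
  obtain ⟨c, hc⟩ := h
  exact ⟨f ∘ c, by rw [← RingHom.map_dotProduct, hc, map_one]⟩

theorem UniRow.mulVec {u : ι → A} (h : UniRow u) (g : GL ι A) : UniRow (g.1 *ᵥ u) := by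
  obtain ⟨c, hc⟩ := h
  exact ⟨c ᵥ* (g⁻¹).1, by rw [dotProduct_mulVec, vecMul_vecMul, Units.inv_mul, vecMul_one, hc]⟩

theorem UniRow.of_rel {u v : ι → A} (h : UniRow u) (hr : RowRel u v) : UniRow v := by
  obtain ⟨g, _, rfl⟩ := hr
  exact h.mulVec g

/-- Adding to one coordinate a combination of the other ones. -/
theorem rowRel_update (u : ι → A) (i : ι) (c : ι → A) (hc : c i = 0) :
    RowRel u (Function.update u i (u i + c ⬝ᵥ u)) := by
  refine ⟨rankOne (Pi.single i 1) c (by simp [hc]),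
    rankOne_single_left_mem i 1 c _ (fun _ _ => trivial) hc, ?_⟩
  ext k
  simp only [rankOne, add_mulVec, one_mulVec, vecMulVec_mulVec, Pi.add_apply]
  by_cases hk : k = i
  · subst hk; simp
  · simp [hk]

/-- Adding multiples of one coordinate to the other ones. -/
theorem rowRel_add (u : ι → A) (i : ι) (c : ι → A) (hc : c i = 0) :
    RowRel u (u + u i • c) := by
  refine ⟨rankOne c (Pi.single i 1) (by simp [hc]),
    rankOne_single_right_mem i 1 c _ (fun _ _ => trivial) hc, ?_⟩
  ext k
  simp [rankOne, add_mulVec, vecMulVec_mulVec, mul_comm]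

theorem rowRel_single_single (i j : ι) : RowRel (Pi.single i (1 : A)) (Pi.single j 1) := by
  by_cases hij : i = j
  · subst hij; exact RowRel.refl _
  have h1 := rowRel_add (Pi.single i (1 : A)) i (Pi.single j 1) (by simp [hij])
  have h2 := rowRel_add (Pi.single i (1 : A) + (Pi.single i (1 : A) : ι → A) i • Pi.single j 1) j
    (Pi.single i (-1)) (by simp [Ne.symm hij])
  refine (h1.trans h2).trans ?_
  have e : (Pi.single i (1 : A) + (Pi.single i (1 : A) : ι → A) i • Pi.single j 1 +
      (Pi.single i (1 : A) + (Pi.single i (1 : A) : ι → A) i • Pi.single j 1 : ι → A) j •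
        Pi.single i (-1) : ι → A) = Pi.single j 1 := by
    ext k
    simp [Pi.single_apply, Ne.symm hij]
    split_ifs <;> simp
  rw [e]
  exact RowRel.refl _

theorem rowRel_single_of_eq_one {u : ι → A} {i : ι} (h : u i = 1) (j : ι) :
    RowRel u (Pi.single j 1) := by
  refine RowRel.trans ?_ (rowRel_single_single i j)
  convert rowRel_add u i (Pi.single i 1 - u) (by simp [h]) using 1
  rw [h, one_smul]; abel

/-- If the coordinates other than one already generate the unit ideal, then the row is
equivalent to a basis vector. -/
theorem rowRel_single_of_dot_eq_one {u : ι → A} (i : ι) (c : ι → A) (hc : c i = 0)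
    (h : c ⬝ᵥ u = 1) (j : ι) : RowRel u (Pi.single j 1) := by
  have h1 := rowRel_update u i ((1 - u i) • c) (by simp [hc])
  rw [smul_dotProduct, h] at h1
  exact h1.trans (rowRel_single_of_eq_one (i := i) (by simp) j)

/-- Every unimodular row is equivalent to a basis vector. -/
def RowTransitive (ι : Type*) [Fintype ι] [DecidableEq ι] (A : Type*) [CommRing A] : Prop :=
  ∀ (u : ι → A), UniRow u → ∀ i, RowRel u (Pi.single i 1)

theorem comp_single_one (f : A →+* B) (i : ι) : f ∘ (Pi.single i 1 : ι → A) = Pi.single i 1 := by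
  ext k; simp [Pi.single_apply, apply_ite f]

theorem RowTransitive.of_ringEquiv (e : A ≃+* B) (h : RowTransitive ι A) : RowTransitive ι B := by
  intro u hu i
  have h1 := (h _ (hu.map (e.symm : B →+* A)) i).map (e : A →+* B)
  rw [comp_single_one] at h1
  convert h1 using 1
  ext k; simp

theorem rowTransitive_of_subsingleton [Subsingleton A] : RowTransitive ι A := by
  intro u hu i
  rw [Subsingleton.elim u (Pi.single i 1)]
  exact RowRel.refl _

end RowEquivalence

section LocalGlobal

open Matrix Polynomial

variable {ι : Type*} [Fintype ι] [DecidableEq ι]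

/-- The relative part of an elementary matrix with respect to a retraction `ρ`. -/
theorem mul_map_inv_mem {A : Type*} [CommRing A] (ρ : A →+* A) (hρ : ∀ a, ρ (ρ a) = ρ a)
    (H : Subgroup (GL ι A))
    (hH : ∀ γ ∈ elemSubgroup ι (Set.univ : Set A), ∀ (i j : ι) (hij : i ≠ j) (y : A), ρ y = 0 →
      GeneralLinearGroup.map ρ γ * elemMat hij y * (GeneralLinearGroup.map ρ γ)⁻¹ ∈ H)
    {α : GL ι A} (hα : α ∈ elemSubgroup ι (Set.univ : Set A)) :
    α * (GeneralLinearGroup.map ρ α)⁻¹ ∈ H := by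
  let K : Subgroup (GL ι A) := Subgroup.closure
    {g | ∃ γ ∈ elemSubgroup ι (Set.univ : Set A), ∃ (i j : ι) (hij : i ≠ j) (y : A), ρ y = 0 ∧
      g = GeneralLinearGroup.map ρ γ * elemMat hij y * (GeneralLinearGroup.map ρ γ)⁻¹}
  have hKH : K ≤ H := by
    rw [Subgroup.closure_le]
    rintro g ⟨γ, hγ, i, j, hij, y, hy, rfl⟩
    exact hH γ hγ i j hij y hy
  have hK : ∀ γ ∈ elemSubgroup ι (Set.univ : Set A), ∀ g ∈ K,
      GeneralLinearGroup.map ρ γ * g * (GeneralLinearGroup.map ρ γ)⁻¹ ∈ K := by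
    intro γ hγ g hg
    have : K ≤ K.comap (MulAut.conj (GeneralLinearGroup.map ρ γ)).toMonoidHom := by
      rw [Subgroup.closure_le]
      rintro g ⟨γ', hγ', i, j, hij, y, hy, rfl⟩
      refine Subgroup.subset_closure ⟨γ * γ', Subgroup.mul_mem _ hγ hγ', i, j, hij, y, hy, ?_⟩
      simp [mul_assoc]
    exact this hg
  suffices h : α * (GeneralLinearGroup.map ρ α)⁻¹ ∈ K from hKH h
  induction hα using Subgroup.closure_induction with
  | mem x hx =>
    obtain ⟨i, j, hij, a, -, rfl⟩ := hx
    refine Subgroup.subset_closure ⟨1, Subgroup.one_mem _, i, j, hij, a - ρ a, by simp [hρ], ?_⟩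
    rw [map_elemMat, ← elemMat_neg, ← elemMat_add, sub_eq_add_neg]
    simp
  | one => simp
  | mul x y hx hy ihx ihy =>
    have := K.mul_mem ihx (hK x hx _ ihy)
    convert this using 1
    simp [mul_assoc]
  | inv x hx ih =>
    have := hK x⁻¹ (Subgroup.inv_mem _ hx) _ (K.inv_mem ih)
    convert this using 1
    simp

/-- The endomorphism `X ↦ c X` of a polynomial ring. -/
noncomputable def scaleX {T : Type*} [CommRing T] (c : T) : T[X] →+* T[X] :=
  compRingHom (Polynomial.C c * Polynomial.X)

theorem coeff_scaleX {T : Type*} [CommRing T] (c : T) (p : T[X]) (n : ℕ) :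
    (scaleX c p).coeff n = p.coeff n * c ^ n := by
  simp [scaleX]

theorem scaleX_C {T : Type*} [CommRing T] (c a : T) : scaleX c (Polynomial.C a) =
    Polynomial.C a := by
  simp [scaleX]

theorem scaleX_X {T : Type*} [CommRing T] (c : T) : scaleX c Polynomial.X =
    Polynomial.C c * Polynomial.X := by
  simp [scaleX]

theorem exists_pow_mul_mem_range {S T κ : Type*} [CommRing S] [CommRing T] [Finite κ]
    (f : S →+* T) (g : S) (hf : ∀ t, ∃ (N : ℕ) (s : S), f g ^ N * t = f s) (t : κ → T) :
    ∃ N, ∀ k, f g ^ N * t k ∈ f.range := by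
  cases nonempty_fintype κ
  choose N s h using fun k => hf (t k)
  refine ⟨∑ k, N k, fun k => ?_⟩
  classical
  rw [← Finset.add_sum_erase _ _ (Finset.mem_univ k), add_comm, pow_add, mul_assoc, h,
    ← map_pow, ← map_mul]
  exact ⟨_, rfl⟩

theorem dilation_elemSubgroup {S T : Type*} [CommRing S] [CommRing T] (f : S →+* T) (g : S)
    (hf : ∀ t, ∃ (N : ℕ) (s : S), f g ^ N * t = f s) (hcard : 3 ≤ Fintype.card ι)
    {α : GL ι T[X]} (hα : α ∈ elemSubgroup ι (Set.univ : Set T[X]))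
    (h0 : GeneralLinearGroup.map (evalRingHom 0) α = 1) :
    ∃ N, ∃ ε ∈ elemSubgroup ι (Set.univ : Set S[X]),
      GeneralLinearGroup.map (mapRingHom f) ε =
        GeneralLinearGroup.map (scaleX (f g ^ N)) α := by
  let E : Subgroup (GL ι T[X]) := elemSubgroup ι ((mapRingHom f).range : Set T[X])
  let H : Subgroup (GL ι T[X]) :=
    { carrier := {x | ∃ N, ∀ N' ≥ N, GeneralLinearGroup.map (scaleX (f g ^ N')) x ∈ E}
      one_mem' := ⟨0, fun N' _ => by rw [map_one]; exact E.one_mem⟩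
      mul_mem' := by
        rintro x y ⟨N, hN⟩ ⟨N', hN'⟩
        refine ⟨max N N', fun K hK => ?_⟩
        rw [map_mul]
        exact E.mul_mem (hN K (le_of_max_le_left hK)) (hN' K (le_of_max_le_right hK))
      inv_mem' := by
        rintro x ⟨N, hN⟩
        refine ⟨N, fun K hK => ?_⟩
        rw [map_inv]
        exact E.inv_mem (hN K hK) }
  have key : α * (GeneralLinearGroup.map (Polynomial.C.comp (evalRingHom (0 : T))) α)⁻¹ ∈ H := by
    refine mul_map_inv_mem _ (fun a => by simp) H ?_ hα
    intro γ hγ i j hij y hy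
    set γ₀ : GL ι T := GeneralLinearGroup.map (evalRingHom 0) γ with hγ₀
    have hγ' : GeneralLinearGroup.map (Polynomial.C.comp (evalRingHom (0 : T))) γ =
        GeneralLinearGroup.map Polynomial.C γ₀ := by rw [hγ₀, map_map_GL]
    rw [hγ']
    obtain ⟨m, hm⟩ := exists_pow_mul_mem_range f g hf
      (Sum.elim (fun ij : ι × ι => γ₀.1 ij.1 ij.2) (fun ij : ι × ι => (γ₀⁻¹).1 ij.1 ij.2))
    obtain ⟨m₂, hm₂⟩ := exists_pow_mul_mem_range f g hf
      (fun k : Fin (y.natDegree + 1) => y.coeff k)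
    have hy0 : y.coeff 0 = 0 := by
      rw [coeff_zero_eq_eval_zero]; simpa using hy
    refine ⟨4 * m + m₂, fun N' hN' => ?_⟩
    set a : T[X] := ∑ n ∈ Finset.range (y.natDegree + 1),
      Polynomial.C (y.coeff n * (f g ^ (N' * n - 4 * m))) * Polynomial.X ^ n with ha
    have hya : scaleX (f g ^ N') y = (Polynomial.C (f g ^ m)) ^ 4 * (a * 1) := by
      ext n
      rw [coeff_scaleX, mul_one, ← Polynomial.C_pow, Polynomial.coeff_C_mul, ha, finsetSum_coeff]
      simp only [Polynomial.coeff_C_mul, Polynomial.coeff_X_pow, mul_ite, mul_one, mul_zero]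
      rw [Finset.sum_ite_eq]
      rcases Nat.eq_zero_or_pos n with rfl | hn
      · simp [hy0]
      split_ifs with h
      · have h1 : 4 * m ≤ N' * n := by nlinarith
        have h2 : N' * n = m * 4 + (N' * n - 4 * m) := by omega
        rw [← pow_mul (f g) N' n, ← pow_mul (f g) m 4]
        conv_lhs => rw [h2, pow_add]
        ring
      · rw [coeff_eq_zero_of_natDegree_lt (by simpa using h)]; simp
    have haR : a ∈ (mapRingHom f).range := by
      rw [ha]
      refine Subring.sum_mem _ fun n hn => ?_
      refine Subring.mul_mem _ ?_ ⟨Polynomial.X ^ n, by simp⟩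
      have hn' : n < y.natDegree + 1 := by simpa using hn
      rcases Nat.eq_zero_or_pos n with rfl | hn0
      · rw [hy0, zero_mul, Polynomial.C_0]; exact Subring.zero_mem _
      obtain ⟨s, hs⟩ := hm₂ ⟨n, hn'⟩
      have h2 : N' * n - 4 * m = m₂ + (N' * n - 4 * m - m₂) := by
        have : 4 * m + m₂ ≤ N' * n := by nlinarith
        omega
      refine ⟨Polynomial.C (s * g ^ (N' * n - 4 * m - m₂)), ?_⟩
      rw [coe_mapRingHom, Polynomial.map_C, map_mul, map_pow, hs, h2, pow_add]
      congr 1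
      simp only [Nat.add_sub_cancel_left]
      ring
    have hcomp : ∀ x : GL ι T, GeneralLinearGroup.map (scaleX (f g ^ N'))
        (GeneralLinearGroup.map Polynomial.C x) = GeneralLinearGroup.map Polynomial.C x := by
      intro x
      rw [map_map_GL]
      congr 2
      ext1 t
      exact scaleX_C _ _
    rw [map_mul, map_mul, map_inv, hcomp, map_elemMat, hya]
    refine conj_elemMat_mem (mapRingHom f).range hcard (Subring.one_mem _)
      (fun s hs => Subring.mul_mem _ haR hs) (fun s hs => by rw [one_mul]; exact hs)
      (Polynomial.C (f g ^ m)) _ ?_ ?_ hij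
    · intro i j
      obtain ⟨s, hs⟩ := hm (Sum.inl (i, j))
      refine ⟨Polynomial.C s, ?_⟩
      rw [coe_mapRingHom, Polynomial.map_C, hs, Polynomial.C_mul]
      rfl
    · intro i j
      obtain ⟨s, hs⟩ := hm (Sum.inr (i, j))
      refine ⟨Polynomial.C s, ?_⟩
      rw [coe_mapRingHom, Polynomial.map_C, hs, Polynomial.C_mul, ← map_inv]
      rfl
  rw [← map_map_GL, h0, map_one, inv_one, mul_one] at key
  obtain ⟨N, hN⟩ := key
  obtain ⟨ε, hε, he⟩ := exists_lift_elemSubgroup (ι := ι) (mapRingHom f) (S := Set.univ)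
    (T := ((mapRingHom f).range : Set T[X])) (fun t ht => by
      obtain ⟨s, hs⟩ := ht; exact ⟨s, trivial, hs⟩) (hN N le_rfl)
  exact ⟨N, ε, hε, he⟩

theorem mapRingHom_eq_zero_scale {S T : Type*} [CommRing S] [CommRing T] (f : S →+* T) (g : S)
    (hf : ∀ s, f s = 0 → ∃ N : ℕ, g ^ N * s = 0) (p : S[X]) (hp : mapRingHom f p = 0)
    (h0 : p.coeff 0 = 0) : ∃ M, ∀ M' ≥ M, scaleX (g ^ M') p = 0 := by
  have hz : ∀ n, f (p.coeff n) = 0 := fun n => by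
    have := congrArg (fun q => Polynomial.coeff q n) hp
    simpa using this
  choose N hN using fun n => hf _ (hz n)
  refine ⟨∑ n ∈ Finset.range (p.natDegree + 1), N n, fun M' hM' => ?_⟩
  ext n
  rw [coeff_scaleX, Polynomial.coeff_zero]
  rcases Nat.eq_zero_or_pos n with rfl | hn
  · rw [h0, zero_mul]
  by_cases h : n < p.natDegree + 1
  · have h1 : N n ≤ M' := (Finset.single_le_sum (f := N) (fun _ _ => Nat.zero_le _)
      (Finset.mem_range.mpr h)).trans hM'
    have h2 : N n ≤ M' * n := h1.trans (Nat.le_mul_of_pos_right _ hn)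
    rw [← pow_mul, ← Nat.add_sub_cancel' h2, pow_add, ← mul_assoc, mul_comm (p.coeff n), hN,
      zero_mul]
  · rw [coeff_eq_zero_of_natDegree_lt (by omega), zero_mul]

/-- The homomorphism `X ↦ C X + Y`. -/
noncomputable def shiftHom (T : Type*) [CommRing T] : T[X] →+* T[X][X] :=
  eval₂RingHom (Polynomial.C.comp Polynomial.C) (Polynomial.C Polynomial.X + Polynomial.X)

theorem shiftHom_C {T : Type*} [CommRing T] (a : T) : shiftHom T (Polynomial.C a) =
    Polynomial.C (Polynomial.C a) := by
  simp [shiftHom]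

theorem shiftHom_X {T : Type*} [CommRing T] : shiftHom T Polynomial.X = Polynomial.C Polynomial.X +
    Polynomial.X := by
  simp [shiftHom]

theorem exists_pow_rowRel_comp {A T : Type*} [CommRing A] [CommRing T] (f : A →+* T) (g : A)
    (hf : ∀ t, ∃ (N : ℕ) (s : A), f g ^ N * t = f s)
    (hf0 : ∀ s, f s = 0 → ∃ N : ℕ, g ^ N * s = 0) (hcard : 3 ≤ Fintype.card ι)
    (U : ι → A[X])
    (hU : RowRel (mapRingHom f ∘ U) (Polynomial.C.comp (evalRingHom 0) ∘ (mapRingHom f ∘ U))) :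
    ∃ L : ℕ, ∀ d y : A[X], RowRel (fun i => (U i).comp (d + Polynomial.C (g ^ L) * y))
      (fun i => (U i).comp d) := by
  obtain ⟨α, hα, hαU⟩ := hU.symm
  set f' : A[X] →+* T[X] := mapRingHom f with hf'
  have hf'1 : ∀ t, ∃ (N : ℕ) (s : A[X]), f' (Polynomial.C g) ^ N * t = f' s := by
    intro t
    obtain ⟨N, hN⟩ := exists_pow_mul_mem_range f g hf (fun k : Fin (t.natDegree + 1) => t.coeff k)
    have : Polynomial.C (f g ^ N) * t ∈ f'.range := by
      rw [hf', Polynomial.mem_map_range]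
      intro n
      rw [Polynomial.coeff_C_mul]
      by_cases h : n < t.natDegree + 1
      · exact hN ⟨n, h⟩
      · rw [coeff_eq_zero_of_natDegree_lt (by omega), mul_zero]; exact Subring.zero_mem _
    obtain ⟨s, hs⟩ := this
    exact ⟨N, s, by rw [hs, hf']; simp⟩
  have hf'0 : ∀ s, f' s = 0 → ∃ N : ℕ, Polynomial.C g ^ N * s = 0 := by
    intro s hs
    have hz : ∀ n, f (s.coeff n) = 0 := fun n => by
      have := congrArg (fun q => Polynomial.coeff q n) hs
      simpa [hf'] using this
    choose N hN using fun n => hf0 _ (hz n)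
    refine ⟨∑ n ∈ Finset.range (s.natDegree + 1), N n, ?_⟩
    ext n
    rw [← Polynomial.C_pow, Polynomial.coeff_C_mul, Polynomial.coeff_zero]
    by_cases h : n < s.natDegree + 1
    · rw [← Finset.add_sum_erase _ _ (Finset.mem_range.mpr h), add_comm, pow_add, mul_assoc, hN,
        mul_zero]
    · rw [coeff_eq_zero_of_natDegree_lt (by omega), mul_zero]
  set σ := shiftHom T with hσ
  set β : GL ι T[X][X] :=
    GeneralLinearGroup.map σ α * (GeneralLinearGroup.map Polynomial.C α)⁻¹ with hβ
  have hβE : β ∈ elemSubgroup ι (Set.univ : Set T[X][X]) :=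
    Subgroup.mul_mem _ (map_mem_elemSubgroup _ (fun _ _ => Set.mem_univ _) hα)
      (Subgroup.inv_mem _ (map_mem_elemSubgroup _ (fun _ _ => Set.mem_univ _) hα))
  have hβ0 : GeneralLinearGroup.map (evalRingHom 0) β = 1 := by
    rw [hβ, map_mul, map_inv, map_map_GL, map_map_GL]
    have e1 : (evalRingHom (0 : T[X])).comp σ = RingHom.id _ := by
      apply Polynomial.ringHom_ext
      · intro a; simp [hσ, shiftHom_C]
      · simp [hσ, shiftHom_X]
    have e2 : (evalRingHom (0 : T[X])).comp Polynomial.C = RingHom.id _ := by ext <;> simp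
    rw [e1, e2, map_id_GL, mul_inv_cancel]
  obtain ⟨N, ε₁, hε₁, he₁⟩ := dilation_elemSubgroup f' (Polynomial.C g) hf'1 hcard hβE hβ0
  set ε₀ : GL ι A[X][X] := GeneralLinearGroup.map (Polynomial.C.comp (evalRingHom 0)) ε₁ with hε₀
  set ε := ε₁ * ε₀⁻¹ with hε
  have hεE : ε ∈ elemSubgroup ι (Set.univ : Set A[X][X]) :=
    Subgroup.mul_mem _ hε₁ (Subgroup.inv_mem _
      (map_mem_elemSubgroup _ (fun _ _ => Set.mem_univ _) hε₁))
  have hε₀1 : GeneralLinearGroup.map (mapRingHom f') ε₀ = 1 := by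
    have e1 : (mapRingHom f').comp (Polynomial.C.comp (evalRingHom 0)) =
        (Polynomial.C.comp (evalRingHom 0)).comp (mapRingHom f') := by
      apply Polynomial.ringHom_ext
      · intro a; simp
      · simp
    have e2 : (Polynomial.C.comp (evalRingHom 0)).comp (scaleX (f' (Polynomial.C g) ^ N)) =
        (Polynomial.C.comp (evalRingHom (0 : T[X]))) := by
      apply Polynomial.ringHom_ext
      · intro a; simp [scaleX_C]
      · simp [scaleX_X]
    rw [hε₀, map_map_GL, e1, ← map_map_GL, he₁, map_map_GL, e2, ← map_map_GL, hβ0, map_one]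
  have heε : GeneralLinearGroup.map (mapRingHom f') ε =
      GeneralLinearGroup.map (scaleX (f' (Polynomial.C g) ^ N)) β := by
    rw [hε, map_mul, map_inv, hε₀1, inv_one, mul_one, he₁]
  have hε_0 : GeneralLinearGroup.map (evalRingHom 0) ε = 1 := by
    have e1 : (evalRingHom (0 : A[X])).comp (Polynomial.C.comp (evalRingHom 0)) =
        evalRingHom 0 := by
      apply Polynomial.ringHom_ext
      · intro a; simp
      · simp
    rw [hε, map_mul, map_inv, hε₀, map_map_GL, e1, mul_inv_cancel]
  -- the two rows to be compared
  set r₁ : ι → A[X][X] := ε.1 *ᵥ (Polynomial.C ∘ U) with hr₁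
  set r₂ : ι → A[X][X] := (scaleX (Polynomial.C g ^ N)).comp (shiftHom A) ∘ U with hr₂
  have hmap : mapRingHom f' ∘ r₁ = mapRingHom f' ∘ r₂ := by
    have s1 : mapRingHom f' ∘ r₁ =
        (GeneralLinearGroup.map (scaleX (f' (Polynomial.C g) ^ N)) β).1 *ᵥ
        (scaleX (f' (Polynomial.C g) ^ N) ∘ (Polynomial.C ∘ (f' ∘ U))) := by
      rw [hr₁, ← map_mulVec_comp, heε]
      congr 1
      ext1 i
      simp [scaleX_C]
    have s2 : mapRingHom f' ∘ r₂ = scaleX (f' (Polynomial.C g) ^ N) ∘ (σ ∘ (f' ∘ U)) := by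
      have : (mapRingHom f').comp ((scaleX (Polynomial.C g ^ N)).comp (shiftHom A)) =
          ((scaleX (f' (Polynomial.C g) ^ N)).comp σ).comp f' := by
        apply Polynomial.ringHom_ext
        · intro a; simp [hσ, shiftHom_C, scaleX_C, hf']
        · simp [hσ, shiftHom_X, scaleX_C, scaleX_X, hf']
      rw [hr₂]
      ext1 i
      exact congrArg (fun h : A[X] →+* T[X][X] => h (U i)) this
    have s3 : β.1 *ᵥ (Polynomial.C ∘ (f' ∘ U)) = σ ∘ (f' ∘ U) := by
      rw [hβ, mul_mulVec_GL]
      have t1 : ((GeneralLinearGroup.map Polynomial.C α)⁻¹).1 *ᵥ (Polynomial.C ∘ (f' ∘ U)) =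
          Polynomial.C ∘ (Polynomial.C.comp (evalRingHom 0) ∘ (f' ∘ U)) := by
        apply inv_mulVec_of_mulVec
        rw [map_mulVec_comp, hαU]
      have t2 : Polynomial.C ∘ (Polynomial.C.comp (evalRingHom 0) ∘ (f' ∘ U)) =
          σ ∘ (Polynomial.C.comp (evalRingHom 0) ∘ (f' ∘ U)) := by
        ext1 i
        simp [hσ, shiftHom_C]
      rw [t1, t2, map_mulVec_comp, hαU]
    rw [s1, s2, map_mulVec_comp, s3]
  have hzero : ∀ i, (r₁ i - r₂ i).coeff 0 = 0 := by
    intro i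
    rw [coeff_zero_eq_eval_zero, Polynomial.eval_sub, sub_eq_zero]
    have u1 : evalRingHom 0 ∘ r₁ = U := by
      rw [hr₁, ← map_mulVec_comp, hε_0]
      ext1 i
      simp
    have u2 : evalRingHom 0 ∘ r₂ = U := by
      have : (evalRingHom (0 : A[X])).comp ((scaleX (Polynomial.C g ^ N)).comp (shiftHom A)) =
          RingHom.id _ := by
        apply Polynomial.ringHom_ext
        · intro a; simp [shiftHom_C, scaleX_C]
        · simp [shiftHom_X, scaleX_C, scaleX_X]
      ext1 i
      exact congrArg (fun h : A[X] →+* A[X] => h (U i)) this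
    exact (congrFun u1 i).trans (congrFun u2 i).symm
  choose M hM using fun i => mapRingHom_eq_zero_scale f' (Polynomial.C g) hf'0 (r₁ i - r₂ i)
    (by rw [map_sub, sub_eq_zero]; exact congrFun hmap i) (hzero i)
  set K := ∑ i, M i with hK
  have hrel : RowRel (Polynomial.C ∘ U) (((scaleX (Polynomial.C g ^ K)).comp
      ((scaleX (Polynomial.C g ^ N)).comp (shiftHom A))) ∘ U) := by
    have h1 : RowRel (Polynomial.C ∘ U) r₁ := ⟨ε, hεE, rfl⟩
    have h2 := h1.map (scaleX (Polynomial.C g ^ K))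
    have h3 : scaleX (Polynomial.C g ^ K) ∘ r₁ = scaleX (Polynomial.C g ^ K) ∘ r₂ := by
      ext1 i
      have := hM i K (Finset.single_le_sum (f := M) (fun _ _ => Nat.zero_le _)
        (Finset.mem_univ i))
      rwa [map_sub, sub_eq_zero] at this
    rw [h3] at h2
    have h4 : scaleX (Polynomial.C g ^ K) ∘ (Polynomial.C ∘ U) = Polynomial.C ∘ U := by
      ext1 i; simp [scaleX_C]
    rw [h4] at h2
    exact h2
  refine ⟨N + K, fun d y => ?_⟩
  have h5 := (hrel.symm).map ((eval₂RingHom (compRingHom d) y))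
  have e1 : (eval₂RingHom (compRingHom d) y : A[X][X] →+* A[X]) ∘ (Polynomial.C ∘ U) =
      fun i => (U i).comp d := by
    ext1 i; simp
  have e2 : (eval₂RingHom (compRingHom d) y : A[X][X] →+* A[X]) ∘
      (((scaleX (Polynomial.C g ^ K)).comp
      ((scaleX (Polynomial.C g ^ N)).comp (shiftHom A))) ∘ U) =
      fun i => (U i).comp (d + Polynomial.C (g ^ (N + K)) * y) := by
    have : (eval₂RingHom (compRingHom d) y : A[X][X] →+* A[X]).comp
        (((scaleX (Polynomial.C g ^ K)).comp
      ((scaleX (Polynomial.C g ^ N)).comp (shiftHom A)))) =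
          compRingHom (d + Polynomial.C (g ^ (N + K)) * y) := by
      apply Polynomial.ringHom_ext
      · intro a; simp [shiftHom_C, scaleX_C]
      · simp only [RingHom.comp_apply, shiftHom_X, map_add, scaleX_C, scaleX_X, map_mul, map_pow,
          coe_eval₂RingHom, Polynomial.eval₂_C, Polynomial.eval₂_X, coe_compRingHom_apply, X_comp,
            C_comp, pow_add]
        ring
    ext1 i
    exact congrArg (fun h : A[X] →+* A[X] => h (U i)) this
  rw [e1, e2] at h5
  exact h5

/-- The local-global principle for the elementary equivalence of rows of polynomials. -/
theorem rowRel_eval_zero_of_local {A : Type*} [CommRing A] (hcard : 3 ≤ Fintype.card ι)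
    (U : ι → A[X]) (s : Set A) (hs : Ideal.span s = ⊤)
    (h : ∀ g ∈ s, RowRel (mapRingHom (algebraMap A (Localization.Away g)) ∘ U)
      (Polynomial.C.comp (evalRingHom 0) ∘ (mapRingHom (algebraMap A (Localization.Away g)) ∘ U))) :
    RowRel U (Polynomial.C.comp (evalRingHom 0) ∘ U) := by
  let Q : Ideal A :=
    { carrier := {q | ∀ d y : A[X], RowRel (fun i => (U i).comp (d + Polynomial.C q * y))
        (fun i => (U i).comp d)}
      zero_mem' := by
        intro d y
        simp only [Polynomial.C_0, zero_mul, add_zero]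
        exact RowRel.refl _
      add_mem' := by
        intro a b ha hb d y
        have h1 := hb (d + Polynomial.C a * y) y
        rw [add_assoc, ← add_mul, ← Polynomial.C_add] at h1
        exact h1.trans (ha d y)
      smul_mem' := by
        intro c a ha d y
        have h1 := ha d (Polynomial.C c * y)
        rw [← mul_assoc, ← Polynomial.C_mul, mul_comm a c] at h1
        exact h1 }
  have hQ : (1 : A) ∈ Q := by
    by_contra hne
    obtain ⟨m, hm, hQm⟩ := Ideal.exists_le_maximal Q ((Ideal.ne_top_iff_one _).mpr hne)
    apply hm.ne_top
    rw [eq_top_iff, ← hs, Ideal.span_le]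
    intro g hg
    obtain ⟨L, hL⟩ := exists_pow_rowRel_comp (algebraMap A (Localization.Away g)) g
      (fun t => by
        obtain ⟨N, a, ha⟩ := IsLocalization.Away.surj g t
        exact ⟨N, a, by rw [mul_comm]; exact ha⟩)
      (fun a ha => by
        obtain ⟨⟨_, n, rfl⟩, hc⟩ := (IsLocalization.map_eq_zero_iff (Submonoid.powers g)
          (Localization.Away g) a).mp ha
        exact ⟨n, hc⟩) hcard U (h g hg)
    exact hm.isPrime.mem_of_pow_mem L (hQm hL)
  have h1 := hQ 0 Polynomial.X
  simp only [Polynomial.C_1, one_mul, zero_add, comp_X] at h1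
  convert h1 using 1
  ext1 i
  simp [comp_zero]

end LocalGlobal

section Monic

open Matrix Polynomial

variable {ι : Type*} [Fintype ι] [DecidableEq ι]

/-- Prime avoidance for a coset of an ideal. -/
theorem exists_add_notMem_of_incomparable {E : Type*} [CommRing E] (J : Ideal E) (d : E)
    (s : Finset (Ideal E)) (hprime : ∀ p ∈ s, p.IsPrime)
    (hinc : ∀ p ∈ s, ∀ q ∈ s, p ≤ q → p = q) (h : ∀ p ∈ s, ¬ (J ≤ p ∧ d ∈ p)) :
    ∃ x ∈ J, ∀ p ∈ s, d + x ∉ p := by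
  classical
  induction s using Finset.induction_on with
  | empty => exact ⟨0, J.zero_mem, by simp⟩
  | insert p s hps ih =>
    obtain ⟨x, hx, hxs⟩ := ih (fun q hq => hprime q (Finset.mem_insert_of_mem hq))
      (fun q hq q' hq' => hinc q (Finset.mem_insert_of_mem hq) q' (Finset.mem_insert_of_mem hq'))
      (fun q hq => h q (Finset.mem_insert_of_mem hq))
    by_cases hp : d + x ∈ p
    · have hpp := hprime p (Finset.mem_insert_self p s)
      have hJ : ¬ J ≤ p := fun hJ => h p (Finset.mem_insert_self p s)
        ⟨hJ, (p.add_mem_iff_left (hJ hx)).mp hp⟩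
      have h2 : ¬ J ⊓ s.inf id ≤ p := by
        intro hle
        rcases (hpp.inf_le.mp hle) with h3 | h3
        · exact hJ h3
        · obtain ⟨q, hq, hqp⟩ := (hpp.inf_le').mp h3
          have := hinc q (Finset.mem_insert_of_mem hq) p (Finset.mem_insert_self p s) hqp
          exact hps (this ▸ hq)
      obtain ⟨y, hy, hyp⟩ := SetLike.not_le_iff_exists.mp h2
      refine ⟨x + y, J.add_mem hx hy.1, ?_⟩
      intro q hq
      rw [← add_assoc]
      rcases Finset.mem_insert.mp hq with rfl | hq
      · rwa [q.add_mem_iff_right hp]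
      · have hyq : y ∈ q := (Finset.inf_le (f := id) hq : s.inf id ≤ q) hy.2
        rw [q.add_mem_iff_left hyq]
        exact hxs q hq
    · refine ⟨x, hx, fun q hq => ?_⟩
      rcases Finset.mem_insert.mp hq with rfl | hq
      · exact hp
      · exact hxs q hq

/-- If `A` is finite over `B` modulo a coordinate of a unimodular row, then the row is elementarily
trivial after localizing at an element of `B` outside a given maximal ideal. -/
theorem exists_rowRel_single_of_isUnit {A B : Type*} [CommRing A] [CommRing B] [Algebra B A]
    (hcard : 3 ≤ Fintype.card ι) {u : ι → A} (hu : UniRow u) (o : ι)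
    [Module.Finite B (A ⧸ Ideal.span {u o})] (m : Ideal B) [m.IsMaximal] :
    ∃ g ∉ m, ∀ {A' : Type _} [CommRing A'] (f : A →+* A'), IsUnit (f (algebraMap B A g)) →
      ∀ j, RowRel (f ∘ u) (Pi.single j 1) := by
  classical
  obtain ⟨p, hp⟩ : ∃ p, p ≠ o := Fintype.exists_ne_of_one_lt_card (by omega) o
  obtain ⟨q, hq⟩ : ∃ q, q ∉ ({o, p} : Finset ι) := by
    by_contra! hall
    have h1 := Finset.card_le_card (fun x _ => hall x : (Finset.univ : Finset ι) ⊆ {o, p})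
    have h2 := Finset.card_le_two (a := o) (b := p)
    rw [Finset.card_univ] at h1
    omega
  have hqo : q ≠ o := fun h => hq (by simp [h])
  have hqp : q ≠ p := fun h => hq (by simp [h])
  let D := A ⧸ Ideal.span {u o}
  let π : A →+* D := Ideal.Quotient.mk _
  let J : Ideal D := Ideal.span (Set.range fun j => if j = o ∨ j = p then 0 else π (u j))
  have hfin : (m.primesOver D).Finite := Algebra.QuasiFinite.finite_primesOver m
  have hover : ∀ P : Ideal D, P ∈ m.primesOver D → P.IsMaximal := fun P hP => by
    have := hP.1
    have := hP.2
    exact Ideal.IsMaximal.of_liesOver_isMaximal P m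
  obtain ⟨x, hxJ, hx⟩ := exists_add_notMem_of_incomparable J (π (u p)) hfin.toFinset
    (fun P hP => ((hfin.mem_toFinset).mp hP).1)
    (fun P hP Q hQ hPQ => (hover P ((hfin.mem_toFinset).mp hP)).eq_of_le
      (hover Q ((hfin.mem_toFinset).mp hQ)).ne_top hPQ)
    (by
      rintro P hP ⟨hJP, hpP⟩
      have hPp := ((hfin.mem_toFinset).mp hP).1
      obtain ⟨c, hc⟩ := hu
      apply hPp.ne_top
      rw [Ideal.eq_top_iff_one, ← map_one π, ← hc, dotProduct, map_sum]
      refine Ideal.sum_mem _ fun j _ => ?_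
      rw [map_mul]
      refine P.mul_mem_left _ ?_
      by_cases hjo : j = o
      · have : π (u j) = 0 := by
          rw [hjo]; exact Ideal.Quotient.eq_zero_iff_mem.mpr (Ideal.mem_span_singleton_self _)
        rw [this]; exact P.zero_mem
      by_cases hjp : j = p
      · rw [hjp]; exact hpP
      · exact hJP (Ideal.subset_span ⟨j, by simp [hjo, hjp]⟩))
  obtain ⟨c, hc⟩ := (Ideal.mem_span_range_iff_exists_fun).mp hxJ
  choose c' hc' using fun i => Ideal.Quotient.mk_surjective (I := Ideal.span {u o}) (c i)
  let b : ι → A := fun j => if j = o ∨ j = p then 0 else c' j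
  have hbx : π (b ⬝ᵥ u) = x := by
    rw [← hc, dotProduct, map_sum]
    refine Finset.sum_congr rfl fun j _ => ?_
    by_cases hj : j = o ∨ j = p
    · simp [b, hj]
    · simp only [b, if_neg hj, map_mul]
      rw [← hc' j]
  let y := u p + b ⬝ᵥ u
  have hπy : π y = π (u p) + x := by simp only [y, map_add, hbx]
  obtain ⟨r, hr, hrm⟩ : ∃ r, algebraMap B D r ∈ Ideal.span {π y} ∧ r ∉ m := by
    by_contra! hall
    obtain ⟨Q, hQ1, hQ2, hQ3⟩ := Ideal.exists_ideal_over_prime_of_isIntegral m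
      (Ideal.span {π y}) (fun r hr => hall r hr)
    have hmem : Q ∈ m.primesOver D := ⟨hQ2, ⟨hQ3.symm⟩⟩
    refine hx Q (hfin.mem_toFinset.mpr hmem) ?_
    rw [← hπy]
    exact hQ1 (Ideal.mem_span_singleton_self _)
  refine ⟨r, hrm, fun {A'} _ f hf j => ?_⟩
  obtain ⟨a', ha'⟩ := Ideal.mem_span_singleton'.mp hr
  obtain ⟨a, rfl⟩ := Ideal.Quotient.mk_surjective a'
  have h1 : algebraMap B A r - a * y ∈ Ideal.span {u o} := by
    rw [← Ideal.Quotient.eq_zero_iff_mem, map_sub, map_mul, sub_eq_zero]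
    exact ha'.symm
  obtain ⟨e, he⟩ := Ideal.mem_span_singleton'.mp h1
  have hrel := (rowRel_update u p b (by simp [b])).map f
  refine hrel.trans (rowRel_single_of_dot_eq_one q
    (Ring.inverse (f (algebraMap B A r)) • (Pi.single p (f a) + Pi.single o (f e))) ?_ ?_ j)
  · simp [hqo, hqp]
  · have h2 : f a * f y + f e * f (u o) = f (algebraMap B A r) := by
      rw [← map_mul, ← map_mul, ← map_add, he]; congr 1; ring
    rw [smul_dotProduct, add_dotProduct, single_dotProduct, single_dotProduct]
    simp only [Function.comp_apply, Function.update_self, Function.update_of_ne (Ne.symm hp)]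
    rw [show u p + b ⬝ᵥ u = y from rfl, h2, smul_eq_mul, Ring.inverse_mul_cancel _ hf]

/-- If `A` carries a degree-scaling homomorphism over `B` and is finite over `B` modulo a
coordinate of a unimodular row, then the row is equivalent to its degree zero part. -/
theorem rowRel_of_finite {A B : Type*} [CommRing A] [CommRing B] [Algebra B A]
    (hcard : 3 ≤ Fintype.card ι) (ψ : A →+* A[X]) (hψ1 : ∀ a, (ψ a).eval 1 = a)
    (hψ : ∀ b, ψ (algebraMap B A b) = Polynomial.C (algebraMap B A b)) {u : ι → A} (hu : UniRow u)
    (o : ι)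
    [Module.Finite B (A ⧸ Ideal.span {u o})] :
    RowRel u (fun i => (ψ (u i)).eval 0) := by
  let S : Set B := {g | ∀ j, RowRel (algebraMap A (Localization.Away (algebraMap B A g)) ∘ u)
    (Pi.single j 1)}
  have hS : Ideal.span S = ⊤ := by
    by_contra hne
    obtain ⟨m, hm, hSm⟩ := Ideal.exists_le_maximal _ hne
    obtain ⟨g, hg, h⟩ := exists_rowRel_single_of_isUnit hcard hu o m
    exact hg (hSm (Ideal.subset_span fun j =>
      h (algebraMap A (Localization.Away (algebraMap B A g)))
      (IsLocalization.Away.algebraMap_isUnit _) j))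
  have hspan : Ideal.span (algebraMap B A '' S) = ⊤ := by
    rw [← Ideal.map_span, hS, Ideal.map_top]
  have key := rowRel_eval_zero_of_local hcard (ψ ∘ u) _ hspan (by
    rintro _ ⟨g, hg, rfl⟩
    set a := algebraMap B A g
    let θ : A →+* (Localization.Away a)[X] :=
      (mapRingHom (algebraMap A (Localization.Away a))).comp ψ
    have hθ : IsUnit (θ a) := by
      simp only [θ, RingHom.comp_apply, a, hψ, coe_mapRingHom, Polynomial.map_C]
      exact (IsLocalization.Away.algebraMap_isUnit _).map Polynomial.C
    let θ' : Localization.Away a →+* (Localization.Away a)[X] := IsLocalization.Away.lift a hθ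
    have e0 : θ' ∘ (algebraMap A (Localization.Away a) ∘ u) =
        mapRingHom (algebraMap A (Localization.Away a)) ∘ (ψ ∘ u) := by
      ext1 i
      exact IsLocalization.Away.lift_eq a hθ (u i)
    obtain ⟨j⟩ : Nonempty ι := Fintype.card_pos_iff.mp (by omega)
    have h1 := (hg j).map θ'
    rw [e0, comp_single_one] at h1
    have h2 := h1.map (Polynomial.C.comp (evalRingHom 0))
    rw [comp_single_one] at h2
    exact h1.trans h2.symm)
  have h2 := key.map (evalRingHom 1)
  convert h2 using 1
  · ext1 i; simp [hψ1]
  · ext1 i; simp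

end Monic

section BasicElements

open Matrix

variable {ι : Type*} [Fintype ι] [DecidableEq ι]

theorem exists_card_le_height {A : Type*} [CommRing A] [IsNoetherianRing A] (u : ι → A) (o : ι)
    (s : Finset ι) : ∃ b : ι → A, ∀ q : Ideal A, q.IsPrime → (∀ i ∈ s, u i + b i * u o ∈ q) →
      u o ∉ q → (s.card : ℕ∞) ≤ q.height := by
  induction s using Finset.induction_on with
  | empty => exact ⟨0, fun q _ _ _ => by simp⟩
  | insert i s his ih =>
    obtain ⟨b, hb⟩ := ih
    let I : Ideal A := Ideal.span ((fun j => u j + b j * u o) '' s)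
    have hfin : {p ∈ I.minimalPrimes | u o ∉ p}.Finite :=
      (I.finite_minimalPrimes_of_isNoetherianRing A).subset (fun p hp => hp.1)
    obtain ⟨x, hx, hxs⟩ := exists_add_notMem_of_incomparable (Ideal.span {u o}) (u i)
      hfin.toFinset (fun p hp => ((hfin.mem_toFinset).mp hp).1.1.1)
      (fun p hp q hq hpq => le_antisymm hpq
        (((hfin.mem_toFinset).mp hq).1.2 ((hfin.mem_toFinset).mp hp).1.1 hpq))
      (fun p hp h => ((hfin.mem_toFinset).mp hp).2 (h.1 (Ideal.mem_span_singleton_self _)))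
    obtain ⟨c, rfl⟩ := Ideal.mem_span_singleton'.mp hx
    have hbj : ∀ j ∈ s, Function.update b i c j = b j := fun j hj =>
      Function.update_of_ne (by rintro rfl; exact his hj) _ _
    refine ⟨Function.update b i c, fun q hq hqs hqo => ?_⟩
    have hIq : I ≤ q := by
      rw [Ideal.span_le]
      rintro _ ⟨j, hj, rfl⟩
      have := hqs j (Finset.mem_insert_of_mem hj)
      rwa [hbj j hj] at this
    obtain ⟨p, hp, hpq⟩ := Ideal.exists_minimalPrimes_le hIq
    have hpp : p.IsPrime := hp.1.1
    have hpo : u o ∉ p := fun h => hqo (hpq h)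
    have hpi := hxs p (hfin.mem_toFinset.mpr ⟨hp, hpo⟩)
    have hlt : p < q := by
      refine lt_of_le_of_ne hpq ?_
      rintro rfl
      have := hqs i (Finset.mem_insert_self i s)
      rw [Function.update_self] at this
      exact hpi this
    rw [Finset.card_insert_of_notMem his, Nat.cast_add, Nat.cast_one]
    refine le_trans ?_ (Ideal.height_add_one_le_of_lt_of_isPrime hlt)
    gcongr
    exact hb p hpp (fun j hj => hp.1.2 (Ideal.subset_span ⟨j, hj, rfl⟩)) hpo

/-- A form of the theorem of Bass: after adding multiples of one coordinate of a unimodular row to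
the others, these generate an ideal meeting `W`, when the primes disjoint from `W` have small
height. -/
theorem exists_mem_span_of_height_lt {A : Type*} [CommRing A] [IsNoetherianRing A]
    (W : Submonoid A) (d : ℕ) (hW : ∀ q : Ideal A, q.IsPrime → Disjoint (q : Set A) W →
    q.height < d)
    (hcard : d + 1 ≤ Fintype.card ι) {u : ι → A} (hu : UniRow u) (o : ι) :
    ∃ b : ι → A, b o = 0 ∧
      ∃ w ∈ W, w ∈ Ideal.span (Set.range fun i => if i = o then 0 else u i + b i * u o) := by
  obtain ⟨b, hb⟩ := exists_card_le_height u o (Finset.univ.erase o)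
  refine ⟨Function.update b o 0, Function.update_self _ _ _, ?_⟩
  by_contra! hall
  obtain ⟨q, hq, hIq, hqW⟩ := Ideal.exists_le_prime_disjoint _ W
    (Set.disjoint_right.mpr fun w hw => hall w hw)
  have hmem : ∀ i, i ≠ o → u i + b i * u o ∈ q := fun i hi =>
    hIq (Ideal.subset_span ⟨i, by simp [hi]⟩)
  have huo : u o ∈ q := by
    by_contra huo
    have h1 := hb q hq (fun i hi => hmem i (Finset.ne_of_mem_erase hi)) huo
    rw [Finset.card_erase_of_mem (Finset.mem_univ o), Finset.card_univ] at h1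
    have h2 := lt_of_le_of_lt h1 (hW q hq hqW)
    have h3 := Nat.cast_lt.mp h2
    omega
  obtain ⟨c, hc⟩ := hu
  apply hq.ne_top
  rw [Ideal.eq_top_iff_one, ← hc]
  refine Ideal.sum_mem _ fun i _ => q.mul_mem_left _ ?_
  by_cases hi : i = o
  · rwa [hi]
  · exact (q.add_mem_iff_left (q.mul_mem_left _ huo)).mp (hmem i hi)

/-- If the primes of `A` have height smaller than `d`, then the elementary group acts transitively
on unimodular rows of length greater than `d`. -/
theorem rowTransitive_of_height_lt {A : Type*} [CommRing A] [IsNoetherianRing A]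
    (d : ℕ) (hA : ∀ q : Ideal A, q.IsPrime → q.height < d)
    (hcard : d + 1 ≤ Fintype.card ι) : RowTransitive ι A := by
  intro u hu o
  obtain ⟨b, hbo, w, hw, hmem⟩ := exists_mem_span_of_height_lt (⊥ : Submonoid A) d
    (fun q hq _ => hA q hq) hcard hu o
  rw [Submonoid.mem_bot] at hw
  subst hw
  obtain ⟨c, hc⟩ := (Ideal.mem_span_range_iff_exists_fun).mp hmem
  have h1 : RowRel u (u + u o • b) := rowRel_add u o b hbo
  refine h1.trans (rowRel_single_of_dot_eq_one o (fun i => if i = o then 0 else c i) (by simp) ?_ o)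
  rw [← hc, dotProduct]
  refine Finset.sum_congr rfl fun i _ => ?_
  by_cases hi : i = o
  · simp [hi]
  · simp [hi, mul_comm]

end BasicElements

section LeadingCoeff

open Matrix Polynomial

theorem height_le_height_add_one_of_liesOver {B : Type*} [CommRing B] [IsNoetherianRing B]
    (p : Ideal B) (q : Ideal B[X]) [q.IsPrime] [q.LiesOver p] : q.height ≤ p.height + 1 := by
  let _ := fun (S R : Type _) [CommSemiring S] [CommSemiring R] [Algebra S R] =>
    (Polynomial.algebra S R)
  have : p.IsPrime := by rw [q.over_def p]; infer_instance
  let Bp := Localization.AtPrime p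
  have hloc : IsLocalization (p.primeCompl.map (Polynomial.C : B →+* B[X])) Bp[X] :=
    Polynomial.isLocalization _ _
  let p' : Ideal Bp := p.map (algebraMap B Bp)
  have : p'.IsMaximal := by
    rw [show p' = _ from Localization.AtPrime.map_eq_maximalIdeal]
    exact IsLocalRing.maximalIdeal.isMaximal Bp
  let q' : Ideal Bp[X] := q.map (algebraMap B[X] Bp[X])
  have disj : Disjoint (p.primeCompl.map (Polynomial.C : B →+* B[X]) : Set B[X]) q := by
    refine Set.disjoint_left.mpr fun a ⟨b, hb⟩ ha ↦ hb.1 ?_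
    rwa [SetLike.mem_coe, Ideal.LiesOver.over (P := q) (p := p), Ideal.mem_comap,
      Polynomial.algebraMap_eq, hb.2]
  have hq' : q'.IsPrime := IsLocalization.isPrime_of_isPrime_disjoint
    (p.primeCompl.map (Polynomial.C : B →+* B[X])) Bp[X] q inferInstance disj
  have : q'.LiesOver p' := IsLocalization.liesOver_of_isPrime_of_disjoint p.primeCompl _ _ disj
  have eq1 : p'.height = p.height :=
    IsLocalization.height_map_of_disjoint p.primeCompl p
      (Disjoint.symm <| Set.disjoint_left.mpr fun _ a b ↦ b a)
  have eq2 : q'.height = q.height :=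
    IsLocalization.height_map_of_disjoint (p.primeCompl.map (Polynomial.C : B →+* B[X])) q disj
  obtain ⟨Q, hQ, hqQ⟩ := Ideal.exists_le_maximal q' hq'.ne_top
  have : Q.LiesOver p' := ⟨‹p'.IsMaximal›.eq_of_le (Ideal.comap_ne_top _ hQ.ne_top)
    (by rw [q'.over_def p']; exact Ideal.comap_mono hqQ)⟩
  rw [← eq1, ← eq2, ← Polynomial.height_eq_height_add_one p' Q]
  exact Ideal.height_mono hqQ

theorem exists_leadingCoeff_notMem {B : Type*} [CommRing B] (p : Ideal B) (q : Ideal B[X])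
    (hpq : p.map Polynomial.C ≤ q) (hne : ¬ q ≤ p.map Polynomial.C) : ∃ F ∈ q,
    F.leadingCoeff ∉ p := by
  by_contra! hall
  apply hne
  intro F hF
  induction hn : F.natDegree using Nat.strong_induction_on generalizing F with
  | _ n ih =>
  have h1 : monomial F.natDegree F.leadingCoeff ∈ p.map Polynomial.C := by
    rw [← Polynomial.C_mul_X_pow_eq_monomial]
    exact Ideal.mul_mem_right _ _ (Ideal.mem_map_of_mem Polynomial.C (hall F hF))
  by_cases h0 : F.natDegree = 0
  · rw [eq_C_of_natDegree_eq_zero h0]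
    have := hall F hF
    rw [leadingCoeff, h0] at this
    exact Ideal.mem_map_of_mem Polynomial.C this
  · have h2 : F.eraseLead ∈ p.map Polynomial.C :=
      ih F.eraseLead.natDegree (by have := eraseLead_natDegree_lt_or_eraseLead_eq_zero F
                                   rcases this with h | h
                                   · omega
                                   · rw [h, natDegree_zero]; omega)
        (by rw [← self_sub_monomial_natDegree_leadingCoeff]; exact q.sub_mem hF (hpq h1)) rfl
    rw [← eraseLead_add_monomial_natDegree_leadingCoeff F]
    exact Ideal.add_mem _ h2 h1

/-- Passing to polynomials whose leading coefficient lies in `W` does not increase the heights of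
disjoint primes. -/
theorem height_lt_of_disjoint_leadingCoeff {B : Type*} [CommRing B] [IsNoetherianRing B]
    (W : Submonoid B) (hW0 : (0 : B) ∉ W) (d : ℕ)
    (hW : ∀ q : Ideal B, q.IsPrime → Disjoint (q : Set B) W → q.height < d)
    (q : Ideal B[X]) [hq : q.IsPrime] (hdisj : ∀ F ∈ q, F.leadingCoeff ∉ W) : q.height < d := by
  set p := q.comap Polynomial.C with hp
  have hpp : p.IsPrime := Ideal.comap_isPrime Polynomial.C q
  have : q.LiesOver p := ⟨rfl⟩
  have hpW : Disjoint (p : Set B) W := Set.disjoint_left.mpr fun a ha haW =>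
    hdisj (Polynomial.C a) ha (by rwa [leadingCoeff_C])
  by_cases hqp : q ≤ p.map Polynomial.C
  · have hq2 : q = p.map Polynomial.C := le_antisymm hqp Ideal.map_comap_le
    refine lt_of_eq_of_lt ?_ (hW p hpp hpW)
    rw [Ideal.height_eq_height_add_of_liesOver_of_hasGoingDown p q]
    have : q.map (Ideal.Quotient.mk (p.map (algebraMap B B[X]))) = ⊥ := by
      rw [Ideal.map_eq_bot_iff_le_ker, Ideal.mk_ker]
      exact hqp
    rw [this]
    have : Nontrivial (B[X] ⧸ (p.map (algebraMap B B[X]))) :=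
      Ideal.Quotient.nontrivial_iff.mpr (fun h => hq.ne_top (hq2.trans h))
    simp
  · obtain ⟨F, hF, hFp⟩ := exists_leadingCoeff_notMem p q Ideal.map_comap_le hqp
    obtain ⟨p', hp', hle, hp'W⟩ := Ideal.exists_le_prime_disjoint (p ⊔ Ideal.span {F.leadingCoeff})
        W
      (by
        refine Set.disjoint_left.mpr fun w hw hwW => ?_
        obtain ⟨a, ha, b, hb, rfl⟩ := Submodule.mem_sup.mp hw
        obtain ⟨c, rfl⟩ := Ideal.mem_span_singleton'.mp hb
        have hmem : Polynomial.C a * Polynomial.X ^ F.natDegree + Polynomial.C c * F ∈ q :=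
          q.add_mem (q.mul_mem_right _ ha) (q.mul_mem_left _ hF)
        have hcoeff : (Polynomial.C a * Polynomial.X ^ F.natDegree + Polynomial.C c * F).coeff
            F.natDegree
            = a + c * F.leadingCoeff := by
          rw [Polynomial.coeff_add, Polynomial.coeff_C_mul, coeff_X_pow_self,
            Polynomial.coeff_C_mul, mul_one]; rfl
        have hdeg : (Polynomial.C a * Polynomial.X ^ F.natDegree + Polynomial.C c * F).natDegree =
            F.natDegree := by
          apply natDegree_eq_of_le_of_coeff_ne_zero
          · compute_degree
          · rw [hcoeff]; rintro h; rw [h] at hwW; exact hW0 hwW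
        refine hdisj _ hmem ?_
        rwa [leadingCoeff, hdeg, hcoeff])
    have hlt : p < p' := lt_of_le_of_ne (le_sup_left.trans hle) (by
      rintro h
      rw [h] at hFp
      exact hFp (hle ((le_sup_right : _ ≤ p ⊔ _) (Ideal.mem_span_singleton_self _))))
    calc q.height ≤ p.height + 1 := height_le_height_add_one_of_liesOver p q
      _ ≤ p'.height := Ideal.height_add_one_le_of_lt_of_isPrime hlt
      _ < d := hW p' hp' hp'W

end LeadingCoeff

section MonoidAlgebra

open Matrix

variable {R : Type*} [CommRing R] {M : Type*} [AddCommMonoid M]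

/-- Elements of the monoid algebra supported in `S`. -/
def suppSub (R : Type*) [CommRing R] {M : Type*} [AddCommMonoid M] (S : Set M) :
    Submodule R (AddMonoidAlgebra R M) where
  carrier := {f | ∀ x, f.coeff x ≠ 0 → x ∈ S}
  add_mem' {f g} hf hg x hx := by
    by_cases h : f.coeff x = 0
    · exact hg x fun h' => hx (by simp [h, h'])
    · exact hf x h
  zero_mem' x hx := by simp at hx
  smul_mem' r f hf x hx := hf x fun h => hx (by simp [h])

theorem single_mem_suppSub {S : Set M} {x : M} (hx : x ∈ S) (a : R) :
    AddMonoidAlgebra.single x a ∈ suppSub R S := fun y hy => by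
  classical
  rw [AddMonoidAlgebra.coeff_single, Finsupp.single_apply] at hy
  split_ifs at hy with h
  · rwa [← h]
  · exact absurd rfl hy

theorem suppSub_mono {S T : Set M} (h : S ⊆ T) : suppSub R S ≤ suppSub R T :=
  fun _ hf x hx => h (hf x hx)

/-- A subgroup containing all terms of `f` contains `f`. -/
theorem mem_of_single_mem {H : Type*} [SetLike H (AddMonoidAlgebra R M)]
    [AddSubmonoidClass H (AddMonoidAlgebra R M)] (K : H) {f : AddMonoidAlgebra R M}
    (h : ∀ x, f.coeff x ≠ 0 → AddMonoidAlgebra.single x (f.coeff x) ∈ K) : f ∈ K := by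
  rw [← AddMonoidAlgebra.sum_coeff_single f]
  exact sum_mem fun x hx => h x (Finsupp.mem_support_iff.mp hx)

theorem exists_of_coeff_mul_ne_zero {f g : AddMonoidAlgebra R M} {z : M}
    (h : (f * g).coeff z ≠ 0) : ∃ x y, f.coeff x ≠ 0 ∧ g.coeff y ≠ 0 ∧ x + y = z := by
  classical
  have := AddMonoidAlgebra.support_coeff_mul_subset f g (Finsupp.mem_support_iff.mpr h)
  obtain ⟨x, hx, y, hy, hxy⟩ := Finset.mem_add.mp this
  exact ⟨x, y, Finsupp.mem_support_iff.mp hx, Finsupp.mem_support_iff.mp hy, hxy⟩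

theorem mul_mem_suppSub {S T U : Set M} (h : ∀ x ∈ S, ∀ y ∈ T, x + y ∈ U)
    {f g : AddMonoidAlgebra R M} (hf : f ∈ suppSub R S) (hg : g ∈ suppSub R T) :
    f * g ∈ suppSub R U := fun z hz => by
  obtain ⟨x, y, hx, hy, rfl⟩ := exists_of_coeff_mul_ne_zero hz
  exact h x (hf x hx) y (hg y hy)

variable {N : Type*} [AddCommMonoid N]

/-- The ring homomorphism of monoid algebras induced by a homomorphism of monoids. -/
noncomputable def expMap (R : Type*) [CommRing R] {M N : Type*} [AddCommMonoid M]
    [AddCommMonoid N] (f : M →+ N) : AddMonoidAlgebra R M →+* AddMonoidAlgebra R N :=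
  AddMonoidAlgebra.mapDomainRingHom R f

theorem expMap_single (f : M →+ N) (x : M) (a : R) :
    expMap R f (AddMonoidAlgebra.single x a) = AddMonoidAlgebra.single (f x) a :=
  AddMonoidAlgebra.mapDomain_single

theorem expMap_injective {f : M →+ N} (hf : Function.Injective f) :
    Function.Injective (expMap R f) := AddMonoidAlgebra.mapDomain_injective hf

theorem coeff_expMap {f : M →+ N} (hf : Function.Injective f) (p : AddMonoidAlgebra R M) (x : M) :
    (expMap R f p).coeff (f x) = p.coeff x := Finsupp.mapDomain_apply hf _ _

theorem expMap_mem_suppSub (f : M →+ N) (p : AddMonoidAlgebra R M) :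
    expMap R f p ∈ suppSub R (Set.range f) := fun x hx => by
  by_contra h
  exact hx (Finsupp.mapDomain_of_notMem_range _ _ h)

theorem exists_expMap_eq {f : M →+ N} (hf : Function.Injective f) {p : AddMonoidAlgebra R N}
    (hp : p ∈ suppSub R (Set.range f)) : ∃ q, expMap R f q = p :=
  ⟨AddMonoidAlgebra.comapDomain f hf p,
    AddMonoidAlgebra.mapDomain_comapDomain (fun x hx => hp x (Finsupp.mem_support_iff.mp hx)) hf⟩

/-- Monoid algebras of isomorphic monoids are isomorphic. -/
noncomputable def expEquiv (R : Type*) [CommRing R] {M N : Type*} [AddCommMonoid M]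
    [AddCommMonoid N] (e : M ≃+ N) : AddMonoidAlgebra R M ≃+* AddMonoidAlgebra R N :=
  AddMonoidAlgebra.mapDomainRingEquiv R e

/-- The grading homomorphism attached to a degree function. -/
noncomputable def degHom (R : Type*) [CommRing R] {M : Type*} [AddCommMonoid M] (deg : M →+ ℕ) :
    AddMonoidAlgebra R M →+* Polynomial (AddMonoidAlgebra R M) :=
  AddMonoidAlgebra.liftNCRingHom (Polynomial.C.comp AddMonoidAlgebra.singleZeroRingHom)
    { toFun x := Polynomial.monomial (deg x.toAdd) (AddMonoidAlgebra.single x.toAdd (1 : R))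
      map_one' := by
        rw [toAdd_one, map_zero]; rfl
      map_mul' x y := by
        rw [Polynomial.monomial_mul_monomial, AddMonoidAlgebra.single_mul_single, one_mul,
          toAdd_mul,
          map_add] }
    (fun _ _ => Commute.all _ _)

theorem degHom_single (deg : M →+ ℕ) (x : M) (a : R) :
    degHom R deg (AddMonoidAlgebra.single x a)
      = Polynomial.monomial (deg x) (AddMonoidAlgebra.single x a) := by
  rw [degHom, AddMonoidAlgebra.liftNCRingHom_single]
  simp [Polynomial.C_mul_monomial, AddMonoidAlgebra.single_mul_single]

theorem degHom_eval_one (deg : M →+ ℕ) (f : AddMonoidAlgebra R M) :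
    (degHom R deg f).eval 1 = f := by
  induction f using AddMonoidAlgebra.induction_linear with
  | zero => simp
  | add f g hf hg => rw [map_add, Polynomial.eval_add, hf, hg]
  | single x a => rw [degHom_single]; simp

theorem degHom_eval_zero_mem (deg : M →+ ℕ) (f : AddMonoidAlgebra R M) :
    (degHom R deg f).eval 0 ∈ suppSub R {x | deg x = 0} := by
  induction f using AddMonoidAlgebra.induction_linear with
  | zero => simp
  | add f g hf hg => rw [map_add, Polynomial.eval_add]; exact add_mem hf hg
  | single x a =>
    rw [degHom_single, Polynomial.eval_monomial]
    by_cases h : deg x = 0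
    · rw [h, pow_zero, mul_one]
      exact single_mem_suppSub (S := {x | deg x = 0}) h a
    · rw [zero_pow h, mul_zero]; exact zero_mem _

open Classical in
/-- The retraction of a monoid algebra onto the algebra of a face. -/
noncomputable def faceHom (R : Type*) [CommRing R] {M : Type*} [AddCommMonoid M]
    (F : AddSubmonoid M) (hF : ∀ a b, a + b ∈ F → a ∈ F) :
    AddMonoidAlgebra R M →+* AddMonoidAlgebra R F :=
  AddMonoidAlgebra.liftNCRingHom AddMonoidAlgebra.singleZeroRingHom
    { toFun x := if h : x.toAdd ∈ F then AddMonoidAlgebra.single ⟨x.toAdd, h⟩ (1 : R) else 0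
      map_one' := by
        rw [dif_pos (by rw [toAdd_one]; exact F.zero_mem)]; rfl
      map_mul' x y := by
        by_cases hx : x.toAdd ∈ F
        · by_cases hy : y.toAdd ∈ F
          · rw [dif_pos hx, dif_pos hy, dif_pos (by rw [toAdd_mul]; exact F.add_mem hx hy),
              AddMonoidAlgebra.single_mul_single, one_mul]
            rfl
          · rw [dif_neg hy, mul_zero, dif_neg]
            intro h
            rw [toAdd_mul, add_comm] at h
            exact hy (hF _ _ h)
        · rw [dif_neg hx, zero_mul, dif_neg]
          intro h
          rw [toAdd_mul] at h
          exact hx (hF _ _ h) }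
    (fun _ _ => Commute.all _ _)

theorem faceHom_single_of_mem (F : AddSubmonoid M) (hF : ∀ a b, a + b ∈ F → a ∈ F) {x : M}
    (hx : x ∈ F) (a : R) :
    faceHom R F hF (AddMonoidAlgebra.single x a) = AddMonoidAlgebra.single ⟨x, hx⟩ a := by
  rw [faceHom, AddMonoidAlgebra.liftNCRingHom_single]
  simp only [MonoidHom.coe_mk, OneHom.coe_mk, toAdd_ofAdd]
  rw [dif_pos hx]
  exact (AddMonoidAlgebra.single_mul_single ..).trans (by rw [zero_add, mul_one])

theorem faceHom_single_of_notMem (F : AddSubmonoid M) (hF : ∀ a b, a + b ∈ F → a ∈ F) {x : M}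
    (hx : x ∉ F) (a : R) : faceHom R F hF (AddMonoidAlgebra.single x a) = 0 := by
  rw [faceHom, AddMonoidAlgebra.liftNCRingHom_single]
  simp only [MonoidHom.coe_mk, OneHom.coe_mk, toAdd_ofAdd]
  rw [dif_neg hx, mul_zero]

theorem faceHom_expMap (F : AddSubmonoid M) (hF : ∀ a b, a + b ∈ F → a ∈ F)
    (f : AddMonoidAlgebra R F) : faceHom R F hF (expMap R F.subtype f) = f := by
  induction f using AddMonoidAlgebra.induction_linear with
  | zero => simp
  | add f g hf hg => rw [map_add, map_add, hf, hg]
  | single x a => rw [expMap_single]; exact faceHom_single_of_mem F hF x.2 a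

theorem coeff_faceHom (F : AddSubmonoid M) (hF : ∀ a b, a + b ∈ F → a ∈ F)
    (f : AddMonoidAlgebra R M) (x : F) : (faceHom R F hF f).coeff x = f.coeff x := by
  classical
  induction f using AddMonoidAlgebra.induction_linear with
  | zero => simp
  | add f g hf hg => simp [hf, hg]
  | single y a =>
    by_cases hy : y ∈ F
    · rw [faceHom_single_of_mem F hF hy, AddMonoidAlgebra.coeff_single, Finsupp.single_apply,
        AddMonoidAlgebra.coeff_single, Finsupp.single_apply]
      simp [Subtype.ext_iff]
    · rw [faceHom_single_of_notMem F hF hy, AddMonoidAlgebra.coeff_single, Finsupp.single_apply,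
        if_neg]
      · rfl
      · rintro rfl; exact hy x.2

end MonoidAlgebra

section Lex

open Matrix

theorem height_le_height_comap_of_isIntegral {C A : Type*} [CommRing C] [CommRing A] [Algebra C A]
    [Algebra.IsIntegral C A] (q : Ideal A) [hq : q.IsPrime] :
    q.height ≤ (q.comap (algebraMap C A)).height := by
  have hp : (q.comap (algebraMap C A)).IsPrime := Ideal.comap_isPrime _ q
  rw [PrimeSpectrum.height_eq_orderHeight ⟨q, hq⟩, PrimeSpectrum.height_eq_orderHeight ⟨_, hp⟩]
  refine Order.height_le_height_apply_of_strictMono (PrimeSpectrum.comap (algebraMap C A)) ?_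
    (⟨q, hq⟩ : PrimeSpectrum A)
  intro a b hab
  obtain ⟨x, hx, hxa⟩ := SetLike.exists_of_lt (show a.asIdeal < b.asIdeal from hab)
  have := a.2
  have h := Ideal.comap_lt_comap_of_integral_mem_sdiff (R := C) (le_of_lt hab)
    (⟨hx, hxa⟩ : x ∈ (b.asIdeal : Set A) \ a.asIdeal) (Algebra.IsIntegral.isIntegral x)
  exact h

/-- Polynomials whose lexicographically leading coefficient is `1`. -/
noncomputable def lexMonic (R : Type*) [CommRing R] [Nontrivial R] :
    (n : ℕ) → {W : Submonoid (MvPolynomial (Fin n) R) // 0 ∉ W}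
  | 0 => ⟨⊥, by rw [Submonoid.mem_bot]; exact zero_ne_one⟩
  | n + 1 => ⟨{ carrier := {f | (MvPolynomial.finSuccEquiv R n f).leadingCoeff ∈ (lexMonic R n).1}
                one_mem' := by
                  rw [Set.mem_ofPred_eq, map_one, Polynomial.leadingCoeff_one]
                  exact one_mem _
                mul_mem' := by
                  intro f g hf hg
                  rw [Set.mem_ofPred_eq] at *
                  have h := mul_mem hf hg
                  rw [map_mul, Polynomial.leadingCoeff_mul']
                  · exact h
                  · intro h0
                    rw [h0] at h
                    exact (lexMonic R n).2 h }, by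
      intro h
      change (MvPolynomial.finSuccEquiv R n 0).leadingCoeff ∈ (lexMonic R n).1 at h
      rw [map_zero, Polynomial.leadingCoeff_zero] at h
      exact (lexMonic R n).2 h⟩

theorem lexMonic_spec {R : Type*} [CommRing R] [Nontrivial R] : ∀ (n : ℕ)
    (f : MvPolynomial (Fin n) R), f ∈ (lexMonic R n).1 → ∃ L, MvPolynomial.coeff L f = 1 ∧
      ∀ x, MvPolynomial.coeff x f ≠ 0 → x ≠ L → ∃ i, x i < L i ∧ ∀ j < i, x j = L j
  | 0, f, hf => by
    have hf : f ∈ (⊥ : Submonoid (MvPolynomial (Fin 0) R)) := hf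
    rw [Submonoid.mem_bot] at hf
    subst hf
    exact ⟨0, by simp, fun x _ hx => absurd (Subsingleton.elim _ _) hx⟩
  | n + 1, f, hf => by
    obtain ⟨L, h1, h2⟩ := lexMonic_spec n _ hf
    refine ⟨L.cons (MvPolynomial.finSuccEquiv R n f).natDegree, ?_, ?_⟩
    · rw [← MvPolynomial.finSuccEquiv_coeff_coeff]; exact h1
    · intro x hx hxL
      rw [← Finsupp.cons_tail x, ← MvPolynomial.finSuccEquiv_coeff_coeff] at hx
      have hle : x 0 ≤ (MvPolynomial.finSuccEquiv R n f).natDegree := by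
        apply Polynomial.le_natDegree_of_ne_zero
        intro h
        rw [h] at hx
        exact hx (MvPolynomial.coeff_zero _)
      rcases hle.lt_or_eq with hlt | heq
      · exact ⟨0, by simpa using hlt, fun j hj => absurd hj (Fin.not_lt_zero j)⟩
      · obtain ⟨i, hi, hj⟩ := h2 x.tail (by rw [heq] at hx; exact hx) (by
          rintro h
          apply hxL
          rw [← heq, ← h, Finsupp.cons_tail])
        refine ⟨i.succ, ?_, ?_⟩
        · rw [Finsupp.cons_succ]; exact hi
        · intro j hji
          induction j using Fin.cases with
          | zero => rw [Finsupp.cons_zero, heq]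
          | succ j => rw [Finsupp.cons_succ]; exact hj j (Fin.succ_lt_succ_iff.mp hji)

theorem height_lt_of_disjoint_lexMonic {R : Type*} [CommRing R] [Nontrivial R] [IsNoetherianRing R]
    (d : ℕ) (hR : ∀ q : Ideal R, q.IsPrime → q.height < d) : ∀ (n : ℕ)
    (q : Ideal (MvPolynomial (Fin n) R)), q.IsPrime →
      Disjoint (q : Set (MvPolynomial (Fin n) R)) (lexMonic R n).1 → q.height < d
  | 0, q, hq, _ => by
    let e := (MvPolynomial.isEmptyRingEquiv R (Fin 0)).symm
    rw [← RingEquiv.height_comap e q]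
    exact hR _ (Ideal.comap_isPrime _ q)
  | n + 1, q, hq, hd => by
    let e := (MvPolynomial.finSuccEquiv R n).symm.toRingEquiv
    rw [← RingEquiv.height_comap e q]
    have : (q.comap e).IsPrime := Ideal.comap_isPrime _ q
    refine height_lt_of_disjoint_leadingCoeff (lexMonic R n).1 (lexMonic R n).2 d
      (height_lt_of_disjoint_lexMonic d hR n) (q.comap e) ?_
    intro F hF hFW
    refine Set.disjoint_left.mp hd (show e F ∈ q from hF) ?_
    change (MvPolynomial.finSuccEquiv R n (e F)).leadingCoeff ∈ (lexMonic R n).1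
    rw [show MvPolynomial.finSuccEquiv R n (e F) = F from
      (MvPolynomial.finSuccEquiv R n).apply_symm_apply F]
    exact hFW

end Lex

section Box

open Matrix

variable {R : Type*} [CommRing R]

/-- A module of elements whose exponents are translates of a finite set of exponents is finitely
generated. -/
theorem fg_of_box {T X Y : Type*} [AddCommMonoid T] [AddCommMonoid X] [AddCommMonoid Y]
    {j : Y →+ X} (hj : Function.Injective j) (g : T →+ Y)
    [Algebra (AddMonoidAlgebra R T) (AddMonoidAlgebra R Y)]
    (halg : algebraMap (AddMonoidAlgebra R T) (AddMonoidAlgebra R Y) = expMap R g)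
    [IsNoetherianRing (AddMonoidAlgebra R T)] (S : Set Y) (Z : Set X) (hfin : Z.Finite)
    (hZ : ∀ y ∈ S, ∃ t, ∃ z ∈ Z, j y = j (g t) + z)
    (K : Submodule (AddMonoidAlgebra R T) (AddMonoidAlgebra R Y)) (hK : ∀ f ∈ K, f ∈ suppSub R S) :
    K.FG := by
  let f := (expMap R j).comp (algebraMap (AddMonoidAlgebra R T) (AddMonoidAlgebra R Y))
  let _ : Module (AddMonoidAlgebra R T) (AddMonoidAlgebra R X) := Module.compHom _ f
  have hsm : ∀ (b : AddMonoidAlgebra R T) (x : AddMonoidAlgebra R X), b • x = f b * x :=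
    fun _ _ => rfl
  let i : AddMonoidAlgebra R Y →ₗ[AddMonoidAlgebra R T] AddMonoidAlgebra R X :=
    { toFun := expMap R j
      map_add' := map_add _
      map_smul' := fun b x => by
        rw [Algebra.smul_def, map_mul, RingHom.id_apply, hsm]
        rfl }
  let Q : Submodule (AddMonoidAlgebra R T) (AddMonoidAlgebra R X) :=
    Submodule.span _ ((fun z => AddMonoidAlgebra.single z (1 : R)) '' Z)
  have hQ : Q.FG := Submodule.fg_span (hfin.image _)
  have : IsNoetherian (AddMonoidAlgebra R T) Q := isNoetherian_of_fg_of_noetherian _ hQ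
  refine Submodule.fg_of_fg_map_injective i (expMap_injective hj) ?_
  refine (isNoetherian_submodule.mp this) _ ?_
  rintro _ ⟨a, ha, rfl⟩
  refine mem_of_single_mem Q ?_
  intro x hx
  obtain ⟨y, rfl⟩ : x ∈ Set.range j := expMap_mem_suppSub (R := R) j a x hx
  obtain ⟨t, z, hz, hyz⟩ := hZ y (hK a ha y (by rwa [← coeff_expMap (R := R) hj]))
  rw [hyz]
  have h : AddMonoidAlgebra.single (j (g t) + z) ((i a).coeff (j (g t) + z))
      = AddMonoidAlgebra.single t ((i a).coeff (j (g t) + z)) • AddMonoidAlgebra.single z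
          (1 : R) := by
    rw [hsm, RingHom.comp_apply, halg, expMap_single, expMap_single,
      AddMonoidAlgebra.single_mul_single, mul_one]
  rw [h]
  exact Q.smul_mem _ (Submodule.subset_span ⟨z, hz, rfl⟩)

theorem exists_ringHom_restrict {A P : Type*} [CommRing A] [CommRing P] {f : A →+* P}
    (hf : Function.Injective f) (φ : P →+* P) (h : ∀ a, φ (f a) ∈ f.range) :
    ∃ φ' : A →+* A, ∀ a, f (φ' a) = φ (f a) := by
  choose g hg using h
  exact ⟨{ toFun := g
           map_one' := hf (by rw [hg, map_one, map_one])
           map_mul' := fun x y => hf (by rw [hg, map_mul, map_mul, map_mul, hg, hg])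
           map_zero' := hf (by rw [hg, map_zero, map_zero])
           map_add' := fun x y => hf (by rw [hg, map_add, map_add, map_add, hg, hg]) }, hg⟩

end Box

section Substitution

open Matrix

variable {R : Type*} [CommRing R] {r : ℕ}

/-- Lexicographic comparison of exponents. -/
def LexLt (x L : Fin (r + 1) →₀ ℕ) : Prop := ∃ i, x i < L i ∧ ∀ j < i, x j = L j

/-- The substitution adding multiples of powers of the last variable to the other ones. -/
noncomputable def lastShift (R : Type*) [CommRing R] {r : ℕ} (ε : R) (cs : Fin (r + 1) → ℕ) :
    MvPolynomial (Fin (r + 1)) R →ₐ[R] MvPolynomial (Fin (r + 1)) R :=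
  MvPolynomial.aeval fun i => if i = Fin.last r then MvPolynomial.X i else
    MvPolynomial.X i + MvPolynomial.monomial (Finsupp.single (Fin.last r) (cs i)) ε

theorem lastShift_X_last (ε : R) (cs : Fin (r + 1) → ℕ) :
    lastShift R ε cs (MvPolynomial.X (Fin.last r)) = MvPolynomial.X (Fin.last r) := by
  rw [lastShift, MvPolynomial.aeval_X, if_pos rfl]

theorem lastShift_X (ε : R) (cs : Fin (r + 1) → ℕ) {i : Fin (r + 1)} (hi : i ≠ Fin.last r) :
    lastShift R ε cs (MvPolynomial.X i) =
      MvPolynomial.X i + MvPolynomial.monomial (Finsupp.single (Fin.last r) (cs i)) ε := by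
  rw [lastShift, MvPolynomial.aeval_X, if_neg hi]

theorem lastShift_monomial_last (ε : R) (cs : Fin (r + 1) → ℕ) (n : ℕ) (a : R) :
    lastShift R ε cs (MvPolynomial.monomial (Finsupp.single (Fin.last r) n) a) =
      MvPolynomial.monomial (Finsupp.single (Fin.last r) n) a := by
  rw [← MvPolynomial.C_mul_X_pow_eq_monomial, map_mul, map_pow, lastShift_X_last,
    MvPolynomial.algHom_C]
  rfl

theorem lastShift_lastShift_neg (ε : R) (cs : Fin (r + 1) → ℕ) (f : MvPolynomial (Fin (r + 1)) R) :
    lastShift R ε cs (lastShift R (-ε) cs f) = f := by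
  have : (lastShift R ε cs).comp (lastShift R (-ε) cs) = AlgHom.id R _ := by
    apply MvPolynomial.algHom_ext
    intro i
    rw [AlgHom.comp_apply, AlgHom.id_apply]
    by_cases hi : i = Fin.last r
    · rw [hi, lastShift_X_last, lastShift_X_last]
    · rw [lastShift_X _ _ hi, map_add, lastShift_X _ _ hi, lastShift_monomial_last, map_neg,
        add_neg_cancel_right]
  exact DFunLike.congr_fun this f

theorem exists_dominating_weights (b e : ℕ) : ∀ (n : ℕ) (Q : Fin (n + 1) → ℕ → Prop),
    (∀ i, i ≠ Fin.last n → ∀ N, ∃ c, N ≤ c ∧ Q i c) →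
    ∃ cs : Fin (n + 1) → ℕ, cs (Fin.last n) = 1 ∧ (∀ i, i ≠ Fin.last n → Q i (cs i) ∧ b ≤ cs i) ∧
      ∀ i, e * (∑ j, if i < j then cs j else 0) < cs i
  | 0, Q, hQ => ⟨fun _ => 1, rfl, fun i hi => absurd (Subsingleton.elim (α := Fin 1) _ _) hi,
      fun i => by simp [Subsingleton.elim (α := Fin 1) i 0]⟩
  | n + 1, Q, hQ => by
    obtain ⟨cs, h1, h2, h3⟩ := exists_dominating_weights b e n (fun i => Q i.succ)
      (fun i hi N => hQ i.succ
        (by rw [← Fin.succ_last]; exact fun h => hi (Fin.succ_injective _ h)) N)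
    obtain ⟨c, hc, hQc⟩ := hQ 0 (by rw [← Fin.succ_last]; exact (Fin.succ_ne_zero _).symm)
      (b + e * (∑ j, cs j) + 1)
    refine ⟨Fin.cons c cs, by rw [← Fin.succ_last]; exact h1, fun i hi => ?_, fun i => ?_⟩
    · induction i using Fin.cases with
      | zero => exact ⟨hQc, by simp only [Fin.cons_zero]; omega⟩
      | succ i => exact h2 i (fun h => hi (by rw [h, Fin.succ_last]))
    · induction i using Fin.cases with
      | zero =>
        rw [Fin.sum_univ_succ]
        simp only [lt_irrefl, if_false, Fin.succ_pos, if_true, Fin.cons_succ, Fin.cons_zero,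
          zero_add]
        omega
      | succ i =>
        rw [Fin.sum_univ_succ]
        simp only [Fin.not_lt_zero, if_false, Fin.succ_lt_succ_iff, Fin.cons_succ, zero_add]
        exact h3 i

/-- The weighted degree of an exponent. -/
noncomputable def weightHom (cs : Fin (r + 1) → ℕ) : (Fin (r + 1) →₀ ℕ) →+ ℕ where
  toFun x := ∑ i, cs i * x i
  map_zero' := by simp
  map_add' x y := by simp [mul_add, Finset.sum_add_distrib]

theorem weightHom_single (cs : Fin (r + 1) → ℕ) (i : Fin (r + 1)) (n : ℕ) :
    weightHom cs (Finsupp.single i n) = cs i * n := by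
  classical
  change ∑ j, cs j * (Finsupp.single i n) j = _
  rw [Finset.sum_eq_single i]
  · simp
  · intro j _ hj
    rw [Finsupp.single_eq_of_ne hj, mul_zero]
  · simp

theorem weightHom_lt {e : ℕ} {cs : Fin (r + 1) → ℕ}
    (hcs : ∀ i, e * (∑ j, if i < j then cs j else 0) < cs i) {x L : Fin (r + 1) →₀ ℕ}
    (hx : ∀ i, x i ≤ e) (h : LexLt x L) : weightHom cs x < weightHom cs L := by
  obtain ⟨i, hi, hj⟩ := h
  have key : ∀ j, cs j * x j + (if j = i then cs i else 0)
      ≤ cs j * L j + e * (if i < j then cs j else 0) := by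
    intro j
    rcases lt_trichotomy j i with hji | rfl | hij
    · rw [if_neg hji.ne, hj j hji]; omega
    · rw [if_pos rfl, if_neg (lt_irrefl _), mul_zero]
      nlinarith [Nat.mul_le_mul_left (cs j) hi]
    · rw [if_neg hij.ne', if_pos hij]
      nlinarith [Nat.mul_le_mul_left (cs j) (hx j)]
  have := Finset.sum_le_sum (s := Finset.univ) fun j _ => key j
  rw [Finset.sum_add_distrib, Finset.sum_add_distrib, Finset.sum_ite_eq' Finset.univ i, if_pos
    (Finset.mem_univ i), ← Finset.mul_sum] at this
  have h2 := hcs i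
  change ∑ i, cs i * x i < ∑ i, cs i * L i
  omega

/-- Monic of degree `D` in the last variable. -/
def LastMonic (f : MvPolynomial (Fin (r + 1)) R) (D : ℕ) : Prop :=
  f - AddMonoidAlgebra.single (Finsupp.single (Fin.last r) D) 1 ∈
    suppSub R {x | x (Fin.last r) < D}

theorem LastMonic.mul {f g : MvPolynomial (Fin (r + 1)) R} {D E : ℕ} (hf : LastMonic f D)
    (hg : LastMonic g E) : LastMonic (f * g) (D + E) := by
  have h1 : f * g - AddMonoidAlgebra.single (Finsupp.single (Fin.last r) (D + E)) 1
      = (f - AddMonoidAlgebra.single (Finsupp.single (Fin.last r) D) 1) *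
          (g - AddMonoidAlgebra.single (Finsupp.single (Fin.last r) E) 1)
        + (f - AddMonoidAlgebra.single (Finsupp.single (Fin.last r) D) 1) *
          AddMonoidAlgebra.single (Finsupp.single (Fin.last r) E) 1
        + AddMonoidAlgebra.single (Finsupp.single (Fin.last r) D) 1 *
          (g - AddMonoidAlgebra.single (Finsupp.single (Fin.last r) E) 1) := by
    have : (AddMonoidAlgebra.single (Finsupp.single (Fin.last r) (D + E)) 1 :
        MvPolynomial (Fin (r + 1)) R) = AddMonoidAlgebra.single (Finsupp.single (Fin.last r) D) 1
        * AddMonoidAlgebra.single (Finsupp.single (Fin.last r) E) 1 := by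
      rw [AddMonoidAlgebra.single_mul_single, one_mul, Finsupp.single_add]
    rw [this]
    ring
  rw [LastMonic, h1]
  refine add_mem (add_mem (mul_mem_suppSub ?_ hf hg) (mul_mem_suppSub
    (T := {Finsupp.single (Fin.last r) E}) ?_ hf (single_mem_suppSub (Set.mem_singleton _) _)))
    (mul_mem_suppSub (S := {Finsupp.single (Fin.last r) D}) ?_
      (single_mem_suppSub (Set.mem_singleton _) _) hg)
  · intro x hx y hy
    exact add_lt_add (show x (Fin.last r) < D from hx) (show y (Fin.last r) < E from hy)
  · rintro x hx y rfl
    change (x + _) (Fin.last r) < _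
    rw [Finsupp.add_apply, Finsupp.single_eq_same]
    exact Nat.add_lt_add_right hx _
  · rintro x rfl y hy
    change (_ + y) (Fin.last r) < _
    rw [Finsupp.add_apply, Finsupp.single_eq_same]
    exact Nat.add_lt_add_left hy _

theorem lastMonic_monomial (D : ℕ) :
    LastMonic (MvPolynomial.monomial (Finsupp.single (Fin.last r) D) (1 : R)) D := by
  rw [LastMonic]
  have : MvPolynomial.monomial (Finsupp.single (Fin.last r) D) (1 : R)
      - AddMonoidAlgebra.single (Finsupp.single (Fin.last r) D) 1 = 0 := sub_self _
  rw [this]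
  exact zero_mem (suppSub R _)

theorem lastMonic_lastShift_monomial {cs : Fin (r + 1) → ℕ} (hcs : ∀ i, 0 < cs i)
    (hlast : cs (Fin.last r) = 1) (x : Fin (r + 1) →₀ ℕ) :
    LastMonic (lastShift R 1 cs (MvPolynomial.monomial x 1)) (weightHom cs x) := by
  have h0 : LastMonic (lastShift R 1 cs (MvPolynomial.monomial 0 1)) 0 := by
    have := lastMonic_monomial (R := R) (r := r) 0
    rw [Finsupp.single_zero] at this
    rwa [show MvPolynomial.monomial 0 (1 : R) = (1 : MvPolynomial (Fin (r + 1)) R) from rfl,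
      map_one]
  have hadd : ∀ x y : Fin (r + 1) →₀ ℕ,
      LastMonic (lastShift R 1 cs (MvPolynomial.monomial x 1)) (weightHom cs x) →
      LastMonic (lastShift R 1 cs (MvPolynomial.monomial y 1)) (weightHom cs y) →
      LastMonic (lastShift R 1 cs (MvPolynomial.monomial (x + y) 1)) (weightHom cs (x + y)) := by
    intro x y hx hy
    have h := hx.mul hy
    rwa [← map_mul, MvPolynomial.monomial_mul, one_mul, ← map_add] at h
  have hone : ∀ i, LastMonic (lastShift R 1 cs (MvPolynomial.monomial (Finsupp.single i 1) 1))
      (weightHom cs (Finsupp.single i 1)) := by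
    intro i
    rw [weightHom_single, mul_one]
    by_cases hi : i = Fin.last r
    · rw [hi, lastShift_monomial_last, hlast]
      exact lastMonic_monomial 1
    · change LastMonic (lastShift R 1 cs (MvPolynomial.X i)) _
      rw [lastShift_X _ _ hi, LastMonic]
      have h : MvPolynomial.X i + MvPolynomial.monomial (Finsupp.single (Fin.last r) (cs i)) (1 : R)
          - AddMonoidAlgebra.single (Finsupp.single (Fin.last r) (cs i)) 1
          = AddMonoidAlgebra.single (Finsupp.single i 1) 1 := add_sub_cancel_right _ _
      rw [h]
      refine single_mem_suppSub ?_ 1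
      change (Finsupp.single i 1) (Fin.last r) < cs i
      rw [Finsupp.single_eq_of_ne (Ne.symm hi)]
      exact hcs i
  induction x using Finsupp.induction_linear with
  | zero => rw [map_zero]; exact h0
  | add x y hx hy => exact hadd x y hx hy
  | single i n =>
    induction n with
    | zero => rw [Finsupp.single_zero, map_zero]; exact h0
    | succ n ih => rw [Finsupp.single_add]; exact hadd _ _ ih (hone i)

theorem lastMonic_lastShift {e : ℕ} {cs : Fin (r + 1) → ℕ}
    (hcs : ∀ i, e * (∑ j, if i < j then cs j else 0) < cs i) (hlast : cs (Fin.last r) = 1)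
    {f : MvPolynomial (Fin (r + 1)) R} {L : Fin (r + 1) →₀ ℕ} (hL : f.coeff L = 1)
    (hlex : ∀ x, f.coeff x ≠ 0 → x ≠ L → LexLt x L) (he : ∀ x, f.coeff x ≠ 0 → ∀ i, x i ≤ e) :
    LastMonic (lastShift R 1 cs f) (weightHom cs L) := by
  classical
  have hpos : ∀ i, 0 < cs i := fun i => lt_of_le_of_lt (Nat.zero_le _) (hcs i)
  have h1 : lastShift R 1 cs (f - AddMonoidAlgebra.single L 1) ∈
      suppSub R {x | x (Fin.last r) < weightHom cs L} := by
    refine mem_of_single_mem (Submodule.comap (lastShift R 1 cs).toLinearMap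
      (suppSub R {x | x (Fin.last r) < weightHom cs L})) ?_
    intro x hx
    rw [AddMonoidAlgebra.coeff_sub, AddMonoidAlgebra.coeff_single, Finsupp.sub_apply,
      Finsupp.single_apply] at hx
    by_cases hxL : L = x
    · rw [if_pos hxL, ← hxL] at hx
      exact absurd (sub_eq_zero.mpr hL) hx
    · rw [if_neg hxL, sub_zero] at hx
      have hlt := weightHom_lt hcs (he x hx) (hlex x hx (Ne.symm hxL))
      have hs : ∀ a : R, (AddMonoidAlgebra.single x a : MvPolynomial (Fin (r + 1)) R)
          = a • MvPolynomial.monomial x 1 := by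
        intro a
        rw [MvPolynomial.smul_monomial, smul_eq_mul, mul_one]; rfl
      refine Set.mem_of_eq_of_mem (hs _) (Submodule.smul_mem _ _ ?_)
      rw [Submodule.mem_comap]
      have h2 := lastMonic_lastShift_monomial (R := R) hpos hlast x
      rw [LastMonic] at h2
      rw [AlgHom.toLinearMap_apply, ← sub_add_cancel (lastShift R 1 cs (MvPolynomial.monomial x 1))
        (AddMonoidAlgebra.single (Finsupp.single (Fin.last r) (weightHom cs x)) 1)]
      refine add_mem (suppSub_mono ?_ h2) (single_mem_suppSub ?_ 1)
      · intro y hy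
        exact lt_trans hy hlt
      · change (Finsupp.single (Fin.last r) (weightHom cs x)) (Fin.last r) < weightHom cs L
        rwa [Finsupp.single_eq_same]
  have h3 := lastMonic_lastShift_monomial (R := R) hpos hlast L
  rw [LastMonic] at h3 ⊢
  rw [map_sub] at h1
  have := add_mem h1 h3
  convert this using 1
  exact (sub_add_sub_cancel _ _ _).symm

end Substitution

section MonicInversion

open Matrix

variable {R : Type*} [CommRing R] {r : ℕ}

/-- The coordinatewise cast of exponents to integers. -/
def castHom (n : ℕ) : (Fin n →₀ ℕ) →+ (Fin n → ℤ) where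
  toFun x i := (x i : ℤ)
  map_zero' := by funext i; simp
  map_add' x y := by funext i; simp

theorem lastShift_mem_coset (G : AddSubgroup (Fin (r + 1) → ℤ)) {cs : Fin (r + 1) → ℕ} (ε : R)
    (hcs : ∀ i, i ≠ Fin.last r → castHom (r + 1) (Finsupp.single (Fin.last r) (cs i))
      - castHom (r + 1) (Finsupp.single i 1) ∈ G) (x : Fin (r + 1) →₀ ℕ) :
    lastShift R ε cs (MvPolynomial.monomial x 1) ∈
      suppSub R {y | castHom (r + 1) y - castHom (r + 1) x ∈ G} := by
  have h0 : lastShift R ε cs (MvPolynomial.monomial 0 1) ∈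
      suppSub R {y | castHom (r + 1) y - castHom (r + 1) 0 ∈ G} := by
    rw [show MvPolynomial.monomial 0 (1 : R) = (1 : MvPolynomial (Fin (r + 1)) R) from rfl, map_one]
    refine single_mem_suppSub ?_ 1
    change castHom (r + 1) 0 - castHom (r + 1) 0 ∈ G
    rw [sub_self]
    exact zero_mem G
  have hadd : ∀ x y : Fin (r + 1) →₀ ℕ,
      lastShift R ε cs (MvPolynomial.monomial x 1) ∈
        suppSub R {z | castHom (r + 1) z - castHom (r + 1) x ∈ G} →
      lastShift R ε cs (MvPolynomial.monomial y 1) ∈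
        suppSub R {z | castHom (r + 1) z - castHom (r + 1) y ∈ G} →
      lastShift R ε cs (MvPolynomial.monomial (x + y) 1) ∈
        suppSub R {z | castHom (r + 1) z - castHom (r + 1) (x + y) ∈ G} := by
    intro x y hx hy
    rw [show MvPolynomial.monomial (x + y) (1 : R) = MvPolynomial.monomial x 1 *
      MvPolynomial.monomial y 1 by rw [MvPolynomial.monomial_mul, one_mul], map_mul]
    refine mul_mem_suppSub ?_ hx hy
    intro a ha b hb
    have := add_mem (show castHom (r + 1) a - castHom (r + 1) x ∈ G from ha)
      (show castHom (r + 1) b - castHom (r + 1) y ∈ G from hb)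
    change castHom (r + 1) (a + b) - castHom (r + 1) (x + y) ∈ G
    rwa [map_add, map_add, add_sub_add_comm]
  have hone : ∀ i, lastShift R ε cs (MvPolynomial.monomial (Finsupp.single i 1) 1) ∈
      suppSub R {z | castHom (r + 1) z - castHom (r + 1) (Finsupp.single i 1) ∈ G} := by
    intro i
    have hself : (MvPolynomial.monomial (Finsupp.single i 1) (1 : R)) ∈
        suppSub R {z | castHom (r + 1) z - castHom (r + 1) (Finsupp.single i 1) ∈ G} := by
      refine single_mem_suppSub ?_ 1
      change castHom (r + 1) (Finsupp.single i 1) - castHom (r + 1) (Finsupp.single i 1) ∈ G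
      rw [sub_self]
      exact zero_mem G
    by_cases hi : i = Fin.last r
    · subst hi
      rw [lastShift_monomial_last]
      exact hself
    · change lastShift R ε cs (MvPolynomial.X i) ∈ _
      rw [lastShift_X _ _ hi]
      exact add_mem hself (single_mem_suppSub (x := Finsupp.single (Fin.last r) (cs i))
        (S := {z | castHom (r + 1) z - castHom (r + 1) (Finsupp.single i 1) ∈ G}) (hcs i hi) ε)
  induction x using Finsupp.induction_linear with
  | zero => exact h0
  | add x y hx hy => exact hadd x y hx hy
  | single i n =>
    induction n with
    | zero => rw [Finsupp.single_zero]; exact h0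
    | succ n ih => rw [Finsupp.single_add]; exact hadd _ _ ih (hone i)

theorem lastShift_sub_mem {cs : Fin (r + 1) → ℕ} (ε : R) {b : ℕ}
    (hcs : ∀ i, i ≠ Fin.last r → b ≤ cs i) (f : MvPolynomial (Fin (r + 1)) R) :
    lastShift R ε cs f - f ∈ suppSub R {y | b ≤ y (Fin.last r)} := by
  let I : Ideal (MvPolynomial (Fin (r + 1)) R) :=
    Ideal.span {MvPolynomial.monomial (Finsupp.single (Fin.last r) b) 1}
  have heq : (Ideal.Quotient.mkₐ R I).comp (lastShift R ε cs) = Ideal.Quotient.mkₐ R I := by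
    apply MvPolynomial.algHom_ext
    intro i
    rw [AlgHom.comp_apply]
    by_cases hi : i = Fin.last r
    · rw [hi, lastShift_X_last]
    · rw [lastShift_X _ _ hi, map_add, add_eq_left]
      refine Ideal.Quotient.eq_zero_iff_mem.mpr (Ideal.mem_span_singleton'.mpr
        ⟨MvPolynomial.monomial (Finsupp.single (Fin.last r) (cs i - b)) ε, ?_⟩)
      rw [MvPolynomial.monomial_mul, mul_one, ← Finsupp.single_add, Nat.sub_add_cancel (hcs i hi)]
  have hmem : lastShift R ε cs f - f ∈ I := Ideal.Quotient.eq.mp (DFunLike.congr_fun heq f)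
  obtain ⟨p, hp⟩ := Ideal.mem_span_singleton'.mp hmem
  rw [← hp]
  refine mul_mem_suppSub (S := Set.univ) (T := {Finsupp.single (Fin.last r) b}) ?_
    (fun _ _ => Set.mem_univ _) (single_mem_suppSub (Set.mem_singleton _) _)
  rintro x - y rfl
  change b ≤ (x + Finsupp.single (Fin.last r) b) (Fin.last r)
  rw [Finsupp.add_apply, Finsupp.single_eq_same]
  exact Nat.le_add_left _ _

theorem lastShift_mem_suppSub {M : AddSubmonoid (Fin (r + 1) →₀ ℕ)}
    {G : AddSubgroup (Fin (r + 1) → ℤ)} (hG : ∀ x ∈ M, castHom (r + 1) x ∈ G) {b : ℕ}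
    (hdeep : ∀ a, castHom (r + 1) a ∈ G → b ≤ a (Fin.last r) → a ∈ M)
    {cs : Fin (r + 1) → ℕ} (ε : R)
    (hcs : ∀ i, i ≠ Fin.last r → (castHom (r + 1) (Finsupp.single (Fin.last r) (cs i))
      - castHom (r + 1) (Finsupp.single i 1) ∈ G) ∧ b ≤ cs i)
    {f : MvPolynomial (Fin (r + 1)) R} (hf : f ∈ suppSub R (M : Set (Fin (r + 1) →₀ ℕ))) :
    lastShift R ε cs f ∈ suppSub R (M : Set (Fin (r + 1) →₀ ℕ)) := by
  refine mem_of_single_mem (Submodule.comap (lastShift R ε cs).toLinearMap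
      (suppSub R (M : Set (Fin (r + 1) →₀ ℕ)))) (f := f) ?_
  intro x hx
  have hxM : x ∈ M := hf x hx
  have hs : ∀ a : R, (AddMonoidAlgebra.single x a : MvPolynomial (Fin (r + 1)) R)
      = a • MvPolynomial.monomial x 1 := by
    intro a
    rw [MvPolynomial.smul_monomial, smul_eq_mul, mul_one]; rfl
  refine Set.mem_of_eq_of_mem (hs _) (Submodule.smul_mem _ _ ?_)
  change lastShift R ε cs (MvPolynomial.monomial x 1) ∈ suppSub R (M : Set (Fin (r + 1) →₀ ℕ))
  intro y hy
  have hyG : castHom (r + 1) y ∈ G := by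
    have h1 : castHom (r + 1) y - castHom (r + 1) x ∈ G :=
      lastShift_mem_coset G ε (fun i hi => (hcs i hi).1) x y hy
    have := add_mem h1 (hG x hxM)
    rwa [sub_add_cancel] at this
  by_cases hyx : x = y
  · exact hyx ▸ hxM
  · refine hdeep y hyG (lastShift_sub_mem ε (fun i hi => (hcs i hi).2)
      (MvPolynomial.monomial x 1) y ?_)
    have h2 : (MvPolynomial.monomial x (1 : R)).coeff y = 0 := by
      rw [MvPolynomial.coeff_monomial, if_neg hyx]
    rw [AddMonoidAlgebra.coeff_sub, Finsupp.sub_apply]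
    change _ - MvPolynomial.coeff y _ ≠ 0
    rw [h2, sub_zero]
    exact hy

end MonicInversion

section MonicInversion

open Matrix

variable {ι : Type*} [Fintype ι] [DecidableEq ι] {R : Type*} [CommRing R] {r : ℕ}

theorem finite_quotient_of_lastMonic [IsNoetherianRing R] [Nontrivial R]
    {M : AddSubmonoid (Fin (r + 1) →₀ ℕ)}
    {G : AddSubgroup (Fin (r + 1) → ℤ)} (hG : ∀ x ∈ M, castHom (r + 1) x ∈ G) {b : ℕ}
    (hdeep : ∀ a, castHom (r + 1) a ∈ G → b ≤ a (Fin.last r) → a ∈ M)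
    {c : ℕ} (hc : 0 < c) (g : (Fin r →₀ ℕ) →+ M)
    (hg : ∀ y, (g y : Fin (r + 1) →₀ ℕ) = c • y.mapDomain Fin.castSucc)
    [Algebra (MvPolynomial (Fin r) R) (AddMonoidAlgebra R M)]
    (halg : algebraMap (MvPolynomial (Fin r) R) (AddMonoidAlgebra R M) = expMap R g)
    {f : AddMonoidAlgebra R M} {D : ℕ} (hf : LastMonic (expMap R M.subtype f) D) :
    Module.Finite (MvPolynomial (Fin r) R) (AddMonoidAlgebra R M ⧸ Ideal.span {f}) := by
  classical
  have hinj : Function.Injective M.subtype := Subtype.val_injective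
  have hlast : ∀ y : Fin r →₀ ℕ, (y.mapDomain Fin.castSucc) (Fin.last r) = 0 := fun y =>
    Finsupp.mapDomain_of_notMem_range _ _ (by rintro ⟨i, hi⟩; exact (Fin.castSucc_lt_last i).ne hi)
  let K : Submodule (MvPolynomial (Fin r) R) (AddMonoidAlgebra R M) :=
    { suppSub R {x : M | (x : Fin (r + 1) →₀ ℕ) (Fin.last r) < D + b} with
      smul_mem' := by
        intro p a ha
        rw [Algebra.smul_def, halg]
        refine mul_mem_suppSub (S := Set.range g) ?_ (expMap_mem_suppSub (R := R) g p) ha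
        rintro _ ⟨t, rfl⟩ y hy
        change ((g t : Fin (r + 1) →₀ ℕ) + y) (Fin.last r) < D + b
        rw [hg, Finsupp.add_apply, Finsupp.smul_apply, hlast, smul_zero, zero_add]
        exact hy }
  have hK : K.FG := by
    refine fg_of_box hinj g halg {x : M | (x : Fin (r + 1) →₀ ℕ) (Fin.last r) < D + b}
      (Set.Iic (Finsupp.equivFunOnFinite.symm fun _ => c + D + b)) (Set.finite_Iic _) ?_ K
      (fun f hf => hf)
    intro y hy
    refine ⟨Finsupp.equivFunOnFinite.symm fun i => (y : Fin (r + 1) →₀ ℕ) i.castSucc / c,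
      Finsupp.equivFunOnFinite.symm fun i => if i = Fin.last r then (y : Fin (r + 1) →₀ ℕ) i else
        (y : Fin (r + 1) →₀ ℕ) i % c, ?_, ?_⟩
    · intro i
      simp only [Finsupp.equivFunOnFinite_symm_apply_apply]
      split_ifs with h
      · have : (y : Fin (r + 1) →₀ ℕ) (Fin.last r) < D + b := hy
        rw [h]
        omega
      · have := Nat.mod_lt ((y : Fin (r + 1) →₀ ℕ) i) hc
        omega
    · ext i
      change (y : Fin (r + 1) →₀ ℕ) i = ((g _ : Fin (r + 1) →₀ ℕ) + _) i
      rw [hg, Finsupp.add_apply, Finsupp.smul_apply, Finsupp.equivFunOnFinite_symm_apply_apply]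
      induction i using Fin.lastCases with
      | last => rw [hlast, if_pos rfl, smul_zero, zero_add]
      | cast i =>
        rw [Finsupp.mapDomain_apply (Fin.castSucc_injective r), if_neg (Fin.castSucc_lt_last i).ne,
          Finsupp.equivFunOnFinite_symm_apply_apply, smul_eq_mul]
        exact (Nat.div_add_mod _ _).symm
  have hDM : ∃ δ : M, (δ : Fin (r + 1) →₀ ℕ) = Finsupp.single (Fin.last r) D := by
    refine ⟨⟨Finsupp.single (Fin.last r) D, ?_⟩, rfl⟩
    have h1 : (expMap R M.subtype f).coeff (Finsupp.single (Fin.last r) D) ≠ 0 := by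
      intro h
      have h2 := hf (Finsupp.single (Fin.last r) D) (by
        rw [AddMonoidAlgebra.coeff_sub, Finsupp.sub_apply, h, AddMonoidAlgebra.coeff_single,
          Finsupp.single_eq_same]
        simp)
      have h3 : (Finsupp.single (Fin.last r) D) (Fin.last r) < D := h2
      rw [Finsupp.single_eq_same] at h3
      exact lt_irrefl _ h3
    obtain ⟨x, hx⟩ := expMap_mem_suppSub M.subtype f _ h1
    rw [← hx]
    exact x.2
  obtain ⟨δ, hδ⟩ := hDM
  have hf' : f - AddMonoidAlgebra.single δ 1 ∈
      suppSub R {x : M | (x : Fin (r + 1) →₀ ℕ) (Fin.last r) < D} := by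
    intro x hx
    refine hf (M.subtype x) ?_
    have : expMap R M.subtype f - AddMonoidAlgebra.single (Finsupp.single (Fin.last r) D) 1
        = expMap R M.subtype (f - AddMonoidAlgebra.single δ 1) := by
      rw [map_sub, expMap_single]
      exact congrArg (fun z => _ - AddMonoidAlgebra.single z 1) hδ.symm
    rw [this, coeff_expMap hinj]
    exact hx
  let H : Submodule (MvPolynomial (Fin r) R) (AddMonoidAlgebra R M) :=
    K ⊔ (Ideal.span {f}).restrictScalars (MvPolynomial (Fin r) R)
  have hsing : ∀ (n : ℕ) (x : M), (x : Fin (r + 1) →₀ ℕ) (Fin.last r) = n →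
      ∀ a : R, AddMonoidAlgebra.single x a ∈ H := by
    intro n
    induction n using Nat.strong_induction_on with
    | _ n ih =>
      intro x hx a
      by_cases hn : n < D + b
      · exact Submodule.mem_sup_left (single_mem_suppSub (x := x)
          (S := {x : M | (x : Fin (r + 1) →₀ ℕ) (Fin.last r) < D + b}) (hx.trans_lt hn) a)
      · obtain ⟨y, hy⟩ : ∃ y : M, x = y + δ := by
          have h1 : (x : Fin (r + 1) →₀ ℕ) =
              ((x : Fin (r + 1) →₀ ℕ) - Finsupp.single (Fin.last r) D) +
                Finsupp.single (Fin.last r) D := by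
            rw [tsub_add_cancel_of_le]
            rw [Finsupp.single_le_iff]
            omega
          refine ⟨⟨(x : Fin (r + 1) →₀ ℕ) - Finsupp.single (Fin.last r) D, hdeep _ ?_ ?_⟩, ?_⟩
          · have h2 := congrArg (castHom (r + 1)) h1
            rw [map_add, ← hδ] at h2
            have h3 := sub_mem (hG x x.2) (hG δ δ.2)
            rw [h2, add_sub_cancel_right] at h3
            rwa [← hδ]
          · rw [Finsupp.tsub_apply, Finsupp.single_eq_same]
            omega
          · apply Subtype.ext
            change (x : Fin (r + 1) →₀ ℕ) = _ + (δ : Fin (r + 1) →₀ ℕ)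
            exact h1.trans (congrArg
              (((x : Fin (r + 1) →₀ ℕ) - Finsupp.single (Fin.last r) D) + ·) hδ.symm)
        have h2 : AddMonoidAlgebra.single x a = AddMonoidAlgebra.single y a * f
            - AddMonoidAlgebra.single y a * (f - AddMonoidAlgebra.single δ 1) := by
          rw [mul_sub, sub_sub_cancel, AddMonoidAlgebra.single_mul_single, mul_one, hy]
        have hyn : (y : Fin (r + 1) →₀ ℕ) (Fin.last r) + D = n := by
          rw [← hx, hy]
          change _ = ((y : Fin (r + 1) →₀ ℕ) + (δ : Fin (r + 1) →₀ ℕ)) (Fin.last r)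
          rw [hδ, Finsupp.add_apply, Finsupp.single_eq_same]
        rw [h2]
        refine sub_mem (Submodule.mem_sup_right (Ideal.mul_mem_left _ _
          (Ideal.mem_span_singleton_self f))) (mem_of_single_mem H fun z hz => ?_)
        have h3 := mul_mem_suppSub (S := {y})
            (T := {x : M | (x : Fin (r + 1) →₀ ℕ) (Fin.last r) < D})
          (U := {x : M | (x : Fin (r + 1) →₀ ℕ) (Fin.last r) < n}) (by
            rintro y' hy' w hw
            rw [Set.mem_singleton_iff.mp hy']
            have hw : (w : Fin (r + 1) →₀ ℕ) (Fin.last r) < D := hw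
            change ((y : Fin (r + 1) →₀ ℕ) + (w : Fin (r + 1) →₀ ℕ)) (Fin.last r) < n
            rw [Finsupp.add_apply]
            omega) (single_mem_suppSub (Set.mem_singleton y) a) hf' z hz
        exact ih _ h3 z rfl _
  refine ⟨?_⟩
  have htop : K.map (((Ideal.Quotient.mkₐ (MvPolynomial (Fin r) R) (Ideal.span {f})) :
      AddMonoidAlgebra R M →ₐ[MvPolynomial (Fin r) R] _).toLinearMap) = ⊤ := by
    rw [eq_top_iff]
    rintro q -
    obtain ⟨a, rfl⟩ := Ideal.Quotient.mk_surjective q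
    have ha : a ∈ H := mem_of_single_mem H fun x _ => hsing _ x rfl _
    obtain ⟨k, hk, s, hs, rfl⟩ := Submodule.mem_sup.mp ha
    refine ⟨k, hk, ?_⟩
    change Ideal.Quotient.mk _ k = Ideal.Quotient.mk _ (k + s)
    rw [map_add, Ideal.Quotient.eq_zero_iff_mem.mpr hs, add_zero]
  rw [← htop]
  exact hK.map _

end MonicInversion

section MonicInversion

open Matrix

variable {ι : Type*} [Fintype ι] [DecidableEq ι] {R : Type*} [CommRing R] {r : ℕ}

/-- Multiplication of exponents by `c` as a map into a monoid. -/
noncomputable def smulHom {σ : Type*} {M : AddSubmonoid (σ →₀ ℕ)} {c : ℕ} (hcM : ∀ y, c • y ∈ M) :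
    (σ →₀ ℕ) →+ M where
  toFun y := ⟨c • y, hcM y⟩
  map_zero' := Subtype.ext (smul_zero c)
  map_add' x y := Subtype.ext (smul_add c x y)

theorem coe_smulHom {σ : Type*} {M : AddSubmonoid (σ →₀ ℕ)} {c : ℕ} (hcM : ∀ y, c • y ∈ M)
    (y : σ →₀ ℕ) : (smulHom hcM y : σ →₀ ℕ) = c • y := rfl

theorem finite_of_smulHom [IsNoetherianRing R] {σ : Type*} [Finite σ] {M : AddSubmonoid (σ →₀ ℕ)}
    {c : ℕ} (hc : 0 < c) (hcM : ∀ y, c • y ∈ M)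
    [Algebra (MvPolynomial σ R) (AddMonoidAlgebra R M)]
    (halg : algebraMap (MvPolynomial σ R) (AddMonoidAlgebra R M) = expMap R (smulHom hcM)) :
    Module.Finite (MvPolynomial σ R) (AddMonoidAlgebra R M) := by
  classical
  have : IsNoetherianRing (AddMonoidAlgebra R (σ →₀ ℕ)) :=
    inferInstanceAs (IsNoetherianRing (MvPolynomial σ R))
  refine ⟨fg_of_box (j := M.subtype) Subtype.val_injective (smulHom hcM) halg Set.univ
    (Set.Iic (Finsupp.equivFunOnFinite.symm fun _ => c)) (Set.finite_Iic _) ?_ ⊤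
    fun _ _ _ _ => Set.mem_univ _⟩
  intro y _
  refine ⟨Finsupp.equivFunOnFinite.symm fun i => (y : σ →₀ ℕ) i / c,
    Finsupp.equivFunOnFinite.symm fun i => (y : σ →₀ ℕ) i % c, ?_, ?_⟩
  · intro i
    simp only [Finsupp.equivFunOnFinite_symm_apply_apply]
    exact (Nat.mod_lt _ hc).le
  · ext i
    change (y : σ →₀ ℕ) i = ((smulHom hcM _ : σ →₀ ℕ) + _) i
    rw [coe_smulHom, Finsupp.add_apply, Finsupp.smul_apply,
      Finsupp.equivFunOnFinite_symm_apply_apply, Finsupp.equivFunOnFinite_symm_apply_apply]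
    exact (Nat.div_add_mod _ _).symm

theorem isNoetherianRing_of_smul_mem [IsNoetherianRing R] {σ : Type*} [Finite σ]
    {M : AddSubmonoid (σ →₀ ℕ)} {c : ℕ} (hc : 0 < c) (hcM : ∀ y, c • y ∈ M) :
    IsNoetherianRing (AddMonoidAlgebra R M) := by
  let _ : Algebra (MvPolynomial σ R) (AddMonoidAlgebra R M) := (expMap R (smulHom hcM)).toAlgebra
  have := finite_of_smulHom (R := R) hc hcM rfl
  exact IsNoetherianRing.of_finite (MvPolynomial σ R) (AddMonoidAlgebra R M)

theorem exists_coeff_lt {M : Type*} [AddCommMonoid M] (f : AddMonoidAlgebra R M) (deg : M → ℕ) :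
    ∃ N, ∀ x, f.coeff x ≠ 0 → deg x < N := by
  refine ⟨(f.coeff.support.sup deg) + 1, fun x hx => Nat.lt_succ_of_le ?_⟩
  exact Finset.le_sup (f := deg) (Finsupp.mem_support_iff.mpr hx)

theorem lexMonic_add_shift {c N : ℕ} (hc : 0 < c) {p f : AddMonoidAlgebra R (Fin (r + 1) →₀ ℕ)}
    (hN : ∀ x, p.coeff x ≠ 0 → x 0 < N) {L : Fin (r + 1) →₀ ℕ} (hL : f.coeff L = 1)
    (hlex : ∀ x, f.coeff x ≠ 0 → x ≠ L → LexLt x L)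
    (s : (Fin (r + 1) →₀ ℕ) →+ (Fin (r + 1) →₀ ℕ)) (hs : ∀ x, s x = c • x) :
    ∃ L', (p + expMap R s (AddMonoidAlgebra.single (Finsupp.single 0 N) 1 * f)).coeff L' = 1 ∧
      ∀ x, (p + expMap R s (AddMonoidAlgebra.single (Finsupp.single 0 N) 1 * f)).coeff x ≠ 0 →
        x ≠ L' → LexLt x L' := by
  have hsinj : Function.Injective s := by
    intro x y h
    rw [hs, hs] at h
    ext i
    exact Nat.eq_of_mul_eq_mul_left hc (DFunLike.congr_fun h i)
  have hcoeff : ∀ x, (expMap R s (AddMonoidAlgebra.single (Finsupp.single 0 N) 1 * f)).coeff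
      (s (Finsupp.single 0 N + x)) = f.coeff x := by
    intro x
    rw [coeff_expMap hsinj]
    exact (MvPolynomial.coeff_monomial_mul x (Finsupp.single 0 N) (1 : R) f).trans (one_mul _)
  have hform : ∀ y, (expMap R s (AddMonoidAlgebra.single (Finsupp.single 0 N) 1 * f)).coeff y ≠ 0 →
      ∃ x, y = s (Finsupp.single 0 N + x) ∧ f.coeff x ≠ 0 := by
    intro y hy
    obtain ⟨z, rfl⟩ := expMap_mem_suppSub s _ y hy
    rw [coeff_expMap hsinj] at hy
    obtain ⟨a, x, ha, hx, rfl⟩ := exists_of_coeff_mul_ne_zero hy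
    obtain rfl : a = Finsupp.single 0 N := single_mem_suppSub (R := R)
      (S := {Finsupp.single 0 N}) (Set.mem_singleton _) 1 a ha
    exact ⟨x, rfl, hx⟩
  have hge : ∀ x, N ≤ s (Finsupp.single 0 N + x) 0 := by
    intro x
    rw [hs, Finsupp.smul_apply, Finsupp.add_apply, Finsupp.single_eq_same, smul_eq_mul]
    nlinarith
  have hp : ∀ x, p.coeff (s (Finsupp.single 0 N + x)) = 0 := fun x => by
    by_contra h
    exact absurd (hN _ h) (hge x).not_gt
  refine ⟨s (Finsupp.single 0 N + L), ?_, fun y hy hyL => ?_⟩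
  · rw [AddMonoidAlgebra.coeff_add, Finsupp.add_apply, hp, hcoeff, zero_add, hL]
  · by_cases hpy : p.coeff y = 0
    · rw [AddMonoidAlgebra.coeff_add, Finsupp.add_apply, hpy, zero_add] at hy
      obtain ⟨x, rfl, hx⟩ := hform y hy
      obtain ⟨i, hi, hj⟩ := hlex x hx (fun h => hyL (by rw [h]))
      refine ⟨i, ?_, fun j hji => ?_⟩
      · rw [hs, hs]
        simp only [Finsupp.smul_apply, Finsupp.add_apply, smul_eq_mul]
        exact Nat.mul_lt_mul_of_pos_left (Nat.add_lt_add_left hi _) hc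
      · rw [hs, hs]
        simp only [Finsupp.smul_apply, Finsupp.add_apply, hj j hji]
    · exact ⟨0, (hN y hpy).trans_le (hge L), fun j hj => absurd hj (Fin.not_lt_zero j)⟩

theorem exists_lexMonic_rowRel [IsNoetherianRing R] [Nontrivial R] (d : ℕ)
    (hR : ∀ q : Ideal R, q.IsPrime → q.height < d) (hcard : d + 1 ≤ Fintype.card ι)
    {M : AddSubmonoid (Fin (r + 1) →₀ ℕ)} {c : ℕ} (hc : 0 < c) (hcM : ∀ y, c • y ∈ M)
    {u : ι → AddMonoidAlgebra R M} (hu : UniRow u) (o : ι) :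
    ∃ u', RowRel u u' ∧ ∃ L, (expMap R M.subtype (u' o)).coeff L = 1 ∧
      ∀ x, (expMap R M.subtype (u' o)).coeff x ≠ 0 → x ≠ L → LexLt x L := by
  let _ : Algebra (MvPolynomial (Fin (r + 1)) R) (AddMonoidAlgebra R M) :=
    (expMap R (smulHom hcM)).toAlgebra
  have halg : algebraMap (MvPolynomial (Fin (r + 1)) R) (AddMonoidAlgebra R M) =
    expMap R (smulHom hcM) := rfl
  have := finite_of_smulHom (R := R) hc hcM halg
  have := isNoetherianRing_of_smul_mem (R := R) hc hcM
  obtain ⟨b, hbo, w, ⟨f, hf, rfl⟩, hmem⟩ := exists_mem_span_of_height_lt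
    ((lexMonic R (r + 1)).1.map (algebraMap (MvPolynomial (Fin (r + 1)) R) (AddMonoidAlgebra R M)))
    d (fun q hq hdisj => by
      refine (height_le_height_comap_of_isIntegral (C := MvPolynomial (Fin (r + 1)) R) q).trans_lt
        (height_lt_of_disjoint_lexMonic d hR (r + 1) _ (Ideal.comap_isPrime _ q) ?_)
      rw [Set.disjoint_left] at hdisj ⊢
      exact fun x hx hxW => hdisj hx ⟨x, hxW, rfl⟩) hcard hu o
  obtain ⟨L, hL, hlex⟩ := lexMonic_spec (r + 1) f hf
  obtain ⟨a, ha⟩ := (Ideal.mem_span_range_iff_exists_fun).mp hmem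
  obtain ⟨N, hN⟩ := exists_coeff_lt (expMap R M.subtype (u o)) fun x => x 0
  let t : AddMonoidAlgebra R M := algebraMap (MvPolynomial (Fin (r + 1)) R) (AddMonoidAlgebra R M)
    (AddMonoidAlgebra.single (Finsupp.single 0 N) 1)
  have hu1 := rowRel_add u o b hbo
  have hdot : (Function.update a o 0) ⬝ᵥ (u + u o • b) =
      algebraMap (MvPolynomial (Fin (r + 1)) R) (AddMonoidAlgebra R M) f := by
    refine Eq.trans (Finset.sum_congr rfl fun i _ => ?_) ha
    by_cases hi : i = o
    · rw [hi, Function.update_self, if_pos rfl, zero_mul, mul_zero]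
    · rw [Function.update_of_ne hi, if_neg hi, Pi.add_apply, Pi.smul_apply, smul_eq_mul,
        mul_comm (u o)]
  have hu2 := hu1.trans (rowRel_update (u + u o • b) o (t • Function.update a o 0)
    (by rw [Pi.smul_apply, Function.update_self, smul_zero]))
  refine ⟨_, hu2, ?_⟩
  obtain ⟨L', h1, h2⟩ := lexMonic_add_shift hc hN hL hlex (M.subtype.comp (smulHom hcM))
    (fun x => rfl)
  have heq : expMap R M.subtype (Function.update (u + u o • b) o
      ((u + u o • b) o + (t • Function.update a o 0) ⬝ᵥ (u + u o • b)) o) =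
      expMap R M.subtype (u o) + expMap R (M.subtype.comp (smulHom hcM))
        (AddMonoidAlgebra.single (Finsupp.single 0 N) 1 * f) := by
    rw [Function.update_self, smul_dotProduct, hdot, smul_eq_mul, ← map_mul, Pi.add_apply,
      Pi.smul_apply, hbo, smul_zero, add_zero, map_add, halg]
    congr 1
    exact DFunLike.congr_fun (AddMonoidAlgebra.mapDomainRingHom_comp (R := R)
      M.subtype (smulHom hcM)).symm _
  rw [heq]
  exact ⟨L', h1, h2⟩

end MonicInversion

section MonicInversion

open Matrix

variable {ι : Type*} [Fintype ι] [DecidableEq ι] {R : Type*} [CommRing R] {r : ℕ}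

/-- The degree in the last variable. -/
noncomputable def lastDeg (M : AddSubmonoid (Fin (r + 1) →₀ ℕ)) : M →+ ℕ :=
  (Finsupp.applyAddHom (Fin.last r)).comp M.subtype

theorem smul_mem_of_single_mem {σ : Type*} {M : AddSubmonoid (σ →₀ ℕ)} {c : ℕ}
    (h : ∀ i, Finsupp.single i c ∈ M) (y : σ →₀ ℕ) : c • y ∈ M := by
  induction y using Finsupp.induction_linear with
  | zero => rw [smul_zero]; exact zero_mem M
  | add x y hx hy => rw [smul_add]; exact add_mem hx hy
  | single i n =>
    rw [Finsupp.smul_single, smul_eq_mul, mul_comm, ← smul_eq_mul, ← Finsupp.smul_single]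
    exact AddSubmonoid.nsmul_mem M (h i) n

/-- Monic inversion for monomial rings closed under the shifts by powers of the last variable. -/
theorem rowTransitive_of_deep [IsNoetherianRing R] (d : ℕ)
    (hR : ∀ q : Ideal R, q.IsPrime → q.height < d) (hcard : d + 1 ≤ Fintype.card ι)
    (hcard' : 3 ≤ Fintype.card ι) {M : AddSubmonoid (Fin (r + 1) →₀ ℕ)} {c : ℕ} (hc : 0 < c)
    (hcM : ∀ i, Finsupp.single i c ∈ M)
    {G : AddSubgroup (Fin (r + 1) → ℤ)} (hG : ∀ x ∈ M, castHom (r + 1) x ∈ G)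
    (hsub : ∀ i, i ≠ Fin.last r → ∀ N : ℕ, ∃ k, N ≤ k ∧
      castHom (r + 1) (Finsupp.single (Fin.last r) k) - castHom (r + 1) (Finsupp.single i 1) ∈ G)
    {b : ℕ} (hdeep : ∀ a, castHom (r + 1) a ∈ G → b ≤ a (Fin.last r) → a ∈ M)
    (hface : RowTransitive ι (AddMonoidAlgebra R (AddMonoidHom.mker (lastDeg M)))) :
    RowTransitive ι (AddMonoidAlgebra R M) := by
  cases subsingleton_or_nontrivial R
  · have : Subsingleton (AddMonoidAlgebra R M) := AddMonoidAlgebra.coeff_injective.subsingleton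
    exact rowTransitive_of_subsingleton
  intro u hu o
  have hinj : Function.Injective M.subtype := Subtype.val_injective
  obtain ⟨u', hu', L, hL, hlex⟩ := exists_lexMonic_rowRel d hR hcard hc
    (smul_mem_of_single_mem hcM) hu o
  refine hu'.trans ?_
  have huni := hu.of_rel hu'
  obtain ⟨e, he⟩ := exists_coeff_lt (expMap R M.subtype (u' o)) fun x => ∑ i, x i
  obtain ⟨cs, hlast, hcs, hdom⟩ := exists_dominating_weights b e r
    (fun i k => castHom (r + 1) (Finsupp.single (Fin.last r) k)
      - castHom (r + 1) (Finsupp.single i 1) ∈ G) hsub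
  have hrestrict : ∀ (ε : R) (a : AddMonoidAlgebra R M),
      (lastShift R ε cs : MvPolynomial (Fin (r + 1)) R →+* MvPolynomial (Fin (r + 1)) R)
        (expMap R M.subtype a) ∈ (expMap R M.subtype).range := by
    intro ε a
    obtain ⟨q, hq⟩ := exists_expMap_eq (R := R) hinj
      (p := lastShift R ε cs (expMap R M.subtype a)) (by
        have h1 := lastShift_mem_suppSub hG hdeep ε hcs (f := expMap R M.subtype a) (by
          have := expMap_mem_suppSub M.subtype a
          rwa [AddSubmonoid.coe_subtype, Subtype.range_coe] at this)
        rwa [AddSubmonoid.coe_subtype, Subtype.range_coe])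
    exact ⟨q, hq⟩
  obtain ⟨φ, hφ⟩ := exists_ringHom_restrict (expMap_injective (R := R) hinj)
    (lastShift R (1 : R) cs : MvPolynomial (Fin (r + 1)) R →+* MvPolynomial (Fin (r + 1)) R)
    (hrestrict 1)
  obtain ⟨φ', hφ'⟩ := exists_ringHom_restrict (expMap_injective (R := R) hinj)
    (lastShift R (-1 : R) cs : MvPolynomial (Fin (r + 1)) R →+* MvPolynomial (Fin (r + 1)) R)
    (hrestrict (-1))
  have hφφ' : ∀ a, φ' (φ a) = a := by
    intro a
    apply expMap_injective (R := R) hinj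
    rw [hφ', hφ]
    have := lastShift_lastShift_neg (-1 : R) cs (expMap R M.subtype a)
    rwa [neg_neg] at this
  suffices h : RowRel (φ ∘ u') (Pi.single o 1) by
    have h1 := h.map φ'
    rw [comp_single_one] at h1
    convert h1 using 1
    ext1 k
    exact (hφφ' _).symm
  have hmonic : LastMonic (expMap R M.subtype ((φ ∘ u') o)) (weightHom cs L) := by
    rw [Function.comp_apply, hφ]
    exact lastMonic_lastShift hdom hlast hL hlex fun x hx i =>
      (Finset.single_le_sum (fun j _ => Nat.zero_le (x j)) (Finset.mem_univ i)).trans (he x hx).le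
  let g : (Fin r →₀ ℕ) →+ M := (smulHom (smul_mem_of_single_mem hcM)).comp
    (Finsupp.mapDomain.addMonoidHom Fin.castSucc)
  let _ : Algebra (MvPolynomial (Fin r) R) (AddMonoidAlgebra R M) := (expMap R g).toAlgebra
  have hfin := finite_quotient_of_lastMonic hG hdeep hc g (fun y => rfl) rfl hmonic
  have hlast0 : ∀ y : Fin r →₀ ℕ, (y.mapDomain Fin.castSucc) (Fin.last r) = 0 := fun y =>
    Finsupp.mapDomain_of_notMem_range _ _ (by rintro ⟨i, hi⟩; exact (Fin.castSucc_lt_last i).ne hi)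
  have key := rowRel_of_finite (B := MvPolynomial (Fin r) R) hcard' (degHom R (lastDeg M))
    (degHom_eval_one _) (fun p => by
      change degHom R (lastDeg M) (expMap R g p) = Polynomial.C (expMap R g p)
      induction p using AddMonoidAlgebra.induction_linear with
      | zero => rw [map_zero, map_zero, map_zero]
      | add p q hp hq => rw [map_add, map_add, map_add, hp, hq]
      | single x a =>
        rw [expMap_single, degHom_single]
        have : lastDeg M (g x) = 0 := by
          change (c • x.mapDomain Fin.castSucc) (Fin.last r) = 0
          rw [Finsupp.smul_apply, hlast0, smul_zero]
        rw [this, Polynomial.monomial_zero_left]) (huni.map φ) o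
  refine key.trans ?_
  have huv := (huni.map φ).of_rel key
  set v : ι → AddMonoidAlgebra R M :=
    fun i => ((degHom R (lastDeg M)) ((φ ∘ u') i)).eval 0 with hv
  let F : AddSubmonoid M := AddMonoidHom.mker (lastDeg M)
  have hF : ∀ a b, a + b ∈ F → a ∈ F := by
    intro a b hab
    have h1 : lastDeg M (a + b) = 0 := hab
    rw [map_add] at h1
    exact Nat.eq_zero_of_add_eq_zero_right h1
  have hvF : ∀ i, expMap R F.subtype (faceHom R F hF (v i)) = v i := by
    intro i
    obtain ⟨q, hq⟩ := exists_expMap_eq (R := R) (f := F.subtype) Subtype.val_injective (p := v i)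
        (by
      rw [AddSubmonoid.coe_subtype, Subtype.range_coe]
      exact degHom_eval_zero_mem (lastDeg M) _)
    rw [← hq, faceHom_expMap]
  have h2 := (hface _ (huv.map (faceHom R F hF)) o).map (expMap R F.subtype)
  rw [comp_single_one] at h2
  convert h2 using 1
  ext1 k
  exact (hvF k).symm

end MonicInversion

section ConeCoordinates

open Matrix

theorem exists_linear_form_extension {V κ : Type*} [AddCommGroup V] [Finite κ]
    (φ : V →ₗ[ℤ] (κ → ℤ)) (ζ : V →ₗ[ℤ] ℤ) (hk : ∃ k, φ k = 0 ∧ ζ k ≠ 0) :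
    ∃ ω : V →ₗ[ℤ] ℤ, (∀ x, φ x = 0 → ζ x = 0 → ω x = 0) ∧ ∃ g, φ g = 0 ∧ ω g = 1 := by
  cases nonempty_fintype κ
  obtain ⟨s, hs⟩ := Module.projective_lifting_property φ.rangeRestrict LinearMap.id
    φ.surjective_rangeRestrict
  have hs' : ∀ y, φ (s y) = y := fun y => congrArg Subtype.val (DFunLike.congr_fun hs y)
  obtain ⟨δ, hδ⟩ := (IsPrincipalIdealRing.principal ((LinearMap.ker φ).map ζ)).principal
  have hdvd : ∀ x, φ x = 0 → δ ∣ ζ x := by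
    intro x hx
    have : ζ x ∈ Submodule.span ℤ {δ} := hδ ▸ Submodule.mem_map_of_mem hx
    exact Ideal.mem_span_singleton.mp this
  have hδ0 : δ ≠ 0 := by
    rintro rfl
    obtain ⟨k, hk, hk'⟩ := hk
    exact hk' (zero_dvd_iff.mp (hdvd k hk))
  have hproj : ∀ x, φ (x - s (φ.rangeRestrict x)) = 0 := by
    intro x
    rw [map_sub, hs']
    exact sub_self _
  choose q hq using fun x => hdvd _ (hproj x)
  refine ⟨⟨⟨q, fun x y => ?_⟩, fun a x => ?_⟩, fun x hx hx' => ?_, ?_⟩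
  · apply mul_left_cancel₀ hδ0
    rw [← hq, mul_add, ← hq, ← hq, ← map_add, map_add, map_add]
    congr 1
    abel
  · apply mul_left_cancel₀ hδ0
    rw [← hq, map_smul, map_smul, ← smul_sub, map_smul, smul_eq_mul, hq]
    simp only [RingHom.id_apply, smul_eq_mul]
    ring
  · apply mul_left_cancel₀ hδ0
    change δ * q x = _
    have : φ.rangeRestrict x = 0 := Subtype.ext hx
    rw [← hq, this, map_zero, sub_zero, hx', mul_zero]
  · have : δ ∈ (LinearMap.ker φ).map ζ := hδ ▸ Submodule.mem_span_singleton_self δ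
    obtain ⟨g, hg, hgδ⟩ := this
    refine ⟨g, hg, ?_⟩
    apply mul_left_cancel₀ hδ0
    change δ * q g = _
    have : φ.rangeRestrict g = 0 := Subtype.ext hg
    rw [← hq, this, map_zero, sub_zero, hgδ, mul_one]

theorem nonneg_of_four_mul_le {n : ℕ} {K : ℤ} (hK : 4 * (n : ℤ) ≤ K) {x : Fin n → ℤ}
    (h : ∀ i, 4 * (∑ j, x j) - ∑ j, |x j| ≤ 4 * K * x i) : ∀ i, 0 ≤ x i := by
  intro i
  by_contra! hi
  set s := ∑ j, x j with hs
  set a := ∑ j, |x j| with ha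
  have hn : (1 : ℤ) ≤ n := by
    have := i.pos
    exact_mod_cast this
  have hK0 : 0 < K := by linarith
  have h1 : 4 * s < a := by nlinarith [h i]
  have ha0 : 0 < a := lt_of_lt_of_le (abs_pos.mpr hi.ne)
    (Finset.single_le_sum (f := fun j => |x j|) (fun j _ => abs_nonneg _) (Finset.mem_univ i))
  have hsa : -a ≤ s := by
    rw [hs, ha, ← Finset.sum_neg_distrib]
    exact Finset.sum_le_sum fun j _ => neg_abs_le _
  have h2 : ∀ j, 2 * K * (|x j| - x j) ≤ a - 4 * s := by
    intro j
    rcases le_or_gt 0 (x j) with hj | hj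
    · rw [abs_of_nonneg hj]; linarith
    · rw [abs_of_neg hj]; nlinarith [h j]
  have h3 := Finset.sum_le_sum (s := Finset.univ) fun j _ => h2 j
  rw [← Finset.mul_sum, Finset.sum_sub_distrib, Finset.sum_const, Finset.card_univ,
    Fintype.card_fin, nsmul_eq_mul, ← hs, ← ha] at h3
  nlinarith [mul_le_mul_of_nonneg_right hK (show (0 : ℤ) ≤ a - s by linarith),
    mul_le_mul_of_nonneg_left (show 4 * s ≤ a by linarith) (show (0 : ℤ) ≤ n by linarith),
    mul_pos (show (0 : ℤ) < n by linarith) ha0,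
    mul_le_mul_of_nonneg_left hsa (show (0 : ℤ) ≤ n by linarith)]

theorem exists_bound_of_smul_single {n : ℕ} {G : AddSubgroup (Fin n → ℤ)} {c : ℕ} (hc : 0 < c)
    (hcG : ∀ i, Pi.single i (c : ℤ) ∈ G) (ω : G →+ ℤ) :
    ∃ B : ℤ, 0 ≤ B ∧ ∀ x : G, |ω x| ≤ B * ∑ j, |(x : Fin n → ℤ) j| := by
  refine ⟨∑ j, |ω ⟨_, hcG j⟩|, Finset.sum_nonneg fun j _ => abs_nonneg _, fun x => ?_⟩
  have h1 : (c : ℤ) • x = ∑ j, (x : Fin n → ℤ) j • (⟨_, hcG j⟩ : G) := by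
    apply Subtype.ext
    rw [AddSubgroup.val_finsetSum]
    ext k
    simp [Finset.sum_apply, Pi.single_apply, mul_comm]
  have h2 : (c : ℤ) * ω x = ∑ j, (x : Fin n → ℤ) j * ω ⟨_, hcG j⟩ := by
    have := congrArg ω h1
    rw [map_zsmul, map_sum, smul_eq_mul] at this
    rw [this]
    exact Finset.sum_congr rfl fun j _ => by rw [map_zsmul, smul_eq_mul]
  have h3 : |ω x| ≤ |(c : ℤ) * ω x| := by
    rw [abs_mul, Nat.abs_cast]
    have : (1 : ℤ) ≤ c := by exact_mod_cast hc
    nlinarith [abs_nonneg (ω x)]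
  refine h3.trans ?_
  rw [h2, Finset.sum_mul]
  refine (Finset.abs_sum_le_sum_abs _ _).trans (Finset.sum_le_sum fun j _ => ?_)
  rw [abs_mul, mul_comm]
  exact mul_le_mul_of_nonneg_left
    (Finset.single_le_sum (f := fun j => |(x : Fin n → ℤ) j|) (fun j _ => abs_nonneg _)
      (Finset.mem_univ j)) (abs_nonneg _)

end ConeCoordinates

section ConeCoordinates

open Matrix

/-- The map with coordinates `l i` for `i < m` and last coordinate `z`. -/
def snocHom {V : Type*} [AddCommGroup V] {m : ℕ} (l : Fin m → V →+ ℤ) (z : V →+ ℤ) :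
    V →+ (Fin (m + 1) → ℤ) :=
  AddMonoidHom.pi (Fin.snoc (α := fun _ => V →+ ℤ) l z)

theorem snocHom_castSucc {V : Type*} [AddCommGroup V] {m : ℕ} (l : Fin m → V →+ ℤ) (z : V →+ ℤ)
    (x : V) (i : Fin m) : snocHom l z x i.castSucc = l i x := by
  rw [snocHom, AddMonoidHom.pi_apply, Fin.snoc_castSucc]

theorem snocHom_last {V : Type*} [AddCommGroup V] {m : ℕ} (l : Fin m → V →+ ℤ) (z : V →+ ℤ)
    (x : V) : snocHom l z x (Fin.last m) = z x := by
  rw [snocHom, AddMonoidHom.pi_apply, Fin.snoc_last]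

theorem exists_eq_of_triangular {V : Type*} [AddCommGroup V] {m : ℕ} (l : Fin m → V →+ ℤ)
    (h : ∀ i, ∃ g, l i g = 1 ∧ ∀ j < i, l j g = 0) (t : Fin m → ℤ) : ∃ x, ∀ i, l i x = t i := by
  have : ∀ k ≤ m, ∃ x, ∀ i : Fin m, (i : ℕ) < k → l i x = t i := by
    intro k
    induction k with
    | zero => exact fun _ => ⟨0, fun i hi => absurd hi (Nat.not_lt_zero _)⟩
    | succ k ih =>
      intro hk
      obtain ⟨x, hx⟩ := ih (by omega)
      obtain ⟨g, hg, hg'⟩ := h ⟨k, hk⟩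
      refine ⟨x + (t ⟨k, hk⟩ - l ⟨k, hk⟩ x) • g, fun i hi => ?_⟩
      rw [map_add, map_zsmul, smul_eq_mul]
      rcases Nat.lt_succ_iff_lt_or_eq.mp hi with hi | hi
      · rw [hg' i (Fin.lt_def.mpr hi), hx i hi, mul_zero, add_zero]
      · obtain rfl : i = ⟨k, hk⟩ := Fin.ext hi
        rw [hg]; ring
  obtain ⟨x, hx⟩ := this m le_rfl
  exact ⟨x, fun i => hx i i.2⟩

theorem exists_perturbed_forms {m : ℕ} (G : AddSubgroup (Fin (m + 1) → ℤ)) {c : ℕ} (hc : 0 < c)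
    (hcG : ∀ i, Pi.single i (c : ℤ) ∈ G) (K : ℤ) (hK : (m : ℤ) + 1 < K)
    (z : Fin (m + 1) → G →+ ℤ)
    (hz : ∀ i x, z i x = K * (x : Fin (m + 1) → ℤ) i - ∑ j, (x : Fin (m + 1) → ℤ) j) :
    ∃ ω : Fin m → G →+ ℤ, ∀ i, ∃ g, (ω i g = 1 ∧ z i.castSucc g = 0) ∧
      ∀ j < i, ω j g = 0 ∧ z j.castSucc g = 0 := by
  have hsum : ∀ x : Fin (m + 1) → ℤ, (∀ i, (c : ℤ) ∣ x i) → x ∈ G := by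
    intro x hx
    choose y hy using hx
    have : x = ∑ i, y i • Pi.single i (c : ℤ) := by
      ext k
      simp [Finset.sum_apply, Pi.single_apply, hy, mul_comm]
    rw [this]
    exact sum_mem fun i _ => zsmul_mem (hcG i) _
  have hex : ∀ i : Fin m, ∃ ω : G →ₗ[ℤ] ℤ,
      (∀ x, (∀ j ≤ i.castSucc, z j x = 0) → z i.succ x = 0 → ω x = 0) ∧
      ∃ g, (∀ j ≤ i.castSucc, z j g = 0) ∧ ω g = 1 := by
    intro i
    let φ : G →ₗ[ℤ] (Fin (m + 1) → ℤ) := LinearMap.pi fun j =>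
      if j ≤ i.castSucc then (z j).toIntLinearMap else 0
    have hφ : ∀ x, φ x = 0 ↔ ∀ j ≤ i.castSucc, z j x = 0 := by
      intro x
      rw [funext_iff]
      refine forall_congr' fun j => ?_
      by_cases hj : j ≤ i.castSucc
      · simp [φ, hj]
      · simp [φ, hj]
    obtain ⟨ω, h1, g, h2, h3⟩ := exists_linear_form_extension φ (z i.succ).toIntLinearMap (by
      let k : G := ⟨fun j => if j = i.succ then (c : ℤ) * (K - m) else c, hsum _ fun j => by
        split_ifs
        · exact dvd_mul_right _ _
        · exact dvd_rfl⟩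
      have hk : ∑ j, (k : Fin (m + 1) → ℤ) j = c * K := by
        change ∑ j, (if j = i.succ then (c : ℤ) * (K - m) else c) = _
        rw [Finset.sum_ite, Finset.filter_eq' Finset.univ i.succ, if_pos (Finset.mem_univ _),
          Finset.sum_singleton, Finset.filter_ne' Finset.univ i.succ, Finset.sum_const,
          Finset.card_erase_of_mem (Finset.mem_univ _), Finset.card_univ, Fintype.card_fin,
          nsmul_eq_mul, Nat.add_sub_cancel]
        ring
      refine ⟨k, (hφ k).mpr fun j hj => ?_, ?_⟩
      · rw [hz, hk]
        have : j ≠ i.succ := (hj.trans_lt Fin.castSucc_lt_succ).ne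
        change K * (if j = i.succ then (c : ℤ) * (K - m) else c) - c * K = 0
        rw [if_neg this]; ring
      · change z i.succ k ≠ 0
        rw [hz, hk]
        change K * (if i.succ = i.succ then (c : ℤ) * (K - m) else c) - c * K ≠ 0
        rw [if_pos rfl]
        have : K * (c * (K - m)) - c * K = (c : ℤ) * K * (K - m - 1) := by ring
        rw [this]
        have hc' : (0 : ℤ) < c := by exact_mod_cast hc
        refine mul_ne_zero (mul_ne_zero hc'.ne' ?_) ?_ <;> omega)
    exact ⟨ω, fun x hx hx' => h1 x ((hφ x).mpr hx) hx', g, (hφ g).mp h2, h3⟩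
  choose ω h1 g h2 h3 using hex
  refine ⟨fun i => (ω i).toAddMonoidHom, fun i =>
    ⟨g i, ⟨h3 i, h2 i _ le_rfl⟩, fun j hj => ⟨?_, ?_⟩⟩⟩
  · exact h1 j _ (fun k hk => h2 i k (hk.trans (Fin.castSucc_le_castSucc_iff.mpr hj.le)))
      (h2 i _ (Fin.succ_le_castSucc_iff.mpr hj))
  · exact h2 i _ (Fin.castSucc_le_castSucc_iff.mpr hj.le)

/-- Coordinates on a lattice whose positive cone is a simplicial cone inside the open orthant. -/
theorem exists_cone_coordinates {m : ℕ} (G : AddSubgroup (Fin (m + 1) → ℤ)) {c : ℕ} (hc : 0 < c)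
    (hcG : ∀ i, Pi.single i (c : ℤ) ∈ G) (S b : ℕ) :
    ∃ l : G →+ (Fin (m + 1) → ℤ), Function.Injective l ∧
      (∀ x : G, (∀ i, 1 ≤ (x : Fin (m + 1) → ℤ) i) → ∑ i, (x : Fin (m + 1) → ℤ) i ≤ S →
        ∀ i, 0 ≤ l x i) ∧
      (∃ b' : ℕ, ∀ x : G, (∀ i, 0 ≤ l x i) → ∀ j, (b' : ℤ) ≤ l x j →
        ∀ i, (b : ℤ) ≤ (x : Fin (m + 1) → ℤ) i) ∧
      (∃ c' : ℕ, 0 < c' ∧ ∃ p, l p = Pi.single (Fin.last m) (c' : ℤ)) ∧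
      ∀ i, i ≠ Fin.last m → ∃ h, ∃ k : ℤ, l h = Pi.single (Fin.last m) k + Pi.single i 1 := by
  set K : ℤ := 4 * ((m + 1 : ℕ) : ℤ) + S + 1 with hKdef
  have hK1 : 4 * ((m + 1 : ℕ) : ℤ) ≤ K := by omega
  have hK0 : 0 < K := by omega
  let z : Fin (m + 1) → G →+ ℤ := fun i =>
    { toFun x := K * (x : Fin (m + 1) → ℤ) i - ∑ j, (x : Fin (m + 1) → ℤ) j
      map_zero' := by simp
      map_add' x y := by
        simp only [AddSubgroup.coe_add, Pi.add_apply, Finset.sum_add_distrib]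
        ring }
  have hz : ∀ i x, z i x = K * (x : Fin (m + 1) → ℤ) i - ∑ j, (x : Fin (m + 1) → ℤ) j :=
    fun _ _ => rfl
  obtain ⟨ω, hω⟩ := exists_perturbed_forms G hc hcG K (by omega) z hz
  choose B' hB'0 hB' using fun i => exists_bound_of_smul_single hc hcG (ω i)
  set B : ℤ := ∑ i, B' i with hBdef
  have hB0 : 0 ≤ B := Finset.sum_nonneg fun i _ => hB'0 i
  have hB : ∀ i (x : G), |ω i x| ≤ B * ∑ j, |(x : Fin (m + 1) → ℤ) j| := fun i x =>
    (hB' i x).trans (mul_le_mul_of_nonneg_right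
      (Finset.single_le_sum (fun j _ => hB'0 j) (Finset.mem_univ i))
      (Finset.sum_nonneg fun j _ => abs_nonneg _))
  set N : ℤ := 4 * (B + 1) * (S + 1) with hN
  have hS0 : (0 : ℤ) ≤ S := Int.natCast_nonneg S
  have hN0 : 0 < N := by positivity
  let f : Fin m → G →+ ℤ := fun i => N • z i.castSucc + ω i
  have hf : ∀ i x, f i x = N * z i.castSucc x + ω i x := fun i x => rfl
  have hlow : ∀ x : G, (∀ i, 0 ≤ snocHom f (z (Fin.last m)) x i) → ∀ i,
      4 * (∑ j, (x : Fin (m + 1) → ℤ) j) - ∑ j, |(x : Fin (m + 1) → ℤ) j|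
        ≤ 4 * K * (x : Fin (m + 1) → ℤ) i := by
    intro x hx i
    have ha : 0 ≤ ∑ j, |(x : Fin (m + 1) → ℤ) j| := Finset.sum_nonneg fun j _ => abs_nonneg _
    suffices h : -(∑ j, |(x : Fin (m + 1) → ℤ) j|) ≤ 4 * z i x by
      rw [hz] at h; linarith
    have hi := hx i
    induction i using Fin.lastCases with
    | last => rw [snocHom_last] at hi; linarith
    | cast i =>
      rw [snocHom_castSucc, hf] at hi
      have h1 := (le_abs_self _).trans (hB i x)
      have h2 : 0 ≤ (B + 1) * (S + 1) * (4 * z i.castSucc x + ∑ j, |(x : Fin (m + 1) → ℤ) j|) := by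
        have : 0 ≤ (B * S + S + 1) * ∑ j, |(x : Fin (m + 1) → ℤ) j| := by positivity
        rw [hN] at hi
        nlinarith
      have := nonneg_of_mul_nonneg_right h2 (by positivity)
      linarith
  have hnn : ∀ x : G, (∀ i, 0 ≤ snocHom f (z (Fin.last m)) x i) →
      ∀ i, 0 ≤ (x : Fin (m + 1) → ℤ) i := fun x hx => nonneg_of_four_mul_le hK1 (hlow x hx)
  have hinj : Function.Injective (snocHom f (z (Fin.last m))) := by
    rw [injective_iff_map_eq_zero]
    intro x hx
    apply Subtype.ext
    ext i
    refine le_antisymm ?_ (hnn x (fun i => by rw [hx]; exact le_rfl) i)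
    have := hnn (-x) (fun i => by rw [map_neg, hx, neg_zero]; exact le_rfl) i
    change 0 ≤ -(x : Fin (m + 1) → ℤ) i at this
    change (x : Fin (m + 1) → ℤ) i ≤ 0
    linarith
  refine ⟨snocHom f (z (Fin.last m)), hinj, fun x hx hxS i => ?_, ?_, ?_, fun i hi => ?_⟩
  · have hzi : ∀ i, 1 ≤ z i x := by
      intro i
      rw [hz]
      nlinarith [hx i]
    induction i using Fin.lastCases with
    | last => rw [snocHom_last]; linarith [hzi (Fin.last m)]
    | cast i =>
      rw [snocHom_castSucc, hf]
      have h1 := (neg_abs_le (ω i x)).trans' (neg_le_neg (hB i x))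
      have h2 : ∑ j, |(x : Fin (m + 1) → ℤ) j| = ∑ j, (x : Fin (m + 1) → ℤ) j :=
        Finset.sum_congr rfl fun j _ => abs_of_nonneg (by linarith [hx j])
      rw [h2] at h1
      have h3 := mul_le_mul_of_nonneg_left hxS hB0
      have h4 := mul_le_mul_of_nonneg_left (hzi i.castSucc) hN0.le
      nlinarith [mul_nonneg hB0 hS0]
  · refine ⟨(4 * K * b * (N * K + B)).toNat, fun x hx j hj i => ?_⟩
    have hb0 : (0 : ℤ) ≤ b := Int.natCast_nonneg b
    rw [Int.toNat_of_nonneg (by positivity)] at hj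
    have hx0 := hnn x hx
    have ha : ∑ j, |(x : Fin (m + 1) → ℤ) j| = ∑ j, (x : Fin (m + 1) → ℤ) j :=
      Finset.sum_congr rfl fun j _ => abs_of_nonneg (hx0 j)
    have hs0 : 0 ≤ ∑ j, (x : Fin (m + 1) → ℤ) j := Finset.sum_nonneg fun j _ => hx0 j
    have hzs : ∀ i, z i x ≤ K * ∑ j, (x : Fin (m + 1) → ℤ) j := by
      intro i
      rw [hz]
      have := Finset.single_le_sum (fun j _ => hx0 j) (Finset.mem_univ i)
      nlinarith
    have hup : snocHom f (z (Fin.last m)) x j ≤ (N * K + B) * ∑ j, (x : Fin (m + 1) → ℤ) j := by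
      induction j using Fin.lastCases with
      | last =>
        rw [snocHom_last]
        have : 0 ≤ ((N - 1) * K + B) * ∑ j, (x : Fin (m + 1) → ℤ) j := by
          have : 0 ≤ N - 1 := by linarith
          positivity
        nlinarith [hzs (Fin.last m)]
      | cast j =>
        rw [snocHom_castSucc, hf]
        have h1 := (le_abs_self _).trans (hB j x)
        rw [ha] at h1
        nlinarith [mul_le_mul_of_nonneg_left (hzs j.castSucc) hN0.le]
    have h1 : 4 * K * b ≤ ∑ j, (x : Fin (m + 1) → ℤ) j := by
      refine le_of_mul_le_mul_right (a := N * K + B) ?_ (by positivity)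
      linarith
    have h2 := hlow x hx i
    rw [ha] at h2
    refine le_of_mul_le_mul_left (a := 4 * K) ?_ (by positivity)
    linarith
  · let cG : (Fin (m + 1) → ℤ) →+ G :=
      { toFun x := ⟨(c : ℤ) • x, by
          have : (c : ℤ) • x = ∑ i, x i • Pi.single i (c : ℤ) := by
            ext k
            simp [Finset.sum_apply, Pi.single_apply, mul_comm]
          rw [this]
          exact sum_mem fun i _ => zsmul_mem (hcG i) _⟩
        map_zero' := Subtype.ext (smul_zero _)
        map_add' x y := Subtype.ext (smul_add _ _ _) }
    have hni : ¬ Function.Injective ((AddMonoidHom.pi f).comp cG).toIntLinearMap := fun h => by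
      have := card_le_of_injective ℤ _ h
      simp at this
    have hni' : ¬ ∀ x, ((AddMonoidHom.pi f).comp cG) x = 0 → x = 0 := fun h =>
      hni ((injective_iff_map_eq_zero ((AddMonoidHom.pi f).comp cG)).mpr h)
    push Not at hni'
    obtain ⟨x, hx, hx0⟩ := hni'
    have hp : ∀ i, f i (cG x) = 0 := fun i => congrFun hx i
    have hcx : cG x ≠ 0 := by
      intro h
      have h1 : (c : ℤ) • x = 0 := congrArg Subtype.val h
      exact hx0 ((smul_eq_zero.mp h1).resolve_left (by exact_mod_cast hc.ne'))
    have hlp : snocHom f (z (Fin.last m)) (cG x) =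
        Pi.single (Fin.last m) (z (Fin.last m) (cG x)) := by
      ext j
      induction j using Fin.lastCases with
      | last => rw [snocHom_last, Pi.single_eq_same]
      | cast j => rw [snocHom_castSucc, hp, Pi.single_eq_of_ne (Fin.castSucc_lt_last j).ne]
    have hz0 : z (Fin.last m) (cG x) ≠ 0 := by
      intro h
      rw [h, Pi.single_zero] at hlp
      exact hcx (hinj (hlp.trans (map_zero _).symm))
    rcases lt_or_gt_of_ne hz0 with h | h
    · refine ⟨(-z (Fin.last m) (cG x)).toNat, by omega, -cG x, ?_⟩
      rw [map_neg, hlp, Int.toNat_of_nonneg (by omega), Pi.single_neg]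
    · refine ⟨(z (Fin.last m) (cG x)).toNat, by omega, cG x, ?_⟩
      rw [hlp, Int.toNat_of_nonneg (by omega)]
  · obtain ⟨i, rfl⟩ := Fin.exists_castSucc_eq.mpr hi
    obtain ⟨h, hh⟩ := exists_eq_of_triangular f (fun i => by
      obtain ⟨g, ⟨h1, h2⟩, h3⟩ := hω i
      refine ⟨g, by rw [hf, h1, h2]; ring, fun j hj => ?_⟩
      rw [hf, (h3 j hj).1, (h3 j hj).2]; ring) (Pi.single i 1)
    refine ⟨h, z (Fin.last m) h, ?_⟩
    ext j
    induction j using Fin.lastCases with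
    | last => rw [snocHom_last, Pi.add_apply, Pi.single_eq_same, Pi.single_eq_of_ne hi.symm,
      add_zero]
    | cast j =>
      rw [snocHom_castSucc, Pi.add_apply, Pi.single_eq_of_ne (Fin.castSucc_lt_last j).ne, zero_add,
        hh]
      simp [Pi.single_apply]

end ConeCoordinates

section FrobeniusCone

open Matrix

variable {ι : Type*} [Fintype ι] [DecidableEq ι] {R : Type*} [CommRing R]

theorem RowTransitive.of_expMap {M N : Type*} [AddCommMonoid M] [AddCommMonoid N] {j : M →+ N}
    (hj : Function.Injective j) (h : RowTransitive ι (AddMonoidAlgebra R M))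
    {u w : ι → AddMonoidAlgebra R N} (hw : w ⬝ᵥ u = 1)
    (hu : ∀ i, u i ∈ suppSub R (Set.range j)) (hw' : ∀ i, w i ∈ suppSub R (Set.range j)) (o : ι) :
    RowRel u (Pi.single o 1) := by
  choose u₀ hu₀ using fun i => exists_expMap_eq hj (hu i)
  choose w₀ hw₀ using fun i => exists_expMap_eq hj (hw' i)
  have hu1 : expMap R j ∘ u₀ = u := funext hu₀
  have hw1 : expMap R j ∘ w₀ = w := funext hw₀
  have huni : UniRow u₀ := by
    refine ⟨w₀, expMap_injective (R := R) hj ?_⟩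
    rw [RingHom.map_dotProduct, map_one, hu1, hw1, hw]
  have := (h _ huni o).map (expMap R j)
  rwa [hu1, comp_single_one] at this

theorem rowTransitive_of_interior_succ [IsNoetherianRing R] (d : ℕ)
    (hR : ∀ q : Ideal R, q.IsPrime → q.height < d) (hcard : d + 1 ≤ Fintype.card ι)
    (hcard' : 3 ≤ Fintype.card ι) {m : ℕ}
    (hT : ∀ (M : AddSubmonoid (Fin m →₀ ℕ)) (c : ℕ), 0 < c → (∀ i, Finsupp.single i c ∈ M) →
      RowTransitive ι (AddMonoidAlgebra R M))
    {N : AddSubmonoid (Fin (m + 1) →₀ ℕ)} (hN : ∀ x ∈ N, x ≠ 0 → ∀ i, 0 < x i)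
    {G : AddSubgroup (Fin (m + 1) → ℤ)} (hG : ∀ x ∈ N, castHom (m + 1) x ∈ G)
    {c : ℕ} (hc : 0 < c) (hcG : ∀ i, Pi.single i (c : ℤ) ∈ G) {b : ℕ}
    (hdeep : ∀ a, castHom (m + 1) a ∈ G → (∀ i, b ≤ a i) → a ∈ N) :
    RowTransitive ι (AddMonoidAlgebra R N) := by
  intro u hu o
  obtain ⟨w, hw⟩ := hu
  choose S₁ hS₁ using fun i => exists_coeff_lt (u i) fun x => ∑ j, (x : Fin (m + 1) →₀ ℕ) j
  choose S₂ hS₂ using fun i => exists_coeff_lt (w i) fun x => ∑ j, (x : Fin (m + 1) →₀ ℕ) j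
  obtain ⟨l, hinj, hpos, ⟨b', hb'⟩, ⟨c', hc', p, hp⟩, hh⟩ :=
    exists_cone_coordinates G hc hcG (∑ i, (S₁ i + S₂ i)) b
  have hcast : Function.Injective (castHom (m + 1)) := fun x y h => by
    ext i
    exact Nat.cast_injective (R := ℤ) (congrFun h i)
  let M : AddSubmonoid (Fin (m + 1) →₀ ℕ) :=
    { carrier := {a | ∃ y : N, l ⟨_, hG y y.2⟩ = castHom (m + 1) a}
      zero_mem' := ⟨0, by
        have : (⟨_, hG (0 : N) (0 : N).2⟩ : G) = 0 := Subtype.ext (map_zero _)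
        rw [this, map_zero, map_zero]⟩
      add_mem' := by
        rintro a a' ⟨y, hy⟩ ⟨y', hy'⟩
        refine ⟨y + y', ?_⟩
        have : (⟨_, hG (y + y' : N) (y + y' : N).2⟩ : G) = ⟨_, hG y y.2⟩ + ⟨_, hG y' y'.2⟩ :=
          Subtype.ext (map_add _ _ _)
        rw [this, map_add, map_add, hy, hy'] }
  choose y hy using fun a : M => a.2
  have hyuniq : ∀ (a : M) (y' : N), l ⟨_, hG y' y'.2⟩ = castHom (m + 1) a → y a = y' := by
    intro a y' h
    have h1 := congrArg Subtype.val (hinj ((hy a).trans h.symm))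
    exact Subtype.ext (hcast h1)
  let j : M →+ N :=
    { toFun := y
      map_zero' := hyuniq _ _ (by
        have : (⟨_, hG (0 : N) (0 : N).2⟩ : G) = 0 := Subtype.ext (map_zero _)
        rw [this, map_zero]
        exact (map_zero _).symm)
      map_add' := fun a a' => hyuniq _ _ (by
        have : (⟨_, hG (y a + y a' : N) (y a + y a' : N).2⟩ : G)
            = ⟨_, hG (y a) (y a).2⟩ + ⟨_, hG (y a') (y a').2⟩ := Subtype.ext (map_add _ _ _)
        rw [this, map_add, hy, hy]
        exact (map_add _ _ _).symm) }
  have hj : Function.Injective j := by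
    intro a a' h
    have h1 : y a = y a' := h
    apply Subtype.ext
    apply hcast
    rw [← hy, ← hy]
    congr 2
    rw [h1]
  have hrange : ∀ z : N, (∑ i, (z : Fin (m + 1) →₀ ℕ) i ≤ ∑ i, (S₁ i + S₂ i)) →
      z ∈ Set.range j := by
    intro z hz
    have h0 : ∀ i, 0 ≤ l ⟨_, hG z z.2⟩ i := by
      by_cases hz0 : z = 0
      · intro i
        have : (⟨_, hG z z.2⟩ : G) = 0 := by
          apply Subtype.ext
          rw [hz0]
          exact map_zero _
        rw [this, map_zero]
        exact le_rfl
      · refine hpos ⟨_, hG z z.2⟩ (fun i => ?_) ?_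
        · exact Int.natCast_pos.mpr (hN z z.2 (fun h => hz0 (Subtype.ext h)) i)
        · change ∑ i, (((z : Fin (m + 1) →₀ ℕ) i : ℕ) : ℤ) ≤ _
          exact_mod_cast hz
    let a : Fin (m + 1) →₀ ℕ := Finsupp.equivFunOnFinite.symm fun i => (l ⟨_, hG z z.2⟩ i).toNat
    have ha : l ⟨_, hG z z.2⟩ = castHom (m + 1) a := by
      ext i
      exact (Int.toNat_of_nonneg (h0 i)).symm
    exact ⟨⟨a, z, ha⟩, hyuniq _ _ ha⟩
  have hMmem : ∀ (a : Fin (m + 1) →₀ ℕ) (x : G), l x = castHom (m + 1) a →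
      ∀ i, b' ≤ a i → a ∈ M := by
    intro a x hx i hi
    have h1 := hb' x (fun k => by rw [hx]; exact Int.natCast_nonneg _) i
      (by rw [hx]; exact Int.ofNat_le.mpr hi)
    let z : Fin (m + 1) →₀ ℕ :=
      Finsupp.equivFunOnFinite.symm fun k => ((x : Fin (m + 1) → ℤ) k).toNat
    have hzx : castHom (m + 1) z = x := by
      ext k
      exact Int.toNat_of_nonneg (by have := h1 k; omega)
    have hz : z ∈ N := by
      refine hdeep z (by rw [hzx]; exact x.2) fun k => ?_
      have h2 := h1 k
      rw [← hzx] at h2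
      exact Int.ofNat_le.mp h2
    refine ⟨⟨z, hz⟩, ?_⟩
    rw [← hx]
    congr 1
    exact Subtype.ext hzx
  have hcastsingle : ∀ (i : Fin (m + 1)) (k : ℕ),
      castHom (m + 1) (Finsupp.single i k) = Pi.single i (k : ℤ) := by
    intro i k
    ext t
    change ((Finsupp.single i k t : ℕ) : ℤ) = _
    rw [Finsupp.single_apply, Pi.single_apply, Nat.cast_ite, Nat.cast_zero]
    simp only [eq_comm]
  have hsingle : ∀ i, Finsupp.single i (c' * (b' + 1)) ∈ M := by
    intro i
    have hx : ∃ x, l x = castHom (m + 1) (Finsupp.single i (c' * (b' + 1))) := by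
      rw [hcastsingle]
      by_cases hi : i = Fin.last m
      · refine ⟨((b' + 1 : ℕ) : ℤ) • p, ?_⟩
        rw [map_zsmul, hp, hi, ← Pi.single_smul, smul_eq_mul, mul_comm c', Nat.cast_mul]
      · obtain ⟨h, k, hk⟩ := hh i hi
        refine ⟨((c' * (b' + 1) : ℕ) : ℤ) • h - (((b' + 1 : ℕ) : ℤ) * k) • p, ?_⟩
        rw [map_sub, map_zsmul, map_zsmul, hk, hp, smul_add, ← Pi.single_smul, ← Pi.single_smul,
          ← Pi.single_smul, smul_eq_mul, smul_eq_mul, smul_eq_mul, mul_one]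
        rw [show ((c' * (b' + 1) : ℕ) : ℤ) * k = ((b' + 1 : ℕ) : ℤ) * k * c' by push_cast; ring,
          add_sub_cancel_left]
    obtain ⟨x, hx⟩ := hx
    refine hMmem _ x hx i ?_
    rw [Finsupp.single_eq_same]
    nlinarith
  have hMT : RowTransitive ι (AddMonoidAlgebra R M) := by
    refine rowTransitive_of_deep d hR hcard hcard' (c := c' * (b' + 1)) (by positivity) hsingle
      (G := l.range) (b := b') ?_ ?_ ?_ ?_
    · rintro a ⟨z, hz⟩
      exact ⟨_, hz⟩
    · intro i hi n
      obtain ⟨h, k, hk⟩ := hh i hi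
      refine ⟨(-k + (n + k.natAbs) * c').toNat, ?_, -h + ((n : ℤ) + k.natAbs) • p, ?_⟩
      · have : (1 : ℤ) ≤ c' := by exact_mod_cast hc'
        have h1 : (n : ℤ) + |k| ≤ (n + |k|) * c' := by nlinarith [abs_nonneg k]
        have h2 := le_abs_self k
        rw [Int.natCast_natAbs]
        omega
      · have : (1 : ℤ) ≤ c' := by exact_mod_cast hc'
        have h1 : (n : ℤ) + |k| ≤ (n + |k|) * c' := by nlinarith [abs_nonneg k]
        have h2 := le_abs_self k
        rw [map_add, map_neg, map_zsmul, hk, hp, hcastsingle, hcastsingle, Int.toNat_of_nonneg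
          (by rw [Int.natCast_natAbs]; omega), ← Pi.single_smul, smul_eq_mul, Pi.single_add,
          Pi.single_neg, Nat.cast_one]
        abel
    · rintro a ⟨x, hx⟩ ha
      exact hMmem a x hx _ ha
    · let M₀ : AddSubmonoid (Fin m →₀ ℕ) :=
        M.comap (Finsupp.mapDomain.addMonoidHom Fin.castSucc)
      have hlast : ∀ y : Fin m →₀ ℕ, (y.mapDomain Fin.castSucc) (Fin.last m) = 0 := fun y =>
        Finsupp.mapDomain_of_notMem_range _ _
          (by rintro ⟨i, hi⟩; exact (Fin.castSucc_lt_last i).ne hi)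
      let f : M₀ →+ AddMonoidHom.mker (lastDeg M) :=
        { toFun y := ⟨⟨(y : Fin m →₀ ℕ).mapDomain Fin.castSucc, y.2⟩, hlast y⟩
          map_zero' := Subtype.ext
            (Subtype.ext (Finsupp.mapDomain_zero (f := (Fin.castSucc : Fin m → Fin (m+1)))))
          map_add' x y := Subtype.ext
            (Subtype.ext (Finsupp.mapDomain_add (f := (Fin.castSucc : Fin m → Fin (m+1))))) }
      have hf : Function.Bijective f := by
        constructor
        · intro x y h
          have h1 : (x : Fin m →₀ ℕ).mapDomain Fin.castSucc
              = (y : Fin m →₀ ℕ).mapDomain Fin.castSucc :=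
            congrArg (fun z : AddMonoidHom.mker (lastDeg M) => ((z : M) : Fin (m + 1) →₀ ℕ)) h
          exact Subtype.ext (Finsupp.mapDomain_injective (Fin.castSucc_injective m) h1)
        · rintro ⟨⟨a, haM⟩, ha⟩
          have ha : a (Fin.last m) = 0 := ha
          have h1 : (a.comapDomain Fin.castSucc (Fin.castSucc_injective m).injOn).mapDomain
              Fin.castSucc = a := by
            ext i
            induction i using Fin.lastCases with
            | last => rw [hlast, ha]
            | cast i =>
              rw [Finsupp.mapDomain_apply (Fin.castSucc_injective m), Finsupp.comapDomain_apply]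
          have h2 : a.comapDomain Fin.castSucc (Fin.castSucc_injective m).injOn ∈ M₀ :=
            Set.mem_of_eq_of_mem (s := M) h1 haM
          exact ⟨⟨_, h2⟩, Subtype.ext (Subtype.ext h1)⟩
      refine RowTransitive.of_ringEquiv (expEquiv R (AddEquiv.ofBijective f hf))
        (hT M₀ (c' * (b' + 1)) (by positivity) fun i => ?_)
      change Finsupp.mapDomain Fin.castSucc (Finsupp.single i (c' * (b' + 1))) ∈ M
      rw [Finsupp.mapDomain_single]
      exact hsingle _
  have hle : ∀ i, S₁ i + S₂ i ≤ ∑ i, (S₁ i + S₂ i) := fun i =>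
    Finset.single_le_sum (f := fun i => S₁ i + S₂ i) (fun _ _ => Nat.zero_le _) (Finset.mem_univ i)
  refine RowTransitive.of_expMap hj hMT hw (fun i z hz => hrange z ?_) (fun i z hz => hrange z ?_) o
  · have := hS₁ i z hz
    have := hle i
    omega
  · have := hS₂ i z hz
    have := hle i
    omega

theorem rowTransitive_of_unique_monoid [IsNoetherianRing R] (d : ℕ)
    (hR : ∀ q : Ideal R, q.IsPrime → q.height < d) (hcard : d + 1 ≤ Fintype.card ι)
    {N : Type*} [AddCommMonoid N] [Subsingleton N] : RowTransitive ι (AddMonoidAlgebra R N) := by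
  let _ : Unique N := ⟨⟨0⟩, fun x => Subsingleton.elim _ _⟩
  exact RowTransitive.of_ringEquiv (AddMonoidAlgebra.uniqueRingEquiv (R := R) N).symm
    (rowTransitive_of_height_lt d hR hcard)

end FrobeniusCone

section AllFaces

open Matrix

variable {ι : Type*} [Fintype ι] [DecidableEq ι] {R : Type*} [CommRing R]

theorem mem_of_le_of_dvd {n : ℕ} {M : AddSubmonoid (Fin n →₀ ℕ)} {c : ℕ}
    (hcM : ∀ i, Finsupp.single i c ∈ M) {y a : Fin n →₀ ℕ} (hy : y ∈ M)
    (hle : ∀ i, y i ≤ a i) (hdvd : ∀ i, (c : ℤ) ∣ (a i : ℤ) - y i) : a ∈ M := by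
  choose k hk using hdvd
  have h1 : a = y + ∑ i, (k i).toNat • Finsupp.single i c := by
    ext j
    rw [Finsupp.add_apply, Finsupp.finsetSum_apply, Finset.sum_eq_single j
      (fun i _ hi => by rw [Finsupp.smul_apply, Finsupp.single_eq_of_ne hi.symm, smul_zero])
      (fun h => absurd (Finset.mem_univ j) h), Finsupp.smul_apply, Finsupp.single_eq_same]
    have h2 := hk j
    have h3 := hle j
    rcases Nat.eq_zero_or_pos c with rfl | hc
    · simp at h2 ⊢; omega
    · have h4 : 0 ≤ k j := by
        by_contra h
        push Not at h
        have : (0 : ℤ) < c := by exact_mod_cast hc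
        nlinarith
      zify
      rw [smul_eq_mul, Nat.cast_mul, Int.toNat_of_nonneg h4]
      linarith
  rw [h1]
  exact add_mem hy (sum_mem fun i _ => nsmul_mem (hcM i) _)

theorem exists_deep_bound {n : ℕ} {M : AddSubmonoid (Fin n →₀ ℕ)} {c : ℕ} (hc : 0 < c)
    (hcM : ∀ i, Finsupp.single i c ∈ M) :
    ∃ b : ℕ, ∀ a, castHom n a ∈ AddSubgroup.closure (castHom n '' M) → (∀ i, b ≤ a i) → a ∈ M := by
  classical
  have := NeZero.of_pos hc
  have hrep : ∀ g ∈ AddSubgroup.closure (castHom n '' M), ∃ y ∈ M, ∀ i, ((g i : ℤ) : ZMod c) =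
      y i := by
    intro g hg
    induction hg using AddSubgroup.closure_induction with
    | mem x hx =>
      obtain ⟨y, hy, rfl⟩ := hx
      exact ⟨y, hy, fun i => by simp [castHom]⟩
    | zero => exact ⟨0, zero_mem _, fun i => by simp⟩
    | add x y _ _ hx hy =>
      obtain ⟨x', hx', hx⟩ := hx
      obtain ⟨y', hy', hy⟩ := hy
      exact ⟨x' + y', add_mem hx' hy', fun i => by simp [hx, hy]⟩
    | neg x _ hx =>
      obtain ⟨x', hx', hx⟩ := hx
      refine ⟨(c - 1) • x', nsmul_mem hx' _, fun i => ?_⟩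
      simp [hx, Nat.cast_sub (show 1 ≤ c from hc)]
  let Y : (Fin n → ZMod c) → (Fin n →₀ ℕ) := fun ρ =>
    if h : ∃ y ∈ M, ∀ i, ρ i = (y i : ZMod c) then h.choose else 0
  refine ⟨∑ ρ, ∑ i, Y ρ i, fun a ha hb => ?_⟩
  have h := hrep _ ha
  let ρ : Fin n → ZMod c := fun i => ((castHom n a i : ℤ) : ZMod c)
  have hY : Y ρ = h.choose := dif_pos h
  obtain ⟨h1, h2⟩ := h.choose_spec
  rw [← hY] at h1 h2
  refine mem_of_le_of_dvd hcM h1 (fun i => ?_) fun i => ?_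
  · refine le_trans ?_ (hb i)
    exact (Finset.single_le_sum (f := fun i => Y ρ i) (fun _ _ => Nat.zero_le _)
      (Finset.mem_univ i)).trans (Finset.single_le_sum (f := fun ρ => ∑ i, Y ρ i)
        (fun _ _ => Nat.zero_le _) (Finset.mem_univ ρ))
  · have := h2 i
    rw [← ZMod.intCast_zmod_eq_zero_iff_dvd]
    push_cast
    rw [sub_eq_zero, ← this]
    simp [castHom]

/-- The submonoid of elements which are zero or have support `F`. -/
def interiorMonoid {n : ℕ} (M : AddSubmonoid (Fin n →₀ ℕ)) (F : Finset (Fin n)) :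
    AddSubmonoid M where
  carrier := {x | x = 0 ∨ (x : Fin n →₀ ℕ).support = F}
  zero_mem' := Or.inl rfl
  add_mem' := by
    rintro x y (rfl | hx) hy
    · rwa [zero_add]
    · rcases hy with rfl | hy
      · rw [add_zero]; exact Or.inr hx
      · refine Or.inr ?_
        rw [AddSubmonoid.coe_add]
        ext i
        have h1 := Finset.ext_iff.mp hx i
        have h2 := Finset.ext_iff.mp hy i
        rw [Finsupp.mem_support_iff] at h1 h2 ⊢
        rw [Finsupp.add_apply, ← h1]
        rw [← h1] at h2
        omega

/-- The submonoid of elements supported in `F`. -/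
def faceMonoid {n : ℕ} (M : AddSubmonoid (Fin n →₀ ℕ)) (F : Finset (Fin n)) : AddSubmonoid M where
  carrier := {x | (x : Fin n →₀ ℕ).support ⊆ F}
  zero_mem' := by simp
  add_mem' := by
    intro x y hx hy i hi
    have h1 := @hx i
    have h2 := @hy i
    rw [Finsupp.mem_support_iff] at h1 h2 hi
    rw [AddSubmonoid.coe_add, Finsupp.add_apply] at hi
    by_contra h
    exact hi (by rw [not_not.mp (mt h1 h), not_not.mp (mt h2 h), add_zero])

theorem mem_faceMonoid {n : ℕ} {M : AddSubmonoid (Fin n →₀ ℕ)} {F : Finset (Fin n)} {x : M} :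
    x ∈ faceMonoid M F ↔ (x : Fin n →₀ ℕ).support ⊆ F := Iff.rfl

theorem faceMonoid_of_add {n : ℕ} {M : AddSubmonoid (Fin n →₀ ℕ)} {F : Finset (Fin n)} (x y : M)
    (h : x + y ∈ faceMonoid M F) : x ∈ faceMonoid M F := by
  intro i hi
  refine h ?_
  rw [Finsupp.mem_support_iff] at hi ⊢
  rw [AddSubmonoid.coe_add, Finsupp.add_apply]
  omega

theorem rowTransitive_interiorMonoid [IsNoetherianRing R] (d : ℕ)
    (hR : ∀ q : Ideal R, q.IsPrime → q.height < d) (hcard : d + 1 ≤ Fintype.card ι)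
    (hcard' : 3 ≤ Fintype.card ι) {n : ℕ}
    (hT : ∀ m < n, ∀ (M : AddSubmonoid (Fin m →₀ ℕ)) (c : ℕ), 0 < c →
      (∀ i, Finsupp.single i c ∈ M) → RowTransitive ι (AddMonoidAlgebra R M))
    {M : AddSubmonoid (Fin n →₀ ℕ)} {c : ℕ} (hc : 0 < c) (hcM : ∀ i, Finsupp.single i c ∈ M)
    (F : Finset (Fin n)) : RowTransitive ι (AddMonoidAlgebra R (interiorMonoid M F)) := by
  rcases h : F.card with _ | m
  · have : Subsingleton (interiorMonoid M F) := by
      have h0 : ∀ x : interiorMonoid M F, x = 0 := by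
        rintro ⟨x, rfl | hx⟩
        · rfl
        · rw [Finset.card_eq_zero.mp h, Finsupp.support_eq_empty] at hx
          exact Subtype.ext (Subtype.ext hx)
      exact ⟨fun x y => (h0 x).trans (h0 y).symm⟩
    exact rowTransitive_of_unique_monoid d hR hcard
  · let s : Fin (m + 1) ↪ Fin n := (F.orderEmbOfFin h).toEmbedding
    have hs : ∀ i, i ∈ F ↔ i ∈ Set.range s := fun i => by
      rw [← Finset.mem_coe, ← Finset.range_orderEmbOfFin F h]; rfl
    let f : (Fin (m + 1) →₀ ℕ) →+ (Fin n →₀ ℕ) := Finsupp.mapDomain.addMonoidHom s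
    have hf : ∀ a i, f a (s i) = a i := fun a i => Finsupp.mapDomain_apply s.injective a i
    have hf0 : ∀ a i, i ∉ F → f a i = 0 := fun a i hi =>
      Finsupp.mapDomain_of_notMem_range a i fun hi' => hi ((hs i).mpr hi')
    have hfinj : Function.Injective f := Finsupp.mapDomain_injective s.injective
    let M' : AddSubmonoid (Fin (m + 1) →₀ ℕ) := M.comap f
    have hcM' : ∀ i, Finsupp.single i c ∈ M' := fun i => by
      change Finsupp.mapDomain s (Finsupp.single i c) ∈ M
      rw [Finsupp.mapDomain_single]
      exact hcM _
    let N : AddSubmonoid (Fin (m + 1) →₀ ℕ) :=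
      { carrier := {a | ∃ h : f a ∈ M, (⟨f a, h⟩ : M) ∈ interiorMonoid M F}
        zero_mem' := ⟨by rw [map_zero]; exact zero_mem _, Or.inl (Subtype.ext (map_zero f))⟩
        add_mem' := by
          rintro a b ⟨ha, ha'⟩ ⟨hb, hb'⟩
          refine ⟨by rw [map_add]; exact add_mem ha hb, ?_⟩
          exact Set.mem_of_eq_of_mem (Subtype.ext (map_add f a b)) (add_mem ha' hb') }
    have hNpos : ∀ a ∈ N, a ≠ 0 → ∀ i, 0 < a i := by
      rintro a ⟨h1, h2 | h2⟩ h3 i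
      · exact absurd (hfinj ((congrArg Subtype.val h2).trans (map_zero f).symm)) h3
      · have : s i ∈ (f a).support := h2 ▸ (hs (s i)).mpr ⟨i, rfl⟩
        rw [Finsupp.mem_support_iff, hf] at this
        omega
    obtain ⟨b, hb⟩ := exists_deep_bound hc hcM'
    have key : RowTransitive ι (AddMonoidAlgebra R N) := by
      refine rowTransitive_of_interior_succ d hR hcard hcard'
        (hT m (by have := F.card_le_univ; rw [Fintype.card_fin] at this; omega)) hNpos
        (G := AddSubgroup.closure (castHom (m + 1) '' M')) ?_ hc ?_ (b := b + 1) ?_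
      · rintro x ⟨hx, _⟩
        exact AddSubgroup.subset_closure ⟨x, hx, rfl⟩
      · intro i
        refine AddSubgroup.subset_closure ⟨_, hcM' i, ?_⟩
        ext j
        simp [castHom, Finsupp.single_apply, Pi.single_apply, eq_comm]
      · intro a ha hba
        have h1 : a ∈ M' := hb a ha fun i => (Nat.le_succ b).trans (hba i)
        refine ⟨h1, Or.inr ?_⟩
        ext i
        rw [Finsupp.mem_support_iff]
        by_cases hi : i ∈ F
        · obtain ⟨j, rfl⟩ := (hs i).mp hi
          simp only [hf, hi, iff_true]
          have := hba j
          omega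
        · simp [hf0 a i hi, hi]
    let g : N →+ interiorMonoid M F :=
      { toFun a := ⟨⟨f a, a.2.1⟩, a.2.2⟩
        map_zero' := Subtype.ext (Subtype.ext (map_zero f))
        map_add' a b := Subtype.ext (Subtype.ext (map_add f _ _)) }
    have hg : Function.Bijective g := by
      constructor
      · intro a b hab
        exact Subtype.ext (hfinj (congrArg (fun z : interiorMonoid M F => ((z : M) : Fin n →₀ ℕ))
          hab))
      · rintro ⟨⟨x, hxM⟩, hx⟩
        have hxF : ∀ i, i ∉ F → x i = 0 := by
          intro i hi
          rcases hx with hx | hx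
          · rw [show x = 0 from congrArg Subtype.val hx]; rfl
          · by_contra h
            exact hi (hx ▸ Finsupp.mem_support_iff.mpr h)
        let a : Fin (m + 1) →₀ ℕ := Finsupp.equivFunOnFinite.symm fun i => x (s i)
        have ha : f a = x := by
          ext i
          by_cases hi : i ∈ F
          · obtain ⟨j, rfl⟩ := (hs i).mp hi
            rw [hf]; rfl
          · rw [hf0 a i hi, hxF i hi]
        have haM : f a ∈ M := Set.mem_of_eq_of_mem (s := M) ha hxM
        have hax : (⟨f a, haM⟩ : M) = ⟨x, hxM⟩ := Subtype.ext ha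
        have haN : a ∈ N := ⟨haM, Set.mem_of_eq_of_mem (s := interiorMonoid M F) hax hx⟩
        exact ⟨⟨a, haN⟩, Subtype.ext (Subtype.ext ha)⟩
    exact RowTransitive.of_ringEquiv (expEquiv R (AddEquiv.ofBijective g hg)) key

end AllFaces

section AllFaces

open Matrix

variable {ι : Type*} [Fintype ι] [DecidableEq ι] {R : Type*} [CommRing R]
variable {n : ℕ} {M : AddSubmonoid (Fin n →₀ ℕ)}

/-- The endomorphism of a monoid algebra killing all monomials not supported in `F`. -/
noncomputable def restr (R : Type*) [CommRing R] {n : ℕ} (M : AddSubmonoid (Fin n →₀ ℕ))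
    (F : Finset (Fin n)) : AddMonoidAlgebra R M →+* AddMonoidAlgebra R M :=
  (expMap R (faceMonoid M F).subtype).comp (faceHom R (faceMonoid M F) faceMonoid_of_add)

theorem restr_single_of_subset {F : Finset (Fin n)} {x : M} (hx : (x : Fin n →₀ ℕ).support ⊆ F)
    (a : R) : restr R M F (AddMonoidAlgebra.single x a) = AddMonoidAlgebra.single x a := by
  rw [restr, RingHom.comp_apply, faceHom_single_of_mem _ _ (mem_faceMonoid.mpr hx), expMap_single]
  rfl

theorem restr_single_of_not_subset {F : Finset (Fin n)} {x : M}
    (hx : ¬ (x : Fin n →₀ ℕ).support ⊆ F) (a : R) :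
    restr R M F (AddMonoidAlgebra.single x a) = 0 := by
  rw [restr, RingHom.comp_apply, faceHom_single_of_notMem _ _ (mt mem_faceMonoid.mp hx), map_zero]

theorem coeff_restr_of_subset {F : Finset (Fin n)} {x : M} (hx : (x : Fin n →₀ ℕ).support ⊆ F)
    (f : AddMonoidAlgebra R M) : (restr R M F f).coeff x = f.coeff x := by
  rw [restr, RingHom.comp_apply]
  exact (coeff_expMap (Subtype.val_injective) _ (⟨x, hx⟩ : faceMonoid M F)).trans
    (coeff_faceHom _ _ _ _)

theorem restr_mem_suppSub (F : Finset (Fin n)) (f : AddMonoidAlgebra R M) :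
    restr R M F f ∈ suppSub R {x : M | (x : Fin n →₀ ℕ).support ⊆ F} := by
  rw [restr, RingHom.comp_apply]
  refine suppSub_mono ?_ (expMap_mem_suppSub _ _)
  rintro _ ⟨x, rfl⟩
  exact x.2

theorem restr_restr {F F' : Finset (Fin n)} (h : F' ⊆ F) (f : AddMonoidAlgebra R M) :
    restr R M F' (restr R M F f) = restr R M F' f := by
  induction f using AddMonoidAlgebra.induction_linear with
  | zero => simp
  | add f g hf hg => simp only [map_add, hf, hg]
  | single x a =>
    by_cases hx : (x : Fin n →₀ ℕ).support ⊆ F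
    · rw [restr_single_of_subset hx]
    · rw [restr_single_of_not_subset hx, map_zero, restr_single_of_not_subset fun hx' =>
        hx (hx'.trans h)]

theorem restr_eq_self {F : Finset (Fin n)} {f : AddMonoidAlgebra R M}
    (hf : f ∈ suppSub R {x : M | (x : Fin n →₀ ℕ).support ⊆ F}) : restr R M F f = f := by
  have h : f ∈ ((restr R M F : AddMonoidAlgebra R M →+ AddMonoidAlgebra R M).eqLocus
      (AddMonoidHom.id _)) :=
    mem_of_single_mem _ fun x hx => restr_single_of_subset (hf x hx) _
  exact h

theorem restr_expMap_interior {F F' : Finset (Fin n)} (h : ¬ F ⊆ F')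
    (f : AddMonoidAlgebra R (interiorMonoid M F)) :
    restr R M F' (expMap R (interiorMonoid M F).subtype f)
      = restr R M ∅ (expMap R (interiorMonoid M F).subtype f) := by
  induction f using AddMonoidAlgebra.induction_linear with
  | zero => simp
  | add f g hf hg => simp only [map_add, hf, hg]
  | single x a =>
    rw [expMap_single]
    rcases x with ⟨x, rfl | hx⟩
    · rw [restr_single_of_subset, restr_single_of_subset]
      · exact (Finsupp.support_zero (M := ℕ)).subset
      · exact (Finsupp.support_zero (M := ℕ)).subset.trans (Finset.empty_subset _)
    · rw [restr_single_of_not_subset, restr_single_of_not_subset]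
      · intro h'
        exact h ((hx.symm.subset.trans h').trans (Finset.empty_subset _))
      · intro h'
        exact h (hx.symm.subset.trans h')

/-- Elements fixed by the retraction to `F` which agree with a constant on all proper faces. -/
theorem mem_suppSub_interior {F : Finset (Fin n)} {f : AddMonoidAlgebra R M}
    (h : ∀ G, G ⊂ F → restr R M G f = 0) (hF : restr R M F f = f) :
    f ∈ suppSub R {x : M | (x : Fin n →₀ ℕ).support = F} := by
  intro x hx
  have h1 : (x : Fin n →₀ ℕ).support ⊆ F := by
    rw [← hF] at hx
    exact restr_mem_suppSub F f x hx
  by_contra h2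
  rw [← coeff_restr_of_subset subset_rfl, h _ (lt_of_le_of_ne h1 h2)] at hx
  exact hx rfl

theorem exists_rowRel_restr [IsNoetherianRing R] (d : ℕ)
    (hR : ∀ q : Ideal R, q.IsPrime → q.height < d) (hcard : d + 1 ≤ Fintype.card ι)
    (hcard' : 3 ≤ Fintype.card ι)
    (hT : ∀ m < n, ∀ (M : AddSubmonoid (Fin m →₀ ℕ)) (c : ℕ), 0 < c →
      (∀ i, Finsupp.single i c ∈ M) → RowTransitive ι (AddMonoidAlgebra R M))
    {c : ℕ} (hc : 0 < c) (hcM : ∀ i, Finsupp.single i c ∈ M)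
    {u : ι → AddMonoidAlgebra R M} (hu : UniRow u) (o : ι) (k : ℕ) :
    ∀ 𝒢 : Finset (Finset (Fin n)), 𝒢.card = k → (∀ F ∈ 𝒢, ∀ F' ⊆ F, F' ∈ 𝒢) →
      ∃ u', RowRel u u' ∧ ∀ F ∈ 𝒢, restr R M F ∘ u' = Pi.single o 1 := by
  induction k with
  | zero =>
    intro 𝒢 h𝒢 _
    rw [Finset.card_eq_zero.mp h𝒢]
    exact ⟨u, RowRel.refl _, by simp⟩
  | succ k ih =>
    intro 𝒢 h𝒢 hlow
    obtain ⟨F, hF, hmax⟩ := 𝒢.exists_max_image Finset.card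
      (Finset.card_pos.mp (by omega))
    have hnot : ∀ F' ∈ 𝒢.erase F, ¬ F ⊆ F' := fun F' hF' h =>
      (Finset.mem_erase.mp hF').1
        (Finset.eq_of_subset_of_card_le h (hmax F' (Finset.mem_erase.mp hF').2)).symm
    obtain ⟨u', huu', hu'⟩ := ih (𝒢.erase F) (by rw [Finset.card_erase_of_mem hF, h𝒢]; rfl) (by
      intro F₁ h₁ F₂ h₂
      refine Finset.mem_erase.mpr ⟨?_, hlow F₁ (Finset.mem_erase.mp h₁).2 F₂ h₂⟩
      rintro rfl
      exact hnot F₁ h₁ h₂)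
    have hproper : ∀ G, G ⊂ F → restr R M G ∘ u' = Pi.single o 1 := fun G hG =>
      hu' G (Finset.mem_erase.mpr ⟨hG.ne, hlow F hF G hG.subset⟩)
    let J : interiorMonoid M F →+ M := (interiorMonoid M F).subtype
    have hJ : Function.Injective J := Subtype.val_injective
    obtain ⟨v₀, hv₀⟩ := hu.of_rel huu'
    let w : ι → AddMonoidAlgebra R M := restr R M F ∘ u'
    let v : ι → AddMonoidAlgebra R M := restr R M F ∘ v₀
    have hvw : v ⬝ᵥ w = 1 := by
      rw [← map_one (restr R M F), ← hv₀, RingHom.map_dotProduct]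
    have hsingle : ∀ (f : AddMonoidAlgebra R M →+* AddMonoidAlgebra R M) (i : ι),
        f ((Pi.single o 1 : ι → AddMonoidAlgebra R M) i) =
            (Pi.single o 1 : ι → AddMonoidAlgebra R M) i :=
      fun f i => congrFun (comp_single_one f o) i
    have hy : ∀ i, w i - (Pi.single o 1 : ι → AddMonoidAlgebra R M) i ∈
        suppSub R {x : M | (x : Fin n →₀ ℕ).support = F} := by
      intro i
      refine mem_suppSub_interior (fun G hG => ?_) ?_
      · rw [map_sub, hsingle, show w i = restr R M F (u' i) from rfl, restr_restr hG.subset,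
          sub_eq_zero]
        exact congrFun (hproper G hG) i
      · rw [map_sub, hsingle, show w i = restr R M F (u' i) from rfl, restr_restr subset_rfl]
    have hSJ : suppSub R {x : M | (x : Fin n →₀ ℕ).support = F} ≤ suppSub R (Set.range J) :=
      suppSub_mono fun x hx => ⟨⟨x, Or.inr hx⟩, rfl⟩
    have hone : ∀ i, (Pi.single o 1 : ι → AddMonoidAlgebra R M) i ∈ suppSub R (Set.range J) := by
      intro i
      rw [Pi.single_apply]
      split_ifs
      · exact single_mem_suppSub (S := Set.range J) (x := 0) ⟨0, rfl⟩ (1 : R)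
      · exact zero_mem _
    let x : AddMonoidAlgebra R M := w o - 1
    have hx : x ∈ suppSub R {x : M | (x : Fin n →₀ ℕ).support = F} := by
      have := hy o
      rwa [Pi.single_eq_same] at this
    let c' : ι → AddMonoidAlgebra R M := Pi.single o 1 - x • v
    have hc'w : c' ⬝ᵥ w = 1 := by
      rw [sub_dotProduct, smul_dotProduct, hvw, single_dotProduct, one_mul, smul_eq_mul, mul_one]
      exact sub_sub_cancel _ _
    have hc'J : ∀ i, c' i ∈ suppSub R (Set.range J) := fun i => by
      refine sub_mem (hone i) (hSJ ?_)
      refine mul_mem_suppSub (T := {x : M | (x : Fin n →₀ ℕ).support ⊆ F}) ?_ hx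
        (restr_mem_suppSub F (v₀ i))
      intro a ha b hb
      change ((a + b : M) : Fin n →₀ ℕ).support = F
      have ha : (a : Fin n →₀ ℕ).support = F := ha
      have hb : (b : Fin n →₀ ℕ).support ⊆ F := hb
      refine Finset.Subset.antisymm (faceMonoid M F |>.add_mem (x := a) (y := b) ha.subset hb) ?_
      rw [← ha]
      intro i hi
      rw [Finsupp.mem_support_iff] at hi ⊢
      rw [AddSubmonoid.coe_add, Finsupp.add_apply]
      omega
    have hwJ : ∀ i, w i ∈ suppSub R (Set.range J) := fun i => by
      have := add_mem (hSJ (hy i)) (hone i)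
      rwa [sub_add_cancel] at this
    choose u₀ hu₀ using fun i => exists_expMap_eq hJ (hwJ i)
    choose w₀ hw₀ using fun i => exists_expMap_eq hJ (hc'J i)
    have hu1 : expMap R J ∘ u₀ = w := funext hu₀
    have hw1 : expMap R J ∘ w₀ = c' := funext hw₀
    have huni : UniRow u₀ := by
      refine ⟨w₀, expMap_injective (R := R) hJ ?_⟩
      rw [RingHom.map_dotProduct, map_one, hu1, hw1, hc'w]
    obtain ⟨ε, hε, hεu⟩ := rowTransitive_interiorMonoid d hR hcard hcard' hT hc hcM F u₀ huni o
    let g := GeneralLinearGroup.map (expMap R J) ε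
    have hgw : g.1 *ᵥ w = Pi.single o 1 := by
      rw [← hu1, map_mulVec_comp, hεu, comp_single_one]
    refine ⟨g.1 *ᵥ u', huu'.trans ⟨g, map_mem_elemSubgroup _ (fun _ _ => Set.mem_univ _) hε, rfl⟩,
      fun F' hF' => ?_⟩
    have hmapmap : ∀ G, G = F ∨ ¬ F ⊆ G → GeneralLinearGroup.map (restr R M G) g
        = if G = F then g else GeneralLinearGroup.map (restr R M ∅) g := by
      rintro G (rfl | hG)
      · rw [if_pos rfl]
        refine Units.ext (Matrix.ext fun i j => ?_)
        exact restr_eq_self (suppSub_mono (by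
          rintro _ ⟨x, rfl⟩
          rcases x with ⟨x, rfl | hx⟩
          · exact (Finsupp.support_zero (M := ℕ)).subset.trans (Finset.empty_subset _)
          · exact hx.subset) (expMap_mem_suppSub J _))
      · rw [if_neg (by rintro rfl; exact hG subset_rfl)]
        exact Units.ext (Matrix.ext fun i j => restr_expMap_interior hG _)
    rw [← map_mulVec_comp]
    by_cases hFF' : F' = F
    · rw [hmapmap _ (Or.inl hFF'), if_pos hFF', hFF']
      exact hgw
    · have hF'' := Finset.mem_erase.mpr ⟨hFF', hF'⟩
      have hn := hnot F' hF''
      have hempty : ∅ ⊂ F := by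
        refine Finset.ssubset_iff_subset_ne.mpr ⟨Finset.empty_subset _, ?_⟩
        rintro rfl
        exact hn (Finset.empty_subset _)
      rw [hmapmap _ (Or.inr hn), if_neg hFF', hu' F' hF'', ← hproper ∅ hempty]
      rw [show restr R M ∅ ∘ u' = restr R M ∅ ∘ w from
        funext fun i => (restr_restr (Finset.empty_subset F) (u' i)).symm, map_mulVec_comp, hgw,
        comp_single_one]
      refine (hproper ∅ hempty).symm.trans ?_
      exact funext fun i => (restr_restr (Finset.empty_subset F) (u' i)).symm

/-- Row transitivity over monoid algebras of simplicial monoids. -/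
theorem rowTransitive_of_single_mem [IsNoetherianRing R] (d : ℕ)
    (hR : ∀ q : Ideal R, q.IsPrime → q.height < d) (hcard : d + 1 ≤ Fintype.card ι)
    (hcard' : 3 ≤ Fintype.card ι) (n : ℕ) : ∀ (M : AddSubmonoid (Fin n →₀ ℕ)) (c : ℕ), 0 < c →
      (∀ i, Finsupp.single i c ∈ M) → RowTransitive ι (AddMonoidAlgebra R M) := by
  induction n using Nat.strong_induction_on with
  | _ n ih =>
    intro M c hc hcM u hu o
    obtain ⟨u', huu', hu'⟩ := exists_rowRel_restr d hR hcard hcard' ih hc hcM hu o _ Finset.univ rfl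
      (fun _ _ _ _ => Finset.mem_univ _)
    convert huu'
    rw [← hu' Finset.univ (Finset.mem_univ _)]
    exact funext fun i => restr_eq_self fun x _ => Finset.subset_univ _

end AllFaces

section RelativeRows

open Matrix

variable {ι : Type*} [Fintype ι] [DecidableEq ι]

theorem conj_elemMat_mul_mem {A : Type*} [CommRing A] (hcard : 3 ≤ Fintype.card ι) (I : Ideal A)
    {a b : A} (ha : a ∈ I) (hb : b ∈ I) (g : GL ι A) {i j : ι} (hij : i ≠ j) :
    g * elemMat hij (a * b) * g⁻¹ ∈ elemSubgroup ι (I : Set A) := by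
  have := conj_elemMat_mem (⊤ : Subring A) hcard (a := a) (b := b) trivial (T := I)
    (fun s _ => I.mul_mem_right s ha) (fun s _ => I.mul_mem_right s hb) 1 g
    (fun _ _ => trivial) (fun _ _ => trivial) hij
  rwa [one_pow, one_mul] at this

theorem inv_map_mul_map_mem {A B : Type*} [CommRing A] [CommRing B] (p₁ p₂ : B →+* A) {T : Set B}
    (H : Subgroup (GL ι A))
    (hH : ∀ (γ : GL ι A) (i j : ι) (hij : i ≠ j), ∀ y ∈ T,
      γ * elemMat hij (p₂ y - p₁ y) * γ⁻¹ ∈ H)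
    {g : GL ι B} (hg : g ∈ elemSubgroup ι T) :
    (GeneralLinearGroup.map p₁ g)⁻¹ * GeneralLinearGroup.map p₂ g ∈ H := by
  suffices h : ∀ γ : GL ι A, γ * ((GeneralLinearGroup.map p₁ g)⁻¹ * GeneralLinearGroup.map p₂ g) *
      γ⁻¹ ∈ H by
    simpa using h 1
  induction hg using Subgroup.closure_induction with
  | mem g hg =>
    obtain ⟨i, j, hij, y, hy, rfl⟩ := hg
    intro γ
    rw [map_elemMat, map_elemMat, ← elemMat_neg, ← elemMat_add, neg_add_eq_sub]
    exact hH γ i j hij y hy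
  | one => intro γ; simp
  | mul x y _ _ hx hy =>
    intro γ
    have h1 := H.mul_mem (hx (γ * (GeneralLinearGroup.map p₁ y)⁻¹)) (hy γ)
    convert h1 using 1
    rw [map_mul, map_mul]
    group
  | inv x _ hx =>
    intro γ
    have h1 := H.inv_mem (hx (γ * GeneralLinearGroup.map p₁ x))
    convert h1 using 1
    rw [map_inv, map_inv]
    group

variable {R : Type*} [CommRing R] {n : ℕ}

/-- Rows congruent to a base vector modulo a deep monomial ideal. -/
theorem exists_elemSubgroup_single [IsNoetherianRing R] (d : ℕ)
    (hR : ∀ q : Ideal R, q.IsPrime → q.height < d) (hcard : d + 1 ≤ Fintype.card ι)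
    (hcard' : 3 ≤ Fintype.card ι) {M : AddSubmonoid (Fin n →₀ ℕ)} {c : ℕ} (hc : 0 < c)
    (hcM : ∀ i, Finsupp.single i c ∈ M) (v : M) (hv : ∀ i, 0 < (v : Fin n →₀ ℕ) i)
    {u : ι → AddMonoidAlgebra R M} (huni : UniRow u) (o : ι) (z : ι → AddMonoidAlgebra R M)
    (hz : ∀ i, u i - (Pi.single o 1 : ι → AddMonoidAlgebra R M) i
      = AddMonoidAlgebra.single (v + v) 1 * z i) :
    ∃ g ∈ elemSubgroup ι (Ideal.span {AddMonoidAlgebra.single v (1 : R)} :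
      Set (AddMonoidAlgebra R M)), g.1 *ᵥ u = Pi.single o 1 := by
  rcases n with _ | n
  · have hv0 : v = 0 := Subtype.ext (Finsupp.ext fun i => i.elim0)
    have h1 : Ideal.span {AddMonoidAlgebra.single v (1 : R)} = ⊤ := by
      rw [hv0]; exact Ideal.span_singleton_one
    rw [h1]
    exact rowTransitive_of_single_mem d hR hcard hcard' 0 M c hc hcM u huni o
  let N : AddSubmonoid (Fin (n + 1) →₀ ℕ) :=
    { carrier := {x | x = 0 ∨ ∃ y ∈ M, x = (v : Fin (n + 1) →₀ ℕ) + v + y}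
      zero_mem' := Or.inl rfl
      add_mem' := by
        rintro x y (rfl | ⟨x, hx, rfl⟩) (rfl | ⟨y, hy, rfl⟩)
        · exact Or.inl (zero_add _)
        · exact Or.inr ⟨y, hy, zero_add _⟩
        · exact Or.inr ⟨x, hx, add_zero _⟩
        · exact Or.inr ⟨x + (v + v + y), add_mem hx (add_mem (add_mem v.2 v.2) hy), by abel⟩ }
  have hNM : N ≤ M := by
    rintro x (rfl | ⟨y, hy, rfl⟩)
    · exact zero_mem _
    · exact add_mem (add_mem v.2 v.2) hy
  have hNpos : ∀ x ∈ N, x ≠ 0 → ∀ i, 0 < x i := by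
    rintro x (rfl | ⟨y, hy, rfl⟩) hx i
    · exact absurd rfl hx
    · have := hv i
      rw [Finsupp.add_apply, Finsupp.add_apply]
      omega
  obtain ⟨b, hb⟩ := exists_deep_bound hc hcM
  have hNT : RowTransitive ι (AddMonoidAlgebra R N) := by
    refine rowTransitive_of_interior_succ d hR hcard hcard'
      (rowTransitive_of_single_mem d hR hcard hcard' n) hNpos
      (G := AddSubgroup.closure (castHom (n + 1) '' M))
      (fun x hx => AddSubgroup.subset_closure ⟨x, hNM hx, rfl⟩) hc ?_
      (b := b + ∑ i, ((v : Fin (n + 1) →₀ ℕ) i + (v : Fin (n + 1) →₀ ℕ) i)) ?_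
    · intro i
      refine AddSubgroup.subset_closure ⟨_, hcM i, ?_⟩
      ext j
      simp [castHom, Finsupp.single_apply, Pi.single_apply, eq_comm]
    · intro a ha hba
      have h1 : ∀ i, b + ((v : Fin (n + 1) →₀ ℕ) i + (v : Fin (n + 1) →₀ ℕ) i) ≤ a i := fun i =>
        (Nat.add_le_add_left (Finset.single_le_sum
          (f := fun i => (v : Fin (n + 1) →₀ ℕ) i + (v : Fin (n + 1) →₀ ℕ) i)
          (fun _ _ => Nat.zero_le _) (Finset.mem_univ i)) b).trans (hba i)
      have h2 : a = (v : Fin (n + 1) →₀ ℕ) + v + (a - (v + v)) := by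
        ext i
        have := h1 i
        simp only [Finsupp.add_apply, Finsupp.tsub_apply]
        omega
      refine Or.inr ⟨a - (v + v), hb _ ?_ fun i => ?_, h2⟩
      · rw [h2, map_add] at ha
        have h3 : castHom (n + 1) ((v : Fin (n + 1) →₀ ℕ) + v) ∈
            AddSubgroup.closure (castHom (n + 1) '' M) :=
          AddSubgroup.subset_closure ⟨_, add_mem v.2 v.2, rfl⟩
        exact (AddSubgroup.add_mem_cancel_left _ h3).mp ha
      · have := h1 i
        simp only [Finsupp.add_apply, Finsupp.tsub_apply]
        omega
  let J : N →+ M := AddSubmonoid.inclusion hNM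
  have hJ : Function.Injective J := AddSubmonoid.inclusion_injective hNM
  obtain ⟨w, hw⟩ := huni
  have hzJ : ∀ f : AddMonoidAlgebra R M, AddMonoidAlgebra.single (v + v) 1 * f ∈
      suppSub R {x : M | ∃ y : M, x = v + v + y} := fun f =>
    mul_mem_suppSub (S := {v + v}) (T := Set.univ) (by rintro _ rfl y _; exact ⟨y, rfl⟩)
      (single_mem_suppSub (S := {v + v}) (x := v + v) rfl 1) (fun _ _ => Set.mem_univ _)
  have hsub : suppSub R {x : M | ∃ y : M, x = v + v + y} ≤ suppSub R (Set.range J) :=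
    suppSub_mono (by
      rintro x ⟨y, rfl⟩
      exact ⟨⟨v + v + y, Or.inr ⟨y, y.2, rfl⟩⟩, rfl⟩)
  have hone : ∀ i, (Pi.single o 1 : ι → AddMonoidAlgebra R M) i ∈ suppSub R (Set.range J) := by
    intro i
    rw [Pi.single_apply]
    split_ifs
    · exact single_mem_suppSub (S := Set.range J) (x := 0) ⟨0, rfl⟩ (1 : R)
    · exact zero_mem _
  have huJ : ∀ i, u i ∈ suppSub R (Set.range J) := fun i => by
    rw [← sub_add_cancel (u i) ((Pi.single o 1 : ι → AddMonoidAlgebra R M) i), hz]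
    exact add_mem (hsub (hzJ _)) (hone i)
  let c' : ι → AddMonoidAlgebra R M := Pi.single o 1 - (AddMonoidAlgebra.single (v + v) 1 * z o) • w
  have hc'J : ∀ i, c' i ∈ suppSub R (Set.range J) := fun i =>
    sub_mem (hone i) (hsub (by
      rw [Pi.smul_apply, smul_eq_mul, mul_assoc]
      exact hzJ _))
  have hc'u : c' ⬝ᵥ u = 1 := by
    rw [sub_dotProduct, smul_dotProduct, hw, single_dotProduct, one_mul, smul_eq_mul, mul_one, ← hz,
      Pi.single_eq_same]
    exact sub_sub_cancel _ _
  choose u₀ hu₀ using fun i => exists_expMap_eq hJ (huJ i)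
  choose w₀ hw₀ using fun i => exists_expMap_eq hJ (hc'J i)
  have hu1 : expMap R J ∘ u₀ = u := funext hu₀
  have hw1 : expMap R J ∘ w₀ = c' := funext hw₀
  have huni₀ : UniRow u₀ := by
    refine ⟨w₀, expMap_injective (R := R) hJ ?_⟩
    rw [RingHom.map_dotProduct, map_one, hu1, hw1, hc'u]
  obtain ⟨ε, hε, hεu⟩ := hNT u₀ huni₀ o
  have hbot : ∀ a b : N, a + b ∈ (⊥ : AddSubmonoid N) → a ∈ (⊥ : AddSubmonoid N) := by
    intro a b hab
    rw [AddSubmonoid.mem_bot] at hab ⊢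
    ext i
    have := DFunLike.congr_fun (congrArg Subtype.val hab) i
    simp only [AddSubmonoid.coe_add, Finsupp.add_apply, AddSubmonoid.coe_zero,
      Finsupp.zero_apply] at this ⊢
    omega
  let ρ : AddMonoidAlgebra R N →+* AddMonoidAlgebra R N :=
    (expMap R (⊥ : AddSubmonoid N).subtype).comp (faceHom R ⊥ hbot)
  have hρρ : ∀ a, ρ (ρ a) = ρ a := fun a => by
    change expMap R _ (faceHom R ⊥ hbot (expMap R _ _)) = _
    rw [faceHom_expMap]; rfl
  have hv0 : ∀ y : M, v + v + y ≠ 0 := fun y h => by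
    have h1 := DFunLike.congr_fun (congrArg Subtype.val h) 0
    have h2 := hv 0
    simp only [AddSubmonoid.coe_add, Finsupp.add_apply, AddSubmonoid.coe_zero,
      Finsupp.zero_apply] at h1
    omega
  have hρ0 : ∀ f : AddMonoidAlgebra R N, expMap R J f ∈ suppSub R {x : M | ∃ y : M, x = v + v + y} →
      ρ f = 0 := by
    intro f hf
    have h : f ∈ (ρ : AddMonoidAlgebra R N →+ AddMonoidAlgebra R N).ker := by
      refine mem_of_single_mem _ fun x hx => ?_
      rw [AddMonoidHom.mem_ker]
      change expMap R _ (faceHom R ⊥ hbot _) = 0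
      rw [faceHom_single_of_notMem, map_zero]
      intro hx0
      obtain ⟨y, hy⟩ := hf (J x) (by rwa [coeff_expMap hJ])
      rw [AddSubmonoid.mem_bot] at hx0
      rw [hx0, map_zero] at hy
      exact hv0 y hy.symm
    exact h
  have hker : ∀ f : AddMonoidAlgebra R N, ρ f = 0 →
      expMap R J f ∈ suppSub R {x : M | ∃ y : M, x = v + v + y} := by
    intro f hf x hx
    obtain ⟨y, rfl⟩ := expMap_mem_suppSub J f x hx
    rw [coeff_expMap hJ] at hx
    rcases y with ⟨y, rfl | ⟨y', hy', rfl⟩⟩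
    · refine absurd ?_ hx
      have h1 : faceHom R ⊥ hbot f = 0 := expMap_injective (R := R)
        (f := (⊥ : AddSubmonoid N).subtype) Subtype.val_injective (hf.trans (map_zero _).symm)
      have h2 := coeff_faceHom ⊥ hbot f 0
      rw [h1] at h2
      exact h2.symm
    · exact ⟨⟨y', hy'⟩, rfl⟩
  have hρu : ρ ∘ u₀ = Pi.single o 1 := by
    rw [← comp_single_one ρ o]
    funext i
    change ρ (u₀ i) = ρ _
    rw [← sub_eq_zero, ← map_sub]
    refine hρ0 _ ?_
    rw [map_sub, hu₀, show expMap R J ((Pi.single o 1 : ι → AddMonoidAlgebra R N) i)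
      = (Pi.single o 1 : ι → AddMonoidAlgebra R M) i from congrFun (comp_single_one _ o) i, hz]
    exact hzJ _
  let T : Ideal (AddMonoidAlgebra R M) := Ideal.span {AddMonoidAlgebra.single v (1 : R)}
  have hη := mul_map_inv_mem ρ hρρ ((elemSubgroup ι (T : Set (AddMonoidAlgebra R M))).comap
    (GeneralLinearGroup.map (expMap R J))) (by
      intro γ _ i j hij y hy
      rw [Subgroup.mem_comap, map_mul, map_mul, map_inv, map_elemMat]
      have h1 : ∃ f, expMap R J y = AddMonoidAlgebra.single v 1 *
          (AddMonoidAlgebra.single v 1 * f) := by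
        have h2 : expMap R J y ∈ (AddMonoidHom.range
            (AddMonoidHom.mulLeft (AddMonoidAlgebra.single (v + v) (1 : R)))) := by
          refine mem_of_single_mem _ fun x hx => ?_
          obtain ⟨y', hy'⟩ := hker y hy x hx
          refine ⟨AddMonoidAlgebra.single y' ((expMap R J y).coeff x), ?_⟩
          change AddMonoidAlgebra.single (v + v) 1 * _ = _
          rw [AddMonoidAlgebra.single_mul_single, one_mul, ← hy']
        obtain ⟨f, hf⟩ := h2
        refine ⟨f, hf.symm.trans ?_⟩
        change AddMonoidAlgebra.single (v + v) 1 * _ = _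
        rw [← mul_assoc, AddMonoidAlgebra.single_mul_single, one_mul]
      obtain ⟨f, hf⟩ := h1
      rw [hf]
      exact conj_elemMat_mul_mem hcard' T (Ideal.mem_span_singleton_self _)
        (T.mul_mem_right _ (Ideal.mem_span_singleton_self _)) _ hij) (Subgroup.inv_mem _ hε)
  refine ⟨_, Subgroup.inv_mem _ (Subgroup.mem_comap.mp hη), ?_⟩
  rw [← map_inv, ← hu1, map_mulVec_comp, _root_.mul_inv_rev, inv_inv, inv_inv, mul_mulVec_GL, hεu,
    map_inv]
  rw [inv_mulVec_of_mulVec (g := GeneralLinearGroup.map ρ ε) (u := Pi.single o 1)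
    (v := Pi.single o 1),
    comp_single_one]
  nth_rw 1 [← hρu]
  rw [map_mulVec_comp, hεu, comp_single_one]

end RelativeRows

section RelativeRows

open Matrix

variable {ι : Type*} [Fintype ι] [DecidableEq ι]

/-- The double of a ring along a principal ideal. -/
def doubleAlg {R : Type*} [CommRing R] (c : R) : Subalgebra R (R × R) where
  carrier := {p | ∃ x, p.2 = p.1 + c * x}
  add_mem' := by
    rintro p q ⟨x, hx⟩ ⟨y, hy⟩
    exact ⟨x + y, by rw [Prod.snd_add, Prod.fst_add, hx, hy]; ring⟩
  mul_mem' := by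
    rintro p q ⟨x, hx⟩ ⟨y, hy⟩
    exact ⟨x * q.1 + p.1 * y + c * x * y, by rw [Prod.snd_mul, Prod.fst_mul, hx, hy]; ring⟩
  algebraMap_mem' r := ⟨0, by rw [mul_zero, add_zero]; rfl⟩

universe u

theorem exists_double {R : Type u} [CommRing R] [IsNoetherianRing R] (d : ℕ)
    (hR : ∀ q : Ideal R, q.IsPrime → q.height < d) (c : R) :
    ∃ (B : Type u) (_ : CommRing B) (q₁ q₂ : B →+* R) (δ : R →+* B) (y : B),
      IsNoetherianRing B ∧ (∀ q : Ideal B, q.IsPrime → q.height < d) ∧ q₁ y = 0 ∧ q₂ y = c ∧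
      (∀ a, q₁ (δ a) = a) ∧ (∀ a, q₂ (δ a) = a) ∧ (∀ b b', q₁ b = q₁ b' → q₂ b = q₂ b' → b = b') ∧
      ∀ b, ∃ t, q₂ b = q₁ b + c * t := by
  have hnoeth : IsNoetherian R (doubleAlg c) :=
    inferInstanceAs (IsNoetherian R (Subalgebra.toSubmodule (doubleAlg c)))
  have hfin : Module.Finite R (doubleAlg c) := inferInstance
  exact ⟨doubleAlg c, inferInstance, (RingHom.fst R R).comp (doubleAlg c).val.toRingHom,
    (RingHom.snd R R).comp (doubleAlg c).val.toRingHom, algebraMap R _,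
    ⟨(0, c), 1, by simp⟩, isNoetherian_of_tower R hnoeth,
    fun q hq => (height_le_height_comap_of_isIntegral (C := R) q).trans_lt
      (hR _ (Ideal.comap_isPrime _ q)),
    rfl, rfl, fun _ => rfl, fun _ => rfl, fun b b' h h' => Subtype.ext (Prod.ext h h'), fun b =>
      b.2⟩

variable {R : Type u} [CommRing R] {n : ℕ}

/-- Rows congruent to a base vector modulo a power of a monomial term are carried to it by
elementary matrices with entries divisible by the term. -/
theorem exists_elemSubgroup_monomial [IsNoetherianRing R] (d : ℕ)
    (hR : ∀ q : Ideal R, q.IsPrime → q.height < d) (hcard : d + 1 ≤ Fintype.card ι)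
    (hcard' : 3 ≤ Fintype.card ι) {M : AddSubmonoid (Fin n →₀ ℕ)} {c : ℕ} (hc : 0 < c)
    (hcM : ∀ i, Finsupp.single i c ∈ M) (v : M) (hv : ∀ i, 0 < (v : Fin n →₀ ℕ) i) (a : R)
    {u : ι → AddMonoidAlgebra R M} (huni : UniRow u) (o : ι)
    (hu : ∀ i, (AddMonoidAlgebra.single v a) ^ 4 ∣
      u i - (Pi.single o 1 : ι → AddMonoidAlgebra R M) i) :
    ∃ g ∈ elemSubgroup ι (Ideal.span {AddMonoidAlgebra.single v a} :
      Set (AddMonoidAlgebra R M)), g.1 *ᵥ u = Pi.single o 1 := by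
  obtain ⟨B, _, q₁, q₂, δ₀, y, _, hB, hq₁y, hq₂y, hq₁δ, hq₂δ, hqinj, hqdiff⟩ :=
      exists_double d hR (a ^ 2)
  let p₁ : AddMonoidAlgebra B M →+* AddMonoidAlgebra R M := AddMonoidAlgebra.mapRingHom M q₁
  let p₂ : AddMonoidAlgebra B M →+* AddMonoidAlgebra R M := AddMonoidAlgebra.mapRingHom M q₂
  let δ : AddMonoidAlgebra R M →+* AddMonoidAlgebra B M := AddMonoidAlgebra.mapRingHom M δ₀
  have hp₁ : ∀ x r, p₁ (AddMonoidAlgebra.single x r) = AddMonoidAlgebra.single x (q₁ r) :=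
      fun x r =>
    AddMonoidAlgebra.mapRingHom_single _ _ _
  have hp₂ : ∀ x r, p₂ (AddMonoidAlgebra.single x r) = AddMonoidAlgebra.single x (q₂ r) :=
      fun x r =>
    AddMonoidAlgebra.mapRingHom_single _ _ _
  have hδ : ∀ x r, δ (AddMonoidAlgebra.single x r) = AddMonoidAlgebra.single x (δ₀ r) :=
    fun x r => AddMonoidAlgebra.mapRingHom_single _ _ _
  have hpδ₁ : ∀ f, p₁ (δ f) = f := fun f => by
    induction f using AddMonoidAlgebra.induction_linear with
    | zero => simp
    | add f g hf hg => rw [map_add, map_add, hf, hg]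
    | single x r => rw [hδ, hp₁, hq₁δ]
  have hpδ₂ : ∀ f, p₂ (δ f) = f := fun f => by
    induction f using AddMonoidAlgebra.induction_linear with
    | zero => simp
    | add f g hf hg => rw [map_add, map_add, hf, hg]
    | single x r => rw [hδ, hp₂, hq₂δ]
  let Y : AddMonoidAlgebra B M := AddMonoidAlgebra.single 0 y
  have hY₁ : p₁ Y = 0 := by
    rw [hp₁, hq₁y, AddMonoidAlgebra.single_zero]
  have hY₂ : p₂ Y = AddMonoidAlgebra.single 0 (a ^ 2) := by rw [hp₂, hq₂y]
  have hinj : ∀ f g, p₁ f = p₁ g → p₂ f = p₂ g → f = g := by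
    intro f g h1 h2
    refine AddMonoidAlgebra.ext (Finsupp.ext fun x => hqinj _ _ ?_ ?_)
    · have := congrArg (fun t => t.coeff x) h1
      simpa [p₁] using this
    · have := congrArg (fun t => t.coeff x) h2
      simpa [p₂] using this
  have hdiff : ∀ f, ∃ g, p₂ f - p₁ f = AddMonoidAlgebra.single 0 (a ^ 2) * g := fun f => by
    induction f using AddMonoidAlgebra.induction_linear with
    | zero => exact ⟨0, by simp⟩
    | add f g hf hg =>
      obtain ⟨f', hf⟩ := hf
      obtain ⟨g', hg⟩ := hg
      exact ⟨f' + g', by rw [map_add, map_add, add_sub_add_comm, hf, hg, mul_add]⟩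
    | single x r =>
      obtain ⟨t, ht⟩ := hqdiff r
      refine ⟨AddMonoidAlgebra.single x t, ?_⟩
      rw [hp₁, hp₂, AddMonoidAlgebra.single_mul_single, zero_add, ← AddMonoidAlgebra.single_sub]
      rw [ht, add_sub_cancel_left]
  choose z hz using hu
  have hsq : ∀ b : R, AddMonoidAlgebra.single v b ^ 2 = AddMonoidAlgebra.single (v + v) (b ^ 2) :=
      fun b => by
    rw [sq, AddMonoidAlgebra.single_mul_single, sq]
  have hss : (AddMonoidAlgebra.single v a) ^ 4 = AddMonoidAlgebra.single 0 (a ^ 2) *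
      AddMonoidAlgebra.single 0 (a ^ 2) * AddMonoidAlgebra.single (v + v + (v + v)) (1 : R) := by
    rw [show (AddMonoidAlgebra.single v a) ^ 4 = (AddMonoidAlgebra.single v a ^ 2) ^ 2
      by ring, hsq, sq,
      AddMonoidAlgebra.single_mul_single, AddMonoidAlgebra.single_mul_single,
      AddMonoidAlgebra.single_mul_single, mul_one, zero_add, zero_add]
  let u' : ι → AddMonoidAlgebra B M := fun i =>
    (Pi.single o 1 : ι → AddMonoidAlgebra B M) i
      + AddMonoidAlgebra.single (v + v + (v + v)) 1 *
        (Y * δ (AddMonoidAlgebra.single 0 (a ^ 2) * z i))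
  have hone : ∀ (x : M), p₁ (AddMonoidAlgebra.single x 1) = AddMonoidAlgebra.single x 1 :=
      fun x => by
    rw [hp₁, map_one]
  have hone' : ∀ (x : M), p₂ (AddMonoidAlgebra.single x 1) = AddMonoidAlgebra.single x 1 :=
      fun x => by
    rw [hp₂, map_one]
  have hu₁ : p₁ ∘ u' = Pi.single o 1 := by
    rw [← comp_single_one p₁ o]
    funext i
    simp only [u', Function.comp_apply, map_add, map_mul, hY₁, zero_mul, mul_zero, add_zero]
  have hu₂ : p₂ ∘ u' = u := by
    funext i
    simp only [u', Function.comp_apply, map_add, map_mul, hY₂, hpδ₂, hone']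
    rw [show p₂ ((Pi.single o 1 : ι → AddMonoidAlgebra B M) i)
      = (Pi.single o 1 : ι → AddMonoidAlgebra R M) i from congrFun (comp_single_one p₂ o) i,
      ← add_sub_cancel ((Pi.single o 1 : ι → AddMonoidAlgebra R M) i) (u i), hz, hss]
    ring
  obtain ⟨w, hw⟩ := huni
  let x : AddMonoidAlgebra B M := AddMonoidAlgebra.single (v + v + (v + v)) 1 *
    (Y * δ (AddMonoidAlgebra.single 0 (a ^ 2) * z o))
  have hx₁ : p₁ x = 0 := by simp only [x, map_mul, hY₁, zero_mul, mul_zero]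
  have hx₂ : p₂ x = u o - 1 := by
    have h1 := hz o
    rw [Pi.single_eq_same] at h1
    simp only [x, map_mul, hY₂, hpδ₂, hone']
    rw [h1, hss]
    ring
  have huni' : UniRow u' := by
    refine ⟨Pi.single o 1 - x • (δ ∘ w), hinj _ _ ?_ ?_⟩
    · rw [sub_dotProduct, smul_dotProduct, map_sub, smul_eq_mul, map_mul, hx₁, zero_mul, sub_zero,
        RingHom.map_dotProduct, hu₁, comp_single_one, map_one, single_dotProduct, one_mul,
          Pi.single_eq_same]
    · rw [sub_dotProduct, smul_dotProduct, map_sub, smul_eq_mul, map_mul, hx₂,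
        RingHom.map_dotProduct, RingHom.map_dotProduct, hu₂, comp_single_one, map_one,
        show p₂ ∘ δ ∘ w = w from funext fun i => hpδ₂ (w i), hw, single_dotProduct, one_mul,
          mul_one]
      exact sub_sub_cancel _ _
  obtain ⟨g, hg, hgu⟩ := exists_elemSubgroup_single d hB hcard hcard' hc hcM (v + v)
    (fun i => Nat.add_pos_left (hv i) _) huni' o
    (fun i => Y * δ (AddMonoidAlgebra.single 0 (a ^ 2) * z i))
      (fun i => by simp only [u', add_sub_cancel_left])
  let T : Ideal (AddMonoidAlgebra R M) := Ideal.span {AddMonoidAlgebra.single v a}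
  refine ⟨(GeneralLinearGroup.map p₁ g)⁻¹ * GeneralLinearGroup.map p₂ g,
    inv_map_mul_map_mem p₁ p₂ (elemSubgroup ι (T : Set (AddMonoidAlgebra R M))) ?_ hg, ?_⟩
  · intro γ i j hij y hy
    obtain ⟨f, rfl⟩ := Ideal.mem_span_singleton'.mp hy
    obtain ⟨f', hf'⟩ := hdiff f
    have h1 : p₂ (f * AddMonoidAlgebra.single (v + v) 1) - p₁
        (f * AddMonoidAlgebra.single (v + v) 1)
        = AddMonoidAlgebra.single v a * (AddMonoidAlgebra.single v a * f') := by
      rw [map_mul, map_mul, hone, hone', ← sub_mul, hf', mul_right_comm, ← mul_assoc, ← sq, hsq,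
        AddMonoidAlgebra.single_mul_single, zero_add, mul_one]
    rw [h1]
    exact conj_elemMat_mul_mem hcard' T (Ideal.mem_span_singleton_self _)
      (T.mul_mem_right _ (Ideal.mem_span_singleton_self _)) _ hij
  · rw [mul_mulVec_GL]
    refine inv_mulVec_of_mulVec ?_
    rw [← hu₂, map_mulVec_comp, hgu, comp_single_one]
    nth_rw 1 [← hu₁]
    rw [map_mulVec_comp, hgu, comp_single_one]

end RelativeRows

section ProjectiveRows

open Matrix

variable {ν : Type*} [Fintype ν] [DecidableEq ν] {A B : Type*} [CommRing A] [CommRing B]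

/-- Extension of a vector by zero at the extra index. -/
def extVec (q : ν → A) : Option ν → A := fun i => i.elim 0 q

theorem extVec_dot_single (q : ν → A) : extVec q ⬝ᵥ (Pi.single none 1 : Option ν → A) = 0 := by
  simp [extVec]

theorem single_dot_extVec (q : ν → A) : (Pi.single none 1 : Option ν → A) ⬝ᵥ extVec q = 0 := by
  simp [extVec]

theorem extVec_zero : extVec (0 : ν → A) = 0 := by
  funext i
  cases i <;> rfl

theorem comp_extVec (f : A →+* B) (q : ν → A) : f ∘ extVec q = extVec (f ∘ q) := by
  funext i
  cases i
  · exact map_zero f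
  · rfl

/-- The transvection adding multiples of the last coordinate to the others. -/
def colTrans (q : ν → A) : GL (Option ν) A := rankOne (extVec q) (Pi.single none 1)
    (single_dot_extVec q)

/-- The transvection adding a combination of the other coordinates to the last one. -/
def rowTrans (φ : ν → A) : GL (Option ν) A := rankOne (Pi.single none 1) (extVec φ)
    (extVec_dot_single φ)

theorem map_colTrans (f : A →+* B) (q : ν → A) :
    GeneralLinearGroup.map f (colTrans q) = colTrans (f ∘ q) := by
  unfold colTrans
  rw [map_rankOne f _ _ _ (by rw [comp_single_one, comp_extVec]; exact single_dot_extVec _)]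
  simp only [comp_single_one, comp_extVec]

theorem map_rowTrans (f : A →+* B) (q : ν → A) :
    GeneralLinearGroup.map f (rowTrans q) = rowTrans (f ∘ q) := by
  unfold rowTrans
  rw [map_rankOne f _ _ _ (by rw [comp_single_one, comp_extVec]; exact extVec_dot_single _)]
  simp only [comp_single_one, comp_extVec]

theorem colTrans_zero : colTrans (0 : ν → A) = 1 := by
  apply Units.ext
  simp [colTrans, rankOne, extVec_zero]

theorem rowTrans_zero : rowTrans (0 : ν → A) = 1 := by
  apply Units.ext
  simp [rowTrans, rankOne, extVec_zero]

theorem colTrans_mulVec (q : ν → A) (u : Option ν → A) :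
    (colTrans q).1 *ᵥ u = u + u none • extVec q := by
  simp only [colTrans, rankOne, add_mulVec, one_mulVec, vecMulVec_mulVec, single_dotProduct,
    one_mul]
  simp

theorem rowTrans_mulVec (φ : ν → A) (u : Option ν → A) :
    (rowTrans φ).1 *ᵥ u = u + (φ ⬝ᵥ (u ∘ some)) • Pi.single none 1 := by
  simp only [rowTrans, rankOne, add_mulVec, one_mulVec, vecMulVec_mulVec, op_smul_eq_smul]
  simp [dotProduct, Fintype.sum_option, extVec]

/-- The transvections of the projective module `im E ⊕ A` with coordinates in `T`. -/
def transSet (E : Matrix ν ν A) (T : Set A) : Set (GL (Option ν) A) :=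
  {g | (∃ q : ν → A, E *ᵥ q = q ∧ (∀ i, q i ∈ T) ∧ g = colTrans q) ∨
    ∃ φ : ν → A, φ ᵥ* E = φ ∧ (∀ i, φ i ∈ T) ∧ g = rowTrans φ}

/-- The elementary group of the projective module `im E ⊕ A`. -/
def projElem (E : Matrix ν ν A) : Subgroup (GL (Option ν) A) :=
    Subgroup.closure (transSet E Set.univ)

/-- The relative elementary group of the projective module `im E ⊕ A`. -/
def projElemRel (E : Matrix ν ν A) (T : Set A) : Subgroup (GL (Option ν) A) :=
  Subgroup.closure {g | ∃ h ∈ projElem E, ∃ t ∈ transSet E T, g = h * t * h⁻¹}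

theorem transSet_mono (E : Matrix ν ν A) {S T : Set A} (h : S ⊆ T) : transSet E S ⊆ transSet E
    T := by
  rintro g (⟨q, h1, h2, h3⟩ | ⟨q, h1, h2, h3⟩)
  · exact Or.inl ⟨q, h1, fun i => h (h2 i), h3⟩
  · exact Or.inr ⟨q, h1, fun i => h (h2 i), h3⟩

theorem projElemRel_mono (E : Matrix ν ν A) {S T : Set A} (h : S ⊆ T) :
    projElemRel E S ≤ projElemRel E T :=
  Subgroup.closure_mono (by
    rintro g ⟨x, hx, t, ht, rfl⟩
    exact ⟨x, hx, t, transSet_mono E h ht, rfl⟩)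

theorem projElemRel_le (E : Matrix ν ν A) (T : Set A) : projElemRel E T ≤ projElem E := by
  rw [projElemRel, Subgroup.closure_le]
  rintro g ⟨x, hx, t, ht, rfl⟩
  exact mul_mem (mul_mem hx (Subgroup.subset_closure (transSet_mono E (Set.subset_univ T) ht)))
    (inv_mem hx)

theorem mem_projElemRel {E : Matrix ν ν A} {T : Set A} {t : GL (Option ν) A}
    (ht : t ∈ transSet E T) :
    t ∈ projElemRel E T :=
  Subgroup.subset_closure ⟨1, one_mem _, t, ht, by simp⟩

theorem conj_mem_projElemRel {E : Matrix ν ν A} {T : Set A} {h t : GL (Option ν) A}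
    (hh : h ∈ projElem E)
    (ht : t ∈ projElemRel E T) : h * t * h⁻¹ ∈ projElemRel E T := by
  have : projElemRel E T ≤ (projElemRel E T).comap (MulAut.conj h).toMonoidHom := by
    conv_lhs => rw [projElemRel]
    rw [Subgroup.closure_le]
    rintro g ⟨x, hx, t, ht, rfl⟩
    exact Subgroup.subset_closure ⟨h * x, mul_mem hh hx, t, ht, by
      simp only [MulEquiv.coe_toMonoidHom, MulAut.conj_apply]; group⟩
  exact this ht

theorem colTrans_mem {E : Matrix ν ν A} {T : Set A} {q : ν → A} (hq : E *ᵥ q = q)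
    (hT : ∀ i, q i ∈ T) :
    colTrans q ∈ projElemRel E T :=
  mem_projElemRel (Or.inl ⟨q, hq, hT, rfl⟩)

theorem rowTrans_mem {E : Matrix ν ν A} {T : Set A} {q : ν → A} (hq : q ᵥ* E = q)
    (hT : ∀ i, q i ∈ T) :
    rowTrans q ∈ projElemRel E T :=
  mem_projElemRel (Or.inr ⟨q, hq, hT, rfl⟩)

theorem map_mem_transSet (f : A →+* B) {E : Matrix ν ν A} {S : Set A} {T : Set B}
    (h : ∀ s ∈ S, f s ∈ T) {g : GL (Option ν) A} (hg : g ∈ transSet E S) :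
    GeneralLinearGroup.map f g ∈ transSet (E.map f) T := by
  rcases hg with ⟨q, h1, h2, rfl⟩ | ⟨q, h1, h2, rfl⟩
  · refine Or.inl ⟨f ∘ q, ?_, fun i => h _ (h2 i), map_colTrans f q⟩
    nth_rw 2 [← h1]
    funext i
    exact (RingHom.map_mulVec f E q i).symm
  · refine Or.inr ⟨f ∘ q, ?_, fun i => h _ (h2 i), map_rowTrans f q⟩
    nth_rw 2 [← h1]
    funext i
    exact (RingHom.map_vecMul f E q i).symm

theorem map_mem_projElem (f : A →+* B) {E : Matrix ν ν A} {g : GL (Option ν) A}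
    (hg : g ∈ projElem E) :
    GeneralLinearGroup.map f g ∈ projElem (E.map f) := by
  have : projElem E ≤ (projElem (E.map f)).comap (GeneralLinearGroup.map f) := by
    rw [projElem, Subgroup.closure_le]
    exact fun g hg => Subgroup.subset_closure (map_mem_transSet f (fun _ _ => Set.mem_univ _) hg)
  exact this hg

theorem map_mem_projElemRel (f : A →+* B) {E : Matrix ν ν A} {S : Set A} {T : Set B}
    (h : ∀ s ∈ S, f s ∈ T) {g : GL (Option ν) A} (hg : g ∈ projElemRel E S) :
    GeneralLinearGroup.map f g ∈ projElemRel (E.map f) T := by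
  have : projElemRel E S ≤ (projElemRel (E.map f) T).comap (GeneralLinearGroup.map f) := by
    rw [projElemRel, Subgroup.closure_le]
    rintro g ⟨x, hx, t, ht, rfl⟩
    exact Subgroup.subset_closure ⟨_, map_mem_projElem f hx, _, map_mem_transSet f h ht, by
      rw [map_mul, map_mul, map_inv]⟩
  exact this hg

theorem exists_lift_transSet (f : A →+* B) {E : Matrix ν ν A} (hE : E * E = E) (S : Ideal A)
    {T : Set B}
    (h : ∀ t ∈ T, ∃ s ∈ S, f s = t) {g : GL (Option ν) B} (hg : g ∈ transSet (E.map f) T) :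
    ∃ g' ∈ transSet E S, GeneralLinearGroup.map f g' = g := by
  rcases hg with ⟨q, h1, h2, rfl⟩ | ⟨q, h1, h2, rfl⟩
  · choose p hpS hp using fun i => h _ (h2 i)
    have hq : f ∘ p = q := funext hp
    refine ⟨colTrans (E *ᵥ p), Or.inl ⟨_, by rw [mulVec_mulVec, hE], fun i => ?_, rfl⟩, ?_⟩
    · exact S.sum_mem fun j _ => S.mul_mem_left _ (hpS j)
    · rw [map_colTrans]
      congr 1
      rw [← h1, ← hq]
      funext i
      exact RingHom.map_mulVec f E p i
  · choose p hpS hp using fun i => h _ (h2 i)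
    have hq : f ∘ p = q := funext hp
    refine ⟨rowTrans (p ᵥ* E), Or.inr ⟨_, by rw [vecMul_vecMul, hE], fun i => ?_, rfl⟩, ?_⟩
    · exact S.sum_mem fun j _ => S.mul_mem_right _ (hpS j)
    · rw [map_rowTrans]
      congr 1
      rw [← h1, ← hq]
      funext i
      exact RingHom.map_vecMul f E p i

theorem exists_lift_projElem (f : A →+* B) (hf : Function.Surjective f) {E : Matrix ν ν A}
    (hE : E * E = E)
    {g : GL (Option ν) B} (hg : g ∈ projElem (E.map f)) :
    ∃ g' ∈ projElem E, GeneralLinearGroup.map f g' = g := by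
  have : projElem (E.map f) ≤ (projElem E).map (GeneralLinearGroup.map f) := by
    conv_lhs => rw [projElem]
    rw [Subgroup.closure_le]
    intro g hg
    obtain ⟨g', hg', h⟩ := exists_lift_transSet f hE ⊤ (fun t _ => by
      obtain ⟨s, hs⟩ := hf t
      exact ⟨s, Submodule.mem_top, hs⟩) hg
    exact ⟨g', Subgroup.subset_closure (transSet_mono E (Set.subset_univ _) hg'), h⟩
  exact this hg

theorem exists_lift_projElemRel (f : A →+* B) (hf : Function.Surjective f) {E : Matrix ν ν A}
    (hE : E * E = E) (S : Ideal A) {T : Set B}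
    (h : ∀ t ∈ T, ∃ s ∈ S, f s = t) {g : GL (Option ν) B} (hg : g ∈ projElemRel (E.map f) T) :
    ∃ g' ∈ projElemRel E S, GeneralLinearGroup.map f g' = g := by
  have : projElemRel (E.map f) T ≤ (projElemRel E S).map (GeneralLinearGroup.map f) := by
    conv_lhs => rw [projElemRel]
    rw [Subgroup.closure_le]
    rintro g ⟨x, hx, t, ht, rfl⟩
    obtain ⟨x', hx', rfl⟩ := exists_lift_projElem f hf hE hx
    obtain ⟨t', ht', rfl⟩ := exists_lift_transSet f hE S h ht
    exact ⟨x' * t' * x'⁻¹, Subgroup.subset_closure ⟨x', hx', t', ht', rfl⟩, by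
      rw [map_mul, map_mul, map_inv]⟩
  exact this hg

theorem projElemRel_sub_mem {E : Matrix ν ν A} (T : Ideal A) {g : GL (Option ν) A}
    (hg : g ∈ projElemRel E T) (u : Option ν → A) (i : Option ν) : (g.1 *ᵥ u) i - u i ∈ T := by
  have h0 : ∀ t ∈ transSet (E.map (Ideal.Quotient.mk T)) ({0} : Set (A ⧸ T)), t = 1 := by
    rintro t (⟨q, h1, h2, rfl⟩ | ⟨q, h1, h2, rfl⟩)
    · rw [show q = 0 from funext h2, colTrans_zero]
    · rw [show q = 0 from funext h2, rowTrans_zero]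
  have h1 : projElemRel (E.map (Ideal.Quotient.mk T)) ({0} : Set (A ⧸ T)) ≤ ⊥ := by
    rw [projElemRel, Subgroup.closure_le]
    rintro g ⟨x, hx, t, ht, rfl⟩
    rw [h0 t ht, mul_one, mul_inv_cancel]
    exact one_mem _
  have h2 := h1 (map_mem_projElemRel (Ideal.Quotient.mk T) (T := {0})
    (fun s hs => Ideal.Quotient.eq_zero_iff_mem.mpr hs) hg)
  rw [Subgroup.mem_bot] at h2
  have h3 := congrFun (map_mulVec_comp (Ideal.Quotient.mk T) g u) i
  rw [h2, Units.val_one, one_mulVec] at h3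
  rw [← Ideal.Quotient.eq]
  exact h3.symm

/-- Membership in the projective module `im E ⊕ A`. -/
def ProjVec (E : Matrix ν ν A) (u : Option ν → A) : Prop := E *ᵥ (u ∘ some) = u ∘ some

theorem ProjVec.map (f : A →+* B) {E : Matrix ν ν A} {u : Option ν → A} (h : ProjVec E u) :
    ProjVec (E.map f) (f ∘ u) := by
  funext i
  exact (RingHom.map_mulVec f E (u ∘ some) i).symm.trans (congrArg f (congrFun h i))

theorem ProjVec.mulVec {E : Matrix ν ν A} {g : GL (Option ν) A} (hg : g ∈ projElem E)
    {u : Option ν → A} (hu : ProjVec E u) : ProjVec E (g.1 *ᵥ u) := by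
  let D : Matrix (Option ν) (Option ν) A := Matrix.of fun i j =>
    i.elim (j.elim 1 fun _ => 0) fun i' => j.elim 0 fun j' => E i' j'
  have hD : ∀ w : Option ν → A, (D *ᵥ w) none = w none ∧ (D *ᵥ w) ∘ some = E *ᵥ (w ∘ some) :=
      fun w =>
    ⟨by simp [D, Matrix.mulVec, dotProduct, Fintype.sum_option],
     by funext i; simp [D, Matrix.mulVec, dotProduct, Fintype.sum_option]⟩
  have hDP : ∀ w, ProjVec E w ↔ D *ᵥ w = w := fun w => by
    constructor
    · intro h
      funext i
      cases i with
      | none => exact (hD w).1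
      | some i => exact (congrFun (hD w).2 i).trans (congrFun h i)
    · intro h
      rw [ProjVec, ← (hD w).2, h]
  have hD1 : D *ᵥ Pi.single none 1 = Pi.single none 1 := by
    funext i
    cases i <;> simp [D]
  have hD2 : (Pi.single none 1 : Option ν → A) ᵥ* D = Pi.single none 1 := by
    funext i
    cases i <;> simp [D]
  have hD3 : ∀ q : ν → A, E *ᵥ q = q → D *ᵥ extVec q = extVec q := fun q hq => (hDP _).mp hq
  have hD4 : ∀ q : ν → A, q ᵥ* E = q → extVec q ᵥ* D = extVec q := fun q hq => by
    funext i
    cases i with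
    | none => simp [D, extVec, Matrix.vecMul, dotProduct, Fintype.sum_option]
    | some i =>
      refine Eq.trans ?_ (congrFun hq i)
      simp [D, extVec, Matrix.vecMul, dotProduct, Fintype.sum_option]
  have key : ∀ g ∈ projElem E, D * g.1 = g.1 * D := by
    intro g hg
    induction hg using Subgroup.closure_induction with
    | mem t ht =>
      rcases ht with ⟨q, h1, -, rfl⟩ | ⟨q, h1, -, rfl⟩
      · simp only [colTrans, rankOne, mul_add, add_mul, mul_one, one_mul, mul_vecMulVec,
          vecMulVec_mul,
          hD3 q h1, hD2]
      · simp only [rowTrans, rankOne, mul_add, add_mul, mul_one, one_mul, mul_vecMulVec,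
          vecMulVec_mul,
          hD4 q h1, hD1]
    | one => simp
    | mul x y _ _ hx hy => rw [Units.val_mul, ← mul_assoc, hx, mul_assoc, hy, mul_assoc]
    | inv x _ hx =>
      calc D * (x⁻¹).1 = (x⁻¹).1 * (x.1 * D) * (x⁻¹).1 := by
            rw [← mul_assoc, Units.inv_mul, one_mul]
        _ = (x⁻¹).1 * D := by
            rw [← hx, mul_assoc, mul_assoc, Units.mul_inv, mul_one]
  rw [hDP] at hu ⊢
  rw [mulVec_mulVec, key g hg, ← mulVec_mulVec, hu]

end ProjectiveRows

section NilpotentLifting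

open Matrix

universe u

variable {ν : Type*} [Fintype ν] [DecidableEq ν] {A B : Type u} [CommRing A] [CommRing B]

theorem colTrans_neg (q : ν → A) : (colTrans q)⁻¹ = colTrans (-q) := by
  apply Units.ext
  have : extVec (-q) = -extVec q := by
    funext i
    cases i
    · exact neg_zero.symm
    · rfl
  change 1 - vecMulVec (extVec q) _ = 1 + vecMulVec (extVec (-q)) _
  rw [this, neg_vecMulVec, sub_eq_add_neg]

theorem colTrans_none (q : ν → A) (u : Option ν → A) : ((colTrans q).1 *ᵥ u) none = u none := by
  rw [colTrans_mulVec]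
  simp [extVec]

theorem colTrans_some (q : ν → A) (u : Option ν → A) (i : ν) :
    ((colTrans q).1 *ᵥ u) (some i) = u (some i) + u none * q i := by
  rw [colTrans_mulVec]
  simp [extVec]

theorem rowTrans_none (q : ν → A) (u : Option ν → A) :
    ((rowTrans q).1 *ᵥ u) none = u none + q ⬝ᵥ (u ∘ some) := by
  rw [rowTrans_mulVec]
  simp

theorem rowTrans_some (q : ν → A) (u : Option ν → A) (i : ν) :
    ((rowTrans q).1 *ᵥ u) (some i) = u (some i) := by
  rw [rowTrans_mulVec]
  simp

theorem exists_projElemRel_sq {E : Matrix ν ν A} (hE : E * E = E) (T : Ideal A) {y : A} (hy : y ∈ T)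
    (a : ν × ν → A) (s : Finset (ν × ν)) : ∀ u : Option ν → A, ProjVec E u →
    (∀ i, u i - (Pi.single none 1 : Option ν → A) i ∈ T) →
    u none - 1 - y * ∑ x ∈ s, a x * E x.1 x.2 ∈ T ^ 2 →
    ∃ g ∈ projElemRel E (T : Set A), ∀ i, (g.1 *ᵥ u) i - (Pi.single none 1 : Option ν → A) i ∈
    T ^ 2 := by
  classical
  induction s using Finset.induction_on with
  | empty =>
    intro u hP hu h1
    rw [Finset.sum_empty, mul_zero, sub_zero] at h1
    have hp : ∀ i : ν, u (some i) ∈ T := fun i => by simpa using hu (some i)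
    refine ⟨colTrans (-(u ∘ some)), colTrans_mem (by rw [mulVec_neg, hP])
      (fun i => T.neg_mem (hp i)), ?_⟩
    rintro (_ | i)
    · rw [colTrans_none, Pi.single_eq_same]
      exact h1
    · rw [colTrans_some, Pi.single_eq_of_ne (by simp), sub_zero,
        show u (some i) + u none * (-(u ∘ some)) i = -((u none - 1) * u (some i)) by
          simp only [Pi.neg_apply, Function.comp_apply]; ring]
      exact neg_mem (Ideal.mul_mem_right _ _ h1)
  | insert x s hx ih =>
    intro u hP hu h1
    rw [Finset.sum_insert hx] at h1
    let q : ν → A := fun i => E i x.2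
    let φ : ν → A := fun j => -(y * a x) * E x.1 j
    have hq : E *ᵥ q = q := by
      funext i
      exact congrFun (congrFun hE i) x.2
    have hφ : φ ᵥ* E = φ := by
      have : φ = (-(y * a x)) • E x.1 := rfl
      rw [this, smul_vecMul]
      congr 1
      funext j
      exact congrFun (congrFun hE x.1) j
    have hφq : φ ⬝ᵥ q = -(y * a x) * E x.1 x.2 := by
      have : φ = (-(y * a x)) • E x.1 := rfl
      rw [this, smul_dotProduct, smul_eq_mul]
      congr 1
      exact congrFun (congrFun hE x.1) x.2
    have hφT : ∀ i, φ i ∈ T := fun i => T.mul_mem_right _ (T.neg_mem (T.mul_mem_right _ hy))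
    let g := (colTrans q)⁻¹ * rowTrans φ * (colTrans q)⁻¹⁻¹
    have hcol : colTrans q ∈ projElem E := projElemRel_le E Set.univ (colTrans_mem hq fun _ =>
        Set.mem_univ _)
    have hg : g ∈ projElemRel E (T : Set A) := conj_mem_projElemRel (inv_mem hcol)
        (rowTrans_mem hφ hφT)
    have hgn : (g.1 *ᵥ u) none = u none + φ ⬝ᵥ (u ∘ some) + u none * (-(y * a x) * E x.1 x.2) := by
      simp only [g]
      rw [inv_inv, mul_mulVec_GL, mul_mulVec_GL, colTrans_neg, colTrans_none, rowTrans_none,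
        colTrans_none, ← hφq,
        show ((colTrans q).1 *ᵥ u) ∘ some = u ∘ some + u none • q from funext fun i =>
          colTrans_some q u i,
        dotProduct_add, dotProduct_smul, smul_eq_mul, add_assoc]
    obtain ⟨g', hg', h'⟩ := ih (g.1 *ᵥ u) (hP.mulVec (projElemRel_le _ _ hg)) (fun i => by
      have := T.add_mem (projElemRel_sub_mem T hg u i) (hu i)
      rwa [sub_add_sub_cancel] at this) (by
      have e : (g.1 *ᵥ u) none - 1 - y * ∑ x ∈ s, a x * E x.1 x.2
          = (u none - 1 - y * (a x * E x.1 x.2 + ∑ x ∈ s, a x * E x.1 x.2))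
            + φ ⬝ᵥ (u ∘ some) - (u none - 1) * (y * a x * E x.1 x.2) := by
        rw [hgn]; ring
      rw [e, sq]
      rw [sq] at h1
      refine sub_mem (add_mem h1 (Submodule.sum_mem _ fun i _ => Ideal.mul_mem_mul (hφT i) ?_))
        (Ideal.mul_mem_mul ?_ (T.mul_mem_right _ (T.mul_mem_right _ hy)))
      · simpa using hu (some i)
      · simpa using hu none)
    refine ⟨g' * g, mul_mem hg' hg, ?_⟩
    rw [mul_mulVec_GL]
    exact h'

/-- Unimodular elements congruent to the base vector modulo `T` become congruent to it modulo any
power of `T`. -/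
theorem exists_projElemRel_pow {E : Matrix ν ν A} (hE : E * E = E) (a : ν × ν → A)
    (ha : ∑ x, a x * E x.1 x.2 = 1) (T : Ideal A) (K : ℕ) {u : Option ν → A} (hP : ProjVec E u)
    (hu : ∀ i, u i - (Pi.single none 1 : Option ν → A) i ∈ T) :
    ∃ g ∈ projElemRel E (T : Set A),
      ∀ i, (g.1 *ᵥ u) i - (Pi.single none 1 : Option ν → A) i ∈ T ^ (K + 1) := by
  induction K with
  | zero => exact ⟨1, one_mem _, by simpa using hu⟩
  | succ K ih =>
    obtain ⟨g, hg, h⟩ := ih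
    have h1 := h none
    rw [Pi.single_eq_same] at h1
    obtain ⟨g', hg', h'⟩ := exists_projElemRel_sq hE (T ^ (K + 1)) h1 a Finset.univ (g.1 *ᵥ u)
      (hP.mulVec (projElemRel_le _ _ hg)) h (by rw [ha, mul_one, sub_self]; exact zero_mem _)
    refine ⟨g' * g, mul_mem (projElemRel_mono E (Ideal.pow_le_self (Nat.succ_ne_zero K)) hg') hg,
      fun i => ?_⟩
    rw [mul_mulVec_GL]
    have := h' i
    rw [← pow_mul] at this
    exact Ideal.pow_le_pow_right (by omega) this

/-- An idempotent matrix has rank `k` at every point. -/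
def HasRank (E : Matrix ν ν A) (k : ℕ) : Prop :=
  ∀ (F : Type u) [Field F] (h : A →+* F), (E.map h).rank = k

theorem HasRank.map (f : A →+* B) {E : Matrix ν ν A} {k : ℕ} (h : HasRank E k) :
    HasRank (E.map f) k := by
  intro F _ g
  have := h F (g.comp f)
  rwa [RingHom.coe_comp, ← Matrix.map_map] at this

theorem HasRank.exists_sum_eq_one {E : Matrix ν ν A} {k : ℕ} (h : HasRank E k) (hk : 0 < k) :
    ∃ a : ν × ν → A, ∑ x, a x * E x.1 x.2 = 1 := by
  by_contra hne
  have htop : Ideal.span (Set.range fun x : ν × ν => E x.1 x.2) ≠ ⊤ := by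
    intro htop
    rw [Ideal.eq_top_iff_one, Ideal.mem_span_range_iff_exists_fun] at htop
    exact hne htop
  obtain ⟨m, hm, hle⟩ := Ideal.exists_le_maximal _ htop
  let := Ideal.Quotient.field m
  have h0 := h (A ⧸ m) (Ideal.Quotient.mk m)
  have : E.map (Ideal.Quotient.mk m) = 0 := by
    ext i j
    exact Ideal.Quotient.eq_zero_iff_mem.mpr (hle (Ideal.subset_span ⟨(i, j), rfl⟩))
  rw [this, Matrix.rank_zero] at h0
  omega

end NilpotentLifting

section Realization

open Matrix

variable {ν κ : Type*} [Fintype ν] [DecidableEq ν] [Fintype κ] [DecidableEq κ] {A : Type*}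
  [CommRing A]

theorem rowTrans_neg (q : ν → A) : (rowTrans q)⁻¹ = rowTrans (-q) := by
  apply Units.ext
  have : extVec (-q) = -extVec q := by
    funext i
    cases i
    · exact neg_zero.symm
    · rfl
  change 1 - vecMulVec _ (extVec q) = 1 + vecMulVec _ (extVec (-q))
  rw [this, vecMulVec_neg, sub_eq_add_neg]

theorem elemMat_mulVec {i j : ν} (h : i ≠ j) (a : A) (u : ν → A) :
    (elemMat h a).1 *ᵥ u = u + Pi.single i (a * u j) := by
  simp only [elemMat, rankOne, add_mulVec, one_mulVec, vecMulVec_mulVec, single_dotProduct, one_mul,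
    op_smul_eq_smul]
  congr 1
  funext x
  simp [Pi.single_apply, mul_comm]

/-- The image of a row under a matrix on its first coordinates. -/
def extMul (X : Matrix ν κ A) (c : Option κ → A) : Option ν → A := fun i =>
    i.elim (c none) (X *ᵥ (c ∘ some))

theorem extMul_single (X : Matrix ν κ A) : extMul X (Pi.single none 1) = Pi.single none 1 := by
  have h : (Pi.single none 1 : Option κ → A) ∘ some = 0 := by
    funext i
    simp
  funext i
  cases i with
  | none => simp [extMul]
  | some i => simp [extMul, h]

theorem exists_projElemRel_comp {E : Matrix ν ν A} {X : Matrix ν κ A} {Y : Matrix κ ν A} {s : A}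
    (hEX : E * X = X) (hYE : Y * E = Y) (hYX : Y * X = s • (1 : Matrix κ κ A)) (T : Ideal A)
    (hs : s ∈ T)
    (hYT : ∀ i j, Y i j ∈ T) {g : GL (Option κ) A}
    (hg : g ∈ elemSubgroup (Option κ) (Ideal.span {s} : Set A)) :
    ∃ h ∈ projElemRel E (T : Set A), ∀ c, h.1 *ᵥ extMul X c = extMul X (g.1 *ᵥ c) := by
  have hX : ∀ a, E *ᵥ (fun i => X i a) = fun i => X i a := fun a => by
    funext i
    exact congrFun (congrFun hEX i) a
  have hY : ∀ b, Y b ᵥ* E = Y b := fun b => by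
    funext i
    exact congrFun (congrFun hYE b) i
  have hYXc : ∀ b (c : κ → A), Y b ⬝ᵥ (X *ᵥ c) = s * c b := fun b c => by
    have := congrFun (mulVec_mulVec c Y X) b
    rw [hYX, smul_mulVec, one_mulVec] at this
    exact this
  have hYXa : ∀ b a, Y b ⬝ᵥ (fun i => X i a) = s * (1 : Matrix κ κ A) b a := fun b a => by
    exact congrFun (congrFun hYX b) a
  induction hg using Subgroup.closure_induction with
  | mem t ht =>
    obtain ⟨i, j, hij, y, hy, rfl⟩ := ht
    obtain ⟨x, rfl⟩ := Ideal.mem_span_singleton'.mp hy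
    rcases i with _ | a
    · rcases j with _ | b
      · exact absurd rfl hij
      refine ⟨rowTrans (x • Y b), rowTrans_mem (by rw [smul_vecMul, hY])
        (fun i => T.mul_mem_left _ (hYT b i)),
        fun c => ?_⟩
      rw [elemMat_mulVec]
      funext l
      cases l with
      | none =>
        rw [rowTrans_none, smul_dotProduct]
        change c none + x • (Y b ⬝ᵥ (X *ᵥ (c ∘ some))) =
          (c + Pi.single none (x * s * c (some b)) : Option κ → A) none
        rw [hYXc, Pi.add_apply, Pi.single_eq_same, smul_eq_mul, mul_assoc, Function.comp_apply]
      | some l =>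
        rw [rowTrans_some]
        change (X *ᵥ (c ∘ some)) l = (X *ᵥ ((c + Pi.single none (x * s * c (some b))) ∘ some)) l
        have : (c + Pi.single none (x * s * c (some b))) ∘ some = c ∘ some := by
          funext m
          simp
        rw [this]
    · rcases j with _ | b
      · refine ⟨colTrans ((x * s) • fun i => X i a), colTrans_mem (by rw [mulVec_smul, hX])
          (fun i => T.mul_mem_right _ (T.mul_mem_left _ hs)), fun c => ?_⟩
        rw [elemMat_mulVec]
        funext l
        cases l with
        | none =>
          rw [colTrans_none]
          change c none = (c + Pi.single (some a) (x * s * c none) : Option κ → A) none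
          simp
        | some l =>
          rw [colTrans_some]
          change (X *ᵥ (c ∘ some)) l + c none * (x * s * X l a)
            = (X *ᵥ ((c + Pi.single (some a) (x * s * c none)) ∘ some)) l
          have : (c + Pi.single (some a) (x * s * c none)) ∘ some = c ∘ some +
              Pi.single a (x * s * c none) := by
            funext m
            simp [Pi.single_apply]
          rw [this, mulVec_add, mulVec_single, Pi.add_apply]
          simp [Matrix.col, mul_comm]
          ring
      · have hab : b ≠ a := fun h => hij (by rw [h])
        let q : ν → A := fun i => X i a
        let φ : ν → A := x • Y b
        have hq : E *ᵥ q = q := hX a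
        have hφ : φ ᵥ* E = φ := by rw [smul_vecMul, hY]
        have hφq : φ ⬝ᵥ q = 0 := by
          rw [smul_dotProduct, hYXa, Matrix.one_apply_ne hab, mul_zero, smul_zero]
        have hφm : rowTrans φ ∈ projElemRel E (T : Set A) :=
          rowTrans_mem hφ (fun i => T.mul_mem_left _ (hYT b i))
        have hcol : colTrans q ∈ projElem E :=
          projElemRel_le E Set.univ (colTrans_mem hq fun _ => Set.mem_univ _)
        refine ⟨(colTrans q)⁻¹ * (rowTrans φ)⁻¹ * (colTrans q)⁻¹⁻¹ * rowTrans φ,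
          mul_mem (conj_mem_projElemRel (inv_mem hcol) (inv_mem hφm)) hφm, fun c => ?_⟩
        have key : ∀ u : Option ν → A,
            ((colTrans q)⁻¹ * (rowTrans φ)⁻¹ * (colTrans q)⁻¹⁻¹ * rowTrans φ).1 *ᵥ u
            = u + (φ ⬝ᵥ (u ∘ some)) • extVec q := fun u => by
          rw [inv_inv, mul_mulVec_GL, mul_mulVec_GL, mul_mulVec_GL, colTrans_neg, rowTrans_neg]
          have e1 : ((rowTrans φ).1 *ᵥ u) ∘ some = u ∘ some := funext fun i => rowTrans_some _ _ _
          have e2 : ∀ w : Option ν → A, ((colTrans q).1 *ᵥ w) ∘ some = w ∘ some + w none • q :=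
            fun w => funext fun i => colTrans_some _ _ _
          have hn : ((rowTrans (-φ)).1 *ᵥ ((colTrans q).1 *ᵥ ((rowTrans φ).1 *ᵥ u))) none =
              u none := by
            rw [rowTrans_none, colTrans_none, rowTrans_none, e2, e1, neg_dotProduct, dotProduct_add,
              dotProduct_smul, hφq, smul_zero, add_zero, add_neg_cancel_right]
          funext l
          cases l with
          | none =>
            rw [colTrans_none, hn]
            simp [extVec]
          | some l =>
            rw [colTrans_some, hn, rowTrans_some, colTrans_some, rowTrans_some, rowTrans_none]
            simp [extVec]
            ring
        rw [key, elemMat_mulVec]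
        have e3 : φ ⬝ᵥ (extMul X c ∘ some) = x * s * c (some b) := by
          rw [smul_dotProduct]
          change x • (Y b ⬝ᵥ (X *ᵥ (c ∘ some))) = _
          rw [hYXc, smul_eq_mul, mul_assoc, Function.comp_apply]
        rw [e3]
        funext l
        cases l with
        | none =>
          change c none + x * s * c (some b) * 0 =
            (c + Pi.single (some a) (x * s * c (some b)) : Option κ → A) none
          simp
        | some l =>
          change (X *ᵥ (c ∘ some)) l + x * s * c (some b) * X l a
            = (X *ᵥ ((c + Pi.single (some a) (x * s * c (some b))) ∘ some)) l
          have : (c + Pi.single (some a) (x * s * c (some b))) ∘ some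
              = c ∘ some + Pi.single a (x * s * c (some b)) := by
            funext m
            simp [Pi.single_apply]
          rw [this, mulVec_add, mulVec_single, Pi.add_apply]
          simp [Matrix.col, mul_comm]
  | one => exact ⟨1, one_mem _, fun c => by simp⟩
  | mul x y _ _ hx hy =>
    obtain ⟨h, hh, e⟩ := hx
    obtain ⟨h', hh', e'⟩ := hy
    exact ⟨h * h', mul_mem hh hh', fun c => by rw [mul_mulVec_GL, e', e, mul_mulVec_GL]⟩
  | inv x _ hx =>
    obtain ⟨h, hh, e⟩ := hx
    refine ⟨h⁻¹, inv_mem hh, fun c => inv_mulVec_of_mulVec ?_⟩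
    rw [e, ← mul_mulVec_GL, mul_inv_cancel, Units.val_one, one_mulVec]

/-- Transfer of transitivity on rows to a projective module which is free up to `s`. -/
theorem exists_projElemRel_of_rows {E : Matrix ν ν A} {X : Matrix ν κ A} {Y : Matrix κ ν A} {s : A}
    (hEX : E * X = X) (hYE : Y * E = Y) (hYX : Y * X = s • (1 : Matrix κ κ A)) (hXY : X * Y = s • E)
    (T : Ideal A) (hs : s ∈ T) (hYT : ∀ i j, Y i j ∈ T)
    (hrows : ∀ c : Option κ → A, UniRow c →
    (∀ i, s ^ 4 ∣ c i - (Pi.single none 1 : Option κ → A) i) →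
      ∃ g ∈ elemSubgroup (Option κ) (Ideal.span {s} : Set A), g.1 *ᵥ c = Pi.single none 1)
    {u : Option ν → A} (hP : ProjVec E u) (hu : UniRow u)
    (hus : ∀ i, s ^ 5 ∣ u i - (Pi.single none 1 : Option ν → A) i) :
    ∃ h ∈ projElemRel E (T : Set A), h.1 *ᵥ u = Pi.single none 1 := by
  choose w hw using hus
  have hw' : u ∘ some = s ^ 5 • (w ∘ some) := by
    funext i
    simpa using hw (some i)
  let c : Option κ → A := fun i => i.elim (u none) fun b => s ^ 4 * (Y *ᵥ (w ∘ some)) b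
  have hcs : c ∘ some = s ^ 4 • (Y *ᵥ (w ∘ some)) := rfl
  have hcu : extMul X c = u := by
    funext i
    cases i with
    | none => rfl
    | some i =>
      refine congrFun (?_ : X *ᵥ (c ∘ some) = u ∘ some) i
      rw [← hP, hcs, mulVec_smul, mulVec_mulVec, hXY, hw', smul_mulVec, mulVec_smul, smul_smul,
        ← pow_succ]
  obtain ⟨d, hd⟩ := hu
  obtain ⟨g, hg, hgc⟩ := hrows c (by
    refine ⟨fun i => i.elim (d none) ((d ∘ some) ᵥ* X), ?_⟩
    have e1 : ((d ∘ some) ᵥ* X) ⬝ᵥ (c ∘ some) = (d ∘ some) ⬝ᵥ (u ∘ some) := by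
      rw [← dotProduct_mulVec]
      congr 1
      exact funext fun i => congrFun hcu (some i)
    rw [dotProduct, Fintype.sum_option, ← hd, dotProduct, Fintype.sum_option]
    exact congrArg (d none * u none + ·) e1) (by
    rintro (_ | b)
    · exact (pow_dvd_pow s (by norm_num)).trans (Dvd.intro _ (hw none).symm)
    · rw [Pi.single_eq_of_ne (by simp), sub_zero]
      exact Dvd.intro _ rfl)
  obtain ⟨h, hh, e⟩ := exists_projElemRel_comp hEX hYE hYX T hs hYT hg
  exact ⟨h, hh, by rw [← hcu, e, hgc, extMul_single]⟩

end Realization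

section LaurentRow

open Matrix Polynomial LaurentPolynomial

variable {ι : Type*} [Fintype ι] [DecidableEq ι]

theorem UniRow.of_unit_smul {A : Type*} [CommRing A] {u : ι → A} (hu : UniRow u) (d : Aˣ) :
    UniRow ((d : A) • u) := by
  obtain ⟨c, hc⟩ := hu
  exact ⟨((d⁻¹ : Aˣ) : A) • c, by simp [hc]⟩

theorem rowRel_single_of_isUnit_entry {A : Type*} [CommRing A] [Nontrivial ι] {u : ι → A} {o : ι}
    (ho : IsUnit (u o)) (j : ι) : RowRel u (Pi.single j 1) := by
  obtain ⟨w, hw⟩ := ho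
  obtain ⟨i, hi⟩ := exists_ne o
  exact rowRel_single_of_dot_eq_one i (c := Pi.single o ((w⁻¹ : Aˣ) : A)) (by simp [hi])
    (by simp [← hw]) j

theorem rowRel_single_of_unit_smul {A : Type*} [CommRing A] [Nontrivial ι] {u : ι → A} (d : Aˣ)
    {o : ι} (h : RowRel ((d : A) • u) (Pi.single o 1)) (j : ι) : RowRel u (Pi.single j 1) := by
  obtain ⟨g, hg, h⟩ := h
  have h1 : RowRel u (((d⁻¹ : Aˣ) : A) • Pi.single o (1 : A)) := by
    refine ⟨g, hg, ?_⟩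
    rw [← h, mulVec_smul, smul_smul]
    simp
  refine h1.trans (rowRel_single_of_isUnit_entry (o := o) ?_ j)
  simp

theorem isCoprime_X_pow_of_isUnit_coeff_zero {B : Type*} [CommRing B] {q : B[X]}
    (hq : IsUnit (q.coeff 0)) (N : ℕ) : IsCoprime (Polynomial.X ^ N : B[X]) q := by
  obtain ⟨w, hw⟩ := hq
  refine IsCoprime.pow_left ⟨-(Polynomial.C ((w⁻¹ : Bˣ) : B) * q.divX),
    Polynomial.C ((w⁻¹ : Bˣ) : B), ?_⟩
  have h1 := Polynomial.divX_mul_X_add q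
  have h2 : Polynomial.C ((w⁻¹ : Bˣ) : B) * Polynomial.C (w : B) = 1 := by
    rw [← Polynomial.C_mul]; simp
  rw [← hw] at h1
  linear_combination h2 - Polynomial.C ((w⁻¹ : Bˣ) : B) * h1

theorem exists_toLaurent_sub_mem {B : Type*} [CommRing B] {q : B[X]} (hq : IsUnit (q.coeff 0))
    (a : B[T;T⁻¹]) : ∃ (p : B[X]) (c : B[T;T⁻¹]), toLaurent p = a + toLaurent q * c := by
  obtain ⟨N, f, hf⟩ := exists_T_pow a
  obtain ⟨r, s, hrs⟩ := isCoprime_X_pow_of_isUnit_coeff_zero hq N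
  refine ⟨f * r, -(a * toLaurent s), ?_⟩
  have h3 := congrArg (toLaurent (R := B)) hrs
  simp only [map_add, map_mul, map_one, toLaurent_X_pow] at h3
  rw [map_mul, hf]
  linear_combination a * h3

theorem UniRow.of_toLaurent {B : Type*} [CommRing B] {p : ι → B[X]} {o : ι}
    (ho : IsUnit ((p o).coeff 0)) (h : UniRow (toLaurent (R := B) ∘ p)) : UniRow p := by
  obtain ⟨c, hc⟩ := h
  obtain ⟨N, hN⟩ : ∃ N : ℕ, ∀ i, ∃ f : B[X], toLaurent f = c i * T N := by
    choose n f hf using fun i => exists_T_pow (c i)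
    refine ⟨∑ i, n i, fun i => ⟨f i * Polynomial.X ^ (∑ j ∈ Finset.univ.erase i, n j), ?_⟩⟩
    rw [map_mul, hf, toLaurent_X_pow, mul_assoc, ← T_add, ← Finset.add_sum_erase _ n
      (Finset.mem_univ i)]
    push_cast
    rfl
  choose f hf using hN
  have h1 : f ⬝ᵥ p = Polynomial.X ^ N := by
    apply toLaurent_injective
    rw [toLaurent_X_pow, ← one_mul (T _), ← hc]
    simp only [dotProduct, map_sum, map_mul, hf, Finset.sum_mul, Function.comp_apply]
    exact Finset.sum_congr rfl fun i _ => by ring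
  obtain ⟨r, s, hrs⟩ := isCoprime_X_pow_of_isUnit_coeff_zero ho N
  exact ⟨r • f + Pi.single o s, by rw [add_dotProduct, smul_dotProduct, h1, single_dotProduct,
    smul_eq_mul, hrs]⟩

theorem rowRel_of_bimonic {B : Type*} [CommRing B] (hcard : 3 ≤ Fintype.card ι)
    {u : ι → B[T;T⁻¹]} (hu : UniRow u) {o : ι} (d : B[T;T⁻¹]ˣ) {q : B[X]} (hq : q.Monic)
    (hq0 : IsUnit (q.coeff 0)) (h : u o = d * toLaurent q) (j : ι) :
    RowRel u (Pi.single j 1) := by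
  have : Nontrivial ι := Fintype.one_lt_card_iff_nontrivial.1 (by omega)
  refine rowRel_single_of_unit_smul d⁻¹ (o := j) ?_ j
  have hu' := hu.of_unit_smul d⁻¹
  set v := ((d⁻¹ : B[T;T⁻¹]ˣ) : B[T;T⁻¹]) • u
  have hv : v o = toLaurent q := by simp [v, h]
  choose p c hc using fun i => exists_toLaurent_sub_mem hq0 (v i)
  have h1 : RowRel v (toLaurent ∘ Function.update p o q) := by
    have := rowRel_add v o (Function.update c o 0) (by simp)
    convert this using 1
    funext i
    by_cases hi : i = o
    · subst hi; simp [hv]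
    · simp [hi, hc, hv]
  refine h1.trans ?_
  set p' := Function.update p o q
  have hp'o : p' o = q := by simp [p']
  have huni : UniRow p' := UniRow.of_toLaurent (o := o) (by rw [hp'o]; exact hq0) (hu'.of_rel h1)
  have hfin : Module.Finite B (B[X] ⧸ Ideal.span {p' o}) := by
    rw [hp'o]; exact hq.finite_quotient
  let ψ : B[X] →+* B[X][X] := Polynomial.eval₂RingHom (Polynomial.C.comp Polynomial.C)
    (Polynomial.C Polynomial.X * Polynomial.X)
  have hψ0 (a : B[X]) : (ψ a).eval 0 = Polynomial.C (a.coeff 0) := by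
    have : (Polynomial.evalRingHom 0).comp ψ = Polynomial.C.comp Polynomial.constantCoeff :=
      Polynomial.ringHom_ext (by simp [ψ]) (by simp [ψ])
    exact DFunLike.congr_fun this a
  have hψ1 (a : B[X]) : (ψ a).eval 1 = a := by
    have : (Polynomial.evalRingHom 1).comp ψ = RingHom.id _ :=
      Polynomial.ringHom_ext (by simp [ψ]) (by simp [ψ])
    exact DFunLike.congr_fun this a
  have h2 := rowRel_of_finite (B := B) hcard ψ hψ1 (fun b => by simp [ψ]) huni o
  refine (h2.map (toLaurent (R := B))).trans (rowRel_single_of_isUnit_entry (o := o) ?_ j)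
  simp only [Function.comp_apply, hψ0, hp'o, toLaurent_C]
  exact hq0.map _

end LaurentRow

section Nagata

open Matrix Polynomial LaurentPolynomial AddMonoidAlgebra

theorem exists_int_sum_pow_mul_ne_zero {r : ℕ} (D : Finset (Fin r → ℤ)) (hD : 0 ∉ D) :
    ∃ N : ℤ, ∀ δ ∈ D, ∑ i : Fin r, N ^ (i : ℕ) * δ i ≠ 0 := by
  let p (δ : Fin r → ℤ) : ℤ[X] := ∑ i : Fin r, Polynomial.C (δ i) * Polynomial.X ^ (i : ℕ)
  have hp (δ) (hδ : δ ≠ 0) : p δ ≠ 0 := by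
    intro h
    refine hδ (funext fun i => ?_)
    have := congrArg (fun q => q.coeff (i : ℕ)) h
    simpa [p, Polynomial.finsetSum_coeff, Polynomial.coeff_X_pow, Fin.val_inj,
      Finset.sum_ite_eq] using this
  have h1 : ∏ δ ∈ D, p δ ≠ 0 :=
    Finset.prod_ne_zero_iff.2 fun δ hδ => hp δ fun h => hD (h ▸ hδ)
  obtain ⟨N, hN⟩ : ∃ N : ℤ, (∏ δ ∈ D, p δ).eval N ≠ 0 := by
    by_contra! h
    exact h1 (Polynomial.funext (by simpa using h))
  refine ⟨N, fun δ hδ h => hN ?_⟩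
  rw [Polynomial.eval_prod]
  refine Finset.prod_eq_zero hδ ?_
  simp only [p, Polynomial.eval_finsetSum, Polynomial.eval_mul, Polynomial.eval_C,
    Polynomial.eval_pow, Polynomial.eval_X]
  rw [← h]
  exact Finset.sum_congr rfl fun i _ => mul_comm _ _

/-- The automorphism of the lattice making a given weight the first coordinate. -/
def weightEquiv {r : ℕ} (N : ℤ) : (Fin (r + 1) → ℤ) ≃+ ℤ × (Fin r → ℤ) where
  toFun y := (∑ i : Fin (r + 1), N ^ (i : ℕ) * y i, fun i => y i.succ)
  invFun z := Fin.cons (z.1 - ∑ i : Fin r, N ^ ((i : ℕ) + 1) * z.2 i) z.2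
  left_inv y := by
    funext i
    refine Fin.cases ?_ (fun j => ?_) i
    · simp [Fin.sum_univ_succ]
    · simp
  right_inv z := by
    ext i
    · simp [Fin.sum_univ_succ]
    · simp
  map_add' x y := by
    ext i
    · simp [mul_add, Finset.sum_add_distrib]
    · simp

theorem exists_laurent_bimonic {K : Type*} [Field K] {r : ℕ} {f : K[Fin (r + 1) → ℤ]}
    (hf : f ≠ 0) : ∃ (e : K[Fin (r + 1) → ℤ] ≃+* (K[Fin r → ℤ])[T;T⁻¹])
      (d : (K[Fin r → ℤ])[T;T⁻¹]ˣ) (q : (K[Fin r → ℤ])[X]),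
      q.Monic ∧ IsUnit (q.coeff 0) ∧ e f = d * toLaurent q := by
  classical
  obtain ⟨N, hN⟩ := exists_int_sum_pow_mul_ne_zero
    (((f.coeff.support ×ˢ f.coeff.support).image fun x => x.1 - x.2).erase 0) (by simp)
  let e : K[Fin (r + 1) → ℤ] ≃+* (K[Fin r → ℤ])[T;T⁻¹] :=
    (expEquiv K (weightEquiv N)).trans curryRingEquiv
  have he (g : K[Fin (r + 1) → ℤ]) (n : ℤ) (z : Fin r → ℤ) :
      ((e g).coeff n).coeff z = g.coeff ((weightEquiv N).symm (n, z)) := by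
    induction g using AddMonoidAlgebra.induction_linear with
    | zero => simp
    | add g h hg hh => simp [hg, hh]
    | single y c =>
      have h1 : e (single y c) = single (weightEquiv N y).1 (single (weightEquiv N y).2 c) := by
        change curryRingEquiv (expMap K (weightEquiv N).toAddMonoidHom (single y c)) = _
        rw [expMap_single]
        exact curryRingEquiv_single _ _ _
      have h2 : (weightEquiv N).symm (n, z) = y ↔ (n, z) = weightEquiv N y :=
        (weightEquiv N).symm_apply_eq
      rw [h1, AddMonoidAlgebra.coeff_single, AddMonoidAlgebra.coeff_single,
        Finsupp.single_apply (a := y), Finsupp.single_apply]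
      by_cases h : (n, z) = weightEquiv N y
      · rw [if_pos (h2.2 h).symm, ← h, if_pos rfl]
        simp
      · rw [if_neg fun h' : y = _ => h (h2.1 h'.symm)]
        split_ifs with h3
        · rw [AddMonoidAlgebra.coeff_single, Finsupp.single_apply, if_neg]
          exact fun h4 => h (Prod.ext h3.symm h4.symm)
        · simp
  have hmono (n : ℤ) (hn : (e f).coeff n ≠ 0) : IsUnit ((e f).coeff n) := by
    obtain ⟨z, hz⟩ : ∃ z, ((e f).coeff n).coeff z ≠ 0 := by
      by_contra! h
      exact hn (AddMonoidAlgebra.ext (Finsupp.ext h))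
    have h1 : (e f).coeff n = AddMonoidAlgebra.single z (((e f).coeff n).coeff z) := by
      refine AddMonoidAlgebra.ext (Finsupp.ext fun z' => ?_)
      rw [AddMonoidAlgebra.coeff_single, Finsupp.single_apply]
      split_ifs with h
      · rw [h]
      · by_contra h2
        rw [he] at hz h2
        have h3 := hN ((weightEquiv N).symm (n, z) - (weightEquiv N).symm (n, z')) (by
          refine Finset.mem_erase.2 ⟨?_, Finset.mem_image.2 ⟨(_, _), Finset.mem_product.2
            ⟨Finsupp.mem_support_iff.2 hz, Finsupp.mem_support_iff.2 h2⟩, rfl⟩⟩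
          intro h4
          have := (weightEquiv N).symm.injective (sub_eq_zero.1 h4)
          exact h (congrArg Prod.snd this))
        refine h3 ?_
        have h4 : (weightEquiv N ((weightEquiv N).symm (n, z) -
          (weightEquiv N).symm (n, z'))).1 = 0 := by simp
        exact h4
    rw [h1]
    refine IsUnit.of_mul_eq_one (AddMonoidAlgebra.single (-z) (((e f).coeff n).coeff z)⁻¹) ?_
    rw [single_mul_single, mul_inv_cancel₀ hz, add_neg_cancel]
    rfl
  obtain ⟨n, p, hp⟩ := exists_T_pow (e f)
  have hp0 : p ≠ 0 := by
    rintro rfl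
    rw [map_zero] at hp
    have := (isUnit_T n).mul_left_eq_zero.1 hp.symm
    exact hf (e.injective (by rw [this, map_zero]))
  have hpu (m : ℕ) (hm : p.coeff m ≠ 0) : IsUnit (p.coeff m) := by
    have h1 : p.coeff m = (e f).coeff (m - n) := by
      have h2 : (toLaurent p).coeff (m : ℤ) = p.coeff m := by
        rw [coeff_toLaurent]
        exact Finsupp.mapDomain_apply Nat.castEmbedding.injective _ m
      have h3 := coeff_mul_single_add (e f) (1 : K[Fin r → ℤ]) (n : ℤ) ((m : ℤ) - n)
      rw [sub_add_cancel, mul_one] at h3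
      rw [← h2, hp, ← h3]
      rfl
    rw [h1] at hm ⊢
    exact hmono _ hm
  obtain ⟨q, hq⟩ : Polynomial.X ^ p.natTrailingDegree ∣ p := by
    exact Polynomial.X_pow_dvd_iff.2 fun d hd => Polynomial.coeff_eq_zero_of_lt_natTrailingDegree hd
  have hqc (m : ℕ) : q.coeff m = p.coeff (m + p.natTrailingDegree) := by
    have := Polynomial.coeff_X_pow_mul q p.natTrailingDegree m
    rw [← hq] at this
    exact this.symm
  have hq0 : q ≠ 0 := by rintro rfl; exact hp0 (by rw [hq, mul_zero])
  have hu0 : IsUnit (q.coeff 0) := by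
    rw [hqc]
    exact hpu _ (by simpa using hp0)
  obtain ⟨w, hw⟩ : IsUnit q.leadingCoeff := by
    rw [Polynomial.leadingCoeff, hqc]
    apply hpu
    rw [← hqc]
    simpa using hq0
  refine ⟨e, ((isUnit_T (-n : ℤ)).mul ((isUnit_T (p.natTrailingDegree : ℤ)).mul
    (w.isUnit.map LaurentPolynomial.C))).unit, Polynomial.C ((w⁻¹ : Units _) : K[Fin r → ℤ]) *
      q, ?_, ?_, ?_⟩
  · rw [Polynomial.Monic, Polynomial.leadingCoeff_C_mul_of_isUnit (Units.isUnit _), ← hw]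
    simp
  · rw [Polynomial.coeff_C_mul]
    exact (Units.isUnit _).mul hu0
  · have h1 : e f = toLaurent p * T (-n) := by rw [hp, mul_T_assoc]; simp
    have h2 : LaurentPolynomial.C (w : K[Fin r → ℤ]) * LaurentPolynomial.C
        ((w⁻¹ : Units _) : K[Fin r → ℤ]) = 1 := by
      rw [← map_mul]; simp
    rw [h1]
    conv_lhs => rw [hq]
    rw [map_mul, map_mul, toLaurent_X_pow, toLaurent_C]
    simp only [IsUnit.unit_spec]
    linear_combination - (toLaurent q * T (-n) * T (p.natTrailingDegree : ℤ)) * h2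

end Nagata

section LatticeRows

open Matrix AddMonoidAlgebra

theorem rowTransitive_lattice {ι : Type*} [Fintype ι] [DecidableEq ι] (hcard : 3 ≤ Fintype.card ι)
    (K : Type*) [Field K] (r : ℕ) : RowTransitive ι K[Fin r → ℤ] := by
  intro u hu j
  have : Nontrivial ι := Fintype.one_lt_card_iff_nontrivial.1 (by omega)
  obtain ⟨o, ho⟩ : ∃ o, u o ≠ 0 := by
    by_contra! h
    obtain ⟨c, hc⟩ := hu
    rw [funext h, show (fun _ : ι => (0 : K[Fin r → ℤ])) = 0 from rfl, dotProduct_zero] at hc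
    exact zero_ne_one hc
  cases r with
  | zero =>
    refine rowRel_single_of_isUnit_entry (o := o) ?_ j
    have h1 : u o = AddMonoidAlgebra.single 0 ((u o).coeff 0) :=
      AddMonoidAlgebra.ext (Finsupp.ext fun x => by
        rw [Subsingleton.elim x 0, AddMonoidAlgebra.coeff_single, Finsupp.single_eq_same])
    have h2 : (u o).coeff 0 ≠ 0 := fun h => ho (by rw [h1, h, AddMonoidAlgebra.single_zero])
    rw [h1]
    refine IsUnit.of_mul_eq_one (AddMonoidAlgebra.single 0 ((u o).coeff 0)⁻¹) ?_
    rw [single_mul_single, mul_inv_cancel₀ h2, add_zero]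
    rfl
  | succ r =>
    obtain ⟨e, d, q, hq, hq0, h⟩ := exists_laurent_bimonic ho
    have h1 := rowRel_of_bimonic hcard (hu.map e.toRingHom) (o := o) d hq hq0
      h j
    have h2 := h1.map e.symm.toRingHom
    rw [comp_single_one] at h2
    convert h2 using 1
    funext i
    simp

end LatticeRows

section Schanuel

open Matrix

variable {A : Type*} [CommRing A]

theorem exists_equiv_prod_of_exact {K S Q : Type*} [AddCommGroup K] [Module A K] [AddCommGroup S]
    [Module A S] [AddCommGroup Q] [Module A Q] [Module.Projective A Q] (f : K →ₗ[A] S)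
    (g : S →ₗ[A] Q) (hf : Function.Injective f) (hg : Function.Surjective g)
    (h : Function.Exact f g) : Nonempty (S ≃ₗ[A] K × Q) := by
  obtain ⟨l, hl⟩ := Module.projective_lifting_property g LinearMap.id hg
  exact ⟨(h.splitSurjectiveEquiv hf ⟨l, hl⟩).1⟩

/-- Schanuel's lemma. -/
theorem exists_schanuel_equiv {K₁ K₂ P₁ P₂ W : Type*} [AddCommGroup K₁] [Module A K₁]
    [AddCommGroup K₂] [Module A K₂] [AddCommGroup P₁] [Module A P₁] [AddCommGroup P₂] [Module A P₂]
    [AddCommGroup W] [Module A W] [Module.Projective A P₁] [Module.Projective A P₂]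
    (f₁ : K₁ →ₗ[A] P₁) (g₁ : P₁ →ₗ[A] W) (f₂ : K₂ →ₗ[A] P₂) (g₂ : P₂ →ₗ[A] W)
    (hf₁ : Function.Injective f₁) (hg₁ : Function.Surjective g₁) (h₁ : Function.Exact f₁ g₁)
    (hf₂ : Function.Injective f₂) (hg₂ : Function.Surjective g₂) (h₂ : Function.Exact f₂ g₂) :
    Nonempty ((K₁ × P₂) ≃ₗ[A] (K₂ × P₁)) := by
  let S := LinearMap.ker (g₁ ∘ₗ LinearMap.fst A P₁ P₂ - g₂ ∘ₗ LinearMap.snd A P₁ P₂)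
  have hS (x : P₁ × P₂) : x ∈ S ↔ g₁ x.1 = g₂ x.2 := by
    simp [S, sub_eq_zero]
  obtain ⟨e₁⟩ := exists_equiv_prod_of_exact (S := S) (Q := P₂)
    ((LinearMap.inl A P₁ P₂ ∘ₗ f₁).codRestrict S fun x => (hS _).2 (by
      simp [h₁.apply_apply_eq_zero])) (LinearMap.snd A P₁ P₂ ∘ₗ S.subtype)
    (fun x y h => hf₁ (congrArg (fun z : S => (z : P₁ × P₂).1) h))
    (fun y => by
      obtain ⟨x, hx⟩ := hg₁ (g₂ y)
      exact ⟨⟨(x, y), (hS _).2 hx⟩, rfl⟩)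
    (by
      rintro ⟨⟨x, y⟩, hxy⟩
      rw [hS] at hxy
      constructor
      · rintro (rfl : y = 0)
        obtain ⟨z, hz⟩ := (h₁ x).1 (by simpa using hxy)
        exact ⟨z, Subtype.ext (Prod.ext hz rfl)⟩
      · rintro ⟨z, hz⟩
        exact congr(($hz : P₁ × P₂).2).symm)
  obtain ⟨e₂⟩ := exists_equiv_prod_of_exact (S := S) (Q := P₁)
    ((LinearMap.inr A P₁ P₂ ∘ₗ f₂).codRestrict S fun x => (hS _).2 (by
      simp [h₂.apply_apply_eq_zero])) (LinearMap.fst A P₁ P₂ ∘ₗ S.subtype)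
    (fun x y h => hf₂ congr(($h : P₁ × P₂).2))
    (fun x => by
      obtain ⟨y, hy⟩ := hg₂ (g₁ x)
      exact ⟨⟨(x, y), (hS _).2 hy.symm⟩, rfl⟩)
    (by
      rintro ⟨⟨x, y⟩, hxy⟩
      rw [hS] at hxy
      constructor
      · rintro (rfl : x = 0)
        obtain ⟨z, hz⟩ := (h₂ y).1 (by simpa using hxy.symm)
        exact ⟨z, Subtype.ext (Prod.ext rfl hz)⟩
      · rintro ⟨z, hz⟩
        exact congr(($hz : P₁ × P₂).1).symm)
  exact ⟨e₁.symm.trans e₂⟩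

end Schanuel

section LaurentStep

open Matrix Polynomial LaurentPolynomial

variable {B : Type*} [CommRing B]

theorem eq_zero_of_toLaurent_mul_eq_zero {q : B[X]} (hq : q.Monic) {c : B[T;T⁻¹]}
    (h : toLaurent q * c = 0) : c = 0 := by
  obtain ⟨n, p, hp⟩ := exists_T_pow c
  have h1 : toLaurent (q * p) = 0 := by rw [map_mul, hp, ← mul_assoc, h, zero_mul]
  rw [toLaurent_eq_zero, hq.mul_right_eq_zero_iff] at h1
  rw [h1, map_zero] at hp
  exact (isUnit_T n).mul_left_eq_zero.1 hp.symm

theorem mem_map_of_mapRingHom_eq_zero (J : Ideal B) {c : B[T;T⁻¹]}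
    (h : AddMonoidAlgebra.mapRingHom ℤ (Ideal.Quotient.mk J) c = 0) :
    c ∈ J.map (algebraMap B B[T;T⁻¹]) := by
  have h1 (n : ℤ) : c.coeff n ∈ J := by
    rw [← Ideal.Quotient.eq_zero_iff_mem]
    have := congrArg (fun x : (B ⧸ J)[T;T⁻¹] => x.coeff n) h
    simpa using this
  rw [← AddMonoidAlgebra.sum_coeff_single c]
  refine Ideal.sum_mem _ fun n _ => ?_
  change AddMonoidAlgebra.single n (c.coeff n) ∈ _
  rw [LaurentPolynomial.single_eq_C_mul_T]
  exact Ideal.mul_mem_right _ _ (Ideal.mem_map_of_mem _ (h1 n))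

theorem mem_map_of_toLaurent_mul_mem (J : Ideal B) {q : B[X]} (hq : q.Monic) {c : B[T;T⁻¹]}
    (h : toLaurent q * c ∈ J.map (algebraMap B B[T;T⁻¹])) :
    c ∈ J.map (algebraMap B B[T;T⁻¹]) := by
  apply mem_map_of_mapRingHom_eq_zero
  set π := AddMonoidAlgebra.mapRingHom ℤ (Ideal.Quotient.mk J)
  have h1 : π (toLaurent q * c) = 0 := by
    have h2 : J.map (algebraMap B B[T;T⁻¹]) ≤ RingHom.ker π := by
      rw [Ideal.map_le_iff_le_comap]
      intro x hx
      rw [Ideal.mem_comap, RingHom.mem_ker, ← LaurentPolynomial.C_eq_algebraMap]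
      change π (AddMonoidAlgebra.single 0 x) = 0
      simp only [π]
      rw [AddMonoidAlgebra.mapRingHom_single, Ideal.Quotient.eq_zero_iff_mem.2 hx,
        AddMonoidAlgebra.single_zero]
    exact h2 h
  have h3 : π (toLaurent q) = toLaurent (q.map (Ideal.Quotient.mk J)) := by
    have : π.comp (toLaurent (R := B)) =
        (toLaurent (R := B ⧸ J)).comp (Polynomial.mapRingHom (Ideal.Quotient.mk J)) := by
      refine Polynomial.ringHom_ext (fun a => ?_) ?_
      · rw [RingHom.comp_apply, RingHom.comp_apply, toLaurent_C, Polynomial.coe_mapRingHom,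
          Polynomial.map_C, toLaurent_C]
        exact AddMonoidAlgebra.mapRingHom_single _ _ _
      · rw [RingHom.comp_apply, RingHom.comp_apply, toLaurent_X, Polynomial.coe_mapRingHom,
          Polynomial.map_X, toLaurent_X]
        exact (AddMonoidAlgebra.mapRingHom_single _ _ _).trans (by rw [map_one]; rfl)
    exact congr($this q)
  rw [map_mul, h3] at h1
  exact eq_zero_of_toLaurent_mul_eq_zero (hq.map _) h1

theorem finite_laurent_quotient {q : B[X]} (hq : q.Monic) (hq0 : IsUnit (q.coeff 0)) :
    Module.Finite B (B[T;T⁻¹] ⧸ Ideal.span {toLaurent q}) := by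
  have := hq.finite_quotient
  let f : (B[X] ⧸ Ideal.span {q}) →ₐ[B] (B[T;T⁻¹] ⧸ Ideal.span {toLaurent q}) :=
    Ideal.quotientMapₐ _ (toLaurentAlg (R := B)) (by
      rw [Ideal.span_singleton_le_iff_mem, Ideal.mem_comap]
      exact Ideal.mem_span_singleton_self _)
  refine Module.Finite.of_surjective f.toLinearMap fun x => ?_
  obtain ⟨a, rfl⟩ := Ideal.Quotient.mk_surjective x
  obtain ⟨p, c, hp⟩ := exists_toLaurent_sub_mem hq0 a
  refine ⟨Ideal.Quotient.mk _ p, ?_⟩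
  change Ideal.Quotient.mk _ (toLaurent p) = _
  rw [Ideal.Quotient.eq, hp, add_sub_cancel_left]
  exact Ideal.mul_mem_right _ _ (Ideal.mem_span_singleton_self _)

variable {P : Type*} [AddCommGroup P] [Module B[T;T⁻¹] P] [Module B P] [IsScalarTower B B[T;T⁻¹] P]

theorem finite_of_toLaurent_smul_eq_zero [Module.Finite B[T;T⁻¹] P] {q : B[X]} (hq : q.Monic)
    (hq0 : IsUnit (q.coeff 0)) (h : ∀ x : P, toLaurent q • x = 0) : Module.Finite B P := by
  have := finite_laurent_quotient hq hq0
  have htor : Module.IsTorsionBySet B[T;T⁻¹] P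
      (Ideal.span {toLaurent q} : Ideal B[T;T⁻¹]) := by
    rw [← Module.isTorsionBySet_iff_is_torsion_by_span]
    rintro x ⟨_, rfl⟩
    exact h x
  let := htor.module
  have : IsScalarTower B (B[T;T⁻¹] ⧸ Ideal.span {toLaurent q}) P :=
    Module.IsTorsionBySet.isScalarTower htor
  have : IsScalarTower B[T;T⁻¹] (B[T;T⁻¹] ⧸ Ideal.span {toLaurent q}) P :=
    Module.IsTorsionBySet.isScalarTower htor
  have : Module.Finite (B[T;T⁻¹] ⧸ Ideal.span {toLaurent q}) P :=
    Module.Finite.of_restrictScalars_finite B[T;T⁻¹] _ _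
  exact Module.Finite.trans (B[T;T⁻¹] ⧸ Ideal.span {toLaurent q}) P

theorem flat_quotient_span [Module.Flat B P] {m : Type*} [Fintype m] {p : m → P}
    (hp : LinearIndependent B[T;T⁻¹] p) {q : B[X]} (hq : q.Monic)
    (hs : ∀ x : P, toLaurent q • x ∈ Submodule.span B[T;T⁻¹] (Set.range p)) :
    Module.Flat B (P ⧸ Submodule.span B[T;T⁻¹] (Set.range p)) := by
  set F := Submodule.span B[T;T⁻¹] (Set.range p)
  refine Module.Flat.of_forall_isTrivialRelation fun {l f x} h => ?_
  choose y hy using fun i => F.mkQ_surjective (x i)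
  have h1 : ∑ i, f i • y i ∈ F := by
    rw [← Submodule.ker_mkQ F, LinearMap.mem_ker, map_sum, ← h]
    refine Finset.sum_congr rfl fun i _ => ?_
    rw [← hy]
    rfl
  obtain ⟨c, hc⟩ := (Submodule.mem_span_range_iff_exists_fun _).1 h1
  choose d hd using fun i => (Submodule.mem_span_range_iff_exists_fun _).1 (hs (y i))
  have h2 (a : m) : toLaurent q * c a = ∑ i, algebraMap B _ (f i) * d i a := by
    have h3 : ∑ a, (toLaurent q * c a - ∑ i, algebraMap B _ (f i) * d i a) • p a = 0 := by
      simp only [sub_smul, Finset.sum_sub_distrib, mul_smul, ← Finset.smul_sum, hc,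
        Finset.sum_smul]
      rw [Finset.sum_comm]
      simp only [← Finset.smul_sum, hd, algebraMap_smul]
      rw [sub_eq_zero, Finset.smul_sum]
      exact Finset.sum_congr rfl fun i _ => smul_comm _ _ _
    exact sub_eq_zero.1 (Fintype.linearIndependent_iff.1 hp _ h3 a)
  have h4 (a : m) : ∃ e : Fin l → B[T;T⁻¹], ∑ i, e i * algebraMap B _ (f i) = c a := by
    have h5 : c a ∈ (Ideal.span (Set.range f)).map (algebraMap B B[T;T⁻¹]) := by
      refine mem_map_of_toLaurent_mul_mem _ hq ?_
      rw [h2]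
      exact Ideal.sum_mem _ fun i _ => Ideal.mul_mem_right _ _
        (Ideal.mem_map_of_mem _ (Ideal.subset_span ⟨i, rfl⟩))
    rw [Ideal.map_span, ← Set.range_comp] at h5
    exact Ideal.mem_span_range_iff_exists_fun.1 h5
  choose e he using h4
  have h6 : ∑ i, f i • (y i - ∑ a, e a i • p a) = 0 := by
    simp only [smul_sub, Finset.sum_sub_distrib]
    rw [sub_eq_zero, ← hc]
    simp only [← he, Finset.sum_smul, Finset.smul_sum]
    rw [Finset.sum_comm]
    refine Finset.sum_congr rfl fun i _ => Finset.sum_congr rfl fun a _ => ?_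
    rw [mul_comm, mul_smul, algebraMap_smul]
  obtain ⟨k, a', z, hz, ha'⟩ := Module.Flat.isTrivialRelation_of_sum_smul_eq_zero h6
  refine ⟨k, a', fun j => F.mkQ (z j), fun i => ?_, ha'⟩
  have h7 := congrArg F.mkQ (hz i)
  rw [map_sub, hy, (LinearMap.mem_ker (f := F.mkQ)).1, sub_zero, map_sum] at h7
  · rw [h7]; rfl
  · rw [Submodule.ker_mkQ]
    exact Submodule.sum_mem _ fun a _ => F.smul_mem _ (Submodule.subset_span ⟨a, rfl⟩)

end LaurentStep

section LaurentResolution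

open Matrix Polynomial LaurentPolynomial TensorProduct

variable {B : Type*} [CommRing B]
  {W : Type*} [AddCommGroup W] [Module B[T;T⁻¹] W] [Module B W] [IsScalarTower B B[T;T⁻¹] W]

/-- Multiplication by the variable, as an endomorphism over the base. -/
noncomputable def mulVar (B : Type*) [CommRing B] (W : Type*) [AddCommGroup W] [Module B[T;T⁻¹] W]
    [Module B W] [IsScalarTower B B[T;T⁻¹] W] : W →ₗ[B] W :=
  (LinearMap.lsmul B[T;T⁻¹] W (T 1)).restrictScalars B

/-- The kernel of the multiplication map `B[T;T⁻¹] ⊗ W → W`. -/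
noncomputable def laurentRel (B : Type*) [CommRing B] (W : Type*) [AddCommGroup W]
    [Module B[T;T⁻¹] W]
    [Module B W] [IsScalarTower B B[T;T⁻¹] W] :
    (B[T;T⁻¹] ⊗[B] W) →ₗ[B[T;T⁻¹]] (B[T;T⁻¹] ⊗[B] W) :=
  (T 1 : B[T;T⁻¹]) • LinearMap.id - (mulVar B W).baseChange B[T;T⁻¹]

theorem laurentRel_tmul (a : B[T;T⁻¹]) (w : W) :
    laurentRel B W (a ⊗ₜ w) = (T 1 * a) ⊗ₜ w - a ⊗ₜ ((T 1 : B[T;T⁻¹]) • w) := by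
  simp [laurentRel, mulVar, TensorProduct.smul_tmul']

theorem laurentRel_exact : Function.Exact (laurentRel B W)
    ((LinearMap.id : W →ₗ[B] W).liftBaseChange B[T;T⁻¹]) := by
  set ρ := (LinearMap.id : W →ₗ[B] W).liftBaseChange B[T;T⁻¹]
  have hρ (a : B[T;T⁻¹]) (w : W) : ρ (a ⊗ₜ w) = a • w := rfl
  have hstep (a : B[T;T⁻¹]) (w : W) :
      (T 1 * a) ⊗ₜ[B] w - a ⊗ₜ ((T 1 : B[T;T⁻¹]) • w) ∈ LinearMap.range (laurentRel B W) :=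
    ⟨_, laurentRel_tmul a w⟩
  have hpow (n : ℤ) : ∀ w : W, (T n : B[T;T⁻¹]) ⊗ₜ[B] w - 1 ⊗ₜ ((T n : B[T;T⁻¹]) • w) ∈
      LinearMap.range (laurentRel B W) := by
    induction n using Int.induction_on with
    | zero => intro w; simp
    | succ n ih =>
      intro w
      have h1 := Submodule.add_mem _ (hstep (T n) w) (ih ((T 1 : B[T;T⁻¹]) • w))
      rw [sub_add_sub_cancel, smul_smul, ← T_add, ← T_add, add_comm 1 (n : ℤ)] at h1
      exact h1
    | pred n ih =>
      intro w
      have h1 := Submodule.sub_mem _ (ih ((T (-1) : B[T;T⁻¹]) • w))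
        (hstep (T (-n - 1)) ((T (-1) : B[T;T⁻¹]) • w))
      rw [smul_smul, smul_smul, ← T_add, ← T_add, ← T_add, add_neg_cancel, T_zero, one_smul,
        show (1 : ℤ) + (-n - 1) = -n by ring, sub_sub_sub_cancel_left] at h1
      exact h1
  have hmem (x : B[T;T⁻¹] ⊗[B] W) : x - 1 ⊗ₜ ρ x ∈ LinearMap.range (laurentRel B W) := by
    induction x using TensorProduct.induction_on with
    | zero => simp
    | add x y hx hy =>
      rw [map_add, tmul_add, add_sub_add_comm]
      exact Submodule.add_mem _ hx hy
    | tmul a w =>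
      rw [hρ]
      induction a using LaurentPolynomial.induction_on' with
      | add a b ha hb =>
        rw [add_tmul, add_smul, tmul_add, add_sub_add_comm]
        exact Submodule.add_mem _ ha hb
      | C_mul_T n b =>
        have h1 : (LaurentPolynomial.C b * T n : B[T;T⁻¹]) = b • T n := by
          rw [LaurentPolynomial.smul_eq_C_mul]
        have h2 := Submodule.smul_mem _ (LaurentPolynomial.C b) (hpow n w)
        rw [smul_sub, smul_tmul', smul_tmul', smul_eq_mul, smul_eq_mul, mul_one] at h2
        have h3 : (LaurentPolynomial.C b : B[T;T⁻¹]) ⊗ₜ[B] ((T n : B[T;T⁻¹]) • w) =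
            1 ⊗ₜ ((LaurentPolynomial.C b * T n : B[T;T⁻¹]) • w) := by
          have h4 : (LaurentPolynomial.C b : B[T;T⁻¹]) = b • 1 := by
            rw [LaurentPolynomial.smul_eq_C_mul, mul_one]
          rw [h1, smul_assoc, h4]
          exact TensorProduct.smul_tmul b (1 : B[T;T⁻¹]) ((T n : B[T;T⁻¹]) • w)
        rwa [h3] at h2
  intro x
  constructor
  · intro hx
    have := hmem x
    rw [hx, tmul_zero, sub_zero] at this
    exact this
  · rintro ⟨y, rfl⟩
    induction y using TensorProduct.induction_on with
    | zero => simp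
    | add x y hx hy => rw [map_add, map_add, hx, hy, add_zero]
    | tmul a w =>
      rw [laurentRel_tmul, map_sub, hρ, hρ, smul_smul, mul_comm, sub_self]

theorem eq_zero_of_toLaurent_smul_eq_zero {Q : Type*} [AddCommGroup Q] [Module B[T;T⁻¹] Q]
    [Module.Projective B[T;T⁻¹] Q] {q : B[X]} (hq : q.Monic) {x : Q} (h : toLaurent q • x = 0) :
    x = 0 := by
  obtain ⟨s, hs⟩ := Module.projective_def.1 (inferInstance : Module.Projective B[T;T⁻¹] Q)
  refine hs.injective ?_
  rw [map_zero]
  ext1 i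
  have := congrArg (fun y => s y i) h
  simp only [map_smul, map_zero, Finsupp.smul_apply, Finsupp.zero_apply, smul_eq_mul] at this
  simpa using eq_zero_of_toLaurent_mul_eq_zero hq this

theorem laurentRel_injective [Module.Finite B W] [Module.Projective B W] :
    Function.Injective (laurentRel B W) := by
  rw [injective_iff_map_eq_zero]
  intro x hx
  have h1 : (T 1 : B[T;T⁻¹]) • x = (mulVar B W).baseChange B[T;T⁻¹] x := by
    simpa [laurentRel, sub_eq_zero] using hx
  have h2 (n : ℕ) : (T n : B[T;T⁻¹]) • x = (mulVar B W ^ n).baseChange B[T;T⁻¹] x := by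
    induction n with
    | zero => simp [Module.End.one_eq_id]
    | succ n ih =>
      rw [pow_succ', Module.End.mul_eq_comp, LinearMap.baseChange_comp, LinearMap.comp_apply, ← ih,
        map_smul, ← h1, smul_smul, ← T_add]
      push_cast
      rfl
  have h3 (p : B[X]) : toLaurent p • x = (aeval (mulVar B W) p).baseChange B[T;T⁻¹] x := by
    induction p using Polynomial.induction_on' with
    | add p q hp hq => simp [add_smul, hp, hq, LinearMap.baseChange_add]
    | monomial n b =>
      rw [← Polynomial.C_mul_X_pow_eq_monomial, toLaurent_C_mul_X_pow, mul_smul, h2, aeval_mul,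
        Polynomial.aeval_C, aeval_X_pow, ← Algebra.smul_def, LinearMap.baseChange_smul,
          LinearMap.smul_apply,
        LaurentPolynomial.C_eq_algebraMap, algebraMap_smul]
  obtain ⟨χ, hχ, h0⟩ := LinearMap.exists_monic_and_aeval_eq_zero B (mulVar B W)
  refine eq_zero_of_toLaurent_smul_eq_zero hχ ?_
  rw [h3, h0]
  simp

end LaurentResolution

section StablyFree

open Matrix

universe u

open Polynomial LaurentPolynomial TensorProduct

/-- Finitely generated projective modules are stably free. -/
def StablyFreeRing (A : Type u) [CommRing A] : Prop :=
  ∀ (P : Type u) [AddCommGroup P] [Module A P] [Module.Finite A P] [Module.Projective A P],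
    ∃ a b : ℕ, Nonempty ((P × (Fin a → A)) ≃ₗ[A] (Fin b → A))

/-- Finite free modules are closed under products. -/
def finProdEquiv (A : Type*) [CommRing A] (m n : ℕ) :
    ((Fin m → A) × (Fin n → A)) ≃ₗ[A] (Fin (m + n) → A) :=
  (LinearEquiv.sumArrowLequivProdArrow (Fin m) (Fin n) A A).symm.trans
    (LinearEquiv.funCongrLeft A A finSumFinEquiv.symm)

theorem exists_stablyFree_of_span {B : Type u} [CommRing B] [IsNoetherianRing B]
    (hB : StablyFreeRing B) {P : Type u} [AddCommGroup P] [Module B[T;T⁻¹] P] [Module B P]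
    [IsScalarTower B B[T;T⁻¹] P] [Module.Finite B[T;T⁻¹] P] [Module.Projective B[T;T⁻¹] P]
    {m : ℕ} {p : Fin m → P} (hp : LinearIndependent B[T;T⁻¹] p) {q : B[X]} (hq : q.Monic)
    (hq0 : IsUnit (q.coeff 0))
    (hs : ∀ x : P, toLaurent q • x ∈ Submodule.span B[T;T⁻¹] (Set.range p)) :
    ∃ a b : ℕ, Nonempty ((P × (Fin a → B[T;T⁻¹])) ≃ₗ[B[T;T⁻¹]] (Fin b → B[T;T⁻¹])) := by
  have : Module.Free B B[T;T⁻¹] := inferInstance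
  have : Module.Flat B P := Module.Flat.trans B B[T;T⁻¹] P
  have := flat_quotient_span hp hq hs
  set F := Submodule.span B[T;T⁻¹] (Set.range p)
  have : Module.Finite B (P ⧸ F) := by
    refine finite_of_toLaurent_smul_eq_zero hq hq0 fun x => ?_
    obtain ⟨y, rfl⟩ := F.mkQ_surjective x
    rw [← map_smul, ← LinearMap.mem_ker, Submodule.ker_mkQ]
    exact hs y
  have : Module.FinitePresentation B (P ⧸ F) := Module.finitePresentation_of_finite B _
  have : Module.Projective B (P ⧸ F) := Module.Flat.projective_of_finitePresentation
  obtain ⟨a, b, ⟨e⟩⟩ := hB (P ⧸ F)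
  let Q := B[T;T⁻¹] ⊗[B] (P ⧸ F)
  let e1 : (Q × (Fin a → B[T;T⁻¹])) ≃ₗ[B[T;T⁻¹]] (Fin b → B[T;T⁻¹]) :=
    ((LinearEquiv.refl _ Q).prodCongr
      (TensorProduct.piScalarRight B B[T;T⁻¹] B[T;T⁻¹] (Fin a)).symm).trans
    (((TensorProduct.prodRight B B[T;T⁻¹] B[T;T⁻¹] (P ⧸ F) (Fin a → B)).symm).trans
      ((LinearEquiv.baseChange B B[T;T⁻¹] _ _ e).trans
        (TensorProduct.piScalarRight B B[T;T⁻¹] B[T;T⁻¹] (Fin b))))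
  obtain ⟨e2⟩ := exists_schanuel_equiv F.subtype F.mkQ (laurentRel B (P ⧸ F))
    ((LinearMap.id : (P ⧸ F) →ₗ[B] (P ⧸ F)).liftBaseChange B[T;T⁻¹]) F.injective_subtype
    F.mkQ_surjective (by
      intro x
      rw [← LinearMap.mem_ker, Submodule.ker_mkQ]
      simp) laurentRel_injective (fun x => ⟨1 ⊗ₜ x, by simp⟩) laurentRel_exact
  let e3 : F ≃ₗ[B[T;T⁻¹]] (Fin m → B[T;T⁻¹]) := (Module.Basis.span hp).equivFun
  refine ⟨b, m + b, ⟨?_⟩⟩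
  exact ((LinearEquiv.refl _ P).prodCongr e1.symm).trans
    ((LinearEquiv.prodAssoc _ P Q _).symm.trans
    ((((LinearEquiv.prodComm _ P Q).trans e2.symm).prodCongr (LinearEquiv.refl _ _)).trans
    ((LinearEquiv.prodAssoc _ F Q _).trans
    ((e3.prodCongr e1).trans (finProdEquiv _ m b)))))

end StablyFree

section StablyFreeLattice

open Matrix

universe u

open Polynomial LaurentPolynomial AddMonoidAlgebra

theorem exists_stablyFree_of_ringEquiv {A A' : Type u} [CommRing A] [CommRing A'] (e : A ≃+* A')
    (P : Type u) [AddCommGroup P] [Module A P] [Module A' P]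
    (he : ∀ (a : A) (x : P), e a • x = a • x) {a b : ℕ}
    (h : Nonempty ((P × (Fin a → A')) ≃ₗ[A'] (Fin b → A'))) :
    Nonempty ((P × (Fin a → A)) ≃ₗ[A] (Fin b → A)) := by
  obtain ⟨E⟩ := h
  let F : (P × (Fin a → A)) ≃+ (Fin b → A) :=
    (((AddEquiv.refl P).prodCongr (AddEquiv.piCongrRight fun _ => e.toAddEquiv)).trans
      E.toAddEquiv).trans (AddEquiv.piCongrRight fun _ => e.symm.toAddEquiv)
  refine ⟨{ F with map_smul' := fun c x => ?_ }⟩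
  have h1 : ((c • x).1, fun i => e ((c • x).2 i)) = e c • (x.1, fun i => e (x.2 i)) := by
    ext i
    · simp [he]
    · simp
  funext i
  change e.symm (E ((c • x).1, fun i => e ((c • x).2 i)) i) =
    c * e.symm (E (x.1, fun i => e (x.2 i)) i)
  rw [h1, map_smul, Pi.smul_apply, smul_eq_mul, map_mul, e.symm_apply_apply]

theorem exists_stablyFree_of_laurent {A B : Type u} [CommRing A] [CommRing B] [IsNoetherianRing B]
    (hB : StablyFreeRing B) (e : A ≃+* B[T;T⁻¹]) (P : Type u) [AddCommGroup P] [Module A P]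
    [Module.Finite A P] [Module.Projective A P]
    {m : ℕ} {p : Fin m → P} (hp : LinearIndependent A p) {q : B[X]} (hq : q.Monic)
    (hq0 : IsUnit (q.coeff 0)) (d : B[T;T⁻¹]ˣ) {f : A} (hf : e f = d * toLaurent q)
    (hs : ∀ x : P, f • x ∈ Submodule.span A (Set.range p)) :
    ∃ a b : ℕ, Nonempty ((P × (Fin a → A)) ≃ₗ[A] (Fin b → A)) := by
  let _ : Module B[T;T⁻¹] P := Module.compHom P e.symm.toRingHom
  let _ : Module B P := Module.compHom P (algebraMap B B[T;T⁻¹])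
  have he (a : A) (x : P) : e a • x = a • x := by
    change e.symm (e a) • x = a • x
    rw [e.symm_apply_apply]
  have : IsScalarTower B B[T;T⁻¹] P := by
    refine ⟨fun b c x => ?_⟩
    rw [Algebra.smul_def, mul_smul]
    rfl
  have : RingHomInvPair (e : A →+* B[T;T⁻¹]) (e.symm : B[T;T⁻¹] →+* A) :=
      RingHomInvPair.of_ringEquiv e
  have : RingHomInvPair (e.symm : B[T;T⁻¹] →+* A) (e : A →+* B[T;T⁻¹]) := this.symm
  let id' : P ≃ₛₗ[(e : A →+* B[T;T⁻¹])] P :=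
    { AddEquiv.refl P with map_smul' := fun a x => (he a x).symm }
  have : Module.Finite B[T;T⁻¹] P := Module.Finite.of_surjective id'.toLinearMap id'.surjective
  have : Module.Projective B[T;T⁻¹] P := Module.Projective.of_equiv id'
  have hp' : LinearIndependent B[T;T⁻¹] p :=
    hp.map_of_surjective_injective e (AddMonoidHom.id P) e.surjective (by simp)
      fun a x => (he a x).symm
  obtain ⟨a, b, h⟩ := exists_stablyFree_of_span hB hp' hq hq0 fun x => by
    have h1 : toLaurent q • x = (↑d⁻¹ : B[T;T⁻¹]) • f • x := by
      rw [← he f, hf, smul_smul, Units.inv_mul_cancel_left]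
    rw [h1]
    refine Submodule.smul_mem _ _ ?_
    have h2 := hs x
    refine Submodule.span_induction (p := fun y _ => y ∈ Submodule.span B[T;T⁻¹] (Set.range p))
      (fun y hy => Submodule.subset_span hy) (Submodule.zero_mem _)
      (fun _ _ _ _ => Submodule.add_mem _) (fun c y _ hy => ?_) h2
    rw [← he]
    exact Submodule.smul_mem _ _ hy
  exact ⟨a, b, exists_stablyFree_of_ringEquiv e P he h⟩

theorem exists_linearIndependent_smul_mem (A : Type*) [CommRing A] [IsDomain A] (P : Type*)
    [AddCommGroup P] [Module A P] [Module.Finite A P] :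
    ∃ (m : ℕ) (p : Fin m → P) (f : A), LinearIndependent A p ∧ f ≠ 0 ∧
      ∀ x : P, f • x ∈ Submodule.span A (Set.range p) := by
  classical
  obtain ⟨N, w, hw⟩ := Module.Finite.exists_fin (R := A) (M := P)
  obtain ⟨s, hs, hmax⟩ := exists_maximal_linearIndepOn A w
  choose! c hc0 hc using hmax
  let c' i := if i ∈ s then 1 else c i
  have hc' i : c' i • w i ∈ Submodule.span A (w '' s) := by
    by_cases hi : i ∈ s
    · simpa [c', hi] using Submodule.subset_span (Set.mem_image_of_mem w hi)
    · simpa [c', hi] using hc i hi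
  let σ := Fintype.equivFin s
  have hrange : Set.range (fun j => w (σ.symm j)) = w '' s := by
    ext x
    constructor
    · rintro ⟨j, rfl⟩
      exact ⟨_, (σ.symm j).2, rfl⟩
    · rintro ⟨i, hi, rfl⟩
      exact ⟨σ ⟨i, hi⟩, by simp⟩
  refine ⟨Fintype.card s, fun j => w (σ.symm j), ∏ i, c' i, ?_, ?_, fun x => ?_⟩
  · exact LinearIndependent.comp hs σ.symm σ.symm.injective
  · refine Finset.prod_ne_zero_iff.2 fun i _ => ?_
    by_cases hi : i ∈ s
    · simp [c', hi]
    · simpa [c', hi] using hc0 i hi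
  · rw [hrange]
    have hx : x ∈ Submodule.span A (Set.range w) := hw ▸ Submodule.mem_top
    refine Submodule.span_induction
      (p := fun y _ => (∏ i, c' i) • y ∈ Submodule.span A (w '' s)) ?_ (by simp)
      (fun y z _ _ hy hz => by rw [smul_add]; exact Submodule.add_mem _ hy hz)
      (fun a y _ hy => by rw [smul_comm]; exact Submodule.smul_mem _ _ hy) hx
    rintro _ ⟨i, rfl⟩
    rw [← Finset.mul_prod_erase _ _ (Finset.mem_univ i), mul_comm, mul_smul]
    exact Submodule.smul_mem _ _ (hc' i)

theorem stablyFreeRing_lattice (K : Type u) [Field K] (r : ℕ) :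
    StablyFreeRing K[Fin r → ℤ] := by
  induction r with
  | zero =>
    intro P _ _ _ _
    have : IsLocalRing K[Fin 0 → ℤ] := (AddMonoidAlgebra.uniqueRingEquiv _).symm.isLocalRing
    have : Module.Free K[Fin 0 → ℤ] P := Module.free_of_flat_of_isLocalRing
    exact ⟨0, _, ⟨LinearEquiv.prodUnique.trans (Module.finBasis K[Fin 0 → ℤ] P).equivFun⟩⟩
  | succ r ih =>
    intro P _ _ _ _
    obtain ⟨m, p, f, hp, hf, hs⟩ := exists_linearIndependent_smul_mem K[Fin (r + 1) → ℤ] P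
    obtain ⟨e, d, q, hq, hq0, hef⟩ := exists_laurent_bimonic hf
    have : IsNoetherianRing K[Fin r → ℤ] := Algebra.FiniteType.isNoetherianRing K _
    exact exists_stablyFree_of_laurent ih e P hp hq hq0 d hef hs

end StablyFreeLattice

section ProjectiveRank

open Matrix

universe u

open TensorProduct

theorem exists_equiv_of_prod {A P : Type*} [CommRing A] [AddCommGroup P] [Module A P] {b : ℕ}
    (hT : RowTransitive (Fin (b + 1)) A) (φ : (P × A) ≃ₗ[A] (Fin (b + 1) → A)) :
    Nonempty (P ≃ₗ[A] (Fin b → A)) := by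
  have huni : UniRow (φ (0, 1)) := by
    refine ⟨fun i => (φ.symm (Pi.single i 1)).2, ?_⟩
    have h1 : (φ.symm (φ (0, 1))).2 = 1 := by simp
    refine Eq.trans ?_ h1
    conv_rhs => rw [pi_eq_sum_univ' (φ (0, 1))]
    rw [map_sum, Prod.snd_sum]
    refine Finset.sum_congr rfl fun i _ => ?_
    rw [map_smul, Prod.smul_snd, smul_eq_mul, mul_comm]
  obtain ⟨g, -, hg⟩ := hT _ huni 0
  let ψ : (P × A) ≃ₗ[A] (Fin (b + 1) → A) :=
    φ.trans (LinearMap.GeneralLinearGroup.toLinearEquiv (Matrix.GeneralLinearGroup.toLin g))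
  have hψ (a : A) : ψ (0, a) = Pi.single 0 a := by
    have h2 : ψ (0, 1) = Pi.single 0 1 := hg
    have h1 : ((0, a) : P × A) = a • (0, 1) := by simp
    rw [h1, map_smul, h2, ← Pi.single_smul, smul_eq_mul, mul_one]
  have hcons (y : Fin (b + 1) → A) : y = Fin.cons 0 (fun i => y i.succ) + Pi.single 0 (y 0) := by
    funext i
    refine Fin.cases ?_ (fun i => ?_) i <;> simp
  let f : P →ₗ[A] (Fin b → A) :=
    (LinearMap.funLeft A A Fin.succ) ∘ₗ ψ.toLinearMap ∘ₗ LinearMap.inl A P A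
  have hf (p) (i) : f p i = ψ (p, 0) i.succ := rfl
  refine ⟨LinearEquiv.ofBijective f ⟨?_, fun y => ?_⟩⟩
  · rw [injective_iff_map_eq_zero]
    intro p hp
    have h1 : ψ (p, 0) = ψ (0, ψ (p, 0) 0) := by
      rw [hψ]
      funext i
      refine Fin.cases (by simp) (fun i => ?_) i
      rw [← hf, hp]
      simp
    simpa using congrArg Prod.fst (ψ.injective h1)
  · refine ⟨(ψ.symm (Fin.cons 0 y)).1, funext fun i => ?_⟩
    have h1 : ((ψ.symm (Fin.cons 0 y)).1, (0 : A)) =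
        ψ.symm (Fin.cons 0 y) - (0, (ψ.symm (Fin.cons 0 y)).2) := by
      ext <;> simp
    rw [hf, h1, map_sub, hψ]
    simp

theorem exists_equiv_of_prod_free {A P : Type*} [CommRing A] [AddCommGroup P] [Module A P]
    {a k : ℕ} (hk : 2 ≤ k) (hT : ∀ m, 3 ≤ m → RowTransitive (Fin m) A)
    (h : Nonempty ((P × (Fin a → A)) ≃ₗ[A] (Fin (k + a) → A))) :
    Nonempty (P ≃ₗ[A] (Fin k → A)) := by
  induction a with
  | zero =>
    obtain ⟨φ⟩ := h
    exact ⟨LinearEquiv.prodUnique.symm.trans φ⟩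
  | succ a ih =>
    obtain ⟨φ⟩ := h
    refine ih (exists_equiv_of_prod (b := k + a) (hT _ (by omega)) ?_)
    exact ((LinearEquiv.prodAssoc A P (Fin a → A) A).trans
      ((LinearEquiv.refl A P).prodCongr ((LinearEquiv.prodComm A _ _).trans
        (Fin.consLinearEquiv A (fun _ => A))))).trans φ

theorem rank_dualBasis {A P ν F : Type*} [CommRing A] [AddCommGroup P] [Module A P] [Fintype ν]
    [DecidableEq ν] [Field F] [Algebra A F] (x : ν → P) (f : ν → P →ₗ[A] A)
    (hfx : ∀ p, ∑ l, f l p • x l = p) :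
    ((Matrix.of fun l m => f l (x m)).map (algebraMap A F)).rank = Module.finrank F (F ⊗[A] P) := by
  let i : (F ⊗[A] P) →ₗ[F] (ν → F) :=
    (LinearMap.pi fun l => (Algebra.linearMap A F) ∘ₗ f l : P →ₗ[A] (ν → F)).liftBaseChange F
  let j : (ν → F) →ₗ[F] (F ⊗[A] P) := Fintype.linearCombination F fun l => (1 : F) ⊗ₜ[A] x l
  have hi (c : F) (p : P) (l : ν) : i (c ⊗ₜ p) l = c * algebraMap A F (f l p) := by
    simp [i]
  have hj (w : ν → F) : j w = ∑ l, w l ⊗ₜ[A] x l := by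
    simp [j, Fintype.linearCombination_apply, TensorProduct.smul_tmul']
  have hji (y : F ⊗[A] P) : j (i y) = y := by
    induction y using TensorProduct.induction_on with
    | zero => simp
    | add y z hy hz => rw [map_add, map_add, hy, hz]
    | tmul c p =>
      rw [hj]
      conv_rhs => rw [← hfx p, tmul_sum]
      refine Finset.sum_congr rfl fun l _ => ?_
      rw [hi, mul_comm, ← Algebra.smul_def, TensorProduct.smul_tmul]
  have hij : ((Matrix.of fun l m => f l (x m)).map (algebraMap A F)).mulVecLin = i ∘ₗ j := by
    refine LinearMap.ext fun w => funext fun l => ?_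
    rw [LinearMap.comp_apply, hj, map_sum, Finset.sum_apply]
    simp only [hi]
    simp [Matrix.mulVec, dotProduct, mul_comm]
  have hsurj : LinearMap.range j = ⊤ := LinearMap.range_eq_top.2 fun y => ⟨i y, hji y⟩
  rw [Matrix.rank, hij, LinearMap.range_comp, hsurj, Submodule.map_top]
  exact LinearMap.finrank_range_of_inj (Function.LeftInverse.injective hji)

theorem exists_factor_of_stablyFree {A : Type u} [CommRing A] [Nontrivial A]
    (hA : StablyFreeRing A) (hT : ∀ m, 3 ≤ m → RowTransitive (Fin m) A) {ν : Type} [Fintype ν]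
    [DecidableEq ν] {E : Matrix ν ν A} (hE : E * E = E) {k : ℕ} (hk : 2 ≤ k) (hr : HasRank E k) :
    ∃ (X : Matrix ν (Fin k) A) (Y : Matrix (Fin k) ν A), X * Y = E ∧ Y * X = 1 := by
  let P := LinearMap.range E.mulVecLin
  let π : (ν → A) →ₗ[A] P := E.mulVecLin.rangeRestrict
  have hEp (p : P) : E *ᵥ (p : ν → A) = p := by
    obtain ⟨_, w, rfl⟩ := p
    simp [hE]
  have hπ (p : P) : π p = p := Subtype.ext (hEp p)
  have : Module.Projective A P :=
    Module.Projective.of_split P.subtype π (LinearMap.ext hπ)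
  obtain ⟨a, b, ⟨φ⟩⟩ := hA P
  obtain ⟨I, hI⟩ := Ideal.exists_maximal A
  let _ : Field (A ⧸ I) := Ideal.Quotient.field I
  have h1 := rank_dualBasis (F := A ⧸ I) (fun m => π (Pi.single m 1))
    (fun l => LinearMap.proj l ∘ₗ P.subtype) (fun p => by
      have h2 := congrArg π (pi_eq_sum_univ' (p : ν → A))
      rw [hπ] at h2
      conv_rhs => rw [h2, map_sum]
      refine Finset.sum_congr rfl fun l _ => ?_
      rw [map_smul]
      congr 2)
  have h2 : (Matrix.of fun l m => (LinearMap.proj l ∘ₗ P.subtype) (π (Pi.single m 1))) = E := by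
    ext l m
    simp [π, P]
  rw [h2, hr _ (algebraMap A (A ⧸ I))] at h1
  have h3 : Module.finrank (A ⧸ I) ((A ⧸ I) ⊗[A] (P × (Fin a → A))) =
      Module.finrank (A ⧸ I) ((A ⧸ I) ⊗[A] (Fin b → A)) :=
    (LinearEquiv.baseChange A (A ⧸ I) _ _ φ).finrank_eq
  rw [(TensorProduct.prodRight A (A ⧸ I) (A ⧸ I) P (Fin a → A)).finrank_eq, Module.finrank_prod,
    ← h1, Module.finrank_baseChange, Module.finrank_baseChange, Module.finrank_fin_fun,
    Module.finrank_fin_fun] at h3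
  subst h3
  obtain ⟨ψ⟩ := exists_equiv_of_prod_free hk hT ⟨φ⟩
  refine ⟨LinearMap.toMatrix' (P.subtype ∘ₗ ψ.symm.toLinearMap),
    LinearMap.toMatrix' (ψ.toLinearMap ∘ₗ π), ?_, ?_⟩
  · rw [← LinearMap.toMatrix'_comp]
    have : (P.subtype ∘ₗ ψ.symm.toLinearMap) ∘ₗ ψ.toLinearMap ∘ₗ π = E.mulVecLin := by
      ext
      simp [π]
    rw [this]
    exact LinearMap.toMatrix'_toLin' E
  · rw [← LinearMap.toMatrix'_comp]
    have : (ψ.toLinearMap ∘ₗ π) ∘ₗ P.subtype ∘ₗ ψ.symm.toLinearMap = LinearMap.id := by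
      refine LinearMap.ext fun w => ?_
      simp [hπ]
    rw [this, LinearMap.toMatrix'_id]

end ProjectiveRank

section GenericFactorization

open Matrix

universe u

open AddMonoidAlgebra

variable {R : Type u} [CommRing R] {n : ℕ} {M : AddSubmonoid (Fin n →₀ ℕ)}

theorem exists_full_support {c : ℕ} (hc : 0 < c) (hcM : ∀ i, Finsupp.single i c ∈ M) :
    ∃ w : M, ∀ i, 0 < (w : Fin n →₀ ℕ) i := by
  refine ⟨⟨∑ i, Finsupp.single i c, M.sum_mem fun i _ => hcM i⟩, fun i => ?_⟩
  simp only [Finsupp.coe_finsetSum, Finset.sum_apply]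
  exact hc.trans_le ((by simp : c ≤ Finsupp.single i c i).trans
    (Finset.single_le_sum (f := fun j => Finsupp.single j c i) (fun _ _ => Nat.zero_le _)
      (Finset.mem_univ i)))

theorem exists_lattice_embedding (M : AddSubmonoid (Fin n →₀ ℕ)) :
    ∃ (r : ℕ) (θ : M →+ (Fin r → ℤ)), Function.Injective θ ∧ ∀ g, ∃ a b, g + θ b = θ a := by
  let G : Submodule ℤ (Fin n → ℤ) := Submodule.span ℤ (castHom n '' M)
  let e := (Module.finBasis ℤ G).equivFun
  let θ₀ : M →+ G :=
    { toFun := fun x => ⟨castHom n x, Submodule.subset_span ⟨x, x.2, rfl⟩⟩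
      map_zero' := by ext; simp
      map_add' := fun x y => by ext; simp }
  refine ⟨_, e.toLinearMap.toAddMonoidHom.comp θ₀, ?_, fun g => ?_⟩
  · refine e.injective.comp fun x y hxy => ?_
    have h1 : castHom n x = castHom n y := congrArg Subtype.val hxy
    refine Subtype.ext (Finsupp.ext fun i => ?_)
    exact Int.ofNat_inj.1 (congrFun h1 i)
  · have h2 (y : Fin n → ℤ) (hy : y ∈ G) :
        ∃ a b : M, y + castHom n (b : Fin n →₀ ℕ) = castHom n (a : Fin n →₀ ℕ) := by
      have hadd : ∀ y z : Fin n → ℤ,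
          (∃ a b : M, y + castHom n (b : Fin n →₀ ℕ) = castHom n (a : Fin n →₀ ℕ)) →
          (∃ a b : M, z + castHom n (b : Fin n →₀ ℕ) = castHom n (a : Fin n →₀ ℕ)) →
          ∃ a b : M, y + z + castHom n (b : Fin n →₀ ℕ) = castHom n (a : Fin n →₀ ℕ) := by
        rintro y z ⟨a, b, h⟩ ⟨a', b', h'⟩
        refine ⟨a + a', b + b', ?_⟩
        push_cast
        rw [map_add, map_add, ← h, ← h']
        abel
      have hG : y ∈ AddSubgroup.closure (castHom n '' M) := by
        rw [← Submodule.span_int_eq_addSubgroupClosure]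
        exact hy
      clear hy
      induction hG using AddSubgroup.closure_induction with
      | mem y hy =>
        obtain ⟨x, hx, rfl⟩ := hy
        exact ⟨⟨x, hx⟩, 0, by simp⟩
      | zero => exact ⟨0, 0, by simp⟩
      | add y z hy hz h h' =>
        exact hadd y z h h'
      | neg y hy h =>
        obtain ⟨a, b, hab⟩ := h
        exact ⟨b, a, by rw [← hab]; abel⟩
    obtain ⟨a, b, hab⟩ := h2 (e.symm g : G) (e.symm g).2
    refine ⟨a, b, ?_⟩
    have h3 : e.symm g + θ₀ b = θ₀ a := Subtype.ext hab
    have h4 := congrArg e h3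
    rw [map_add, e.apply_symm_apply] at h4
    exact h4

theorem exists_generic_hom (M : AddSubmonoid (Fin n →₀ ℕ)) (𝔭 : Ideal R) [𝔭.IsPrime] :
    ∃ (K : Type u) (_ : Field K) (r : ℕ) (h : R[M] →+* K[Fin r → ℤ]),
      (∀ x, h x = 0 → ∀ m, x.coeff m ∈ 𝔭) ∧
      ∀ y, ∃ (b : M) (q : R) (x : R[M]), q ∉ 𝔭 ∧ y * h (single b q) = h x := by
  obtain ⟨r, θ, hθ, hθ'⟩ := exists_lattice_embedding M
  let K := FractionRing (R ⧸ 𝔭)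
  let φ : R →+* K := (algebraMap (R ⧸ 𝔭) K).comp (Ideal.Quotient.mk 𝔭)
  have hφ (a : R) : φ a = 0 ↔ a ∈ 𝔭 := by
    rw [← Ideal.Quotient.eq_zero_iff_mem]
    exact map_eq_zero_iff _ (IsFractionRing.injective (R ⧸ 𝔭) K)
  let h : R[M] →+* K[Fin r → ℤ] := (AddMonoidAlgebra.mapRingHom _ φ).comp (expMap R θ)
  have hs (m : M) (a : R) : h (single m a) = single (θ m) (φ a) := by
    change AddMonoidAlgebra.mapRingHom _ φ (expMap R θ (single m a)) = _
    rw [expMap_single, mapRingHom_single]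
  refine ⟨K, inferInstance, r, h, fun x hx m => ?_, fun y => ?_⟩
  · rw [← hφ, ← coeff_expMap hθ, ← coeff_mapRingHom]
    change (h x).coeff (θ m) = 0
    rw [hx]
    rfl
  · induction y using AddMonoidAlgebra.induction_linear with
    | zero => exact ⟨0, 1, 0, fun h1 => Ideal.IsPrime.ne_top' ((Ideal.eq_top_iff_one _).2 h1),
        by simp⟩
    | add y z hy hz =>
      obtain ⟨b, q, x, hq, hx⟩ := hy
      obtain ⟨b', q', x', hq', hx'⟩ := hz
      refine ⟨b + b', q * q', x * single b' q' + x' * single b q,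
        fun h1 => (Ideal.IsPrime.mem_or_mem ‹_› h1).elim hq hq', ?_⟩
      rw [← single_mul_single, map_mul, map_add, map_mul, map_mul, ← hx, ← hx']
      ring
    | single g κ =>
      obtain ⟨p, q, hq, hpq⟩ := IsFractionRing.div_surjective (R ⧸ 𝔭) κ
      obtain ⟨p, rfl⟩ := Ideal.Quotient.mk_surjective p
      obtain ⟨q, rfl⟩ := Ideal.Quotient.mk_surjective q
      obtain ⟨a, b, hab⟩ := hθ' g
      have hq0 : φ q ≠ 0 := fun h1 => by
        have := nonZeroDivisors.ne_zero hq
        exact this (Ideal.Quotient.eq_zero_iff_mem.2 ((hφ q).1 h1))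
      refine ⟨b, q, single a p, fun h1 => hq0 ((hφ q).2 h1), ?_⟩
      rw [hs, hs, single_mul_single, hab, ← hpq]
      congr 1
      exact div_mul_cancel₀ _ hq0

theorem exists_common_denominator {A A' : Type*} [CommRing A] [CommRing A'] (h : A →+* A')
    (S : Submonoid A) (hS : ∀ y, ∃ s ∈ S, ∃ x, y * h s = h x) {α : Type*} [Fintype α]
    (y : α → A') : ∃ s ∈ S, ∃ x : α → A, ∀ i, y i * h s = h (x i) := by
  classical
  choose s hs x hx using hS
  refine ⟨∏ i, s (y i), S.prod_mem fun i _ => hs _,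
    fun i => x (y i) * ∏ j ∈ Finset.univ.erase i, s (y j), fun i => ?_⟩
  rw [map_mul, ← hx, ← Finset.mul_prod_erase _ _ (Finset.mem_univ i), map_mul, mul_assoc]

variable {ν : Type} [Fintype ν] [DecidableEq ν]

theorem exists_factor_mod_prime {c : ℕ} (hc : 0 < c) (hcM : ∀ i, Finsupp.single i c ∈ M)
    {E : Matrix ν ν R[M]} (hE : E * E = E) {k : ℕ} (hk : 2 ≤ k) (hr : HasRank E k)
    (𝔭 : Ideal R) [𝔭.IsPrime] :
    ∃ (X : Matrix ν (Fin k) R[M]) (Y : Matrix (Fin k) ν R[M]) (v : M) (d : R), d ∉ 𝔭 ∧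
      (∀ i, 0 < (v : Fin n →₀ ℕ) i) ∧ E * X = X ∧ Y * E = Y ∧
      (∀ i j x, ((Y * X - (AddMonoidAlgebra.single v d : R[M]) • (1 : Matrix (Fin k) (Fin k) R[M]))
      i j).coeff x ∈ 𝔭) ∧
      (∀ i j x, ((X * Y - (AddMonoidAlgebra.single v d : R[M]) • E) i j).coeff x ∈ 𝔭) := by
  obtain ⟨K, _, r, h, hker, hden⟩ := exists_generic_hom M 𝔭
  have hE' : E.map h * E.map h = E.map h := by rw [← Matrix.map_mul, hE]
  obtain ⟨X, Y, hXY, hYX⟩ := exists_factor_of_stablyFree (stablyFreeRing_lattice K r)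
    (fun m hm => rowTransitive_lattice (by simpa using hm) K r) hE' hk (hr.map h)
  let S : Submonoid R[M] :=
    { carrier := {s | ∃ (b : M) (q : R), q ∉ 𝔭 ∧ s = AddMonoidAlgebra.single b q}
      one_mem' := ⟨0, 1, fun h1 => Ideal.IsPrime.ne_top' ((Ideal.eq_top_iff_one _).2 h1), rfl⟩
      mul_mem' := by
        rintro _ _ ⟨b, q, hq, rfl⟩ ⟨b', q', hq', rfl⟩
        exact ⟨b + b', q * q', fun h1 => (Ideal.IsPrime.mem_or_mem ‹_› h1).elim hq hq',
          single_mul_single _ _ _ _⟩ }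
  have hS : ∀ y, ∃ s ∈ S, ∃ x, y * h s = h x := fun y => by
    obtain ⟨b, q, x, hq, hx⟩ := hden y
    exact ⟨_, ⟨b, q, hq, rfl⟩, x, hx⟩
  obtain ⟨s, hs, x, hx⟩ := exists_common_denominator h S hS
    (fun p : ν × Fin k => X p.1 p.2)
  obtain ⟨t, ht, y, hy⟩ := exists_common_denominator h S hS
    (fun p : Fin k × ν => Y p.1 p.2)
  obtain ⟨w, hw⟩ := exists_full_support hc hcM
  obtain ⟨b, q, hq, hbq⟩ := S.mul_mem hs ht
  have hX : (Matrix.of fun i j => x (i, j)).map h = h s • X := by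
    ext1 i j
    simpa [mul_comm] using (hx (i, j)).symm
  have hY : (Matrix.of fun i j => y (i, j)).map h = h t • Y := by
    ext1 i j
    simpa [mul_comm] using (hy (i, j)).symm
  set X₀ : Matrix ν (Fin k) R[M] := Matrix.of fun i j => x (i, j)
  set Y₀ : Matrix (Fin k) ν R[M] := Matrix.of fun i j => y (i, j)
  have hst : (AddMonoidAlgebra.single (b + w) q : R[M]) = s * t * AddMonoidAlgebra.single w 1 := by
    rw [hbq, single_mul_single, mul_one]
  have hEX : E.map h * X = X := by rw [← hXY, Matrix.mul_assoc, hYX, Matrix.mul_one]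
  have hYE : Y * E.map h = Y := by rw [← hXY, ← Matrix.mul_assoc, hYX, Matrix.one_mul]
  have hsm {α β : Type} (a : R[M]) (Z : Matrix α β R[M]) : (a • Z).map h = h a • Z.map h := by
    ext1 i j
    simp
  refine ⟨E * X₀, (AddMonoidAlgebra.single w 1 : R[M]) • (Y₀ * E), b + w, q, hq,
    fun i => ?_, ?_, ?_, ?_, ?_⟩
  · exact Nat.lt_of_lt_of_le (hw i) (Nat.le_add_left _ _)
  · rw [← Matrix.mul_assoc, hE]
  · rw [Matrix.smul_mul, Matrix.mul_assoc, hE]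
  · intro i j
    refine hker _ ?_
    have h1 : ((AddMonoidAlgebra.single w 1 : R[M]) • (Y₀ * E) * (E * X₀) -
        (AddMonoidAlgebra.single (b + w) q : R[M]) • 1).map h =
        0 := by
      rw [Matrix.map_sub _ (map_sub h), Matrix.map_mul,
        hsm,
        hsm, Matrix.map_mul, Matrix.map_mul, hX, hY,
        Matrix.map_one _ (map_zero h) (map_one h), hst, map_mul, map_mul]
      simp only [Matrix.smul_mul, Matrix.mul_smul, hYE, hEX, hYX, smul_smul]
      rw [sub_eq_zero]
      congr 1
      ring
    exact congrFun (congrFun h1 i) j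
  · intro i j
    refine hker _ ?_
    have h1 : (E * X₀ * ((AddMonoidAlgebra.single w 1 : R[M]) • (Y₀ * E)) -
        (AddMonoidAlgebra.single (b + w) q : R[M]) • E).map h =
        0 := by
      rw [Matrix.map_sub _ (map_sub h), Matrix.map_mul, Matrix.map_mul, hX,
        hsm,
        hsm, Matrix.map_mul, hY, hst, map_mul, map_mul]
      simp only [Matrix.smul_mul, Matrix.mul_smul, hYE, hEX, hXY, smul_smul]
      rw [sub_eq_zero]
      congr 1
      ring
    exact congrFun (congrFun h1 i) j

end GenericFactorization

section ReducedFactorization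

open Matrix

universe u

open AddMonoidAlgebra

variable {R : Type u} [CommRing R] {n : ℕ} {M : AddSubmonoid (Fin n →₀ ℕ)}

theorem mapRingHom_mk_eq_zero {N : Type*} [AddCommMonoid N] (I : Ideal R) (z : R[N]) :
    mapRingHom N (Ideal.Quotient.mk I) z = 0 ↔ ∀ x, z.coeff x ∈ I := by
  constructor
  · intro h x
    rw [← Ideal.Quotient.eq_zero_iff_mem, ← coeff_mapRingHom, h]
    rfl
  · intro h
    refine AddMonoidAlgebra.ext (Finsupp.ext fun x => ?_)
    rw [coeff_mapRingHom, Ideal.Quotient.eq_zero_iff_mem.2 (h x)]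
    rfl

theorem eq_zero_of_forall_minimalPrimes [IsReduced R] {N : Type*} [AddCommMonoid N] {z : R[N]}
    (h : ∀ p ∈ minimalPrimes R, mapRingHom N (Ideal.Quotient.mk p) z = 0) : z = 0 := by
  refine AddMonoidAlgebra.ext (Finsupp.ext fun x => ?_)
  have h1 : z.coeff x ∈ nilradical R := by
    rw [nilradical, ← Ideal.sInf_minimalPrimes, Submodule.mem_sInf]
    exact fun p hp => (mapRingHom_mk_eq_zero p z).1 (h p hp) x
  rw [nilradical_eq_zero] at h1
  exact h1

theorem exists_separating [IsNoetherianRing R] (p : minimalPrimes R) :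
    ∃ c : R, c ∉ p.1 ∧ ∀ q : minimalPrimes R, q ≠ p → c ∈ q.1 := by
  classical
  have := (minimalPrimes.finite_of_isNoetherianRing R).fintype
  have hp : p.1.IsPrime := p.2.1.1
  by_contra! hcon
  have h1 : (Finset.univ.erase p).inf (fun q : minimalPrimes R => q.1) ≤ p.1 := by
    intro c hc
    by_contra hcp
    obtain ⟨q, hq, hcq⟩ := hcon c hcp
    exact hcq (Finset.inf_le (f := fun q : minimalPrimes R => q.1)
      (Finset.mem_erase.2 ⟨hq, Finset.mem_univ q⟩) hc)
  obtain ⟨q, hq, hqp⟩ := hp.inf_le'.1 h1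
  exact (Finset.mem_erase.1 hq).1 (Subtype.ext (le_antisymm hqp (p.2.2 q.2.1 hqp)))

variable {ν : Type} [Fintype ν] [DecidableEq ν]

theorem exists_generic_factor [IsNoetherianRing R] [IsReduced R] {c : ℕ} (hc : 0 < c)
    (hcM : ∀ i, Finsupp.single i c ∈ M) {E : Matrix ν ν R[M]} (hE : E * E = E) {k : ℕ}
    (hk : 2 ≤ k) (hr : HasRank E k) :
    ∃ (X : Matrix ν (Fin k) R[M]) (Y : Matrix (Fin k) ν R[M]) (v : M) (d : R),
      d ∈ nonZeroDivisors R ∧ (∀ i, 0 < (v : Fin n →₀ ℕ) i) ∧ E * X = X ∧ Y * E = Y ∧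
      Y * X = (AddMonoidAlgebra.single v d : R[M]) • (1 : Matrix (Fin k) (Fin k) R[M]) ∧
      X * Y = (AddMonoidAlgebra.single v d : R[M]) • E := by
  classical
  let _ := (minimalPrimes.finite_of_isNoetherianRing R).fintype
  have h1 (p : minimalPrimes R) := by
    have : p.1.IsPrime := p.2.1.1
    exact exists_factor_mod_prime hc hcM hE hk hr p.1
  choose X Y v d hd hv hEX hYE hYX hXY using h1
  choose e he heq using exists_separating (R := R)
  obtain ⟨w, hw⟩ := exists_full_support hc hcM
  let V : M := w + ∑ p, v p
  let V' (p : minimalPrimes R) : M := w + ∑ q ∈ Finset.univ.erase p, v q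
  have hV p : V' p + v p = V := by
    rw [add_assoc, Finset.sum_erase_add _ _ (Finset.mem_univ p)]
  let X' : Matrix ν (Fin k) R[M] := ∑ p, (AddMonoidAlgebra.single (V' p) (e p) : R[M]) • X p
  let Y' : Matrix (Fin k) ν R[M] := ∑ p, (AddMonoidAlgebra.single 0 (e p) : R[M]) • Y p
  let D : R := ∑ p, e p * e p * d p
  let f (p : minimalPrimes R) : R[M] →+* (R ⧸ p.1)[M] := mapRingHom M (Ideal.Quotient.mk p.1)
  have hf p (m : M) (a : R) (ha : a ∈ p.1) : f p (AddMonoidAlgebra.single m a) = 0 := by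
    rw [mapRingHom_single, Ideal.Quotient.eq_zero_iff_mem.2 ha, AddMonoidAlgebra.single_zero]
  have hfe p (m : M) q (hq : p ≠ q) : f p (AddMonoidAlgebra.single m (e q)) = 0 :=
    hf p m _ (heq q p hq)
  have hsm {α β : Type} (p) (a : R[M]) (Z : Matrix α β R[M]) :
      (a • Z).map (f p) = f p a • Z.map (f p) := by
    ext1 i j
    simp
  have hsum {α β : Type} (p) (Z : minimalPrimes R → Matrix α β R[M]) :
      (∑ q, Z q).map (f p) = ∑ q, (Z q).map (f p) :=
    map_sum (RingHom.toAddMonoidHom (f p)).mapMatrix Z Finset.univ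
  have hX p : X'.map (f p) = f p (AddMonoidAlgebra.single (V' p) (e p)) • (X p).map (f p) := by
    rw [hsum, Finset.sum_eq_single p, hsm]
    · intro q _ hq
      rw [hsm, hfe p _ q hq.symm, zero_smul]
    · simp
  have hY p : Y'.map (f p) = f p (AddMonoidAlgebra.single 0 (e p)) • (Y p).map (f p) := by
    rw [hsum, Finset.sum_eq_single p, hsm]
    · intro q _ hq
      rw [hsm, hfe p _ q hq.symm, zero_smul]
    · simp
  have hDmk (p : minimalPrimes R) :
      Ideal.Quotient.mk p.1 D = Ideal.Quotient.mk p.1 (e p * e p * d p) := by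
    rw [map_sum, Finset.sum_eq_single p]
    · intro q _ hq
      exact Ideal.Quotient.eq_zero_iff_mem.2 (Ideal.mul_mem_right _ _
        (Ideal.mul_mem_right _ _ (heq q p hq.symm)))
    · simp
  have hD p : f p (AddMonoidAlgebra.single V D) = f p (AddMonoidAlgebra.single (V' p) (e p)) *
      f p (AddMonoidAlgebra.single 0 (e p)) * f p (AddMonoidAlgebra.single (v p) (d p)) := by
    rw [← map_mul, ← map_mul, single_mul_single, single_mul_single, add_zero, hV,
      mapRingHom_single, mapRingHom_single, hDmk]
  have hYX' p : (Y p * X p).map (f p) = f p (AddMonoidAlgebra.single (v p) (d p)) • 1 := by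
    have h2 : (Y p * X p - (AddMonoidAlgebra.single (v p) (d p) : R[M]) •
        (1 : Matrix (Fin k) (Fin k) R[M])).map (f p) = 0 := by
      ext1 i j
      exact (mapRingHom_mk_eq_zero _ _).2 (hYX p i j)
    rw [Matrix.map_sub _ (map_sub (f p)), hsm, Matrix.map_one _ (map_zero (f p)) (map_one (f p)),
      sub_eq_zero] at h2
    exact h2
  have hXY' p : (X p * Y p).map (f p) =
      f p (AddMonoidAlgebra.single (v p) (d p)) • E.map (f p) := by
    have h2 : (X p * Y p - (AddMonoidAlgebra.single (v p) (d p) : R[M]) • E).map (f p) = 0 := by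
      ext1 i j
      exact (mapRingHom_mk_eq_zero _ _).2 (hXY p i j)
    rw [Matrix.map_sub _ (map_sub (f p)), hsm, sub_eq_zero] at h2
    exact h2
  have hext {α β : Type} (Z Z' : Matrix α β R[M]) (h : ∀ p, Z.map (f p) = Z'.map (f p)) :
      Z = Z' := by
    ext1 i j
    refine sub_eq_zero.1 (eq_zero_of_forall_minimalPrimes fun p hp => ?_)
    rw [map_sub, sub_eq_zero]
    exact congrFun (congrFun (h ⟨p, hp⟩) i) j
  refine ⟨X', Y', V, D, ?_, fun i => ?_, ?_, ?_, hext _ _ fun p => ?_, hext _ _ fun p => ?_⟩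
  · rw [mem_nonZeroDivisors_iff_right]
    intro x hx
    have h2 : x ∈ nilradical R := by
      rw [nilradical, ← Ideal.sInf_minimalPrimes, Submodule.mem_sInf]
      intro q hq
      let p : minimalPrimes R := ⟨q, hq⟩
      have hp : p.1.IsPrime := p.2.1.1
      have h3 : Ideal.Quotient.mk p.1 (x * D) = 0 := by rw [hx, map_zero]
      rw [map_mul, hDmk, ← map_mul, Ideal.Quotient.eq_zero_iff_mem] at h3
      refine (hp.mem_or_mem h3).resolve_right fun h4 => ?_
      rcases hp.mem_or_mem h4 with h5 | h5
      · exact (hp.mem_or_mem h5).elim (he p) (he p)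
      · exact hd p h5
    rw [nilradical_eq_zero] at h2
    exact h2
  · exact Nat.lt_of_lt_of_le (hw i) (Nat.le_add_right _ _)
  · simp only [X', Matrix.mul_sum, Matrix.mul_smul, hEX]
  · simp only [Y', Matrix.sum_mul, Matrix.smul_mul, hYE]
  · rw [Matrix.map_mul, hX, hY, hsm, Matrix.map_one _ (map_zero (f p)) (map_one (f p)), hD,
      Matrix.smul_mul, Matrix.mul_smul, ← Matrix.map_mul, hYX', smul_smul, smul_smul]
    congr 1
    ring
  · rw [Matrix.map_mul, hX, hY, hsm, hD,
      Matrix.smul_mul, Matrix.mul_smul, ← Matrix.map_mul, hXY', smul_smul, smul_smul, mul_assoc]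

end ReducedFactorization

section DeepIdeal

open Matrix

universe u

open AddMonoidAlgebra

variable {R : Type u} [CommRing R] {n : ℕ} {M : AddSubmonoid (Fin n →₀ ℕ)}

/-- The ideal spanned by the terms with coefficient in `C` and all exponents at least `K`. -/
def deepIdeal (C : Ideal R) (K : ℕ) (M : AddSubmonoid (Fin n →₀ ℕ)) : Ideal R[M] where
  carrier := {x | ∀ m : M, x.coeff m ≠ 0 → x.coeff m ∈ C ∧ ∀ i, K ≤ (m : Fin n →₀ ℕ) i}
  zero_mem' := fun m hm => absurd rfl hm
  add_mem' := by
    intro x y hx hy m hm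
    rw [AddMonoidAlgebra.coeff_add, Finsupp.add_apply] at hm ⊢
    by_cases h1 : x.coeff m = 0
    · rw [h1, zero_add] at hm ⊢
      exact hy m hm
    · by_cases h2 : y.coeff m = 0
      · rw [h2, add_zero]
        exact hx m h1
      · exact ⟨C.add_mem (hx m h1).1 (hy m h2).1, (hx m h1).2⟩
  smul_mem' := by
    intro a x hx m hm
    rw [smul_eq_mul] at hm ⊢
    have h1 : ∀ m : M, (a * x).coeff m ∈ C := by
      intro m
      rw [← Ideal.Quotient.eq_zero_iff_mem, ← coeff_mapRingHom, map_mul,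
        (mapRingHom_mk_eq_zero C x).2 fun y => ?_, mul_zero]
      · rfl
      · by_cases hy : x.coeff y = 0
        · rw [hy]
          exact C.zero_mem
        · exact (hx y hy).1
    refine ⟨h1 m, fun i => ?_⟩
    obtain ⟨y, z, -, hz, rfl⟩ := exists_of_coeff_mul_ne_zero hm
    exact ((hx z hz).2 i).trans (Nat.le_add_left _ _)

theorem single_mem_deepIdeal {C : Ideal R} {K : ℕ} {m : M} {a : R} (ha : a ∈ C)
    (hm : ∀ i, K ≤ (m : Fin n →₀ ℕ) i) : single m a ∈ deepIdeal C K M := by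
  intro m' hm'
  rw [coeff_single, Finsupp.single_apply] at hm' ⊢
  split_ifs at hm' ⊢ with h
  · exact ⟨ha, h ▸ hm⟩
  · exact absurd rfl hm'

theorem deepIdeal_mono {C C' : Ideal R} (h : C ≤ C') (K : ℕ) :
    deepIdeal C K M ≤ deepIdeal C' K M := fun _ hx m hm => ⟨h (hx m hm).1, (hx m hm).2⟩

theorem deepIdeal_mul_le (C C' : Ideal R) (K K' : ℕ) :
    deepIdeal C K M * deepIdeal C' K' M ≤ deepIdeal (C * C') (K + K') M := by
  rw [Ideal.mul_le]
  intro x hx y hy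
  have h1 : x ∈ (deepIdeal (C * C') (K + K') M).toAddSubmonoid.comap (AddMonoidHom.mulRight y) := by
    refine mem_of_single_mem _ fun m hm => ?_
    have h2 : y ∈ (deepIdeal (C * C') (K + K') M).toAddSubmonoid.comap
        (AddMonoidHom.mulLeft (single m (x.coeff m))) := by
      refine mem_of_single_mem _ fun m' hm' => ?_
      change single m (x.coeff m) * single m' (y.coeff m') ∈ deepIdeal (C * C') (K + K') M
      rw [single_mul_single]
      exact single_mem_deepIdeal (Ideal.mul_mem_mul (hx m hm).1 (hy m' hm').1)
        fun i => Nat.add_le_add ((hx m hm).2 i) ((hy m' hm').2 i)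
    exact h2
  exact h1

theorem deepIdeal_pow_le (C : Ideal R) (K : ℕ) : deepIdeal C 1 M ^ K ≤ deepIdeal (C ^ K) K M := by
  induction K with
  | zero =>
    intro x _ m _
    simp
  | succ K ih =>
    rw [pow_succ, pow_succ]
    exact (Ideal.mul_mono_left ih).trans (deepIdeal_mul_le _ _ _ _)

theorem exists_lift_deepIdeal (C : Ideal R) {t : (R ⧸ C)[M]} (ht : t ∈ deepIdeal ⊤ 1 M) :
    ∃ s ∈ deepIdeal (⊤ : Ideal R) 1 M, mapRingHom M (Ideal.Quotient.mk C) s = t := by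
  classical
  let σ : R ⧸ C → R := fun y => if y = 0 then 0 else Function.surjInv Ideal.Quotient.mk_surjective y
  have hσ0 : σ 0 = 0 := if_pos rfl
  have hσ y : Ideal.Quotient.mk C (σ y) = y := by
    by_cases hy : y = 0
    · rw [hy, hσ0, map_zero]
    · simp only [σ, if_neg hy]
      exact Function.surjInv_eq _ _
  let s : R[M] := ofCoeff (Finsupp.mapRange σ hσ0 t.coeff)
  have hs m : s.coeff m = σ (t.coeff m) := rfl
  refine ⟨s, fun m hm => ⟨trivial, (ht m fun h => hm ?_).2⟩, ?_⟩
  · rw [hs, h, hσ0]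
  · refine AddMonoidAlgebra.ext (Finsupp.ext fun m => ?_)
    rw [coeff_mapRingHom, hs, hσ]

theorem mem_deepIdeal_of_map_eq_zero {C : Ideal R} {x : R[M]} (hx : x ∈ deepIdeal (⊤ : Ideal R) 1 M)
    (h : mapRingHom M (Ideal.Quotient.mk C) x = 0) : x ∈ deepIdeal C 1 M :=
  fun m hm => ⟨(mapRingHom_mk_eq_zero C x).1 h m, (hx m hm).2⟩

theorem map_mem_deepIdeal (C : Ideal R) {x : R[M]} (hx : x ∈ deepIdeal (⊤ : Ideal R) 1 M) :
    mapRingHom M (Ideal.Quotient.mk C) x ∈ deepIdeal (⊤ : Ideal (R ⧸ C)) 1 M := by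
  intro m hm
  refine ⟨trivial, (hx m fun h => hm ?_).2⟩
  rw [coeff_mapRingHom, h, map_zero]

theorem exists_dvd_of_mem_deepIdeal {c : ℕ} (hc : 0 < c) (hcM : ∀ i, Finsupp.single i c ∈ M)
    (v : M) (a : R) : ∃ K₀, ∀ K, K₀ ≤ K → ∀ x ∈ deepIdeal (Ideal.span {a} ^ K) K M,
      single v a ^ 5 ∣ x := by
  obtain ⟨b, hb⟩ := exists_deep_bound hc hcM
  refine ⟨b + 5 + 5 * ∑ i, (v : Fin n →₀ ℕ) i, fun K hK x hx => ?_⟩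
  rw [← Ideal.mem_span_singleton]
  refine mem_of_single_mem _ fun m hm => ?_
  obtain ⟨h1, h2⟩ := hx m hm
  rw [Ideal.span_singleton_pow, Ideal.mem_span_singleton] at h1
  obtain ⟨y, hy⟩ := h1
  have hv i : (v : Fin n →₀ ℕ) i ≤ ∑ i, (v : Fin n →₀ ℕ) i :=
    Finset.single_le_sum (f := fun i => (v : Fin n →₀ ℕ) i) (fun _ _ => Nat.zero_le _)
      (Finset.mem_univ i)
  have hle : 5 • (v : Fin n →₀ ℕ) ≤ (m : Fin n →₀ ℕ) := by
    intro i
    have := hv i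
    have := h2 i
    simp only [Finsupp.smul_apply, smul_eq_mul]
    omega
  obtain ⟨z, hz⟩ := exists_add_of_le hle
  have hzM : z ∈ M := by
    refine hb z ?_ fun i => ?_
    · have h3 : castHom n z = castHom n (m : Fin n →₀ ℕ) - castHom n
          ((5 • v : M) : Fin n →₀ ℕ) := by
        rw [hz, map_add, AddSubmonoidClass.coe_nsmul]
        abel
      rw [h3]
      exact AddSubgroup.sub_mem _ (AddSubgroup.subset_closure ⟨_, m.2, rfl⟩)
        (AddSubgroup.subset_closure ⟨_, (5 • v : M).2, rfl⟩)
    · have h3 := hv i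
      have h4 := h2 i
      have h5 := DFunLike.congr_fun hz i
      simp only [Finsupp.add_apply, Finsupp.smul_apply, smul_eq_mul] at h5
      omega
  have hm' : m = 5 • v + ⟨z, hzM⟩ := Subtype.ext (by rw [hz]; rfl)
  have h6 : single m (x.coeff m) = single v a ^ 5 * single ⟨z, hzM⟩ (a ^ (K - 5) * y) := by
    rw [single_pow, single_mul_single, ← hm', hy, ← mul_assoc, ← pow_add]
    congr 3
    omega
  rw [Ideal.mem_span_singleton]
  exact ⟨_, h6⟩

end DeepIdeal

section FullSupport

open Matrix

universe u

open AddMonoidAlgebra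

theorem height_lt_of_ringKrullDim_lt {R : Type*} [CommRing R] {d : ℕ}
    (h : ringKrullDim R < (d : WithBot ℕ∞)) (q : Ideal R) (hq : q.IsPrime) : q.height < d := by
  have h1 := (Ideal.height_le_ringKrullDim_of_ne_top hq.ne_top).trans_lt h
  exact_mod_cast h1

theorem ringKrullDim_le_of_height_lt {R : Type*} [CommRing R] {d : ℕ}
    (h : ∀ q : Ideal R, q.IsPrime → q.height < (d + 1 : ℕ)) : ringKrullDim R ≤
    (d : WithBot ℕ∞) := by
  rw [ringKrullDim_le_iff_height_le]
  intro q hq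
  have h1 : q.height ≤ d := by
    have := h q hq
    push_cast at this
    exact Order.le_of_lt_add_one this
  exact_mod_cast h1

variable {R : Type u} [CommRing R] {n : ℕ} {M : AddSubmonoid (Fin n →₀ ℕ)}
  {ν : Type} [Fintype ν] [DecidableEq ν] {k : ℕ}

theorem mapRingHom_mk_surjective {N : Type*} [AddCommMonoid N] (C : Ideal R) :
    Function.Surjective (mapRingHom N (Ideal.Quotient.mk C)) := by
  intro t
  refine mem_of_single_mem (mapRingHom N (Ideal.Quotient.mk C)).range fun x _ => ?_
  obtain ⟨a, ha⟩ := Ideal.Quotient.mk_surjective (t.coeff x)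
  exact ⟨AddMonoidAlgebra.single x a, by rw [mapRingHom_single, ha]⟩

variable (k R M ν) in
/-- Unimodular rows of a projective module of rank `k` plus a free summand which are standard modulo
the terms of full support are relatively elementary equivalent to the standard row. -/
def FullTransitive : Prop := ∀ E : Matrix ν ν R[M], E * E = E → HasRank E k →
  ∀ u : Option ν → R[M], ProjVec E u → UniRow u →
    (∀ i, u i - Pi.single (M := fun _ => R[M]) none 1 i ∈ deepIdeal (⊤ : Ideal R) 1 M) →
    ∃ g ∈ projElemRel E (deepIdeal (⊤ : Ideal R) 1 M : Set R[M]), g.1 *ᵥ u = Pi.single none 1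

theorem exists_projElemRel_deepIdeal (hk : 0 < k) {C : Ideal R} (hC : FullTransitive (R ⧸ C) M ν k)
    {E : Matrix ν ν R[M]} (hE : E * E = E) (hr : HasRank E k) {u : Option ν → R[M]}
    (hP : ProjVec E u) (hU : UniRow u)
    (hu : ∀ i, u i - Pi.single (M := fun _ => R[M]) none 1 i ∈ deepIdeal (⊤ : Ideal R) 1 M)
    (K : ℕ) :
    ∃ g ∈ projElemRel E (deepIdeal (⊤ : Ideal R) 1 M : Set R[M]), ∀ i,
      (g.1 *ᵥ u) i - Pi.single (M := fun _ => R[M]) none 1 i ∈ deepIdeal (C ^ (K + 1)) (K + 1)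
      M := by
  set f := mapRingHom M (Ideal.Quotient.mk C) with hf
  have hfs : Function.Surjective f := mapRingHom_mk_surjective C
  have hfE : E.map f * E.map f = E.map f := by rw [← Matrix.map_mul, hE]
  have hsingle i : f (Pi.single (M := fun _ => R[M]) none 1 i)
      = Pi.single (M := fun _ => (R ⧸ C)[M]) none 1 i :=
    congrFun (comp_single_one f (none : Option ν)) i
  obtain ⟨g₀, hg₀, hgu⟩ := hC (E.map f) hfE (hr.map f) (f ∘ u) (hP.map f) (hU.map f) fun i => by
    rw [← hsingle, Function.comp_apply, ← map_sub]
    exact map_mem_deepIdeal C (hu i)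
  obtain ⟨g, hg, rfl⟩ := exists_lift_projElemRel f hfs hE (deepIdeal (⊤ : Ideal R) 1 M)
    (fun t ht => exists_lift_deepIdeal C ht) hg₀
  rw [map_mulVec_comp] at hgu
  have h1 i : (g.1 *ᵥ u) i - Pi.single (M := fun _ => R[M]) none 1 i ∈ deepIdeal C 1 M := by
    refine mem_deepIdeal_of_map_eq_zero ?_ ?_
    · have h2 := add_mem (projElemRel_sub_mem _ hg u i) (hu i)
      rwa [sub_add_sub_cancel] at h2
    · rw [← hf, map_sub, hsingle, sub_eq_zero]
      exact congrFun hgu i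
  obtain ⟨a, ha⟩ := hr.exists_sum_eq_one hk
  obtain ⟨g', hg', hgu'⟩ := exists_projElemRel_pow hE a ha (deepIdeal C 1 M) K
    (hP.mulVec (projElemRel_le _ _ hg)) h1
  refine ⟨g' * g, mul_mem (projElemRel_mono E (deepIdeal_mono le_top 1) hg') hg, fun i => ?_⟩
  rw [mul_mulVec_GL]
  exact deepIdeal_pow_le C (K + 1) (hgu' i)

theorem FullTransitive.of_nilpotent (hk : 0 < k) {C : Ideal R} (hC : FullTransitive (R ⧸ C) M ν k)
    (hC' : IsNilpotent C) : FullTransitive R M ν k := by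
  intro E hE hr u hP hU hu
  obtain ⟨K, hK⟩ := hC'
  obtain ⟨g, hg, h⟩ := exists_projElemRel_deepIdeal hk hC hE hr hP hU hu K
  refine ⟨g, hg, funext fun i => ?_⟩
  rw [← sub_eq_zero]
  refine AddMonoidAlgebra.ext (Finsupp.ext fun m => ?_)
  by_contra hm
  have h1 := (h i m hm).1
  rw [pow_succ, hK, zero_mul] at h1
  exact hm h1

theorem FullTransitive.of_quotient [IsNoetherianRing R] [IsReduced R] {c : ℕ} (hc : 0 < c)
    (hcM : ∀ i, Finsupp.single i c ∈ M) (hk : 2 ≤ k)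
    (hR : ∀ q : Ideal R, q.IsPrime → q.height < k)
    (h : ∀ d ∈ nonZeroDivisors R, FullTransitive (R ⧸ Ideal.span {d}) M ν k) :
    FullTransitive R M ν k := by
  intro E hE hr u hP hU hu
  obtain ⟨X, Y, v, d, hd, hv, hEX, hYE, hYX, hXY⟩ := exists_generic_factor hc hcM hE hk hr
  set C : Ideal R := Ideal.span {d * d} with hC
  obtain ⟨K, hK⟩ := exists_dvd_of_mem_deepIdeal hc hcM (v + v) (d * d)
  obtain ⟨g, hg, hgu⟩ := exists_projElemRel_deepIdeal (by omega) (h (d * d) (mul_mem hd hd)) hE hr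
      hP hU hu K
  have hs : AddMonoidAlgebra.single v d * AddMonoidAlgebra.single v d
      = AddMonoidAlgebra.single (v + v) (d * d) := single_mul_single _ _ _ _
  have hv2 i : 0 < ((v + v : M) : Fin n →₀ ℕ) i := by
    rw [AddSubmonoid.coe_add, Finsupp.add_apply]
    exact Nat.add_pos_left (hv i) _
  have hmem (m : M) (hm : ∀ i, 0 < (m : Fin n →₀ ℕ) i) (a : R) :
      AddMonoidAlgebra.single m a ∈ deepIdeal (⊤ : Ideal R) 1 M := single_mem_deepIdeal trivial hm
  obtain ⟨g', hg', hgu'⟩ := exists_projElemRel_of_rows (X := X)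
      (Y := AddMonoidAlgebra.single v d • Y) (s := AddMonoidAlgebra.single (v + v) (d * d))
    hEX (by rw [Matrix.smul_mul, hYE])
    (by rw [Matrix.smul_mul, hYX, smul_smul, hs])
    (by rw [Matrix.mul_smul, hXY, smul_smul, hs])
    (deepIdeal (⊤ : Ideal R) 1 M) (hmem _ hv2 _)
    (fun i j => Ideal.mul_mem_right _ _ (hmem v hv d))
    (fun c hc' hcs => exists_elemSubgroup_monomial k hR (by simp) (by simp; omega) hc hcM (v + v)
      hv2
      (d * d) hc' none hcs)
    (hP.mulVec (projElemRel_le _ _ hg)) (hU.mulVec g)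
    (fun i => hK (K + 1) (Nat.le_succ K) _ (hgu i))
  exact ⟨g' * g, mul_mem hg' hg, by rw [mul_mulVec_GL, hgu']⟩

theorem fullTransitive_of_height_lt [IsNoetherianRing R] {c : ℕ} (hc : 0 < c)
    (hcM : ∀ i, Finsupp.single i c ∈ M) (hk : 2 ≤ k) (d : ℕ) (hd : d ≤ k)
    (hR : ∀ q : Ideal R, q.IsPrime → q.height < d) : FullTransitive R M ν k := by
  rename_i i1 i2 i3 i4
  revert i1 i4 hR hd
  induction d generalizing R with
  | zero =>
    intro _ _ _ hR E _ _ u _ _ _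
    have hsub : Subsingleton R := by
      rcases subsingleton_or_nontrivial R with h | h
      · exact h
      · obtain ⟨m, hm⟩ := Ideal.exists_maximal R
        exact absurd (hR m hm.isPrime) (by simp)
    have : Subsingleton R[M] :=
      ⟨fun x y => AddMonoidAlgebra.ext (Finsupp.ext fun m => Subsingleton.elim _ _)⟩
    exact ⟨1, one_mem _, Subsingleton.elim _ _⟩
  | succ d ih =>
    intro _ _ hd hR
    have hdim := ringKrullDim_le_of_height_lt hR
    refine FullTransitive.of_nilpotent (by omega) (C := nilradical R) ?_
      (IsNoetherianRing.isNilpotent_nilradical R)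
    have hred : IsReduced (R ⧸ nilradical R) :=
      (Ideal.isRadical_iff_quotient_reduced _).1 (Ideal.radical_isRadical _)
    have hdim' := (ringKrullDim_quotient_le (nilradical R)).trans hdim
    have hlt {S : Type u} [CommRing S] {m m' : ℕ} (hm : m < m') (h : ringKrullDim S ≤ m) :
        ringKrullDim S < (m' : WithBot ℕ∞) := h.trans_lt (by exact_mod_cast hm)
    refine FullTransitive.of_quotient hc hcM hk (height_lt_of_ringKrullDim_lt (hlt hd hdim')) ?_
    intro a ha
    refine ih (by omega) (height_lt_of_ringKrullDim_lt ?_)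
    have h1 := (ringKrullDim_quotient_succ_le_of_nonZeroDivisor ha).trans hdim'
    have h2 : ringKrullDim ((R ⧸ nilradical R) ⧸ Ideal.span {a}) < d := by
      generalize ringKrullDim ((R ⧸ nilradical R) ⧸ Ideal.span {a}) = x at h1
      induction x using WithBot.recBotCoe with
      | bot => exact WithBot.bot_lt_coe _
      | coe x =>
        have h3 : x + 1 ≤ (d : ℕ∞) := by exact_mod_cast h1
        have h4 : x < (d : ℕ∞) := (ENat.add_one_le_iff (fun h => by simp [h] at h3)).1 h3
        exact_mod_cast h4
    exact h2

end FullSupport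

section FaceInduction

open Matrix

universe u

open AddMonoidAlgebra

variable {R : Type u} [CommRing R] {n : ℕ} {M : AddSubmonoid (Fin n →₀ ℕ)}

theorem exists_faceEquiv {c : ℕ} (hcM : ∀ i, Finsupp.single i c ∈ M) (F : Finset (Fin n)) :
    ∃ (m : ℕ) (M' : AddSubmonoid (Fin m →₀ ℕ)) (e : M' ≃+ faceMonoid M F),
      (∀ i, Finsupp.single i c ∈ M') ∧
      ∀ a : M', (∀ i, 1 ≤ (a : Fin m →₀ ℕ) i) ↔ ((e a : M) : Fin n →₀ ℕ).support = F := by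
  let s : Fin F.card ↪ Fin n := (F.orderEmbOfFin rfl).toEmbedding
  have hs : ∀ i, i ∈ F ↔ i ∈ Set.range s := fun i => by
    rw [← Finset.mem_coe, ← Finset.range_orderEmbOfFin F rfl]; rfl
  let f : (Fin F.card →₀ ℕ) →+ (Fin n →₀ ℕ) := Finsupp.mapDomain.addMonoidHom s
  have hf : ∀ a i, f a (s i) = a i := fun a i => Finsupp.mapDomain_apply s.injective a i
  have hf0 : ∀ a i, i ∉ F → f a i = 0 := fun a i hi =>
    Finsupp.mapDomain_of_notMem_range a i fun hi' => hi ((hs i).mpr hi')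
  have hfinj : Function.Injective f := Finsupp.mapDomain_injective s.injective
  have hsupp a : (f a).support ⊆ F := fun i hi => by
    by_contra h
    exact (Finsupp.mem_support_iff.1 hi) (hf0 a i h)
  let g : M.comap f →+ faceMonoid M F :=
    { toFun a := ⟨⟨f a, a.2⟩, hsupp a⟩
      map_zero' := Subtype.ext (Subtype.ext (map_zero f))
      map_add' a b := Subtype.ext (Subtype.ext (map_add f _ _)) }
  have hg : Function.Bijective g := by
    constructor
    · intro a b hab
      exact Subtype.ext (hfinj (congrArg (fun z : faceMonoid M F => ((z : M) : Fin n →₀ ℕ)) hab))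
    · rintro ⟨⟨x, hxM⟩, hx⟩
      let a : Fin F.card →₀ ℕ := Finsupp.equivFunOnFinite.symm fun i => x (s i)
      have ha : f a = x := by
        ext i
        by_cases hi : i ∈ F
        · obtain ⟨j, rfl⟩ := (hs i).mp hi
          rw [hf]; rfl
        · rw [hf0 a i hi]
          by_contra h
          exact hi (hx (Finsupp.mem_support_iff.mpr (Ne.symm h)))
      exact ⟨⟨a, Set.mem_of_eq_of_mem (s := M) ha hxM⟩, Subtype.ext (Subtype.ext ha)⟩
  refine ⟨F.card, M.comap f, AddEquiv.ofBijective g hg, fun i => ?_, fun a => ?_⟩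
  · change Finsupp.mapDomain s (Finsupp.single i c) ∈ M
    rw [Finsupp.mapDomain_single]
    exact hcM _
  · change _ ↔ (f a).support = F
    constructor
    · intro h
      refine (hsupp a).antisymm fun i hi => ?_
      obtain ⟨j, rfl⟩ := (hs i).1 hi
      have := h j
      rw [Finsupp.mem_support_iff, hf]
      omega
    · intro h i
      have h1 : s i ∈ (f a).support := by
        rw [h]
        exact (hs (s i)).2 ⟨i, rfl⟩
      rw [Finsupp.mem_support_iff, hf] at h1
      omega

variable {ν : Type} [Fintype ν] [DecidableEq ν] {k : ℕ}

theorem exists_projElem_restr_face {c : ℕ} (hcM : ∀ i, Finsupp.single i c ∈ M)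
    (hfull : ∀ (m : ℕ) (M' : AddSubmonoid (Fin m →₀ ℕ)), (∀ i, Finsupp.single i c ∈ M') →
      FullTransitive R M' ν k)
    {E : Matrix ν ν R[M]} (hE : E * E = E) (hr : HasRank E k) {u : Option ν → R[M]}
    (hP : ProjVec E u) (hU : UniRow u) (F : Finset (Fin n))
    (hu : ∀ G, G ⊂ F → restr R M G ∘ u = Pi.single none 1) :
    ∃ g ∈ projElem E, restr R M F ∘ (g.1 *ᵥ u) = Pi.single none 1 ∧
      ∀ G, ¬ F ⊆ G → restr R M G ∘ (g.1 *ᵥ u) = restr R M G ∘ u := by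
  obtain ⟨m, M', e, hcM', he⟩ := exists_faceEquiv hcM F
  set q : R[M] →+* R[M'] :=
    ((expEquiv R e).symm : R[faceMonoid M F] →+* R[M']).comp
      (faceHom R (faceMonoid M F) faceMonoid_of_add)
    with hq
  set J : M' →+ M := (faceMonoid M F).subtype.comp (e : M' →+ faceMonoid M F) with hJ
  have hJinj : Function.Injective J := Subtype.val_injective.comp e.injective
  have hcomp (x : R[M']) : expMap R J x = expMap R (faceMonoid M F).subtype (expEquiv R e x) := by
    induction x using AddMonoidAlgebra.induction_linear with
    | zero => simp
    | add f g hf hg => simp only [map_add, hf, hg]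
    | single x a =>
      have h1 : expEquiv R e (AddMonoidAlgebra.single x a) = AddMonoidAlgebra.single (e x) a :=
        AddMonoidAlgebra.mapDomain_single
      rw [h1, expMap_single, expMap_single]
      rfl
  have hrestr (x : R[M]) : expMap R J (q x) = restr R M F x := by
    rw [hcomp, hq, RingHom.comp_apply]
    exact congrArg _ ((expEquiv R e).apply_symm_apply _)
  have hqJ (x : R[M']) : q (expMap R J x) = x := by
    rw [hcomp, hq, RingHom.comp_apply, faceHom_expMap]
    exact (expEquiv R e).symm_apply_apply x
  have hsingle {A B : Type u} [CommRing A] [CommRing B] (f : A →+* B) (i : Option ν) :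
      f (Pi.single (M := fun _ => A) none 1 i) = Pi.single (M := fun _ => B) none 1 i :=
    congrFun (comp_single_one f (none : Option ν)) i
  have hqE : E.map q * E.map q = E.map q := by rw [← Matrix.map_mul, hE]
  obtain ⟨g₀, hg₀, hgu⟩ := hfull m M' hcM' (E.map q) hqE (hr.map q) (q ∘ u) (hP.map q) (hU.map q)
      (by
    intro i a ha
    refine ⟨trivial, (he a).2 ?_⟩
    rw [← hsingle q, Function.comp_apply, ← map_sub, ← coeff_expMap hJinj, hrestr] at ha
    refine mem_suppSub_interior (fun G hG => ?_) (restr_restr subset_rfl _) (J a) ha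
    rw [restr_restr hG.subset, map_sub, hsingle, sub_eq_zero]
    exact congrFun (hu G hG) i)
  let S : Ideal R[M] := ⨅ G : {G : Finset (Fin n) // ¬ F ⊆ G}, RingHom.ker (restr R M G)
  obtain ⟨g, hg, rfl⟩ := exists_lift_projElemRel q (fun x => ⟨_, hqJ x⟩) hE S (fun t ht => by
    refine ⟨expMap R J t, ?_, hqJ t⟩
    rw [Ideal.mem_iInf]
    rintro ⟨G, hG⟩
    rw [RingHom.mem_ker]
    have h1 : t ∈ RingHom.ker ((restr R M G).comp (expMap R J)) := by
      refine mem_of_single_mem _ fun a ha => ?_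
      rw [RingHom.mem_ker, RingHom.comp_apply, expMap_single]
      refine restr_single_of_not_subset (fun h => hG ?_) _
      exact ((he a).1 (ht a ha).2).symm.subset.trans h
    exact h1) hg₀
  rw [map_mulVec_comp] at hgu
  refine ⟨g, projElemRel_le _ _ hg, funext fun i => ?_, fun G hG => funext fun i => ?_⟩
  · rw [Function.comp_apply, ← hrestr, ← hsingle (expMap R J)]
    exact congrArg _ (congrFun hgu i)
  · have h1 := projElemRel_sub_mem S hg u i
    have h2 := (Ideal.mem_iInf.1 h1) ⟨G, hG⟩
    rw [RingHom.mem_ker, map_sub, sub_eq_zero] at h2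
    exact h2

theorem exists_projElem_restr {c : ℕ} (hcM : ∀ i, Finsupp.single i c ∈ M)
    (hfull : ∀ (m : ℕ) (M' : AddSubmonoid (Fin m →₀ ℕ)), (∀ i, Finsupp.single i c ∈ M') →
      FullTransitive R M' ν k)
    {E : Matrix ν ν R[M]} (hE : E * E = E) (hr : HasRank E k) {u : Option ν → R[M]}
    (hP : ProjVec E u) (hU : UniRow u) (l : ℕ) :
    ∀ 𝒢 : Finset (Finset (Fin n)), 𝒢.card = l → (∀ F ∈ 𝒢, ∀ F' ⊆ F, F' ∈ 𝒢) →
      ∃ g ∈ projElem E, ∀ F ∈ 𝒢, restr R M F ∘ (g.1 *ᵥ u) = Pi.single none 1 := by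
  induction l with
  | zero =>
    intro 𝒢 h𝒢 _
    rw [Finset.card_eq_zero.mp h𝒢]
    exact ⟨1, one_mem _, by simp⟩
  | succ l ih =>
    intro 𝒢 h𝒢 hlow
    obtain ⟨F, hF, hmax⟩ := 𝒢.exists_max_image Finset.card (Finset.card_pos.mp (by omega))
    have hnot : ∀ F' ∈ 𝒢.erase F, ¬ F ⊆ F' := fun F' hF' h => (Finset.mem_erase.mp hF').1
      (Finset.eq_of_subset_of_card_le h (hmax F' (Finset.mem_erase.mp hF').2)).symm
    obtain ⟨g, hg, hgu⟩ := ih (𝒢.erase F) (by rw [Finset.card_erase_of_mem hF, h𝒢]; rfl) (by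
      intro F₁ h₁ F₂ h₂
      refine Finset.mem_erase.mpr ⟨?_, hlow F₁ (Finset.mem_erase.mp h₁).2 F₂ h₂⟩
      rintro rfl
      exact hnot F₁ h₁ h₂)
    obtain ⟨g', hg', hF', hG'⟩ := exists_projElem_restr_face hcM hfull hE hr (hP.mulVec hg)
      (hU.mulVec g) F fun G hG => hgu G (Finset.mem_erase.mpr ⟨hG.ne, hlow F hF G hG.subset⟩)
    refine ⟨g' * g, mul_mem hg' hg, fun G hG => ?_⟩
    rw [mul_mulVec_GL]
    by_cases hGF : G = F
    · rw [hGF, hF']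
    · have hG2 := Finset.mem_erase.mpr ⟨hGF, hG⟩
      rw [hG' G (hnot G hG2), hgu G hG2]

theorem exists_projElem_mulVec_eq_single [IsNoetherianRing R] {c : ℕ} (hc : 0 < c)
    (hcM : ∀ i, Finsupp.single i c ∈ M) (hk : 2 ≤ k)
    (hR : ∀ q : Ideal R, q.IsPrime → q.height < k) {E : Matrix ν ν R[M]} (hE : E * E = E)
    (hr : HasRank E k) {u : Option ν → R[M]} (hP : ProjVec E u) (hU : UniRow u) :
    ∃ g ∈ projElem E, g.1 *ᵥ u = Pi.single none 1 := by
  obtain ⟨g, hg, h⟩ := exists_projElem_restr hcM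
    (fun m M' hcM' => fullTransitive_of_height_lt hc hcM' hk k le_rfl hR) hE hr hP hU _ Finset.univ
      rfl
    fun _ _ _ _ => Finset.mem_univ _
  refine ⟨g, hg, funext fun i => ?_⟩
  rw [← h Finset.univ (Finset.mem_univ _), Function.comp_apply]
  exact (restr_eq_self fun _ _ => Finset.subset_univ _).symm

end FaceInduction

section ProjectiveModules

open Matrix TensorProduct

/-- The property that, over the ring `A`, the elementary group of a projective module of rank `k`
  plus
a free summand acts transitively on unimodular elements. -/
def ProjTransitive (k : ℕ) (A : Type) [CommRing A] : Prop :=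
  ∀ (ν : Type) [Fintype ν] [DecidableEq ν] (E : Matrix ν ν A), E * E = E → HasRank E k →
    ∀ u : Option ν → A, ProjVec E u → UniRow u → ∃ g ∈ projElem E, g.1 *ᵥ u = Pi.single none 1

variable {A B : Type} [CommRing A] [CommRing B] {k : ℕ}

theorem ProjTransitive.of_ringEquiv (e : A ≃+* B) (h : ProjTransitive k A) :
    ProjTransitive k B := by
  intro ν _ _ E hE hr u hP hU
  have hEE : (E.map e.symm).map e = E := by
    ext i j
    simp
  have huu : e ∘ e.symm ∘ u = u := by
    funext i
    simp
  obtain ⟨g, hg, hgu⟩ := h ν (E.map e.symm.toRingHom)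
    (by rw [← Matrix.map_mul, hE]) (hr.map e.symm.toRingHom) (e.symm.toRingHom ∘ u)
    (hP.map e.symm.toRingHom) (hU.map e.symm.toRingHom)
  refine ⟨GeneralLinearGroup.map e.toRingHom g, ?_, ?_⟩
  · have h1 := map_mem_projElem e.toRingHom hg
    have h2 : (E.map e.symm.toRingHom).map e.toRingHom = E := hEE
    rwa [h2] at h1
  · have h1 := map_mulVec_comp e.toRingHom g (e.symm.toRingHom ∘ u)
    rw [hgu, comp_single_one] at h1
    have h2 : e.toRingHom ∘ e.symm.toRingHom ∘ u = u := huu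
    rwa [h2] at h1

variable {P : Type} [AddCommGroup P] [Module A P] {N : ℕ}

/-- The coordinates of an element of `P × A` under an embedding of `P` in a free module. -/
def coordVec (G : P →ₗ[A] Fin N → A) (z : P × A) : Option (Fin N) → A := fun i => i.elim z.2 (G z.1)

theorem coordVec_injective {G : P →ₗ[A] Fin N → A} (hG : Function.Injective G) :
    Function.Injective (coordVec G) := fun _ _ h =>
  Prod.ext (hG (funext fun i => congrFun h (some i))) (congrFun h none)

theorem coordVec_zero_one (G : P →ₗ[A] Fin N → A) : coordVec G (0, 1) = Pi.single none 1 := by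
  funext i
  cases i <;> simp [coordVec]

theorem exists_elemGroup_of_projElem {F : (Fin N → A) →ₗ[A] P} {G : P →ₗ[A] Fin N → A}
    {g : GL (Option (Fin N)) A} (hg : g ∈ projElem (LinearMap.toMatrix' (G ∘ₗ F))) :
    ∃ e ∈ elemGroup A P, ∀ z, coordVec G (e z) = g.1 *ᵥ coordVec G z := by
  induction hg using Subgroup.closure_induction with
  | mem g hg =>
    rcases hg with ⟨q, hq, -, rfl⟩ | ⟨φ, hφ, -, rfl⟩
    · have hq' : G (F q) = q := by rwa [LinearMap.toMatrix'_mulVec] at hq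
      let e : (P × A) ≃ₗ[A] (P × A) :=
        { toFun x := (x.1 + x.2 • F q, x.2)
          invFun x := (x.1 - x.2 • F q, x.2)
          map_add' x y := Prod.ext (by simp only [Prod.fst_add, Prod.snd_add, add_smul]; abel) rfl
          map_smul' a x := Prod.ext (by simp [smul_smul]) rfl
          left_inv x := Prod.ext (by simp) rfl
          right_inv x := Prod.ext (by simp) rfl }
      refine ⟨e, Subgroup.subset_closure (Or.inr ⟨F q, fun x => rfl⟩), fun z => ?_⟩
      rw [colTrans_mulVec]
      funext i
      cases i
      · simp [coordVec, extVec, e]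
      · simp [coordVec, extVec, e, hq']
    · let f : P →ₗ[A] A := (dotProductBilin A A φ).comp G
      let e : (P × A) ≃ₗ[A] (P × A) :=
        { toFun x := (x.1, x.2 + f x.1)
          invFun x := (x.1, x.2 - f x.1)
          map_add' x y := Prod.ext rfl (by simp only [Prod.fst_add, Prod.snd_add, map_add]; abel)
          map_smul' a x := Prod.ext rfl (by simp [mul_add])
          left_inv x := Prod.ext rfl (by simp)
          right_inv x := Prod.ext rfl (by simp) }
      refine ⟨e, Subgroup.subset_closure (Or.inl ⟨f, fun x => rfl⟩), fun z => ?_⟩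
      rw [rowTrans_mulVec]
      funext i
      cases i
      · simp [coordVec, e, f]
        rfl
      · simp [coordVec, e]
  | one => exact ⟨1, one_mem _, fun z => by simp⟩
  | mul g g' _ _ h h' =>
    obtain ⟨e, he, h⟩ := h
    obtain ⟨e', he', h'⟩ := h'
    exact ⟨e * e', mul_mem he he', fun z => by rw [mul_mulVec_GL, ← h', ← h]; rfl⟩
  | inv g _ h =>
    obtain ⟨e, he, h⟩ := h
    refine ⟨e⁻¹, inv_mem he, fun z => ?_⟩
    refine (inv_mulVec_of_mulVec ((h (e⁻¹ z)).symm.trans ?_)).symm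
    exact congrArg _ (e.apply_symm_apply z)

theorem hasRank_toMatrix [Module.Finite A P] [Module.Projective A P]
    (hrank : ∀ p : PrimeSpectrum A, Module.rankAtStalk P p = k) {F : (Fin N → A) →ₗ[A] P}
    {G : P →ₗ[A] Fin N → A} (hFG : F ∘ₗ G = .id) : HasRank (LinearMap.toMatrix' (G ∘ₗ F)) k := by
  intro K _ h
  let _ : Algebra A K := h.toAlgebra
  have h1 := rank_dualBasis (F := K) (fun i => F (Pi.single i 1)) (fun i => LinearMap.proj i ∘ₗ G)
    fun p => by
      conv_rhs => rw [← LinearMap.id_apply (R := A) p, ← hFG, LinearMap.comp_apply,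
        pi_eq_sum_univ' (G p), map_sum]
      refine Finset.sum_congr rfl fun l _ => ?_
      rw [← map_smul]
      rfl
  have h2 : (Matrix.of fun l m => (LinearMap.proj (φ := fun _ => A) l ∘ₗ G) (F (Pi.single m 1)))
      = LinearMap.toMatrix' (G ∘ₗ F) := by
    ext l m
    simp [LinearMap.toMatrix'_apply]
  rw [h2] at h1
  have h3 := congrFun (Module.rankAtStalk_eq_finrank_of_free (R := K) (M := K ⊗[A] P)) ⊥
  rw [Module.rankAtStalk_baseChange, hrank] at h3
  exact h1.trans h3.symm

theorem exists_elemGroup_eq_zero_one [Module.Finite A P] [Module.Projective A P]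
    (hA : ProjTransitive k A) (hrank : ∀ p : PrimeSpectrum A, Module.rankAtStalk P p = k)
    {u : P × A} (hu : IsUnimodular (R := A) u) : ∃ e ∈ elemGroup A P, e u = (0, 1) := by
  obtain ⟨N, F, G, -, hG, hFG⟩ := Module.Finite.exists_comp_eq_id_of_projective A P
  have hFG' p : F (G p) = p := LinearMap.congr_fun hFG p
  obtain ⟨ψ, hψ⟩ := hu
  obtain ⟨g, hg, hgu⟩ := hA (Fin N) (LinearMap.toMatrix' (G ∘ₗ F))
    (by rw [← LinearMap.toMatrix'_comp, LinearMap.comp_assoc, ← LinearMap.comp_assoc F, hFG,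
      LinearMap.id_comp])
    (hasRank_toMatrix hrank hFG) (coordVec G u)
    (by
      change LinearMap.toMatrix' (G ∘ₗ F) *ᵥ (G u.1) = G u.1
      rw [LinearMap.toMatrix'_mulVec, LinearMap.comp_apply, hFG'])
    ⟨fun i => i.elim (ψ (0, 1)) fun l => ψ (F (Pi.single l 1), 0), by
      rw [dotProduct, Fintype.sum_option]
      have h1 : ψ (0, 1) * u.2 = ψ (0, u.2) := by
        rw [mul_comm, ← smul_eq_mul, ← map_smul]
        simp
      have h2 : ∑ l, ψ (F (Pi.single l 1), 0) * G u.1 l = ψ (u.1, 0) := by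
        have h3 : (ψ ∘ₗ LinearMap.inl A P A ∘ₗ F) (G u.1) = ψ (u.1, 0) := by
          simp [hFG']
        conv_rhs => rw [← h3, pi_eq_sum_univ' (G u.1), map_sum]
        refine Finset.sum_congr rfl fun l _ => ?_
        rw [map_smul, smul_eq_mul, mul_comm]
        rfl
      refine (congrArg₂ (· + ·) h1 h2).trans ?_
      rw [← map_add, ← hψ]
      simp⟩
  obtain ⟨e, he, heu⟩ := exists_elemGroup_of_projElem hg
  exact ⟨e, he, coordVec_injective hG (by rw [heu, hgu, coordVec_zero_one])⟩

theorem exists_single_mem_of_phiSimplicial {r : ℕ} {M : AddSubmonoid (Fin r → ℕ)}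
    (hM : PhiSimplicial M) : ∃ c : ℕ, 0 < c ∧ ∀ i, Pi.single i c ∈ M := by
  choose m hm hmM using fun i : Fin r => hM.2 (Pi.single i 1)
  refine ⟨∏ i, m i, Finset.prod_pos fun i _ => hm i, fun i => ?_⟩
  obtain ⟨t, ht⟩ := Finset.dvd_prod_of_mem m (Finset.mem_univ i)
  have h1 : (Pi.single i (∏ i, m i) : Fin r → ℕ) = t • m i • Pi.single i 1 := by
    rw [smul_smul, ← Pi.single_smul, smul_eq_mul, mul_one, ht, mul_comm]
  rw [h1]
  exact nsmul_mem (hmM i) t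

theorem projTransitive_of_phiSimplicial {R : Type} [CommRing R] [IsNoetherianRing R] {n r : ℕ}
    (hdim : ringKrullDim R = n) {M : AddSubmonoid (Fin r → ℕ)} (hM : PhiSimplicial M)
    (hk : max (n + 1) 2 ≤ k) : ProjTransitive k (AddMonoidAlgebra R M) := by
  obtain ⟨c, hc, hcM⟩ := exists_single_mem_of_phiSimplicial hM
  let f : (Fin r →₀ ℕ) →+ (Fin r → ℕ) := Finsupp.coeFnAddHom
  let g : M.comap f →+ M :=
    { toFun a := ⟨f a, a.2⟩
      map_zero' := Subtype.ext (map_zero f)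
      map_add' a b := Subtype.ext (map_add f _ _) }
  have hg : Function.Bijective g := by
    constructor
    · intro a b hab
      exact Subtype.ext (DFunLike.coe_injective (congrArg Subtype.val hab))
    · rintro ⟨x, hx⟩
      exact ⟨⟨Finsupp.equivFunOnFinite.symm x, hx⟩, rfl⟩
  refine ProjTransitive.of_ringEquiv (expEquiv R (AddEquiv.ofBijective g hg)) ?_
  intro ν _ _ E hE hr u hP hU
  refine exists_projElem_mulVec_eq_single hc (fun i => ?_) ((le_max_right _ _).trans hk)
    (height_lt_of_ringKrullDim_lt ?_) hE hr hP hU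
  · change ⇑(Finsupp.single i c) ∈ M
    rw [Finsupp.single_eq_pi_single]
    exact hcM i
  · rw [hdim]
    exact_mod_cast (le_max_left _ _).trans hk

end ProjectiveModules

/-- Dhorajia–Keshari: let `R` be a commutative Noetherian ring and `M` a `Φ`-simplicial
monoid.  If `P` is a finitely generated projective `R[M]`-module of constant rank
`≥ max(dim R + 1, 2)`, then `EL(P ⊕ R[M])` acts transitively on `Um(P ⊕ R[M])`. -/
theorem elemGroup_transitive_on_unimodular
    (R : Type) [CommRing R] [IsNoetherianRing R] (n : ℕ) (hdim : ringKrullDim R = n)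
    (r : ℕ) (M : AddSubmonoid (Fin r → ℕ)) (hM : PhiSimplicial M)
    (P : Type) [AddCommGroup P] [Module (AddMonoidAlgebra R M) P]
    [Module.Finite (AddMonoidAlgebra R M) P]
    [Module.Projective (AddMonoidAlgebra R M) P]
    (k : ℕ) (hk : max (n + 1) 2 ≤ k)
    (hrank : ∀ (𝔭 : Ideal (AddMonoidAlgebra R M)) [𝔭.IsPrime],
      Module.finrank (Localization.AtPrime 𝔭) (LocalizedModule 𝔭.primeCompl P) = k)
    (u v : P × AddMonoidAlgebra R M)
    (hu : IsUnimodular (R := AddMonoidAlgebra R M) u)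
    (hv : IsUnimodular (R := AddMonoidAlgebra R M) v) :
    ∃ e ∈ elemGroup (AddMonoidAlgebra R M) P, e u = v := by
  have hA : ProjTransitive k (AddMonoidAlgebra R M) := projTransitive_of_phiSimplicial hdim hM hk
  have hrank' (p : PrimeSpectrum (AddMonoidAlgebra R M)) : Module.rankAtStalk P p = k :=
    hrank p.asIdeal
  obtain ⟨e, he, heu⟩ := exists_elemGroup_eq_zero_one hA hrank' hu
  obtain ⟨e', he', hev⟩ := exists_elemGroup_eq_zero_one hA hrank' hv
  refine ⟨e'⁻¹ * e, mul_mem (inv_mem he') he, ?_⟩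
  change e'⁻¹ (e u) = v
  rw [heu, ← hev]
  exact e'.symm_apply_apply v
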